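/- Let n ≥ 1 and let U be a connected open neighborhood of 0 in ℂⁿ. Let X₁, …, X_{n−1} : U → ℂⁿ be analytic vector fields with X_i(0) = 0 for all i, which commute pairwise ([X_i, X_j] = 0 on U), which are isochore (trace(DX_i(x)) = 0 for all x ∈ U and all i), and such that there exists a point x ∈ U at which the vectors X₁(x), …, X_{n−1}(x) are linearly independent over ℂ. Then X₁, …, X_{n−1} admit a simultaneous volume-preserving convergent Poincaré–Dulac normalization: there exist an analytic map φ defined near 0 with φ(0) = 0 and det(Dφ(x)) = 1 for all x near 0, and analytic vector fields Y₁, …, Y_{n−1} defined near 0, each in Poincaré–Dulac normal form, such that Dφ(x)(Y_i(x)) = X_i(φ(x)) for all x near 0 and all i. -/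

import Mathlib

/-- `Y` is in Poincaré–Dulac normal form on the neighborhood `U` of `0`:
writing the Jordan–Chevalley decomposition `DY(0) = S + N` with `S` semisimple,
`N` nilpotent and `S ∘ N = N ∘ S`, the Lie bracket `[Y, Yˢ]` (where `Yˢ x = S x`)
vanishes on `U`. -/
def InPDNormalForm (𝕂 : Type*) [NontriviallyNormedField 𝕂] {n : ℕ}
    (Y : (Fin n → 𝕂) → (Fin n → 𝕂)) (U : Set (Fin n → 𝕂)) : Prop :=
  ∃ S N : (Fin n → 𝕂) →L[𝕂] (Fin n → 𝕂),
    fderiv 𝕂 Y 0 = S + N ∧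
    Module.End.IsSemisimple (S : Module.End 𝕂 (Fin n → 𝕂)) ∧
    IsNilpotent (N : Module.End 𝕂 (Fin n → 𝕂)) ∧
    S ∘L N = N ∘L S ∧
    ∀ x ∈ U, VectorField.lieBracket 𝕂 Y (fun y => S y) x = 0

/-- `X` admits a convergent Poincaré–Dulac normalization: there are an analytic
vector field `Y` near `0`, in Poincaré–Dulac normal form with `Y 0 = 0`, and an
analytic map `φ` near `0` with `φ 0 = 0` and `Dφ(0)` invertible, such that
`Dφ(x) (Y x) = X (φ x)` for all `x` near `0`. -/
def AdmitsPDNormalization (𝕂 : Type*) [NontriviallyNormedField 𝕂] {n : ℕ}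
    (X : (Fin n → 𝕂) → (Fin n → 𝕂)) : Prop :=
  ∃ (V : Set (Fin n → 𝕂)) (Y φ : (Fin n → 𝕂) → (Fin n → 𝕂)),
    IsOpen V ∧ (0 : Fin n → 𝕂) ∈ V ∧
    AnalyticOnNhd 𝕂 Y V ∧ AnalyticOnNhd 𝕂 φ V ∧
    Y 0 = 0 ∧ φ 0 = 0 ∧ Function.Bijective (fderiv 𝕂 φ 0) ∧
    InPDNormalForm 𝕂 Y V ∧
    ∀ x ∈ V, fderiv 𝕂 φ x (Y x) = X (φ x)

open Filter Topology Metric Set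

set_option linter.unusedSectionVars false

universe u

section SeveralVariables

open scoped unitInterval Real

variable {K : Type*} [TopologicalSpace K] [CompactSpace K]
  {F : Type u} [NormedAddCommGroup F] [NormedSpace ℂ F] [CompleteSpace F]

/-- Evaluation at a point, as a continuous linear map on `C(K, F)`. -/
noncomputable def evalAtCLM (F : Type*) [NormedAddCommGroup F] [NormedSpace ℂ F] (k : K) :
    C(K, F) →L[ℂ] F :=
  LinearMap.mkContinuous
    { toFun := fun φ => φ k, map_add' := fun _ _ => rfl, map_smul' := fun _ _ => rfl } 1
    (fun φ => by simpa using φ.norm_coe_le_norm k)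

@[simp] lemma evalAtCLM_apply {F : Type*} [NormedAddCommGroup F] [NormedSpace ℂ F] (k : K)
    (φ : C(K, F)) : evalAtCLM F k φ = φ k := rfl

lemma clm_circleIntegral {G H : Type*} [NormedAddCommGroup G] [NormedSpace ℂ G] [CompleteSpace G]
    [NormedAddCommGroup H] [NormedSpace ℂ H] [CompleteSpace H] (L : G →L[ℂ] H) {f : ℂ → G}
    {c : ℂ} {R : ℝ} (hf : CircleIntegrable f c R) :
    L (∮ z in C(c, R), f z) = ∮ z in C(c, R), L (f z) := by
  simp only [circleIntegral]
  rw [← L.intervalIntegral_comp_comm hf.out]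
  simp

/-- A continuous curve of continuous maps all of whose evaluations are holomorphic is
holomorphic. -/
theorem differentiableOn_continuousMap {Φ : ℂ → C(K, F)} {U : Set ℂ} (hU : IsOpen U)
    (hc : ContinuousOn Φ U) (hd : ∀ k, DifferentiableOn ℂ (fun z => Φ z k) U) :
    DifferentiableOn ℂ Φ U := by
  intro z₀ hz₀
  obtain ⟨R, hR, hRU⟩ := nhds_basis_closedBall.mem_iff.1 (hU.mem_nhds hz₀)
  lift R to NNReal using hR.le
  have hcR : ContinuousOn Φ (closedBall z₀ R) := hc.mono hRU
  have hInt : CircleIntegrable Φ z₀ R :=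
    (hcR.mono sphere_subset_closedBall).circleIntegrable R.2
  have han := (hasFPowerSeriesOn_cauchy_integral hInt (by exact_mod_cast hR)).analyticAt
  refine (han.differentiableAt.congr_of_eventuallyEq ?_).differentiableWithinAt
  filter_upwards [ball_mem_nhds z₀ hR] with w hw
  ext k
  have h1 : CircleIntegrable (fun z => (z - w)⁻¹ • Φ z) z₀ R := by
    refine ContinuousOn.circleIntegrable R.2 (ContinuousOn.smul
        ((continuousOn_id.sub continuousOn_const).inv₀ ?_)
      (hcR.mono sphere_subset_closedBall))
    intro z hz h
    rw [Pi.sub_apply, id, sub_eq_zero] at h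
    subst h
    simp only [mem_sphere, mem_ball] at hz hw
    exact absurd hz hw.ne
  have h2 :=
      Complex.two_pi_I_inv_smul_circleIntegral_sub_inv_smul_of_differentiable_on_off_countable
    (f := fun z => Φ z k) countable_empty hw
    (((evalAtCLM F k).continuous.comp_continuousOn hcR))
    (fun x hx => (hd k).differentiableAt (hU.mem_nhds (hRU (ball_subset_closedBall hx.1))))
  rw [← h2]
  have h3 := clm_circleIntegral (evalAtCLM F k) h1
  simp only [map_smul, evalAtCLM_apply] at h3
  rw [ContinuousMap.smul_apply, h3]

/-- Integration over the unit interval as a continuous linear map. -/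
noncomputable def integralCM (F : Type*) [NormedAddCommGroup F] [NormedSpace ℂ F]
    [CompleteSpace F] : C(I, F) →L[ℂ] F :=
  LinearMap.mkContinuous
    { toFun := fun φ => ∫ t in (0 : ℝ)..1, φ (projIcc 0 1 zero_le_one t)
      map_add' := fun φ ψ => by
        simp only [ContinuousMap.add_apply]
        exact intervalIntegral.integral_add
          (φ.continuous.comp continuous_projIcc).continuousOn.intervalIntegrable
          (ψ.continuous.comp continuous_projIcc).continuousOn.intervalIntegrable
      map_smul' := fun c φ => by
        simp only [ContinuousMap.smul_apply]
        exact intervalIntegral.integral_smul _ _ } 1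
    (fun φ => by
      simpa using intervalIntegral.norm_integral_le_of_norm_le_const (a := 0) (b := 1)
        (C := ‖φ‖) (f := fun t => φ (projIcc 0 1 zero_le_one t))
        (fun t _ => φ.norm_coe_le_norm _))

lemma integralCM_apply (φ : C(I, F)) :
    integralCM F φ = ∫ t in (0 : ℝ)..1, φ (projIcc 0 1 zero_le_one t) := rfl

lemma integralCM_eq (φ : C(I, F)) {f : ℝ → F} (h : ∀ t : I, φ t = f t) :
    integralCM F φ = ∫ t in (0 : ℝ)..1, f t := by
  rw [integralCM_apply]
  refine intervalIntegral.integral_congr fun t ht => ?_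
  rw [uIcc_of_le zero_le_one] at ht
  simp only [projIcc_of_mem _ ht]
  exact h ⟨t, ht⟩

/-- Multiplication of a scalar and a vector valued continuous map, as a bilinear map. -/
noncomputable def smulCM (K : Type*) [TopologicalSpace K] [CompactSpace K] (F : Type*)
    [NormedAddCommGroup F] [NormedSpace ℂ F] : C(K, ℂ) →L[ℂ] C(K, F) →L[ℂ] C(K, F) :=
  LinearMap.mkContinuous₂
    (LinearMap.mk₂ ℂ (fun (a : C(K, ℂ)) (φ : C(K, F)) =>
        (⟨fun k => a k • φ k, by fun_prop⟩ : C(K, F)))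
      (fun _ _ _ => by ext; simp [add_smul]) (fun _ _ _ => by ext; simp [mul_smul])
      (fun _ _ _ => by ext; simp [smul_add]) (fun _ _ _ => by ext; exact smul_comm _ _ _)) 1
    (fun a φ => by
      rw [one_mul, ContinuousMap.norm_le _ (by positivity)]
      intro k
      simp only [LinearMap.mk₂_apply, ContinuousMap.coe_mk, norm_smul]
      gcongr
      · exact a.norm_coe_le_norm k
      · exact φ.norm_coe_le_norm k)

@[simp] lemma smulCM_apply {F : Type*} [NormedAddCommGroup F] [NormedSpace ℂ F] (a : C(K, ℂ))
    (φ : C(K, F)) (k : K) :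
    smulCM K F a φ k = a k • φ k := rfl

/-- The Cauchy formula, parametrized by the unit interval. -/
lemma cauchy_unitInterval {f : ℂ → F} {c w : ℂ} {R : ℝ} (hw : w ∈ ball c R)
    (hf : ContinuousOn f (closedBall c R)) (hd : ∀ z ∈ ball c R, DifferentiableAt ℂ f z) :
    f w = ∫ t in (0 : ℝ)..1, ((circleMap c R (2 * π * t) - c) * (circleMap c R (2 * π * t) - w)⁻¹) •
      f (circleMap c R (2 * π * t)) := by
  rw [← Complex.two_pi_I_inv_smul_circleIntegral_sub_inv_smul_of_differentiable_on_off_countable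
    countable_empty hw hf (fun x hx => hd x hx.1)]
  have h := intervalIntegral.smul_integral_comp_mul_left (a := 0) (b := 1)
    (fun θ => ((circleMap c R θ - c) * (circleMap c R θ - w)⁻¹) •
      f (circleMap c R θ)) (2 * π)
  have hpi : (2 * π : ℝ) ≠ 0 := by positivity
  rw [mul_zero, mul_one] at h
  rw [circleIntegral]
  have h2 : (∫ θ in (0:ℝ)..2 * π, deriv (circleMap c R) θ • (circleMap c R θ - w)⁻¹ •
      f (circleMap c R θ)) = Complex.I • ∫ θ in (0:ℝ)..2 * π,
        ((circleMap c R θ - c) * (circleMap c R θ - w)⁻¹) • f (circleMap c R θ) := by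
    rw [← intervalIntegral.integral_smul]
    refine intervalIntegral.integral_congr fun θ _ => ?_
    simp only [deriv_circleMap, circleMap_sub_center, smul_smul]
    ring_nf
  rw [h2, ← h, smul_smul, ← Complex.coe_smul, smul_smul]
  push_cast
  have : ((2 * π * Complex.I : ℂ)⁻¹ * Complex.I * (2 * π) : ℂ) = 1 := by
    have : (π : ℂ) ≠ 0 := by exact_mod_cast Real.pi_ne_zero
    field_simp
  rw [this, one_smul]

/-- The curried form of a function of two variables, with values in `C(K, F)`. -/
noncomputable def toCM {E : Type*} (g : E → K → F) (x : E) : C(K, F) :=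
  open Classical in if h : Continuous (g x) then ⟨g x, h⟩ else 0

section toCM

variable {E : Type*} [TopologicalSpace E] {g : E → K → F} {V : Set E}

lemma toCM_apply (hg : ContinuousOn (Function.uncurry g) (V ×ˢ univ)) {x : E} (hx : x ∈ V)
    (k : K) : toCM g x k = g x k := by
  have : Continuous (g x) := by
    rw [← continuousOn_univ]
    exact hg.comp (f := fun k => (x, k)) (by fun_prop) (fun k _ => ⟨hx, mem_univ k⟩)
  rw [toCM, dif_pos this]
  rfl

lemma continuousOn_toCM (hg : ContinuousOn (Function.uncurry g) (V ×ˢ univ)) :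
    ContinuousOn (toCM g) V := by
  rw [continuousOn_iff_continuous_domRestrict]
  refine ContinuousMap.continuous_of_continuous_uncurry _ ?_
  have : (Function.uncurry fun (x : V) (k : K) => V.domRestrict (toCM g) x k) =
      fun p : V × K => Function.uncurry g (p.1, p.2) := by
    ext p
    exact toCM_apply hg p.1.2 p.2
  rw [this]
  exact hg.comp_continuous (by fun_prop) (fun p => ⟨p.1.2, mem_univ _⟩)

end toCM

/-- Every continuous function on an open subset of `E` which is holomorphic along complex lines
is analytic. -/
def OsgoodSpace (E : Type*) [NormedAddCommGroup E] [NormedSpace ℂ E] : Prop :=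
  ∀ (F : Type u) [NormedAddCommGroup F] [NormedSpace ℂ F] [CompleteSpace F] (f : E → F)
    (U : Set E), IsOpen U → ContinuousOn f U → (∀ x ∈ U, ∀ v, LineDifferentiableAt ℂ f x v) →
    AnalyticOnNhd ℂ f U

lemma differentiableOn_line {E : Type*} [NormedAddCommGroup E] [NormedSpace ℂ E] {f : E → F}
    {U : Set E} (h : ∀ x ∈ U, ∀ v, LineDifferentiableAt ℂ f x v) (x v : E) :
    DifferentiableOn ℂ (fun z : ℂ => f (x + z • v)) {z | x + z • v ∈ U} := by
  intro z hz
  have h1 : DifferentiableAt ℂ (fun w : ℂ => f (x + z • v + w • v)) (z - z) := by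
    rw [sub_self]; exact h _ hz v
  have h2 := h1.comp z (f := fun w => w - z) (by fun_prop)
  refine (h2.congr_of_eventuallyEq (Eventually.of_forall fun w => ?_)).differentiableWithinAt
  simp only [Function.comp]
  congr 1
  module

lemma lineDifferentiableAt_toCM {E : Type*} [NormedAddCommGroup E] [NormedSpace ℂ E]
    {g : E → K → F} {V : Set E} (hV : IsOpen V)
    (hg : ContinuousOn (Function.uncurry g) (V ×ˢ univ))
    (hd : ∀ k, ∀ x ∈ V, ∀ v, LineDifferentiableAt ℂ (fun x => g x k) x v) :
    ∀ x ∈ V, ∀ v, LineDifferentiableAt ℂ (toCM g) x v := by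
  intro x hx v
  have hline : Continuous fun z : ℂ => x + z • v := by fun_prop
  have hO : IsOpen {z : ℂ | x + z • v ∈ V} := hV.preimage hline
  refine (differentiableOn_continuousMap hO (Φ := fun z : ℂ => toCM g (x + z • v))
    ((continuousOn_toCM hg).comp hline.continuousOn fun z hz => hz) fun k => ?_).differentiableAt
    (hO.mem_nhds (by simpa using hx))
  refine (differentiableOn_line (hd k) x v).congr fun z hz => ?_
  exact toCM_apply hg hz k

lemma OsgoodSpace.prod {E : Type*} [NormedAddCommGroup E] [NormedSpace ℂ E]
    (hE : OsgoodSpace.{u} E) : OsgoodSpace.{u} (ℂ × E) := by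
  intro F _ _ _ f U hU hc hd ⟨z₀, w₀⟩ hz₀
  obtain ⟨R, hR, hRU⟩ := nhds_basis_closedBall.mem_iff.1 (hU.mem_nhds hz₀)
  rw [← closedBall_prod_same] at hRU
  have hcirc : ∀ t, circleMap z₀ R t ∈ closedBall z₀ R := fun t =>
    circleMap_mem_closedBall _ hR.le t
  set g : E → I → F := fun w t => f (circleMap z₀ R (2 * π * t), w) with hgdef
  have hg : ContinuousOn (Function.uncurry g) (ball w₀ R ×ˢ univ) := by
    refine hc.comp (f := fun p : E × I => (circleMap z₀ R (2 * π * p.2), p.1)) ?_ ?_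
    · have := continuous_circleMap z₀ R
      fun_prop
    · exact fun p hp => hRU ⟨hcirc _, ball_subset_closedBall hp.1⟩
  have hΦ : AnalyticAt ℂ (toCM g) w₀ := by
    refine hE _ (toCM g) (ball w₀ R) isOpen_ball (continuousOn_toCM hg)
      (lineDifferentiableAt_toCM isOpen_ball hg ?_) w₀ (mem_ball_self hR)
    intro t w hw v
    have := hd (circleMap z₀ R (2 * π * t), w) (hRU ⟨hcirc _, ball_subset_closedBall hw⟩) (0, v)
    simpa [LineDifferentiableAt, hgdef] using this
  set a : ℂ → I → ℂ := fun z t =>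
    (circleMap z₀ R (2 * π * t) - z₀) * (circleMap z₀ R (2 * π * t) - z)⁻¹ with hadef
  have hne : ∀ z ∈ ball z₀ R, ∀ t, circleMap z₀ R t - z ≠ 0 := fun z hz t h =>
    circleMap_ne_mem_ball hz t (sub_eq_zero.1 h)
  have ha : ContinuousOn (Function.uncurry a) (ball z₀ R ×ˢ univ) := by
    have := continuous_circleMap z₀ R
    refine ContinuousOn.mul (by fun_prop) (ContinuousOn.inv₀ (by fun_prop) ?_)
    exact fun p hp => hne _ hp.1 _
  have hA : AnalyticAt ℂ (toCM a) z₀ := by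
    have hDO : DifferentiableOn ℂ (toCM a) (ball z₀ R) := by
      refine differentiableOn_continuousMap isOpen_ball (continuousOn_toCM ha) fun t => ?_
      have : DifferentiableOn ℂ (fun z => a z t) (ball z₀ R) := by
        intro z hz
        refine DifferentiableAt.differentiableWithinAt ?_
        exact DifferentiableAt.mul (by fun_prop) (DifferentiableAt.inv (by fun_prop) (hne z hz _))
      exact this.congr fun z hz => toCM_apply ha hz t
    exact hDO.analyticAt (ball_mem_nhds _ hR)
  have hmain : AnalyticAt ℂ (fun p : ℂ × E => integralCM F (smulCM I F (toCM a p.1) (toCM g p.2)))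
      (z₀, w₀) := by
    have h1 : AnalyticAt ℂ (fun p : ℂ × E => toCM a p.1) (z₀, w₀) :=
      hA.comp (g := toCM a) (f := Prod.fst) (x := (z₀, w₀)) analyticAt_fst
    have h2 : AnalyticAt ℂ (fun p : ℂ × E => toCM g p.2) (z₀, w₀) :=
      hΦ.comp (g := toCM g) (f := Prod.snd) (x := (z₀, w₀)) analyticAt_snd
    have h3 := ((smulCM I F).analyticAt_bilinear
      (toCM a z₀, toCM g w₀)).comp₂ h1 h2
    exact ((integralCM F).analyticAt _).comp h3
  refine hmain.congr ?_
  have : ball z₀ R ×ˢ ball w₀ R ∈ 𝓝 (z₀, w₀) :=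
    prod_mem_nhds (ball_mem_nhds _ hR) (ball_mem_nhds _ hR)
  filter_upwards [this] with ⟨z, w⟩ ⟨hz, hw⟩
  have hdiff : ∀ x ∈ closedBall z₀ R, DifferentiableAt ℂ (fun x => f (x, w)) x := by
    intro x hx
    have hmem : (x, w) ∈ U := hRU ⟨hx, ball_subset_closedBall hw⟩
    have h1 : DifferentiableAt ℂ (fun y : ℂ => f ((x, w) + y • ((1 : ℂ), (0 : E)))) (x - x) := by
      rw [sub_self]; exact hd _ hmem _
    have h2 := h1.comp x (f := fun y => y - x) (by fun_prop)
    simpa [Function.comp_def] using h2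
  rw [cauchy_unitInterval (f := fun x => f (x, w)) hz
    (fun x hx => (hdiff x hx).continuousAt.continuousWithinAt)
    (fun x hx => hdiff x (ball_subset_closedBall hx))]
  refine integralCM_eq _ fun t => ?_
  rw [smulCM_apply, toCM_apply ha hz, toCM_apply hg hw]

lemma OsgoodSpace.of_equiv {E E' : Type*} [NormedAddCommGroup E] [NormedSpace ℂ E]
    [NormedAddCommGroup E'] [NormedSpace ℂ E'] (e : E ≃L[ℂ] E')
    (hE : OsgoodSpace.{u} E) : OsgoodSpace.{u} E' := by
  intro F _ _ _ f U hU hc hd x hx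
  have h := hE F (f ∘ e) (e ⁻¹' U) (hU.preimage e.continuous)
    (hc.comp e.continuous.continuousOn fun _ h => h) ?_ (e.symm x) (by simpa using hx)
  · have h' := h.comp (g := f ∘ e) (f := e.symm) (x := x)
        (e.symm.toContinuousLinearMap.analyticAt x)
    simpa [Function.comp_def] using h'
  · intro y hy v
    simpa [LineDifferentiableAt] using hd (e y) hy (e v)

theorem osgoodSpace_of_finiteDimensional (E : Type*) [NormedAddCommGroup E] [NormedSpace ℂ E]
    [FiniteDimensional ℂ E] : OsgoodSpace.{u} E := by
  have key : ∀ n : ℕ, OsgoodSpace.{u} (Fin n → ℂ) := by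
    intro n
    induction n with
    | zero =>
      intro F _ _ _ f U hU _ _ x _
      have : f = fun _ => f x := by
        ext y; congr 1; exact Subsingleton.elim _ _
      rw [this]
      exact analyticAt_const
    | succ n ih =>
      refine OsgoodSpace.of_equiv (E := ℂ × (Fin n → ℂ)) ?_ ih.prod
      exact ContinuousLinearEquiv.ofFinrankEq (by simp [add_comm])
  exact (key (Module.finrank ℂ E)).of_equiv (ContinuousLinearEquiv.ofFinrankEq (by simp))

variable {E : Type*} [NormedAddCommGroup E] [NormedSpace ℂ E] [FiniteDimensional ℂ E]

/-- **Osgood's lemma.** -/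
theorem analyticOnNhd_of_lineDifferentiable {f : E → F} {U : Set E} (hU : IsOpen U)
    (hc : ContinuousOn f U) (hd : ∀ x ∈ U, ∀ v, LineDifferentiableAt ℂ f x v) :
    AnalyticOnNhd ℂ f U :=
  osgoodSpace_of_finiteDimensional E F f U hU hc hd

lemma AnalyticAt.lineDiff {E : Type*} [NormedAddCommGroup E] [NormedSpace ℂ E] {f : E → F} {x : E}
    (h : AnalyticAt ℂ f x) (v : E) : LineDifferentiableAt ℂ f x v :=
  h.differentiableAt.lineDifferentiableAt

/-- A uniform limit of analytic functions is analytic. -/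
theorem analyticOnNhd_of_tendstoUniformlyOn {f : ℕ → E → F} {g : E → F} {U : Set E} (hU : IsOpen U)
    (hf : ∀ k, AnalyticOnNhd ℂ (f k) U) (h : TendstoUniformlyOn f g atTop U) :
    AnalyticOnNhd ℂ g U := by
  refine analyticOnNhd_of_lineDifferentiable hU
    (h.continuousOn (Frequently.of_forall fun k => (hf k).continuousOn)) fun x hx v => ?_
  have hline : Continuous fun z : ℂ => x + z • v := by fun_prop
  have hO : IsOpen {z : ℂ | x + z • v ∈ U} := hU.preimage hline
  have h1 : TendstoLocallyUniformlyOn (fun k (z : ℂ) => f k (x + z • v)) (fun z => g (x + z • v))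
      atTop {z : ℂ | x + z • v ∈ U} :=
    (h.comp (fun z : ℂ => x + z • v)).tendstoLocallyUniformlyOn
  refine (h1.differentiableOn (Eventually.of_forall fun k => ?_) hO).differentiableAt
    (hO.mem_nhds (by simpa using hx))
  exact differentiableOn_line (fun y hy w => (hf k y hy).lineDiff w) x v

/-- Currying an analytic family of continuous maps. -/
theorem analyticOnNhd_toCM {g : E → K → F} {V : Set E} (hV : IsOpen V)
    (hg : ContinuousOn (Function.uncurry g) (V ×ˢ univ))
    (hd : ∀ k, AnalyticOnNhd ℂ (fun x => g x k) V) : AnalyticOnNhd ℂ (toCM g) V :=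
  analyticOnNhd_of_lineDifferentiable hV (continuousOn_toCM hg)
    (lineDifferentiableAt_toCM hV hg fun k x hx v => (hd k x hx).lineDiff v)

/-- Analyticity of integrals depending on a parameter. -/
theorem analyticOnNhd_integral {g : E → ℝ → F} {V : Set E} (hV : IsOpen V)
    (hg : ContinuousOn (Function.uncurry g) (V ×ˢ Icc 0 1))
    (hd : ∀ t ∈ Icc (0 : ℝ) 1, AnalyticOnNhd ℂ (fun x => g x t) V) :
    AnalyticOnNhd ℂ (fun x => ∫ t in (0 : ℝ)..1, g x t) V := by
  have hg' : ContinuousOn (Function.uncurry fun x (t : I) => g x t) (V ×ˢ univ) :=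
    hg.comp (f := fun p : E × I => (p.1, (p.2 : ℝ))) (by fun_prop) fun p hp => ⟨hp.1, p.2.2⟩
  have h := analyticOnNhd_toCM hV hg' fun k => hd k k.2
  intro x hx
  refine (((integralCM F).analyticAt _).comp (h x hx)).congr ?_
  filter_upwards [hV.mem_nhds hx] with y hy
  exact integralCM_eq _ fun t => toCM_apply hg' hy t

end SeveralVariables

section Germs

open scoped unitInterval Real

open Asymptotics

variable {E : Type*} [NormedAddCommGroup E] [NormedSpace ℂ E]
  {F : Type*} [NormedAddCommGroup F] [NormedSpace ℂ F]

lemma HasDerivAt.comp_ofReal_vec {F : Type*} [NormedAddCommGroup F] [NormedSpace ℂ F]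
    {g : ℂ → F} {g' : F} {t : ℝ} (h : HasDerivAt g g' (t : ℂ)) :
    HasDerivAt (fun t : ℝ => g t) g' t := by
  have h1 : HasDerivAt (fun t : ℝ => (t : ℂ)) 1 t := Complex.ofRealCLM.hasDerivAt
  simpa [Function.comp_def] using HasDerivAt.scomp t h h1

lemma isBigO_norm_pow_iff {f : E → F} {N : ℕ} : (f =O[𝓝 0] fun x => ‖x‖ ^ N) ↔
    ∃ C r, 0 < C ∧ 0 < r ∧ ∀ x, ‖x‖ < r → ‖f x‖ ≤ C * ‖x‖ ^ N := by
  constructor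
  · intro h
    obtain ⟨C, hC, h⟩ := h.exists_pos
    rw [isBigOWith_iff] at h
    obtain ⟨r, hr, h⟩ := Metric.eventually_nhds_iff.1 h
    exact ⟨C, r, hC, hr, fun x hx => by simpa using h (y := x) (by simpa using hx)⟩
  · rintro ⟨C, r, hC, hr, h⟩
    refine IsBigO.of_bound C ?_
    filter_upwards [ball_mem_nhds (0 : E) hr] with x hx
    simpa using h x (by simpa using hx)

lemma isBigO_pow_of_le {M N : ℕ} (h : M ≤ N) :
    (fun x : E => ‖x‖ ^ N) =O[𝓝 0] fun x => ‖x‖ ^ M := by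
  refine IsBigO.of_bound 1 ?_
  filter_upwards [ball_mem_nhds (0 : E) one_pos] with x hx
  rw [mem_ball_zero_iff] at hx
  simpa using pow_le_pow_of_le_one (norm_nonneg x) hx.le h

/-- Cauchy estimate for a directional derivative. -/
lemma norm_fderiv_apply_le {f : E → F} {x v : E} {ρ C : ℝ} (hρ : 0 < ρ)
    (hf : ∀ y ∈ closedBall x (ρ * ‖v‖), DifferentiableAt ℂ f y)
    (hC : ∀ y ∈ closedBall x (ρ * ‖v‖), ‖f y‖ ≤ C) : ‖fderiv ℂ f x v‖ ≤ C / ρ := by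
  have hmem : ∀ z ∈ closedBall (0 : ℂ) ρ, x + z • v ∈ closedBall x (ρ * ‖v‖) := by
    intro z hz
    rw [mem_closedBall_zero_iff] at hz
    rw [mem_closedBall, dist_self_add_left, norm_smul]
    gcongr
  have hd : ∀ z ∈ closedBall (0 : ℂ) ρ, DifferentiableAt ℂ (fun z : ℂ => f (x + z • v)) z :=
    fun z hz => (hf _ (hmem z hz)).comp z (by fun_prop)
  have h1 : deriv (fun z : ℂ => f (x + z • v)) 0 = fderiv ℂ f x v := by
    have h2 := (hf x (mem_closedBall_self (by positivity))).hasFDerivAt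
    have h3 : HasDerivAt (fun z : ℂ => x + z • v) v 0 := by
      simpa using ((hasDerivAt_id (0 : ℂ)).smul_const v).const_add x
    have h2' : HasFDerivAt f (fderiv ℂ f x) (x + (0 : ℂ) • v) := by simpa using h2
    exact (h2'.comp_hasDerivAt 0 h3).deriv
  rw [← h1]
  refine Complex.norm_deriv_le_of_forall_mem_sphere_norm_le hρ
    (DifferentiableOn.diffContOnCl fun z hz => ?_)
    fun z hz => hC _ (hmem z (sphere_subset_closedBall hz))
  rw [closure_ball _ hρ.ne'] at hz
  exact (hd z hz).differentiableWithinAt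

theorem isBigO_fderiv [CompleteSpace F] {f : E → F} {N : ℕ} (hf : AnalyticAt ℂ f 0)
    (h : f =O[𝓝 0] fun x => ‖x‖ ^ (N + 1)) : fderiv ℂ f =O[𝓝 0] fun x => ‖x‖ ^ N := by
  obtain ⟨C, r, hC, hr, h0⟩ := isBigO_norm_pow_iff.1 h
  obtain ⟨r', hr', hd⟩ := Metric.eventually_nhds_iff.1 hf.eventually_analyticAt
  set δ := min r r' / 2 with hδ
  have hδ0 : 0 < δ := by positivity
  refine isBigO_norm_pow_iff.2 ⟨C * 2 ^ (N + 1) + ‖fderiv ℂ f 0‖, δ, by positivity, hδ0,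
    fun x hx => ?_⟩
  rcases eq_or_ne x 0 with rfl | hx0
  · rcases N with _ | N
    · simp; positivity
    · have : HasFDerivAt f (0 : E →L[ℂ] F) 0 :=
        IsBigO.hasFDerivAt (n := N + 1 + 1) (by simpa using h) (by omega)
      simp [this.fderiv]
  · have hxp : 0 < ‖x‖ := norm_pos_iff.2 hx0
    have : ‖fderiv ℂ f x‖ ≤ C * 2 ^ (N + 1) * ‖x‖ ^ N := by
      refine ContinuousLinearMap.opNorm_le_bound _ (by positivity) fun v => ?_
      rcases eq_or_ne v 0 with rfl | hv0
      · simp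
      have hvp : 0 < ‖v‖ := norm_pos_iff.2 hv0
      have hρ : 0 < ‖x‖ / ‖v‖ := by positivity
      have hmem : ∀ y ∈ closedBall x (‖x‖ / ‖v‖ * ‖v‖), ‖y‖ ≤ 2 * ‖x‖ := by
        intro y hy
        rw [div_mul_cancel₀ _ hvp.ne', mem_closedBall, dist_eq_norm] at hy
        calc ‖y‖ = ‖(y - x) + x‖ := by simp
          _ ≤ ‖y - x‖ + ‖x‖ := norm_add_le _ _
          _ ≤ _ := by linarith
      have hlt : 2 * ‖x‖ < min r r' := by rw [hδ] at hx; linarith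
      refine (norm_fderiv_apply_le (C := C * (2 * ‖x‖) ^ (N + 1)) hρ (fun y hy => ?_)
        fun y hy => ?_).trans_eq ?_
      · refine (hd (y := y) ?_).differentiableAt
        rw [dist_zero_right]
        exact (hmem y hy).trans_lt (hlt.trans_le (min_le_right _ _))
      · refine (h0 y ((hmem y hy).trans_lt (hlt.trans_le (min_le_left _ _)))).trans ?_
        gcongr
        exact hmem y hy
      · field_simp
        ring
    calc _ ≤ _ := this
      _ ≤ _ := by gcongr; simp

/-- Low order Taylor coefficients of a germ of high order vanish. -/
theorem coeff_eq_zero_of_isBigO {f : E → F} {p : FormalMultilinearSeries ℂ E F}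
    (hp : HasFPowerSeriesAt f p 0) {N : ℕ} (h : f =O[𝓝 0] fun x => ‖x‖ ^ N) :
    ∀ k < N, ∀ y, (p k fun _ => y) = 0 := by
  intro k
  induction k using Nat.strong_induction_on with
  | _ k hk =>
    intro hkN
    have psum_eq : p.partialSum (k + 1) = fun y => p k fun _ => y := by
      funext z
      refine Finset.sum_eq_single _ (fun b hb hnb => ?_) fun hn => ?_
      · have := Finset.mem_range_succ_iff.mp hb
        exact hk b (this.lt_of_ne hnb) (by omega) z
      · exact False.elim (hn (Finset.mem_range.mpr (lt_add_one k)))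
    have h1 := hp.isBigO_sub_partialSum_pow (k + 1)
    simp only [psum_eq, zero_add] at h1
    have h2 : (fun y => p k fun _ => y) =O[𝓝 0] fun y : E => ‖y‖ ^ (k + 1) := by
      have := (h.trans (isBigO_pow_of_le hkN)).sub h1
      simpa using this
    exact h2.continuousMultilinearMap_apply_eq_zero

theorem eventually_eq_zero_of_flat {f : E → F} (hf : AnalyticAt ℂ f 0)
    (h : ∀ N : ℕ, f =O[𝓝 0] fun x => ‖x‖ ^ N) : ∀ᶠ x in 𝓝 0, f x = 0 := by
  obtain ⟨p, hp⟩ := hf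
  obtain ⟨r, hp'⟩ := hp
  filter_upwards [hp'.eventually_hasSum_sub] with y hy
  have : ∀ n, (p n fun _ => y - 0) = 0 := fun n =>
    coeff_eq_zero_of_isBigO ⟨r, hp'⟩ (h (n + 1)) n (by omega) _
  simp only [this] at hy
  exact hy.unique hasSum_zero

variable [FiniteDimensional ℂ E] [CompleteSpace F]

/-- Hadamard's lemma. -/
theorem exists_hadamard {f : E → F} (hf : AnalyticAt ℂ f 0) (h0 : f 0 = 0) :
    ∃ q : E → E →L[ℂ] F, AnalyticAt ℂ q 0 ∧ ∀ᶠ x in 𝓝 0, f x = q x x := by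
  obtain ⟨r, hr, hd⟩ := Metric.eventually_nhds_iff.1 hf.eventually_analyticAt
  have hd' : AnalyticOnNhd ℂ f (ball 0 r) := fun x hx => hd hx
  have hmaps : ∀ x ∈ ball (0 : E) r, ∀ t ∈ Icc (0 : ℝ) 1, (t : ℂ) • x ∈ ball (0 : E) r := by
    intro x hx t ht
    rw [mem_ball_zero_iff] at *
    rw [norm_smul, Complex.norm_real, Real.norm_of_nonneg ht.1]
    exact (mul_le_of_le_one_left (norm_nonneg _) ht.2).trans_lt hx
  have han := hd'.fderiv
  refine ⟨fun x => ∫ t in (0 : ℝ)..1, fderiv ℂ f ((t : ℂ) • x), ?_, ?_⟩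
  · refine analyticOnNhd_integral (g := fun x t => fderiv ℂ f ((t : ℂ) • x)) isOpen_ball ?_ ?_ 0
      (mem_ball_self hr)
    · refine han.continuousOn.comp (f := fun p : E × ℝ => (p.2 : ℂ) • p.1) (by fun_prop) ?_
      exact fun p hp => hmaps _ hp.1 _ hp.2
    · intro t ht x hx
      exact (han _ (hmaps x hx t ht)).comp (f := fun x : E => (t : ℂ) • x)
        (((t : ℂ) • ContinuousLinearMap.id ℂ E).analyticAt x)
  · filter_upwards [ball_mem_nhds (0 : E) hr] with x hx
    have hcont : ContinuousOn (fun t : ℝ => fderiv ℂ f ((t : ℂ) • x)) (uIcc 0 1) := by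
      rw [uIcc_of_le zero_le_one]
      exact han.continuousOn.comp (f := fun t : ℝ => (t : ℂ) • x) (by fun_prop)
        fun t ht => hmaps x hx t ht
    rw [ContinuousLinearMap.intervalIntegral_apply hcont.intervalIntegrable]
    have := intervalIntegral.integral_eq_sub_of_hasDerivAt (a := 0) (b := 1)
      (f := fun t : ℝ => f ((t : ℂ) • x)) (f' := fun t : ℝ => fderiv ℂ f ((t : ℂ) • x) x) ?_ ?_
    · rw [this]; simp [h0]
    · intro t ht
      rw [uIcc_of_le zero_le_one] at ht
      have h1 : HasDerivAt (fun z : ℂ => z • x) x (t : ℂ) := by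
        simpa using (hasDerivAt_id (t : ℂ)).smul_const x
      exact (((hd' _ (hmaps x hx t ht)).differentiableAt.hasFDerivAt).comp_hasDerivAt
        (t : ℂ) h1).comp_ofReal_vec
    · exact (hcont.clm_apply continuousOn_const).intervalIntegrable

/-- Factoring `f (s • y) = s ^ m • H (s, y)`. -/
theorem exists_factor {f : E → F} {p : FormalMultilinearSeries ℂ E F} {r : ℝ} {m : ℕ}
    (hp : HasFPowerSeriesAt f p 0)
    (hf : AnalyticOnNhd ℂ f (ball 0 r)) (hO : f =O[𝓝 0] fun x => ‖x‖ ^ m) :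
    ∃ H : ℂ × E → F, AnalyticOnNhd ℂ H {q | ‖q.1 • q.2‖ < r} ∧
      (∀ s y, s ≠ 0 → s ^ m • H (s, y) = f (s • y)) ∧ ∀ y, H (0, y) = p m fun _ => y := by
  classical
  set H : ℂ × E → F := fun q => if q.1 = 0 then p m fun _ => q.2
    else (q.1 ^ m)⁻¹ • f (q.1 • q.2) with hH
  have hU : IsOpen {q : ℂ × E | ‖q.1 • q.2‖ < r} := isOpen_lt (by fun_prop) (by fun_prop)
  have hpoly : Continuous fun y => p m fun _ => y := (p m).cont.comp (by fun_prop)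
  have hne : ∀ q ∈ {q : ℂ × E | ‖q.1 • q.2‖ < r}, q.1 ≠ 0 → AnalyticAt ℂ H q := by
    intro q hq hq0
    have h1 : AnalyticAt ℂ (fun q : ℂ × E => (q.1 ^ m)⁻¹ • f (q.1 • q.2)) q := by
      have h2 : AnalyticAt ℂ (fun q : ℂ × E => q.1 • q.2) q := analyticAt_fst.smul analyticAt_snd
      have h3 : AnalyticAt ℂ (fun q : ℂ × E => f (q.1 • q.2)) q :=
        (hf _ (mem_ball_zero_iff.2 hq)).comp_of_eq h2 rfl
      exact ((analyticAt_fst.pow m).inv (pow_ne_zero _ hq0)).smul h3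
    refine h1.congr ?_
    filter_upwards [(continuous_fst.tendsto q).eventually_ne hq0] with q' hq'
    simp [hH, hq']
  have hc0 : ∀ y, ContinuousAt H (0, y) := by
    intro y
    have h1 : (f - (fun y => p m fun _ => y)) =O[𝓝 0] fun x : E => ‖x‖ ^ (m + 1) := by
      have h2 := hp.isBigO_sub_partialSum_pow (m + 1)
      have psum_eq : p.partialSum (m + 1) = fun y => p m fun _ => y := by
        funext z
        refine Finset.sum_eq_single _ (fun b hb hnb => ?_) fun hn => ?_
        · have := Finset.mem_range_succ_iff.mp hb
          exact coeff_eq_zero_of_isBigO hp hO b (this.lt_of_ne hnb) z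
        · exact False.elim (hn (Finset.mem_range.mpr (lt_add_one m)))
      simp only [psum_eq, zero_add] at h2
      exact h2
    obtain ⟨C, δ, hC, hδ, hb⟩ := isBigO_norm_pow_iff.1 h1
    have hev : ∀ᶠ q : ℂ × E in 𝓝 (0, y), ‖q.1 • q.2‖ < δ :=
      (isOpen_lt (by fun_prop) (by fun_prop)).mem_nhds (by simpa using hδ)
    have hlim : Tendsto (fun q : ℂ × E => H q - p m fun _ => q.2) (𝓝 (0, y)) (𝓝 0) := by
      have hz : Tendsto (fun q : ℂ × E => C * (‖q.1‖ * ‖q.2‖ ^ (m + 1))) (𝓝 (0, y)) (𝓝 0) := by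
        have : Continuous fun q : ℂ × E => C * (‖q.1‖ * ‖q.2‖ ^ (m + 1)) := by fun_prop
        simpa using this.tendsto (0, y)
      refine squeeze_zero_norm' ?_ hz
      filter_upwards [hev] with q hq
      by_cases h0 : q.1 = 0
      · simp [hH, h0]
      · have hb' := hb _ hq
        simp only [hH, h0, if_false]
        have hpm : (p m fun _ => q.1 • q.2) = q.1 ^ m • p m fun _ => q.2 := by
          have := (p m).map_smul_univ (fun _ => q.1) (fun _ => q.2)
          simpa using this
        have : (q.1 ^ m)⁻¹ • f (q.1 • q.2) - (p m fun _ => q.2) =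
            (q.1 ^ m)⁻¹ • (f - fun y => p m fun _ => y) (q.1 • q.2) := by
          simp only [Pi.sub_apply, hpm, smul_sub]
          rw [inv_smul_smul₀ (pow_ne_zero _ h0)]
        rw [this, norm_smul, norm_inv, norm_pow]
        have hq1 : 0 < ‖q.1‖ := norm_pos_iff.2 h0
        rw [norm_smul, mul_pow] at hb'
        rw [inv_mul_le_iff₀ (by positivity)]
        refine hb'.trans_eq ?_
        ring
    have h3 : Tendsto (fun q : ℂ × E => p m fun _ => q.2) (𝓝 (0, y)) (𝓝 (p m fun _ => y)) :=
      (hpoly.comp continuous_snd).tendsto (0, y)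
    have h4 := hlim.add h3
    simpa [ContinuousAt, hH] using h4
  have hcont : ContinuousOn H {q | ‖q.1 • q.2‖ < r} := by
    intro q hq
    by_cases h0 : q.1 = 0
    · have : q = (0, q.2) := Prod.ext h0 rfl
      rw [this]
      exact (hc0 q.2).continuousWithinAt
    · exact (hne q hq h0).continuousAt.continuousWithinAt
  refine ⟨H, analyticOnNhd_of_lineDifferentiable hU hcont ?_, ?_, ?_⟩
  · intro q hq v
    by_cases h0 : q.1 = 0
    · by_cases hv : v.1 = 0
      · have h1 : (fun t : ℂ => H (q + t • v)) = fun t : ℂ => p m fun _ => q.2 + t • v.2 := by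
          ext t
          simp [hH, h0, hv]
        rw [LineDifferentiableAt, h1]
        have h2 : DifferentiableAt ℂ (p m) (fun _ : Fin m => q.2 + (0 : ℂ) • v.2) :=
          ((p m).hasFDerivAt _).differentiableAt
        exact h2.comp (0 : ℂ) (f := fun (t : ℂ) (_ : Fin m) => q.2 + t • v.2) (by fun_prop)
      · refine (Complex.analyticAt_of_differentiable_on_punctured_nhds_of_continuousAt
          ?_ ?_).differentiableAt
        · have hev : ∀ᶠ t : ℂ in 𝓝 0, q + t • v ∈ {q : ℂ × E | ‖q.1 • q.2‖ < r} := by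
            have : Continuous fun t : ℂ => q + t • v := by fun_prop
            exact this.continuousAt.eventually_mem (by simpa using hU.mem_nhds hq)
          filter_upwards [hev.filter_mono nhdsWithin_le_nhds, self_mem_nhdsWithin] with t ht ht0
          refine (hne _ ht ?_).differentiableAt.comp t (f := fun t : ℂ => q + t • v) (by fun_prop)
          simpa [h0, hv] using ht0
        · have h1 : ContinuousAt H (q + (0 : ℂ) • v) := by
            simpa using hcont.continuousAt (hU.mem_nhds hq)
          exact h1.comp (f := fun t : ℂ => q + t • v) (by fun_prop)
    · exact (hne q hq h0).lineDiff v
  · intro s y hs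
    simp only [hH, hs, if_false]
    rw [smul_inv_smul₀ (pow_ne_zero _ hs)]
  · intro y
    simp [hH]

end Germs

section GeneralizedEigenspaces

open Polynomial

/-- A polynomial acting on the generalized eigenspaces of `D` through prescribed scalars. -/
def ActsOnGenEigenspaces {V : Type*} [AddCommGroup V] [Module ℂ V] (T D : Module.End ℂ V)
    (c : ℂ → ℂ) : Prop :=
  ∀ μ, ∀ v ∈ D.maxGenEigenspace μ, T v = c μ • v

lemma exists_polynomial_sub_mem (Λ : Finset ℂ) (K : ℕ) (c : ℂ → ℂ) :
    ∃ P : ℂ[X], ∀ μ ∈ Λ, (X - C μ) ^ K ∣ P - C (c μ) := by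
  obtain ⟨P, hP⟩ := Ideal.exists_forall_sub_mem_ideal (ι := Λ)
    (I := fun μ => Ideal.span {(X - C (μ : ℂ)) ^ K}) (fun a b hab => by
      rw [Function.onFun, Ideal.isCoprime_span_singleton_iff]
      exact (isCoprime_X_sub_C_of_isUnit_sub
        (sub_ne_zero.2 (fun h => hab (Subtype.ext h))).isUnit).pow) (fun μ => C (c μ))
  exact ⟨P, fun μ hμ => Ideal.mem_span_singleton.1 (hP ⟨μ, hμ⟩)⟩

lemma actsOnGenEigenspaces_aeval {V : Type*} [AddCommGroup V] [Module ℂ V]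
    [FiniteDimensional ℂ V] (D : Module.End ℂ V) {Λ : Finset ℂ} {K : ℕ} {c : ℂ → ℂ} {P : ℂ[X]}
    (hΛ : ∀ μ, D.HasEigenvalue μ → μ ∈ Λ) (hK : Module.finrank ℂ V ≤ K)
    (hP : ∀ μ ∈ Λ, (X - C μ) ^ K ∣ P - C (c μ)) : ActsOnGenEigenspaces (aeval D P) D c := by
  intro μ v hv
  by_cases hμ : D.HasEigenvalue μ
  · obtain ⟨Q, hQ⟩ := hP μ (hΛ μ hμ)
    have h0 : aeval D (P - C (c μ)) v = 0 := by
      rw [hQ, mul_comm, map_mul, Module.End.mul_apply]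
      rw [Module.End.maxGenEigenspace_eq_genEigenspace_finrank,
        Module.End.mem_genEigenspace_nat, LinearMap.mem_ker] at hv
      have : aeval D ((X - C μ) ^ K : ℂ[X]) v = 0 := by
        rw [map_pow, map_sub, aeval_X, aeval_C, Algebra.algebraMap_eq_smul_one,
          ← Nat.sub_add_cancel hK, pow_add, Module.End.mul_apply, hv, map_zero]
      rw [this, map_zero]
    rw [map_sub, aeval_C, Algebra.algebraMap_eq_smul_one, LinearMap.sub_apply, sub_eq_zero] at h0
    simpa using h0
  · have : D.maxGenEigenspace μ = ⊥ := by
      by_contra h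
      exact hμ ((Module.End.hasUnifEigenvalue_iff_hasUnifEigenvalue_one (k := ⊤) (by simp)).1 h)
    rw [this, Submodule.mem_bot] at hv
    simp [hv]

lemma ActsOnGenEigenspaces.ext {V : Type*} [AddCommGroup V] [Module ℂ V]
    [FiniteDimensional ℂ V] {T T' D : Module.End ℂ V} {c : ℂ → ℂ}
    (h : ActsOnGenEigenspaces T D c) (h' : ActsOnGenEigenspaces T' D c) : T = T' := by
  ext v
  have hv : v ∈ ⨆ μ, D.maxGenEigenspace μ := by
    rw [D.iSup_maxGenEigenspace_eq_top]; trivial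
  exact Submodule.iSup_induction _ (motive := fun v => T v = T' v) hv
    (fun μ x hx => by rw [h μ x hx, h' μ x hx]) (by simp)
    (fun x y hx hy => by rw [map_add, map_add, hx, hy])

theorem exists_polynomial_actsOn {V W : Type*} [AddCommGroup V] [Module ℂ V]
    [FiniteDimensional ℂ V] [AddCommGroup W] [Module ℂ W] [FiniteDimensional ℂ W]
    (D : Module.End ℂ V) (A : Module.End ℂ W) (c : ℂ → ℂ) :
    ∃ P : ℂ[X], ActsOnGenEigenspaces (aeval D P) D c ∧ ActsOnGenEigenspaces (aeval A P) A c := by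
  classical
  set Λ : Finset ℂ := D.finite_hasEigenvalue.toFinset ∪ A.finite_hasEigenvalue.toFinset with hΛ
  obtain ⟨P, hP⟩ := exists_polynomial_sub_mem Λ (max (Module.finrank ℂ V) (Module.finrank ℂ W)) c
  refine ⟨P, actsOnGenEigenspaces_aeval D (fun μ h => ?_) (le_max_left _ _) hP,
    actsOnGenEigenspaces_aeval A (fun μ h => ?_) (le_max_right _ _) hP⟩
  · simp [hΛ, h]
  · simp [hΛ, h]

lemma mul_mem_maxGenEigenspace {J : Type*} [CommRing J] [Algebra ℂ J] (D : Module.End ℂ J)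
    (hD : ∀ f g, D (f * g) = f * D g + g * D f)
    {μ ν : ℂ} {f g : J} (hf : f ∈ D.maxGenEigenspace μ)
    (hg : g ∈ D.maxGenEigenspace ν) :
    f * g ∈ D.maxGenEigenspace (μ + ν) := by
  rw [Module.End.mem_maxGenEigenspace] at hf hg
  obtain ⟨a, ha⟩ := hf
  obtain ⟨b, hb⟩ := hg
  have key : ∀ k a b : ℕ, a + b = k → ∀ f g : J,
      ((D - μ • 1) ^ a) f = 0 → ((D - ν • 1) ^ b) g = 0 →
      ((D - (μ + ν) • 1) ^ k) (f * g) = 0 := by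
    intro k
    induction k with
    | zero =>
      intro a b hab f g hf hg
      obtain ⟨rfl, rfl⟩ : a = 0 ∧ b = 0 := by omega
      have : f = 0 := by simpa using hf
      simp [this]
    | succ k ih =>
      intro a b hab f g hf hg
      have hD' : (D - (μ + ν) • 1) (f * g) =
          (D - μ • 1) f * g + f * (D - ν • 1) g := by
        simp only [LinearMap.sub_apply, LinearMap.smul_apply, Module.End.one_apply, hD, add_smul,
          LinearMap.add_apply, sub_mul, mul_sub, smul_mul_assoc, mul_smul_comm]
        ring
      rw [pow_succ, Module.End.mul_apply, hD', map_add]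
      rcases a with _ | a
      · have : f = 0 := by simpa using hf
        simp [this]
      rcases b with _ | b
      · have : g = 0 := by simpa using hg
        simp [this]
      rw [ih a (b + 1) (by omega) _ _ (by rwa [pow_succ, Module.End.mul_apply] at hf) hg,
        ih (a + 1) b (by omega) _ _ hf (by rwa [pow_succ, Module.End.mul_apply] at hg), add_zero]
  rw [Module.End.mem_maxGenEigenspace]
  exact ⟨a + b, key _ a b rfl f g ha hb⟩

/-- A map acting additively on the generalized eigenspaces of a derivation is a derivation. -/
theorem ActsOnGenEigenspaces.leibniz {J : Type*} [CommRing J] [Algebra ℂ J]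
    [FiniteDimensional ℂ J] {D : Module.End ℂ J}
    (hD : ∀ f g, D (f * g) = f * D g + g * D f) {T : Module.End ℂ J} {ρ : ℂ → ℂ}
    (hρ : ∀ a b, ρ (a + b) = ρ a + ρ b)
    (h : ActsOnGenEigenspaces T D ρ) (f g : J) :
    T (f * g) = f * T g + g * T f := by
  have htop : ∀ v : J, v ∈ ⨆ μ, D.maxGenEigenspace μ := fun v => by
    rw [Module.End.iSup_maxGenEigenspace_eq_top]; trivial
  refine Submodule.iSup_induction _ (motive := fun f => T (f * g) = f * T g + g * T f) (htop f)
    (fun μ f hf => ?_) (by simp) (fun x y hx hy => by rw [add_mul, map_add, map_add, hx, hy]; ring)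
  refine Submodule.iSup_induction _ (motive := fun g => T (f * g) = f * T g + g * T f) (htop g)
    (fun ν g hg => ?_) (by simp) (fun x y hx hy => by rw [mul_add, map_add, map_add, hx, hy]; ring)
  rw [h _ _ (mul_mem_maxGenEigenspace D hD hf hg), h _ _ hf, h _ _ hg, hρ]
  simp only [Algebra.smul_def, map_add]
  ring

end GeneralizedEigenspaces

section Jets

open Asymptotics

variable (E : Type*) [NormedAddCommGroup E] [NormedSpace ℂ E]

/-- Functions analytic at the origin. -/
def germAlg : Subalgebra ℂ (E → ℂ) where
  carrier := {f | AnalyticAt ℂ f 0}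
  mul_mem' hf hg := hf.mul hg
  add_mem' hf hg := hf.add hg
  algebraMap_mem' c := (analyticAt_const : AnalyticAt ℂ (fun _ : E => c) 0)

/-- The ideal of functions vanishing at the origin to order `N + 1`. -/
def jetIdeal (N : ℕ) : Ideal (germAlg E) where
  carrier := {f | (f : E → ℂ) =O[𝓝 0] fun x => ‖x‖ ^ (N + 1)}
  add_mem' hf hg := hf.add hg
  zero_mem' := isBigO_zero _ _
  smul_mem' c f hf := by
    have hc : (c : E → ℂ) =O[𝓝 0] fun _ => (1 : ℝ) := c.2.continuousAt.isBigO_one ℝ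
    have h := hc.mul hf
    simp only [one_mul] at h
    exact h

lemma eq_zero_of_isBigO_pow {E F : Type*} [NormedAddCommGroup E] [NormedSpace ℂ E]
    [NormedAddCommGroup F] [NormedSpace ℂ F] {f : E → F} {k : ℕ}
    (h : f =O[𝓝 0] fun x => ‖x‖ ^ (k + 1)) : f 0 = 0 := by
  obtain ⟨C, r, hC, hr, h⟩ := isBigO_norm_pow_iff.1 h
  simpa using h 0 (by simpa using hr)

/-- The algebra of jets of order `N` at the origin. -/
def Jet (N : ℕ) : Type _ := germAlg E ⧸ jetIdeal E N

noncomputable instance (N : ℕ) : CommRing (Jet E N) :=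
  inferInstanceAs (CommRing (germAlg E ⧸ jetIdeal E N))

noncomputable instance (N : ℕ) : Algebra ℂ (Jet E N) :=
  inferInstanceAs (Algebra ℂ (germAlg E ⧸ jetIdeal E N))

variable {E} {N : ℕ}

/-- The jet of an analytic function. -/
def jet (N : ℕ) (f : E → ℂ) (hf : AnalyticAt ℂ f 0) : Jet E N :=
  Ideal.Quotient.mk (jetIdeal E N) ⟨f, hf⟩

lemma jet_eq_iff {f g : E → ℂ} {hf : AnalyticAt ℂ f 0} {hg : AnalyticAt ℂ g 0} :
    jet N f hf = jet N g hg ↔ (fun x => f x - g x) =O[𝓝 0] fun x => ‖x‖ ^ (N + 1) := by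
  exact Ideal.Quotient.eq (I := jetIdeal E N) (x := ⟨f, hf⟩) (y := ⟨g, hg⟩)

lemma jet_eq_zero_iff {f : E → ℂ} {hf : AnalyticAt ℂ f 0} :
    jet N f hf = 0 ↔ f =O[𝓝 0] fun x => ‖x‖ ^ (N + 1) := by
  exact Ideal.Quotient.eq_zero_iff_mem (I := jetIdeal E N) (a := ⟨f, hf⟩)

lemma jet_eq_of_eventuallyEq {f g : E → ℂ} {hf : AnalyticAt ℂ f 0} {hg : AnalyticAt ℂ g 0}
    (h : f =ᶠ[𝓝 0] g) : jet N f hf = jet N g hg := by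
  rw [jet_eq_iff]
  refine (isBigO_zero (E' := ℂ) _ _).congr' ?_ EventuallyEq.rfl
  filter_upwards [h] with x hx
  simp [hx]

lemma jet_surjective (j : Jet E N) : ∃ f hf, jet N f hf = j := by
  obtain ⟨⟨f, hf⟩, rfl⟩ := Ideal.Quotient.mk_surjective j
  exact ⟨f, hf, rfl⟩

lemma jet_add {f g : E → ℂ} (hf : AnalyticAt ℂ f 0) (hg : AnalyticAt ℂ g 0) :
    jet N f hf + jet N g hg = jet N (fun x => f x + g x) (hf.add hg) := rfl

lemma jet_mul {f g : E → ℂ} (hf : AnalyticAt ℂ f 0) (hg : AnalyticAt ℂ g 0) :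
    jet N f hf * jet N g hg = jet N (fun x => f x * g x) (hf.mul hg) := rfl

lemma jet_smul {f : E → ℂ} (c : ℂ) (hf : AnalyticAt ℂ f 0) :
    c • jet N f hf = jet N (fun x => c * f x) (analyticAt_const.mul hf) := rfl

lemma jet_sum {ι : Type*} (s : Finset ι) {f : ι → E → ℂ} (hf : ∀ i, AnalyticAt ℂ (f i) 0) :
    ∑ i ∈ s, jet N (f i) (hf i) =
      jet N (fun x => ∑ i ∈ s, f i x) (Finset.analyticAt_fun_sum s fun i _ => hf i) := by
  classical
  induction s using Finset.induction_on with
  | empty => simp only [Finset.sum_empty]; rfl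
  | insert a s ha ih =>
    rw [Finset.sum_insert ha, ih, jet_add]
    congr 1
    ext x
    rw [Finset.sum_insert ha]

lemma AnalyticAt.clm_app {F G : Type*} [NormedAddCommGroup F] [NormedSpace ℂ F]
    [NormedAddCommGroup G] [NormedSpace ℂ G] {L : E → F →L[ℂ] G} {v : E → F} {x : E}
    (hL : AnalyticAt ℂ L x) (hv : AnalyticAt ℂ v x) : AnalyticAt ℂ (fun x => L x (v x)) x :=
  (ContinuousLinearMap.analyticAt_bilinear (ContinuousLinearMap.apply ℂ G).flip
    (L x, v x)).comp₂ hL hv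

lemma AnalyticAt.fderiv_clm_apply {F : Type*} [NormedAddCommGroup F] [NormedSpace ℂ F]
    [CompleteSpace F] {f : E → F} {W : E → E} {x : E} (hf : AnalyticAt ℂ f x)
    (hW : AnalyticAt ℂ W x) : AnalyticAt ℂ (fun x => fderiv ℂ f x (W x)) x :=
  hf.fderiv.clm_app hW

/-- A linear map out of the jet algebra, given on representatives. -/
noncomputable def jetLift {M : Type*} [AddCommGroup M] [Module ℂ M] (φ : germAlg E →ₗ[ℂ] M)
    (h : ∀ f ∈ jetIdeal E N, φ f = 0) : Jet E N →ₗ[ℂ] M :=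
  Submodule.liftQ ((jetIdeal E N).restrictScalars ℂ) φ h

lemma isBigO_norm_of_zero {F : Type*} [NormedAddCommGroup F] [NormedSpace ℂ F]
    {W : E → F} (hW : AnalyticAt ℂ W 0) (h0 : W 0 = 0) : W =O[𝓝 0] fun x => ‖x‖ := by
  have h := hW.differentiableAt.isBigO_sub
  simpa [h0] using h.norm_right

lemma isBigO_fderiv_apply {F : Type*} [NormedAddCommGroup F] [NormedSpace ℂ F]
    [CompleteSpace F] {f : E → F} {W : E → E} {k : ℕ} (hf : AnalyticAt ℂ f 0)
    (hW : AnalyticAt ℂ W 0) (h0 : W 0 = 0) (h : f =O[𝓝 0] fun x => ‖x‖ ^ (k + 1)) :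
    (fun x => fderiv ℂ f x (W x)) =O[𝓝 0] fun x => ‖x‖ ^ (k + 1) := by
  have h1 := (isBigO_fderiv hf h).norm_left.mul (isBigO_norm_of_zero hW h0).norm_left
  refine IsBigO.trans (IsBigO.of_bound 1 (Eventually.of_forall fun x => ?_))
    (h1.congr_right fun x => by rw [pow_succ])
  simpa using (fderiv ℂ f x).le_opNorm (W x)

/-- The derivation of the jet algebra induced by a vector field vanishing at the origin. -/
noncomputable def jetDer (N : ℕ) (W : E → E) (hW : AnalyticAt ℂ W 0) (h0 : W 0 = 0) :
    Module.End ℂ (Jet E N) :=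
  jetLift (M := Jet E N)
    { toFun := fun f => jet N (fun x => fderiv ℂ f x (W x)) (f.2.fderiv_clm_apply hW)
      map_add' := fun f g => by
        rw [jet_add]
        refine jet_eq_of_eventuallyEq ?_
        filter_upwards [f.2.eventually_analyticAt, g.2.eventually_analyticAt] with x hf hg
        simp [fderiv_add hf.differentiableAt hg.differentiableAt]
      map_smul' := fun c f => by
        rw [RingHom.id_apply, jet_smul]
        refine jet_eq_of_eventuallyEq ?_
        filter_upwards [f.2.eventually_analyticAt] with x hf
        simp [fderiv_const_smul hf.differentiableAt] }
    (fun f hf => jet_eq_zero_iff.2 (isBigO_fderiv_apply f.2 hW h0 hf))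

lemma jetDer_jet {W : E → E} {hW : AnalyticAt ℂ W 0} {h0 : W 0 = 0} {f : E → ℂ}
    (hf : AnalyticAt ℂ f 0) : jetDer N W hW h0 (jet N f hf) =
      jet N (fun x => fderiv ℂ f x (W x)) (hf.fderiv_clm_apply hW) := rfl

lemma jetDer_mul {W : E → E} {hW : AnalyticAt ℂ W 0} {h0 : W 0 = 0} (f g : Jet E N) :
    jetDer N W hW h0 (f * g) = f * jetDer N W hW h0 g + g * jetDer N W hW h0 f := by
  obtain ⟨f, hf, rfl⟩ := jet_surjective f
  obtain ⟨g, hg, rfl⟩ := jet_surjective g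
  rw [jet_mul, jetDer_jet, jetDer_jet, jetDer_jet, jet_mul, jet_mul, jet_add]
  refine jet_eq_of_eventuallyEq ?_
  filter_upwards [hf.eventually_analyticAt, hg.eventually_analyticAt] with x hf hg
  simp [fderiv_fun_mul hf.differentiableAt hg.differentiableAt]

lemma fderiv_fderiv_clm_apply {F : Type*} [NormedAddCommGroup F] [NormedSpace ℂ F]
    [CompleteSpace F] {f : E → F} {W : E → E} {x : E} (hf : AnalyticAt ℂ f x)
    (hW : AnalyticAt ℂ W x) (v : E) : fderiv ℂ (fun x => fderiv ℂ f x (W x)) x v =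
      fderiv ℂ (fderiv ℂ f) x v (W x) + fderiv ℂ f x (fderiv ℂ W x v) := by
  rw [fderiv_clm_apply hf.fderiv.differentiableAt hW.differentiableAt]
  simp [add_comm]

lemma AnalyticAt.fderiv_fderiv_comm {F : Type*} [NormedAddCommGroup F] [NormedSpace ℂ F]
    [CompleteSpace F] {f : E → F} {x : E} (hf : AnalyticAt ℂ f x) (v w : E) :
    fderiv ℂ (fderiv ℂ f) x v w = fderiv ℂ (fderiv ℂ f) x w v :=
  (hf.contDiffAt (n := ⊤)).isSymmSndFDerivAt (by simp) v w

/-- The derivation along a Lie bracket is the commutator. -/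
lemma fderiv_lieBracket_apply {F : Type*} [NormedAddCommGroup F] [NormedSpace ℂ F]
    [CompleteSpace F] {f : E → F} {V W : E → E} {x : E} (hf : AnalyticAt ℂ f x)
    (hV : AnalyticAt ℂ V x) (hW : AnalyticAt ℂ W x) :
    fderiv ℂ f x (VectorField.lieBracket ℂ V W x) =
      fderiv ℂ (fun x => fderiv ℂ f x (W x)) x (V x) -
        fderiv ℂ (fun x => fderiv ℂ f x (V x)) x (W x) := by
  rw [fderiv_fderiv_clm_apply hf hW, fderiv_fderiv_clm_apply hf hV, hf.fderiv_fderiv_comm (W x),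
    VectorField.lieBracket, map_sub]
  abel

/-- The linear part of a jet. -/
noncomputable def jetLin (E : Type*) [NormedAddCommGroup E] [NormedSpace ℂ E] (N : ℕ) :
    Jet E (N + 1) →ₗ[ℂ] (E →L[ℂ] ℂ) :=
  jetLift (M := E →L[ℂ] ℂ)
    { toFun := fun f => fderiv ℂ f 0
      map_add' := fun f g => fderiv_add f.2.differentiableAt g.2.differentiableAt
      map_smul' := fun c f => fderiv_const_smul f.2.differentiableAt c }
    (fun f hf => by
      have h : fderiv ℂ (f : E → ℂ) =O[𝓝 0] fun x => ‖x‖ ^ (N + 1) :=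
        isBigO_fderiv f.2 hf
      exact eq_zero_of_isBigO_pow h)

lemma jetLin_jet {f : E → ℂ} (hf : AnalyticAt ℂ f 0) :
    jetLin E N (jet (N + 1) f hf) = fderiv ℂ f 0 := rfl

/-- The value of a jet. -/
noncomputable def jetVal (E : Type*) [NormedAddCommGroup E] [NormedSpace ℂ E]
    (N : ℕ) : Jet E N →ₗ[ℂ] ℂ :=
  jetLift (M := ℂ)
    { toFun := fun f => (f : E → ℂ) 0
      map_add' := fun _ _ => rfl
      map_smul' := fun _ _ => rfl }
    (fun _ hf => eq_zero_of_isBigO_pow hf)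

lemma jetVal_jet {f : E → ℂ} (hf : AnalyticAt ℂ f 0) : jetVal E N (jet N f hf) = f 0 := rfl

lemma jetLin_jetDer {W : E → E} {hW : AnalyticAt ℂ W 0} {h0 : W 0 = 0} (j : Jet E (N + 1)) :
    jetLin E N (jetDer (N + 1) W hW h0 j) = (jetLin E N j).comp (fderiv ℂ W 0) := by
  obtain ⟨f, hf, rfl⟩ := jet_surjective j
  ext v
  rw [jetDer_jet, jetLin_jet, jetLin_jet, fderiv_fderiv_clm_apply hf hW, h0]
  simp

lemma jetVal_jetDer {W : E → E} {hW : AnalyticAt ℂ W 0} {h0 : W 0 = 0} (j : Jet E N) :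
    jetVal E N (jetDer N W hW h0 j) = 0 := by
  obtain ⟨f, hf, rfl⟩ := jet_surjective j
  rw [jetDer_jet, jetVal_jet, h0, map_zero]

end Jets

section Jets

open Asymptotics

variable {E : Type*} [NormedAddCommGroup E] [NormedSpace ℂ E] {N : ℕ}

/-- The jet of a linear form. -/
noncomputable def jetForm (E : Type*) [NormedAddCommGroup E] [NormedSpace ℂ E] (N : ℕ) :
    (E →L[ℂ] ℂ) →ₗ[ℂ] Jet E N where
  toFun l := jet N (fun x => l x) (l.analyticAt 0)
  map_add' _ _ := rfl
  map_smul' _ _ := rfl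

variable [FiniteDimensional ℂ E]

/-- Coordinate forms in a fixed basis. -/
noncomputable def coordForm (E : Type*) [NormedAddCommGroup E] [NormedSpace ℂ E]
    [FiniteDimensional ℂ E] (j : Fin (Module.finrank ℂ E)) : E →L[ℂ] ℂ :=
  LinearMap.toContinuousLinearMap ((Module.finBasis ℂ E).coord j)

lemma sum_coordForm (x : E) :
    ∑ j, coordForm E j x • (Module.finBasis ℂ E) j = x :=
  (Module.finBasis ℂ E).sum_repr x

lemma exists_mem_adjoin_add (k : ℕ) : ∀ f (hf : AnalyticAt ℂ f 0),
    ∃ a ∈ Algebra.adjoin ℂ (range fun j => jetForm E N (coordForm E j)), ∃ h,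
      ∃ hh : AnalyticAt ℂ h 0,
      h =O[𝓝 0] (fun x : E => ‖x‖ ^ k) ∧ jet N f hf = a + jet N h hh := by
  induction k with
  | zero =>
    intro f hf
    refine ⟨0, zero_mem _, f, hf, ?_, by simp⟩
    simpa using hf.continuousAt.isBigO_one ℝ
  | succ k ih =>
    intro f hf
    obtain ⟨q, hq, hfq⟩ := exists_hadamard (f := fun x => f x - f 0)
      (hf.sub analyticAt_const) (by simp)
    have hqj : ∀ j, AnalyticAt ℂ (fun x => q x (Module.finBasis ℂ E j)) 0 := fun j =>
      hq.clm_app analyticAt_const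
    have hsum : ∀ {g : Fin (Module.finrank ℂ E) → E → ℂ} (hg : ∀ j, AnalyticAt ℂ (g j) 0),
        ∑ j, jetForm E N (coordForm E j) * jet N (g j) (hg j) =
          jet N (fun x => ∑ j, coordForm E j x * g j x) (Finset.analyticAt_fun_sum _ fun j _ =>
            ((coordForm E j).analyticAt 0).mul (hg j)) := fun {g} hg =>
      jet_sum Finset.univ (f := fun j x => coordForm E j x * g j x)
        (fun j => ((coordForm E j).analyticAt 0).mul (hg j))
    choose a ha h hh hO heq using fun j => ih _ (hqj j)
    have hf2 : jet N f hf = algebraMap ℂ _ (f 0) +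
        ∑ j, jetForm E N (coordForm E j) * jet N _ (hqj j) := by
      have : (algebraMap ℂ (Jet E N) (f 0)) = jet N (fun _ => f 0) analyticAt_const := rfl
      rw [this, hsum hqj, jet_add]
      refine jet_eq_of_eventuallyEq ?_
      filter_upwards [hfq] with x hx
      rw [sub_eq_iff_eq_add'] at hx
      rw [hx]
      congr 1
      conv_lhs => rw [show q x x = q x (∑ j, coordForm E j x • (Module.finBasis ℂ E) j) by
        rw [sum_coordForm x]]
      simp
    refine ⟨algebraMap ℂ _ (f 0) + ∑ j, jetForm E N (coordForm E j) * a j, ?_,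
      fun x => ∑ j, coordForm E j x * h j x,
      Finset.analyticAt_fun_sum _ fun j _ => ((coordForm E j).analyticAt 0).mul (hh j), ?_, ?_⟩
    · exact add_mem (Subalgebra.algebraMap_mem _ _) (sum_mem fun j _ => mul_mem
        (Algebra.subset_adjoin (mem_range_self j)) (ha j))
    · refine IsBigO.fun_sum fun j _ => ?_
      have h1 : (fun x => coordForm E j x) =O[𝓝 0] fun x : E => ‖x‖ :=
        isBigO_norm_of_zero ((coordForm E j).analyticAt 0) (map_zero _)
      exact (h1.mul (hO j)).congr_right fun x => by rw [pow_succ, mul_comm]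
    · rw [hf2, add_assoc, ← hsum hh, ← Finset.sum_add_distrib]
      congr 1
      refine Finset.sum_congr rfl fun j _ => ?_
      rw [heq j, mul_add]

lemma adjoin_coordForm (N : ℕ) :
    Algebra.adjoin ℂ (range fun j => jetForm E N (coordForm E j)) = ⊤ := by
  rw [eq_top_iff]
  intro j _
  obtain ⟨f, hf, rfl⟩ := jet_surjective j
  obtain ⟨a, ha, h, hh, hO, heq⟩ := exists_mem_adjoin_add (N := N) (N + 1) f hf
  rw [heq, jet_eq_zero_iff.2 hO, add_zero]
  exact ha

lemma jetForm_pow (l : E →L[ℂ] ℂ) : jetForm E N l ^ (N + 1) = 0 := by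
  have : jetForm E N l ^ (N + 1) = jet N (fun x => l x ^ (N + 1)) ((l.analyticAt 0).pow _) := rfl
  rw [this, jet_eq_zero_iff]
  exact (isBigO_norm_of_zero (l.analyticAt 0) (map_zero _)).pow _

instance finiteDimensional_jet (N : ℕ) : FiniteDimensional ℂ (Jet E N) := by
  have h := Algebra.finite_adjoin_of_finite_of_isIntegral (R := ℂ)
    (finite_range fun j => jetForm E N (coordForm E j)) (by
      rintro _ ⟨j, rfl⟩
      exact IsIntegral.of_pow (n := N + 1) (by omega) (by rw [jetForm_pow]; exact isIntegral_zero))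
  rw [adjoin_coordForm] at h
  exact Module.Finite.equiv (Subalgebra.topEquiv (R := ℂ) (A := Jet E N)).toLinearEquiv

end Jets

section ActsOn

variable {V : Type*} [AddCommGroup V] [Module ℂ V] {T T' D : Module.End ℂ V} {c c' : ℂ → ℂ}

lemma ActsOnGenEigenspaces.mul (h : ActsOnGenEigenspaces T D c)
    (h' : ActsOnGenEigenspaces T' D c') :
    ActsOnGenEigenspaces (T * T') D (fun μ => c μ * c' μ) := by
  intro μ v hv
  rw [Module.End.mul_apply, h' μ v hv, map_smul, h μ v hv, smul_smul, mul_comm]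

lemma ActsOnGenEigenspaces.smul (a : ℂ) (h : ActsOnGenEigenspaces T D c) :
    ActsOnGenEigenspaces (a • T) D (fun μ => a * c μ) := by
  intro μ v hv
  rw [LinearMap.smul_apply, h μ v hv, smul_smul]

lemma ActsOnGenEigenspaces.sum {ι : Type*} {s : Finset ι} {T : ι → Module.End ℂ V}
    {c : ι → ℂ → ℂ} (h : ∀ i ∈ s, ActsOnGenEigenspaces (T i) D (c i)) :
    ActsOnGenEigenspaces (∑ i ∈ s, T i) D (fun μ => ∑ i ∈ s, c i μ) := by
  intro μ v hv
  rw [LinearMap.sum_apply, Finset.sum_smul]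
  exact Finset.sum_congr rfl fun i hi => h i hi μ v hv

lemma ActsOnGenEigenspaces.congr (h : ActsOnGenEigenspaces T D c)
    (hc : ∀ μ, D.HasEigenvalue μ → c μ = c' μ) : ActsOnGenEigenspaces T D c' := by
  intro μ v hv
  by_cases hv0 : v = 0
  · simp [hv0]
  have hμ : D.HasEigenvalue μ := by
    refine (Module.End.hasUnifEigenvalue_iff_hasUnifEigenvalue_one (k := ⊤) (by simp)).1 ?_
    intro h
    change v ∈ D.genEigenspace μ ⊤ at hv
    rw [h, Submodule.mem_bot] at hv
    exact hv0 hv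
  rw [h μ v hv, hc μ hμ]

end ActsOn

section Jets

open Asymptotics Polynomial

variable {E : Type*} [NormedAddCommGroup E] [NormedSpace ℂ E] [FiniteDimensional ℂ E] {N : ℕ}

lemma aeval_adjoint {V W M : Type*} [AddCommGroup V] [Module ℂ V] [AddCommGroup W] [Module ℂ W]
    [AddCommGroup M] [Module ℂ M] {D : Module.End ℂ V} {A : Module.End ℂ W}
    (B : V →ₗ[ℂ] W →ₗ[ℂ] M) (h : ∀ j v, B (D j) v = B j (A v)) (P : ℂ[X]) :
    ∀ j v, B (aeval D P j) v = B j (aeval A P v) := by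
  induction P using Polynomial.induction_on with
  | C a => intro j v; simp
  | add p q hp hq => intro j v; simp [hp, hq]
  | monomial k a ih =>
    intro j v
    have e : (C a * X ^ (k + 1) : ℂ[X]) = C a * X ^ k * X := by ring
    have e' : (C a * X ^ (k + 1) : ℂ[X]) = X * (C a * X ^ k) := by ring
    conv_lhs => rw [e, map_mul (aeval D) (C a * X ^ k) X, aeval_X, Module.End.mul_apply, ih, h]
    conv_rhs => rw [e', map_mul (aeval A) X, aeval_X, Module.End.mul_apply]

lemma jetLin_aeval {W : E → E} {hW : AnalyticAt ℂ W 0} {h0 : W 0 = 0} (P : ℂ[X])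
    (j : Jet E (N + 1)) (v : E) : jetLin E N (aeval (jetDer (N + 1) W hW h0) P j) v =
      jetLin E N j (aeval (fderiv ℂ W 0 : Module.End ℂ E) P v) := by
  refine aeval_adjoint (ContinuousLinearMap.coeLM ℂ ∘ₗ jetLin E N) (fun j v => ?_) P j v
  simp [jetLin_jetDer]

lemma jetVal_aeval {W : E → E} {hW : AnalyticAt ℂ W 0} {h0 : W 0 = 0} (P : ℂ[X])
    (j : Jet E N) (hj : jetVal E N j = 0) : jetVal E N (aeval (jetDer N W hW h0) P j) = 0 := by
  have := aeval_adjoint (D := jetDer N W hW h0) (A := (0 : Module.End ℂ ℂ))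
    ((LinearMap.lsmul ℂ ℂ).flip.flip ∘ₗ jetVal E N) (fun j v => by simp [jetVal_jetDer]) P j 1
  simpa [hj] using this

lemma exists_vec_of_forms (Ψ : (E →L[ℂ] ℂ) →ₗ[ℂ] Jet E N) : ∃ (U : E → E) (hU : AnalyticAt ℂ U 0),
    ∀ l : E →L[ℂ] ℂ, jet N (fun x => l (U x)) ((l.analyticAt _).comp hU) = Ψ l := by
  choose f hf hfj using fun j => jet_surjective (Ψ (coordForm E j))
  have hU : AnalyticAt ℂ (fun x => ∑ j, f j x • Module.finBasis ℂ E j) 0 :=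
    Finset.analyticAt_fun_sum _ fun j _ => (hf j).smul analyticAt_const
  refine ⟨_, hU, fun l => ?_⟩
  have hl : l = ∑ j, l (Module.finBasis ℂ E j) • coordForm E j := by
    ext x
    conv_lhs => rw [← sum_coordForm x]
    simp [mul_comm]
  conv_rhs => rw [hl, map_sum]
  simp only [map_smul, ← hfj, jet_smul]
  have h := jet_sum (N := N) Finset.univ (f := fun j x => l (Module.finBasis ℂ E j) * f j x)
    (fun j => analyticAt_const.mul (hf j))
  refine Eq.trans ?_ h.symm
  congr 1
  ext x
  simp [mul_comm]

lemma isBigO_of_forms {α F : Type*} [NormedAddCommGroup F] {f : Filter α} {U : α → E} {g : α → F}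
    (h : ∀ l : E →L[ℂ] ℂ, (fun x => l (U x)) =O[f] g) : U =O[f] g := by
  have : U = fun x => ∑ j, coordForm E j (U x) • (Module.finBasis ℂ E) j := by
    ext x; rw [sum_coordForm]
  rw [this]
  refine IsBigO.fun_sum fun j _ => ?_
  refine IsBigO.trans (IsBigO.of_bound ‖Module.finBasis ℂ E j‖
    (Eventually.of_forall fun x => ?_)) (h (coordForm E j))
  rw [norm_smul, mul_comm]

lemma eq_of_forms {x y : E} (h : ∀ l : E →L[ℂ] ℂ, l x = l y) : x = y := by
  rw [← sum_coordForm x, ← sum_coordForm y]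
  simp only [h]

lemma isUnit_fderiv_eventually {u : E → E} (hu : AnalyticAt ℂ u 0)
    (hd : IsUnit (fderiv ℂ u 0)) : ∀ᶠ x in 𝓝 0, IsUnit (fderiv ℂ u x) :=
  hu.fderiv.continuousAt.eventually_mem (Units.isOpen.mem_nhds hd)

lemma analyticAt_ringInverse {A : Type*} [NormedAddCommGroup A] [NormedSpace ℂ A]
    {L : A → E →L[ℂ] E}
    {x : A} (hL : AnalyticAt ℂ L x) (h : IsUnit (L x)) :
    AnalyticAt ℂ (fun x => Ring.inverse (L x)) x := by
  obtain ⟨z, hz⟩ := h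
  have h1 : AnalyticAt ℂ (Ring.inverse : (E →L[ℂ] E) → _) (L x) := hz ▸ analyticAt_inverse z
  exact h1.comp hL

end Jets

section Jets

open Asymptotics Polynomial

variable {E : Type*} [NormedAddCommGroup E] [NormedSpace ℂ E] [FiniteDimensional ℂ E] {N : ℕ}

lemma jetDer_form {W : E → E} {hW : AnalyticAt ℂ W 0} {h0 : W 0 = 0} (l : E →L[ℂ] ℂ) {u : E → E}
    (hu : AnalyticAt ℂ u 0) :
    jetDer N W hW h0 (jet N (fun x => l (u x)) ((l.analyticAt _).comp hu)) =
      jet N (fun x => l (fderiv ℂ u x (W x))) ((l.analyticAt _).comp (hu.fderiv_clm_apply hW)) := by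
  rw [jetDer_jet]
  refine jet_eq_of_eventuallyEq ?_
  filter_upwards [hu.eventually_analyticAt] with x hx
  rw [show (fun x => l (u x)) = l ∘ u from rfl,
    fderiv_comp _ l.differentiableAt hx.differentiableAt]
  simp

lemma leibniz_ext {D D' : Module.End ℂ (Jet E N)}
    (hD : ∀ f g, D (f * g) = f * D g + g * D f) (hD' : ∀ f g, D' (f * g) = f * D' g + g * D' f)
    (h : ∀ l : E →L[ℂ] ℂ, D (jetForm E N l) = D' (jetForm E N l)) : D = D' := by
  have := Derivation.ext_of_adjoin_eq_top (D1 := Derivation.mk' D hD) (D2 := Derivation.mk' D' hD')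
    (range fun j => jetForm E N (coordForm E j)) (adjoin_coordForm (E := E) N)
    (by rintro _ ⟨j, rfl⟩; exact h _)
  ext j
  exact DFunLike.congr_fun this j

lemma jetDer_commute {V W : E → E} {hV : AnalyticAt ℂ V 0} {hV0 : V 0 = 0}
    {hW : AnalyticAt ℂ W 0} {hW0 : W 0 = 0}
    (h : ∀ᶠ x in 𝓝 0, VectorField.lieBracket ℂ V W x = 0) :
    Commute (jetDer N V hV hV0) (jetDer N W hW hW0) := by
  refine LinearMap.ext fun j => ?_
  obtain ⟨f, hf, rfl⟩ := jet_surjective j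
  rw [Module.End.mul_apply, Module.End.mul_apply]
  simp only [jetDer_jet]
  refine jet_eq_of_eventuallyEq ?_
  filter_upwards [h, hf.eventually_analyticAt, hV.eventually_analyticAt,
    hW.eventually_analyticAt] with x hx hf hV hW
  have := fderiv_lieBracket_apply hf hV hW
  rw [hx, map_zero] at this
  exact (sub_eq_zero.1 this.symm)

lemma isBigO_lieBracket_of_commute {V W : E → E} {hV : AnalyticAt ℂ V 0} {hV0 : V 0 = 0}
    {hW : AnalyticAt ℂ W 0} {hW0 : W 0 = 0}
    (h : Commute (jetDer N V hV hV0) (jetDer N W hW hW0)) :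
    (VectorField.lieBracket ℂ V W) =O[𝓝 0] fun x => ‖x‖ ^ (N + 1) := by
  refine isBigO_of_forms fun l => ?_
  have h1 := LinearMap.congr_fun h.eq (jetForm E N l)
  rw [Module.End.mul_apply, Module.End.mul_apply] at h1
  have e : ∀ (W : E → E) (hW : AnalyticAt ℂ W 0) (h0 : W 0 = 0),
      jetDer N W hW h0 (jetForm E N l) = jet N (fun x => l (W x)) ((l.analyticAt _).comp hW) := by
    intro W hW h0
    have := jetDer_form (N := N) (hW := hW) (h0 := h0) l (u := fun x => x) analyticAt_id
    refine this.trans (jet_eq_of_eventuallyEq (Eventually.of_forall fun x => ?_))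
    simp
  rw [e, e, jetDer_form l hW, jetDer_form l hV, jet_eq_iff] at h1
  simpa [VectorField.lieBracket] using h1

/-- Normalization of a vector field up to a flat error, by an approximate semisimple part. -/
theorem exists_approx_normalization {X : E → E} (hX : AnalyticAt ℂ X 0) (hX0 : X 0 = 0)
    {S : E →L[ℂ] E} {ρ : ℂ → ℂ} (hρ : ∀ a b, ρ (a + b) = ρ a + ρ b)
    (hS : ActsOnGenEigenspaces (S : Module.End ℂ E) (fderiv ℂ X 0 : Module.End ℂ E) ρ) (N : ℕ) :
    ∃ Z u : E → E, AnalyticAt ℂ Z 0 ∧ AnalyticAt ℂ u 0 ∧ Z 0 = 0 ∧ u 0 = 0 ∧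
      fderiv ℂ u 0 = ContinuousLinearMap.id ℂ E ∧ (∀ᶠ x in 𝓝 0, fderiv ℂ u x (Z x) = S (u x)) ∧
      (∀ W : E → E, AnalyticAt ℂ W 0 → W 0 = 0 →
        (∀ᶠ x in 𝓝 0, VectorField.lieBracket ℂ W X x = 0) →
          VectorField.lieBracket ℂ W Z =O[𝓝 0] fun x => ‖x‖ ^ (N + 1)) ∧
      ∀ f : E → ℂ, AnalyticAt ℂ f 0 → (∀ᶠ x in 𝓝 0, fderiv ℂ f x (X x) = 0) →
        (fun x => fderiv ℂ f x (Z x)) =O[𝓝 0] fun x => ‖x‖ ^ (N + 1) := by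
  set D := jetDer (N + 1) X hX hX0 with hD
  set A : Module.End ℂ E := (fderiv ℂ X 0 : Module.End ℂ E) with hA
  obtain ⟨P, hPD, hPA⟩ := exists_polynomial_actsOn D A ρ
  choose Q hQD hQA using fun l : ℂ => exists_polynomial_actsOn D A (fun μ => if μ = l then 1 else 0)
  set T := aeval D P with hT
  have hSP : (S : Module.End ℂ E) = aeval A P := hS.ext hPA
  set Λ : Finset ℂ := A.finite_hasEigenvalue.toFinset with hΛ
  have hQQ : ∑ l ∈ Λ, aeval A (Q l) * aeval A (Q l) = 1 := by
    refine ActsOnGenEigenspaces.ext (D := A) (c := fun _ => 1)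
      ((ActsOnGenEigenspaces.sum fun l _ => (hQA l).mul (hQA l)).congr fun μ hμ => ?_)
      (fun μ v _ => by simp)
    have : μ ∈ Λ := by simpa [hΛ] using hμ
    simp [this]
  have hTQ : ∀ l, T * aeval D (Q l) = ρ l • aeval D (Q l) := fun l =>
    ActsOnGenEigenspaces.ext ((hPD.mul (hQD l)).congr fun μ _ => by
      split_ifs with h <;> simp [h]) ((hQD l).smul (ρ l))
  have hSQ : ∀ l, (S : Module.End ℂ E) * aeval A (Q l) = ρ l • aeval A (Q l) := fun l =>
    ActsOnGenEigenspaces.ext ((hS.mul (hQA l)).congr fun μ _ => by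
      split_ifs with h <;> simp [h]) ((hQA l).smul (ρ l))
  set R : ℂ → E →L[ℂ] E := fun l => LinearMap.toContinuousLinearMap (aeval A (Q l)) with hR
  have hTleib : ∀ f g, T (f * g) = f * T g + g * T f := by
    intro f g
    exact hPD.leibniz (fun f g => jetDer_mul f g) hρ f g
  set Ψ : (E →L[ℂ] ℂ) →ₗ[ℂ] Jet E (N + 1) :=
    ∑ l ∈ Λ, aeval D (Q l) ∘ₗ jetForm E (N + 1) ∘ₗ
      { toFun := fun ll => ll.comp (R l), map_add' := fun _ _ => rfl, map_smul' := fun _ _ => rfl }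
    with hΨ
  have hΨa : ∀ ll, Ψ ll = ∑ l ∈ Λ, aeval D (Q l) (jetForm E (N + 1) (ll.comp (R l))) := fun ll => by
    rw [hΨ, LinearMap.sum_apply]; rfl
  have hTΨ : ∀ ll, T (Ψ ll) = Ψ (ll.comp S) := by
    intro ll
    rw [hΨa, hΨa, map_sum]
    refine Finset.sum_congr rfl fun l _ => ?_
    rw [← Module.End.mul_apply, hTQ]
    have : (ll.comp S).comp (R l) = ρ l • ll.comp (R l) := by
      ext v
      have := LinearMap.congr_fun (hSQ l) v
      change ll (S (aeval A (Q l) v)) = ρ l • ll (aeval A (Q l) v)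
      rw [← map_smul]
      exact congrArg ll this
    rw [this, map_smul, map_smul]
    rfl
  have hform0 : ∀ l : E →L[ℂ] ℂ, jetVal E (N + 1) (jetForm E (N + 1) l) = 0 := fun l =>
    map_zero l
  have hformL : ∀ l : E →L[ℂ] ℂ, jetLin E N (jetForm E (N + 1) l) = l := fun l => l.fderiv
  obtain ⟨u, hu, hul⟩ := exists_vec_of_forms Ψ
  obtain ⟨V, hV, hVl⟩ := exists_vec_of_forms (T ∘ₗ jetForm E (N + 1))
  have hu0 : u 0 = 0 := by
    refine eq_of_forms fun l => ?_
    have : jetVal E (N + 1) (Ψ l) = 0 := by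
      rw [hΨa, map_sum]
      exact Finset.sum_eq_zero fun m _ => jetVal_aeval _ _ (hform0 _)
    rw [← hul, jetVal_jet] at this
    rw [this, map_zero]
  have hV0 : V 0 = 0 := by
    refine eq_of_forms fun l => ?_
    have : jetVal E (N + 1) ((T ∘ₗ jetForm E (N + 1)) l) = 0 := jetVal_aeval _ _ (hform0 _)
    rw [← hVl, jetVal_jet] at this
    rw [this, map_zero]
  have hdu : fderiv ℂ u 0 = ContinuousLinearMap.id ℂ E := by
    ext v
    refine eq_of_forms fun l => ?_
    have h1 : jetLin E N (Ψ l) v = l v := by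
      rw [hΨa, map_sum, sum_apply]
      simp only [hD, jetLin_aeval, hformL]
      have := congrArg l (LinearMap.congr_fun hQQ v)
      rw [LinearMap.sum_apply, map_sum] at this
      exact this
    rw [← hul, jetLin_jet] at h1
    rw [show (fun x => l (u x)) = l ∘ u from rfl,
      fderiv_comp _ l.differentiableAt hu.differentiableAt] at h1
    simpa using h1
  have hunit : IsUnit (fderiv ℂ u 0) := by rw [hdu]; exact isUnit_one
  have hTV : T = jetDer (N + 1) V hV hV0 := by
    refine leibniz_ext hTleib (fun f g => jetDer_mul f g) fun l => ?_
    have := jetDer_form (N := N + 1) (hW := hV) (h0 := hV0) l (u := fun x => x) analyticAt_id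
    refine (hVl l).symm.trans (Eq.trans ?_ this.symm)
    exact jet_eq_of_eventuallyEq (Eventually.of_forall fun x => by simp)
  set Z : E → E := fun x => Ring.inverse (fderiv ℂ u x) (S (u x)) with hZ
  have hinv : AnalyticAt ℂ (fun x => Ring.inverse (fderiv ℂ u x)) 0 :=
    analyticAt_ringInverse hu.fderiv hunit
  have hZan : AnalyticAt ℂ Z 0 := hinv.clm_app ((S.analyticAt _).comp hu)
  have hZ0 : Z 0 = 0 := by simp [hZ, hu0]
  have hZu : ∀ᶠ x in 𝓝 0, fderiv ℂ u x (Z x) = S (u x) := by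
    filter_upwards [isUnit_fderiv_eventually hu hunit] with x hx
    rw [hZ, ← mul_apply_eq_comp, Ring.mul_inverse_cancel _ hx]
    rfl
  have hVZ : (fun x => V x - Z x) =O[𝓝 0] fun x => ‖x‖ ^ (N + 1 + 1) := by
    have h1 : (fun x => fderiv ℂ u x (V x) - S (u x)) =O[𝓝 0] fun x => ‖x‖ ^ (N + 1 + 1) := by
      refine isBigO_of_forms fun l => ?_
      have h2 := jetDer_form (N := N + 1) (hW := hV) (h0 := hV0) l hu
      rw [← hTV, hul, hTΨ, ← hul, jet_eq_iff] at h2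
      refine h2.neg_left.congr_left fun x => ?_
      simp
    have h3 : (fun x => Ring.inverse (fderiv ℂ u x)) =O[𝓝 0] fun _ => (1 : ℝ) :=
      hinv.continuousAt.isBigO_one ℝ
    have h4 := h3.norm_left.mul h1.norm_left
    simp only [one_mul] at h4
    refine IsBigO.trans (IsBigO.of_bound 1 ?_) h4
    filter_upwards [isUnit_fderiv_eventually hu hunit] with x hx
    have : V x - Z x = Ring.inverse (fderiv ℂ u x) (fderiv ℂ u x (V x) - S (u x)) := by
      rw [map_sub, ← mul_apply_eq_comp, Ring.inverse_mul_cancel _ hx]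
      rfl
    rw [this]
    rw [one_mul, norm_mul, norm_norm, norm_norm]
    exact (Ring.inverse (fderiv ℂ u x)).le_opNorm _
  have hTZ : T = jetDer (N + 1) Z hZan hZ0 := by
    rw [hTV]
    refine LinearMap.ext fun j => ?_
    obtain ⟨f, hf, rfl⟩ := jet_surjective j
    rw [jetDer_jet, jetDer_jet, jet_eq_iff]
    have h3 : fderiv ℂ f =O[𝓝 0] fun _ => (1 : ℝ) := hf.fderiv.continuousAt.isBigO_one ℝ
    have h4 := h3.norm_left.mul hVZ.norm_left
    simp only [one_mul] at h4
    refine IsBigO.trans (IsBigO.of_bound 1 (Eventually.of_forall fun x => ?_)) h4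
    rw [← map_sub]
    rw [one_mul, norm_mul, norm_norm, norm_norm]
    exact (fderiv ℂ f x).le_opNorm _
  have hle := isBigO_pow_of_le (E := E) (Nat.le_succ (N + 1))
  refine ⟨Z, u, hZan, hu, hZ0, hu0, hdu, hZu, fun W hW hW0 hWX => ?_, fun f hf hfX => ?_⟩
  · have hc : Commute (jetDer (N + 1) W hW hW0) D := jetDer_commute hWX
    have hc2 : Commute (jetDer (N + 1) W hW hW0) T :=
      Algebra.commute_of_mem_adjoin_singleton_of_commute (aeval_mem_adjoin_singleton ℂ D) hc
    rw [hTZ] at hc2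
    exact (isBigO_lieBracket_of_commute hc2).trans hle
  · have hD0 : D (jet (N + 1) f hf) = 0 := by
      rw [hD, jetDer_jet, jet_eq_zero_iff]
      exact (isBigO_zero (E' := ℂ) _ _).congr' (hfX.mono fun x hx => hx.symm) EventuallyEq.rfl
    have hmem : jet (N + 1) f hf ∈ D.maxGenEigenspace 0 :=
      (Module.End.mem_maxGenEigenspace _ _ _).2 ⟨1, by simp [hD0]⟩
    have h0 : ρ 0 = 0 := by simpa using hρ 0 0
    have h1 := hPD 0 _ hmem
    rw [h0, zero_smul, hTZ, jetDer_jet, jet_eq_zero_iff] at h1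
    exact h1.trans hle

end Jets

section Primitive

variable {E F : Type*} [NormedAddCommGroup E] [NormedSpace ℂ E] [FiniteDimensional ℂ E]
  [NormedAddCommGroup F] [NormedSpace ℂ F] [CompleteSpace F]

lemma analyticOnNhd_of_hasFDerivAt {s : Set E} (hs : IsOpen s) {f : E → F} {f' : E → E →L[ℂ] F}
    (h : ∀ a ∈ s, HasFDerivAt f (f' a) a) : AnalyticOnNhd ℂ f s :=
  analyticOnNhd_of_lineDifferentiable hs (fun a ha => (h a ha).continuousAt.continuousWithinAt)
    fun a ha _ => (h a ha).differentiableAt.lineDifferentiableAt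

/-- The Poincaré lemma for closed holomorphic one-forms on convex open sets. -/
lemma exists_primitive_of_symmetric {s : Set E} (hs : Convex ℝ s) (hso : IsOpen s)
    {ω : E → E →L[ℂ] F} (hω : AnalyticOnNhd ℂ ω s)
    (hd : ∀ a ∈ s, ∀ x y, fderiv ℂ ω a x y = fderiv ℂ ω a y x) :
    ∃ f : E → F, AnalyticOnNhd ℂ f s ∧ ∀ a ∈ s, HasFDerivAt f (ω a) a := by
  obtain ⟨f, hf⟩ := hs.exists_forall_hasFDerivAt_of_fderiv_symmetric hso (ω := ω)
    (fun a ha => ((hω a ha).differentiableAt.restrictScalars ℝ).differentiableWithinAt)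
    (fun a ha x y => by
      rw [(hω a ha).differentiableAt.fderiv_restrictScalars ℝ]
      exact hd a ha x y)
  exact ⟨f, analyticOnNhd_of_hasFDerivAt hso hf, hf⟩

end Primitive

section Frame

variable {d : ℕ}

/-- The determinant of a family of `d + 1` vectors of `ℂ^(d+1)`, as a multilinear map. -/
noncomputable def detRows (d : ℕ) :
    ContinuousMultilinearMap ℂ (fun _ : Fin (d + 1) => Fin (d + 1) → ℂ) ℂ :=
  { (Matrix.detRowAlternating (n := Fin (d + 1)) (R := ℂ)).toMultilinearMap with
    cont := by
      change Continuous fun M : Matrix (Fin (d + 1)) (Fin (d + 1)) ℂ => M.det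
      exact continuous_id.matrix_det }

lemma detRows_apply (M : Fin (d + 1) → Fin (d + 1) → ℂ) : detRows d M = (Matrix.of M).det := rfl

/-- The family of vectors `w, X₁ x, …, X_d x`. -/
def frame (X : Fin d → (Fin (d + 1) → ℂ) → Fin (d + 1) → ℂ) (w x : Fin (d + 1) → ℂ) :
    Fin (d + 1) → Fin (d + 1) → ℂ :=
  Fin.cons w fun j => X j x

lemma frame_eq_update (X : Fin d → (Fin (d + 1) → ℂ) → Fin (d + 1) → ℂ) (w w' x : Fin (d + 1) → ℂ) :
    frame X w x = Function.update (frame X w' x) 0 w := by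
  simp [frame]

/-- The one-form `w ↦ det (w, X₁ x, …, X_d x)`. -/
noncomputable def volForm (X : Fin d → (Fin (d + 1) → ℂ) → Fin (d + 1) → ℂ) (x : Fin (d + 1) → ℂ) :
    (Fin (d + 1) → ℂ) →L[ℂ] ℂ :=
  ∑ k, detRows d (frame X (Pi.single k 1) x) •
    (ContinuousLinearMap.proj k : (Fin (d + 1) → ℂ) →L[ℂ] ℂ)

lemma volForm_apply (X : Fin d → (Fin (d + 1) → ℂ) → Fin (d + 1) → ℂ) (x w : Fin (d + 1) → ℂ) :
    volForm X x w = detRows d (frame X w x) := by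
  have : w = ∑ k, w k • (Pi.single k 1 : Fin (d + 1) → ℂ) := by
    conv_lhs => rw [← Finset.univ_sum_single w]
    refine Finset.sum_congr rfl fun k _ => ?_
    rw [← Pi.single_smul]; simp
  conv_rhs => rw [frame_eq_update X w 0 x, this]
  rw [show ∀ M, detRows d M = (detRows d).toMultilinearMap M from fun _ => rfl,
    MultilinearMap.map_update_sum, volForm, sum_apply]
  refine Finset.sum_congr rfl fun k _ => ?_
  rw [MultilinearMap.map_update_smul, ← frame_eq_update]
  simp [mul_comm]

variable {X : Fin d → (Fin (d + 1) → ℂ) → Fin (d + 1) → ℂ} {x : Fin (d + 1) → ℂ}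

lemma frame_analyticAt {w : (Fin (d + 1) → ℂ) → Fin (d + 1) → ℂ} (hw : AnalyticAt ℂ w x)
    (hX : ∀ j, AnalyticAt ℂ (X j) x) :
    AnalyticAt ℂ (fun y => frame X (w y) y) x := by
  refine AnalyticAt.pi fun i => ?_
  refine Fin.cases ?_ (fun j => ?_) i
  · simpa [frame] using hw
  · simpa [frame] using hX j

lemma detRows_analyticAt (M : Fin (d + 1) → Fin (d + 1) → ℂ) : AnalyticAt ℂ (detRows d) M := by
  change AnalyticAt ℂ (fun M : Fin (d + 1) → Fin (d + 1) → ℂ => (Matrix.of M).det) M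
  simp only [Matrix.det_apply]
  refine Finset.analyticAt_fun_sum _ fun σ _ => ?_
  have : ∀ i j, AnalyticAt ℂ (fun M : Fin (d + 1) → Fin (d + 1) → ℂ => M i j) M := fun i j =>
    ((ContinuousLinearMap.proj (R := ℂ) (φ := fun _ : Fin (d + 1) => ℂ) j).comp
      (ContinuousLinearMap.proj (R := ℂ)
        (φ := fun _ : Fin (d + 1) => Fin (d + 1) → ℂ) i)).analyticAt M
  simp only [Units.smul_def, zsmul_eq_mul]
  exact analyticAt_const.mul (Finset.analyticAt_fun_prod _ fun i _ => this _ _)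

lemma volForm_analyticAt (hX : ∀ j, AnalyticAt ℂ (X j) x) : AnalyticAt ℂ (volForm X) x := by
  change AnalyticAt ℂ (fun y => volForm X y) x
  unfold volForm
  refine Finset.analyticAt_fun_sum _ fun k _ => ?_
  exact ((detRows_analyticAt _).comp (frame_analyticAt analyticAt_const hX)).smul analyticAt_const

lemma sum_det_update_row (A : (Fin (d + 1) → ℂ) →ₗ[ℂ] Fin (d + 1) → ℂ)
    (M : Fin (d + 1) → Fin (d + 1) → ℂ) :
    ∑ i, detRows d (Function.update M i (A (M i))) = LinearMap.trace ℂ _ A * detRows d M := by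
  have h : ∀ i, detRows d (Function.update M i (A (M i))) =
      ((Matrix.of M).transpose.adjugate * (LinearMap.toMatrix' A *
          (Matrix.of M).transpose)) i i := by
    intro i
    have h1 : detRows d (Function.update M i (A (M i))) =
        Matrix.cramer (Matrix.of M).transpose (A (M i)) i := by
      rw [Matrix.cramer_transpose_apply]; rfl
    rw [h1, Matrix.cramer_eq_adjugate_mulVec, ← LinearMap.toMatrix'_mulVec]
    simp only [Matrix.mulVec, dotProduct, Matrix.mul_apply]
    rfl
  rw [Finset.sum_congr rfl fun i _ => h i]
  change Matrix.trace _ = _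
  rw [← Matrix.mul_assoc, Matrix.trace_mul_cycle, Matrix.mul_adjugate, Matrix.smul_mul,
    Matrix.trace_smul, Matrix.one_mul, Matrix.det_transpose, LinearMap.trace_eq_matrix_trace ℂ
        (Pi.basisFun ℂ (Fin (d + 1))),
    LinearMap.toMatrix_eq_toMatrix']
  simp [detRows_apply, mul_comm]

lemma fderiv_volForm_apply (hX : ∀ j, AnalyticAt ℂ (X j) x) (u w : Fin (d + 1) → ℂ) :
    fderiv ℂ (volForm X) x u w =
      ∑ j : Fin d, detRows d (Function.update (frame X w x) j.succ (fderiv ℂ (X j) x u)) := by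
  have h1 : fderiv ℂ (volForm X) x u w = fderiv ℂ (fun y => volForm X y w) x u := by
    rw [fderiv_clm_apply (𝕜 := ℂ) (volForm_analyticAt hX).differentiableAt
        (differentiableAt_const w)]
    simp
  simp only [volForm_apply] at h1
  rw [h1]
  have hf : HasFDerivAt (fun y => frame X w y)
      (ContinuousLinearMap.pi (R := ℂ) (Fin.cons 0 fun j => fderiv ℂ (X j) x :
        Fin (d + 1) → (Fin (d + 1) → ℂ) →L[ℂ] Fin (d + 1) → ℂ)) x := by
    refine hasFDerivAt_pi.2 fun i => ?_
    refine Fin.cases ?_ (fun j => ?_) i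
    · simpa [frame] using hasFDerivAt_const (𝕜 := ℂ) w x
    · simpa [frame] using (hX j).differentiableAt.hasFDerivAt
  rw [show (fun y => detRows d (frame X w y)) = detRows d ∘ fun y => frame X w y from rfl,
    (((detRows d).hasFDerivAt (frame X w x)).comp x hf).fderiv]
  simp only [ContinuousLinearMap.comp_apply, ContinuousMultilinearMap.linearDeriv_apply]
  rw [Fin.sum_univ_succ]
  simp only [ContinuousLinearMap.coe_pi', Fin.cons_zero, Fin.cons_succ]
  rw [(detRows d).map_coord_zero 0 (by simp)]
  simp

/-- If `A (X j x) = D(X j)(x) u`, then `D ω (u) + A^* ω = tr A • ω` for `ω = volForm X`. -/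
lemma fderiv_volForm_add (hX : ∀ j, AnalyticAt ℂ (X j) x)
    (A : (Fin (d + 1) → ℂ) →L[ℂ] Fin (d + 1) → ℂ)
    (u w : Fin (d + 1) → ℂ) (h : ∀ j, fderiv ℂ (X j) x u = A (X j x)) :
    fderiv ℂ (volForm X) x u w + volForm X x (A w) =
      LinearMap.trace ℂ _ (A : (Fin (d + 1) → ℂ) →ₗ[ℂ] Fin (d + 1) → ℂ) * volForm X x w := by
  rw [fderiv_volForm_apply hX, volForm_apply, volForm_apply, ← sum_det_update_row,
    Fin.sum_univ_succ, add_comm]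
  congr 1
  · rw [frame_eq_update X (A w) w]; rfl
  · exact Finset.sum_congr rfl fun j _ => by rw [h]; rfl

lemma volForm_self (j : Fin d) : volForm X x (X j x) = 0 := by
  rw [volForm_apply, detRows_apply]
  exact Matrix.det_zero_of_row_eq (Fin.succ_ne_zero j).symm (by
    change frame X (X j x) x 0 = frame X (X j x) x j.succ; simp [frame])

/-- The coefficients, multiplied by `det (w, X₁ x, …)`, of a vector in the basis `w, X₁ x, …`. -/
noncomputable def frameCoeff (X : Fin d → (Fin (d + 1) → ℂ) → Fin (d + 1) → ℂ)
    (w x : Fin (d + 1) → ℂ) : (Fin (d + 1) → ℂ) →ₗ[ℂ] Fin (d + 1) → ℂ :=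
  Matrix.cramer (Matrix.of (frame X w x)).transpose

lemma frameCoeff_apply (w v : Fin (d + 1) → ℂ) (i) :
    frameCoeff X w x v i = detRows d (Function.update (frame X w x) i v) := by
  rw [frameCoeff, Matrix.cramer_transpose_apply]; rfl

lemma frameCoeff_zero (w v : Fin (d + 1) → ℂ) : frameCoeff X w x v 0 = volForm X x v := by
  rw [frameCoeff_apply, volForm_apply, ← frame_eq_update]

lemma frameCoeff_base (w : Fin (d + 1) → ℂ) :
    frameCoeff X w x w = Pi.single 0 (volForm X x w) := by
  rw [volForm_apply]
  exact Matrix.cramer_transpose_row_self (Matrix.of (frame X w x)) 0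

lemma frameCoeff_field (w : Fin (d + 1) → ℂ) (j : Fin d) :
    frameCoeff X w x (X j x) = Pi.single j.succ (volForm X x w) := by
  rw [volForm_apply]
  exact Matrix.cramer_transpose_row_self (Matrix.of (frame X w x)) j.succ

lemma frame_expansion (w v : Fin (d + 1) → ℂ) :
    volForm X x w • v = volForm X x v • w + ∑ j : Fin d, frameCoeff X w x v j.succ • X j x := by
  have := Matrix.mulVec_cramer (Matrix.of (frame X w x)).transpose v
  rw [Matrix.det_transpose, ← detRows_apply, ← volForm_apply] at this
  rw [← this, ← frameCoeff_zero (x := x) w v]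
  ext k
  simp only [Matrix.mulVec, dotProduct, Fin.sum_univ_succ, Pi.add_apply, Finset.sum_apply,
    Pi.smul_apply, smul_eq_mul, frameCoeff]
  simp [frame, mul_comm]

/-- The one-form `volForm X` is closed where it does not vanish. -/
lemma fderiv_volForm_symm_of_ne (hX : ∀ j, AnalyticAt ℂ (X j) x)
    (hc : ∀ i j, VectorField.lieBracket ℂ (X i) (X j) x = 0)
    (ht : ∀ j, LinearMap.trace ℂ _ (fderiv ℂ (X j) x : (Fin (d + 1) → ℂ) →ₗ[ℂ] _) = 0)
    {e : Fin (d + 1) → ℂ} (he : volForm X x e ≠ 0) (u v : Fin (d + 1) → ℂ) :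
    fderiv ℂ (volForm X) x u v = fderiv ℂ (volForm X) x v u := by
  have hc' : ∀ i j, fderiv ℂ (X i) x (X j x) = fderiv ℂ (X j) x (X i x) := fun i j => by
    have := hc j i
    rwa [VectorField.lieBracket, sub_eq_zero] at this
  set b : (Fin (d + 1) → ℂ) →ₗ[ℂ] (Fin (d + 1) → ℂ) →ₗ[ℂ] ℂ :=
    LinearMap.mk₂ ℂ (fun u v => fderiv ℂ (volForm X) x u v - fderiv ℂ (volForm X) x v u)
      (fun _ _ _ => by simp; ring) (fun _ _ _ => by simp; ring) (fun _ _ _ => by simp; ring)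
      (fun _ _ _ => by simp; ring) with hb
  have hba : ∀ u v, b u v = fderiv ℂ (volForm X) x u v - fderiv ℂ (volForm X) x v u :=
    fun _ _ => rfl
  have hb1 : ∀ u v, b u v = - b v u := fun u v => by simp [hba]
  have hXj : ∀ u j, fderiv ℂ (volForm X) x u (X j x) + volForm X x (fderiv ℂ (X j) x u) = 0 := by
    intro u j
    have h1 : fderiv ℂ (fun y => volForm X y (X j y)) x u = 0 := by
      simp only [volForm_self]; simp
    rw [fderiv_clm_apply (volForm_analyticAt hX).differentiableAt (hX j).differentiableAt] at h1
    simpa [add_comm] using h1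
  have hXX : ∀ k j, b (X k x) (X j x) = 0 := fun k j => by
    have h1 := hXj (X k x) j
    have h2 := hXj (X j x) k
    rw [hc'] at h1
    rw [hba]
    linear_combination h1 - h2
  have hXe : ∀ k, b (X k x) e = 0 := fun k => by
    have h1 := fderiv_volForm_add hX (fderiv ℂ (X k) x) (X k x) e fun j => hc' j k
    rw [ht, zero_mul] at h1
    have h2 := hXj e k
    rw [hba]
    linear_combination h1 - h2
  have hexp : ∀ u, b u e = 0 → (∀ j, b u (X j x) = 0) → ∀ v, b u v = 0 := fun u h1 h2 v => by
    have h3 := congrArg (b u) (frame_expansion (X := X) (x := x) e v)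
    rw [map_smul, map_add, map_smul, map_sum, h1] at h3
    simp only [map_smul, h2, smul_zero, Finset.sum_const_zero, add_zero] at h3
    exact (smul_eq_zero.1 h3).resolve_left he
  have hX0 : ∀ k v, b (X k x) v = 0 := fun k => hexp _ (hXe k) (hXX k)
  have he0 : ∀ v, b e v = 0 := hexp e (by rw [hba, sub_self]) fun j => by rw [hb1, hXe, neg_zero]
  have := hexp u (by rw [hb1, he0, neg_zero]) (fun j => by rw [hb1, hX0, neg_zero]) v
  rwa [hba, sub_eq_zero] at this

variable {U : Set (Fin (d + 1) → ℂ)}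

lemma eqOn_zero_of_volForm {F : Type*} [NormedAddCommGroup F] [NormedSpace ℂ F]
    (hUo : IsOpen U) (hUc : IsPreconnected U)
    (hX : ∀ j, AnalyticOnNhd ℂ (X j) U) {f : (Fin (d + 1) → ℂ) → F} (hf : AnalyticOnNhd ℂ f U)
    (hn : ∃ x ∈ U, volForm X x ≠ 0)
    (h : ∀ y ∈ U, ∀ e, volForm X y e ≠ 0 → f y = 0) : ∀ y ∈ U, f y = 0 := by
  obtain ⟨x, hx, hne⟩ := hn
  obtain ⟨e, he⟩ : ∃ e, volForm X x e ≠ 0 := by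
    by_contra! hcon
    exact hne (ContinuousLinearMap.ext hcon)
  refine hf.eqOn_zero_of_preconnected_of_eventuallyEq_zero hUc hx ?_
  have hcont : ContinuousAt (fun y => volForm X y e) x :=
    (volForm_analyticAt fun j => hX j x hx).continuousAt.clm_apply continuousAt_const
  filter_upwards [hcont.eventually_ne he, hUo.mem_nhds hx] with y hy hyU
  exact h y hyU e hy

/-- Commuting isochore vector fields have a common first integral. -/
theorem exists_first_integral (hUo : IsOpen U) (hUc : Convex ℝ U)
    (hX : ∀ j, AnalyticOnNhd ℂ (X j) U)
    (hc : ∀ i j, ∀ x ∈ U, VectorField.lieBracket ℂ (X i) (X j) x = 0)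
    (ht : ∀ j, ∀ x ∈ U, LinearMap.trace ℂ _ (fderiv ℂ (X j) x : (Fin (d + 1) → ℂ) →ₗ[ℂ] _) = 0)
    (hn : ∃ x ∈ U, volForm X x ≠ 0) :
    ∃ F : (Fin (d + 1) → ℂ) → ℂ, AnalyticOnNhd ℂ F U ∧ ∀ x ∈ U, HasFDerivAt F (volForm X x) x := by
  have hω : AnalyticOnNhd ℂ (volForm X) U := fun x hx => volForm_analyticAt fun j => hX j x hx
  refine exists_primitive_of_symmetric hUc hUo hω fun a ha u v => ?_
  rw [← sub_eq_zero]
  refine eqOn_zero_of_volForm hUo hUc.isPreconnected hX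
    (f := fun y => fderiv ℂ (volForm X) y u v - fderiv ℂ (volForm X) y v u)
    (fun y hy => ?_) hn (fun y hy e he => ?_) a ha
  · have : ∀ p q, AnalyticAt ℂ (fun y => fderiv ℂ (volForm X) y p q) y := fun p q =>
      ((hω y hy).fderiv.clm_app analyticAt_const).clm_app analyticAt_const
    exact (this u v).sub (this v u)
  · rw [sub_eq_zero]
    exact fderiv_volForm_symm_of_ne (fun j => hX j y hy) (fun i j => hc i j y hy)
      (fun j => ht j y hy) he u v

/-- A vector field commuting with all the `X j` and preserving their first integral is isochore. -/
theorem trace_eq_zero_of_commute (hUo : IsOpen U) (hUc : IsPreconnected U)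
    (hX : ∀ j, AnalyticOnNhd ℂ (X j) U) {F : (Fin (d + 1) → ℂ) → ℂ}
    (hF : ∀ x ∈ U, HasFDerivAt F (volForm X x) x) (hn : ∃ x ∈ U, volForm X x ≠ 0)
    {Z : (Fin (d + 1) → ℂ) → Fin (d + 1) → ℂ} (hZ : AnalyticOnNhd ℂ Z U)
    (hZX : ∀ j, ∀ x ∈ U, VectorField.lieBracket ℂ Z (X j) x = 0)
    (hZF : ∀ x ∈ U, volForm X x (Z x) = 0) :
    ∀ x ∈ U, LinearMap.trace ℂ _ (fderiv ℂ Z x : (Fin (d + 1) → ℂ) →ₗ[ℂ] _) = 0 := by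
  have hω : AnalyticOnNhd ℂ (volForm X) U := fun x hx => volForm_analyticAt fun j => hX j x hx
  have hFa : AnalyticOnNhd ℂ F U := analyticOnNhd_of_hasFDerivAt hUo hF
  refine eqOn_zero_of_volForm hUo hUc hX (fun y hy => ?_) hn fun y hy e he => ?_
  · exact (((LinearMap.trace ℂ (Fin (d + 1) → ℂ)) ∘ₗ
      ContinuousLinearMap.coeLM ℂ).toContinuousLinearMap.analyticAt _).comp (hZ y hy).fderiv
  · have h1 := fderiv_volForm_add (fun j => hX j y hy) (fderiv ℂ Z y) (Z y) e fun j => by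
      have := hZX j y hy
      rwa [VectorField.lieBracket, sub_eq_zero] at this
    have hev : volForm X =ᶠ[𝓝 y] fderiv ℂ F := by
      filter_upwards [hUo.mem_nhds hy] with z hz using (hF z hz).fderiv.symm
    have h2 : fderiv ℂ (fun z => volForm X z (Z z)) y e = 0 := by
      have : (fun z => volForm X z (Z z)) =ᶠ[𝓝 y] fun _ => 0 := by
        filter_upwards [hUo.mem_nhds hy] with z hz using hZF z hz
      rw [this.fderiv_eq]; simp
    rw [fderiv_clm_apply (hω y hy).differentiableAt (hZ y hy).differentiableAt] at h2
    have h3 : fderiv ℂ (volForm X) y (Z y) e = fderiv ℂ (volForm X) y e (Z y) := by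
      rw [hev.fderiv_eq]; exact (hFa y hy).fderiv_fderiv_comm _ _
    have h4 : LinearMap.trace ℂ _
        (fderiv ℂ Z y : (Fin (d + 1) → ℂ) →ₗ[ℂ] _) * volForm X y e = 0 := by
      rw [← h1, h3]
      simpa [add_comm] using h2
    exact (mul_eq_zero.1 h4).resolve_right he

end Frame

section Implicit

variable {Q : Type*} [NormedAddCommGroup Q] [NormedSpace ℂ Q] [FiniteDimensional ℂ Q]

/-- A holomorphic implicit function theorem, uniform along a compact set. -/
theorem exists_implicit_of_isCompact {P : ℂ × Q → ℂ} {K : Set Q} (hK : IsCompact K) {c : ℂ}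
    (hc : c ≠ 0) (hP : ∀ k ∈ K, AnalyticAt ℂ P (1, k)) (h0 : ∀ k ∈ K, P (1, k) = 0)
    (h1 : ∀ k ∈ K, fderiv ℂ P (1, k) (1, 0) = c) {δ₀ : ℝ} (hδ₀ : 0 < δ₀) :
    ∃ (V : Set Q) (κ : Q → ℂ) (C : ℝ), IsOpen V ∧ K ⊆ V ∧ AnalyticOnNhd ℂ κ V ∧
      (∀ q ∈ V, ‖κ q - 1‖ ≤ δ₀ ∧ P (κ q, q) = 0 ∧ ‖κ q - 1‖ ≤ C * ‖P (1, q)‖) := by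
  have hcpos : 0 < ‖c‖ := norm_pos_iff.2 hc
  set W : Set (ℂ × Q) := {p | AnalyticAt ℂ P p ∧ ‖fderiv ℂ P p (1, 0) - c‖ < ‖c‖ / 2} with hW
  have hWn : ∀ p ∈ W, W ∈ 𝓝 p := by
    intro p hp
    have hcont : ContinuousAt (fun p => ‖fderiv ℂ P p (1, 0) - c‖) p :=
      ((hp.1.fderiv.continuousAt.clm_apply continuousAt_const).sub continuousAt_const).norm
    filter_upwards [hp.1.eventually_analyticAt, hcont.eventually_lt continuousAt_const hp.2]
      with q h1 h2 using ⟨h1, h2⟩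
  have hWo : IsOpen W := isOpen_iff_mem_nhds.2 hWn
  have hsub : ({1} : Set ℂ) ×ˢ K ⊆ W := by
    rintro ⟨a, k⟩ ⟨ha, hk⟩
    obtain rfl : a = 1 := ha
    exact ⟨hP k hk, by rw [h1 k hk]; simpa using hcpos⟩
  obtain ⟨A, V, hA, hV, h1A, hKV, hAV⟩ := generalized_tube_lemma isCompact_singleton hK hWo hsub
  obtain ⟨δ₁, hδ₁, hδA⟩ := Metric.isOpen_iff.1 hA 1 (h1A rfl)
  obtain ⟨δ, hδ, hδ0, hδ1⟩ : ∃ δ > 0, δ ≤ δ₀ ∧ δ < δ₁ :=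
    ⟨min δ₀ (δ₁ / 2), by positivity, min_le_left _ _, (min_le_right _ _).trans_lt (by linarith)⟩
  have hB : ∀ z ∈ closedBall (1 : ℂ) δ, ∀ q ∈ V, (z, q) ∈ W := fun z hz q hq =>
    hAV ⟨hδA (closedBall_subset_ball hδ1 hz), hq⟩
  have h1B : (1 : ℂ) ∈ closedBall (1 : ℂ) δ := mem_closedBall_self hδ.le
  set V' : Set Q := {q ∈ V | ‖P (1, q)‖ < ‖c‖ * δ / 2} with hV'
  have hV'o : IsOpen V' := by
    refine isOpen_iff_mem_nhds.2 fun q hq => ?_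
    have : ContinuousAt (fun q => ‖P (1, q)‖) q :=
      ((hB 1 h1B q hq.1).1.continuousAt.comp (f := fun q => ((1 : ℂ), q)) (by fun_prop)).norm
    filter_upwards [hV.mem_nhds hq.1, this.eventually_lt continuousAt_const hq.2]
      with q h1 h2 using ⟨h1, h2⟩
  set T : Q → ℂ → ℂ := fun q z => z - c⁻¹ * P (z, q) with hT
  have hTlip : ∀ q ∈ V, ∀ z ∈ closedBall (1 : ℂ) δ, ∀ w ∈ closedBall (1 : ℂ) δ,
      ‖T q z - T q w‖ ≤ 1 / 2 * ‖z - w‖ := by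
    intro q hq z hz w hw
    refine (convex_closedBall (1 : ℂ) δ).norm_image_sub_le_of_norm_hasDerivWithin_le
      (f' := fun z => 1 - c⁻¹ * fderiv ℂ P (z, q) (1, 0)) (fun z hz => ?_) (fun z hz => ?_) hw hz
    · have h2 := (hB z hz q hq).1.differentiableAt.hasFDerivAt
      have h3 : HasDerivAt (fun z : ℂ => (z, q)) ((1 : ℂ), (0 : Q)) z :=
        (hasDerivAt_id z).prodMk (hasDerivAt_const z q)
      have h4 := h2.comp_hasDerivAt z h3
      exact ((hasDerivAt_id z).sub (h4.const_mul c⁻¹)).hasDerivWithinAt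
    · have h2 := (hB z hz q hq).2
      rw [show 1 - c⁻¹ * fderiv ℂ P (z, q) (1, 0) = - (c⁻¹ * (fderiv ℂ P (z, q) (1, 0) - c)) by
        field_simp; ring, norm_neg, norm_mul, norm_inv, inv_mul_le_iff₀ hcpos]
      linarith
  set z : ℕ → Q → ℂ := fun k => Nat.rec (fun _ => 1) (fun _ f q => T q (f q)) k with hz
  have hz0 : ∀ q, z 0 q = 1 := fun _ => rfl
  have hzs : ∀ k q, z (k + 1) q = T q (z k q) := fun _ _ => rfl
  have hT1 : ∀ q, ‖T q 1 - 1‖ = ‖P (1, q)‖ / ‖c‖ := fun q => by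
    rw [hT]; simp; ring
  have hzB : ∀ k, ∀ q ∈ V', z k q ∈ closedBall (1 : ℂ) δ := by
    intro k q hq
    induction k with
    | zero => exact h1B
    | succ k ih =>
      rw [mem_closedBall, dist_eq_norm, hzs]
      have h2 := hTlip q hq.1 _ ih _ h1B
      have h3 : ‖T q 1 - 1‖ ≤ δ / 2 := by
        rw [hT1, div_le_iff₀ hcpos]; linarith [hq.2.le]
      rw [mem_closedBall, dist_eq_norm] at ih
      calc ‖T q (z k q) - 1‖ = ‖(T q (z k q) - T q 1) + (T q 1 - 1)‖ := by congr 1; ring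
        _ ≤ _ := norm_add_le _ _
        _ ≤ δ := by linarith
  have hstep : ∀ q ∈ V', ∀ k,
      dist (z k q) (z (k + 1) q) ≤ (2 * (‖P (1, q)‖ / ‖c‖)) / 2 / 2 ^ k := by
    intro q hq k
    induction k with
    | zero => rw [dist_comm, dist_eq_norm, hzs, hz0, hT1]; simp
    | succ k ih =>
      rw [dist_eq_norm, hzs, hzs (k + 1)]
      have h2 := hTlip q hq.1 _ (hzB k q hq) _ (hzB (k + 1) q hq)
      rw [dist_eq_norm] at ih
      calc _ ≤ _ := h2
        _ ≤ 1 / 2 * ((2 * (‖P (1, q)‖ / ‖c‖)) / 2 / 2 ^ k) := by gcongr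
        _ = _ := by rw [pow_succ]; field_simp
  have hlim : ∀ q ∈ V', ∃ l, Tendsto (fun k => z k q) atTop (𝓝 l) := fun q hq =>
    cauchySeq_tendsto_of_complete (cauchySeq_of_le_geometric_two (hstep q hq))
  choose! κ hκ using hlim
  have hza : ∀ k, AnalyticOnNhd ℂ (z k) V' := by
    intro k
    induction k with
    | zero => exact fun _ _ => analyticAt_const
    | succ k ih =>
      intro q hq
      have h2 := (hB _ (hzB k q hq) q hq.1).1
      exact (ih q hq).sub (analyticAt_const.mul (h2.comp₂ (ih q hq) analyticAt_id))
  refine ⟨V', κ, 2 / ‖c‖, hV'o, fun k hk => ⟨hKV hk, ?_⟩,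
    analyticOnNhd_of_tendstoUniformlyOn hV'o hza ?_, fun q hq => ?_⟩
  · rw [h0 k hk, norm_zero]; positivity
  · rw [Metric.tendstoUniformlyOn_iff]
    intro ε hε
    have h2 : Tendsto (fun k : ℕ => δ * (1 / 2) ^ k) atTop (𝓝 (δ * 0)) :=
      (tendsto_pow_atTop_nhds_zero_of_lt_one (by norm_num) (by norm_num)).const_mul _
    rw [mul_zero] at h2
    filter_upwards [h2.eventually_lt_const hε] with k hk q hq
    rw [dist_comm]
    refine (dist_le_of_le_geometric_two_of_tendsto (hstep q hq) (hκ q hq) k).trans_lt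
      (lt_of_le_of_lt ?_ hk)
    rw [one_div, inv_pow, ← div_eq_mul_inv]
    gcongr
    rw [← mul_div_assoc, div_le_iff₀ hcpos]; linarith [hq.2.le]
  · have hmem : κ q ∈ closedBall (1 : ℂ) δ :=
      isClosed_closedBall.mem_of_tendsto (hκ q hq) (Eventually.of_forall fun k => hzB k q hq)
    refine ⟨(by simpa [dist_eq_norm] using hmem : ‖κ q - 1‖ ≤ δ).trans hδ0, ?_, ?_⟩
    · have hcont : ContinuousAt (T q) (κ q) := by
        have := (hB _ hmem q hq.1).1.continuousAt.comp (f := fun z => (z, q)) (x := κ q)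
          (by fun_prop)
        exact continuousAt_id.sub (continuousAt_const.mul this)
      have h2 := hcont.tendsto.comp (hκ q hq)
      have h3 := tendsto_nhds_unique ((tendsto_add_atTop_iff_nat 1).2 (hκ q hq)) h2
      have : c⁻¹ * P (κ q, q) = 0 := by
        have h4 : κ q = κ q - c⁻¹ * P (κ q, q) := h3
        linear_combination h4
      exact (mul_eq_zero.1 this).resolve_left (inv_ne_zero hc)
    · have h2 := dist_le_of_le_geometric_two_of_tendsto₀ (hstep q hq) (hκ q hq)
      rw [dist_comm, dist_eq_norm] at h2
      refine h2.trans (le_of_eq ?_)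
      ring

end Implicit

section DualForm

variable {d : ℕ} {X : Fin d → (Fin (d + 1) → ℂ) → Fin (d + 1) → ℂ} {x : Fin (d + 1) → ℂ}

/-- The numerators of the coefficient forms of the frame `x, X₁ x, …, X_d x`. -/
noncomputable def dualNum (X : Fin d → (Fin (d + 1) → ℂ) → Fin (d + 1) → ℂ) (i : Fin d)
    (x : Fin (d + 1) → ℂ) : (Fin (d + 1) → ℂ) →L[ℂ] ℂ :=
  ∑ k, frameCoeff X x x (Pi.single k 1) i.succ •
    (ContinuousLinearMap.proj k : (Fin (d + 1) → ℂ) →L[ℂ] ℂ)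

lemma dualNum_apply (i : Fin d) (w : Fin (d + 1) → ℂ) :
    dualNum X i x w = frameCoeff X x x w i.succ := by
  have : w = ∑ k, w k • (Pi.single k 1 : Fin (d + 1) → ℂ) := by
    conv_lhs => rw [← Finset.univ_sum_single w]
    refine Finset.sum_congr rfl fun k _ => ?_
    rw [← Pi.single_smul]; simp
  conv_rhs => rw [this, map_sum, Finset.sum_apply]
  rw [dualNum, sum_apply]
  refine Finset.sum_congr rfl fun k _ => ?_
  simp [mul_comm]

lemma dualNum_analyticAt (hX : ∀ j, AnalyticAt ℂ (X j) x) (i : Fin d) :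
    AnalyticAt ℂ (dualNum X i) x := by
  change AnalyticAt ℂ (fun y => dualNum X i y) x
  unfold dualNum
  refine Finset.analyticAt_fun_sum _ fun k _ => ?_
  suffices h : AnalyticAt ℂ (fun y => frameCoeff X y y (Pi.single k 1) i.succ) x from
    h.fun_smul analyticAt_const
  simp only [frameCoeff_apply]
  refine (detRows_analyticAt _).comp (g := detRows d) ?_
  have hf := frame_analyticAt (w := fun y => y) analyticAt_id hX
  rw [analyticAt_pi_iff] at hf
  rw [analyticAt_pi_iff]
  intro l
  by_cases hl : l = i.succ
  · subst hl; simpa using analyticAt_const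
  · simpa [Function.update_of_ne hl] using hf l

/-- The volume form evaluated at the Euler vector field. -/
noncomputable def eulerDet (X : Fin d → (Fin (d + 1) → ℂ) → Fin (d + 1) → ℂ)
    (x : Fin (d + 1) → ℂ) : ℂ :=
  volForm X x x

lemma eulerDet_analyticAt (hX : ∀ j, AnalyticAt ℂ (X j) x) : AnalyticAt ℂ (eulerDet X) x :=
  (volForm_analyticAt hX).clm_app analyticAt_id

/-- The coefficient forms of the frame `x, X₁ x, …, X_d x`. -/
noncomputable def dualForm (X : Fin d → (Fin (d + 1) → ℂ) → Fin (d + 1) → ℂ) (i : Fin d)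
    (x : Fin (d + 1) → ℂ) : (Fin (d + 1) → ℂ) →L[ℂ] ℂ :=
  (eulerDet X x)⁻¹ • dualNum X i x

lemma dualForm_apply (i : Fin d) (w : Fin (d + 1) → ℂ) :
    dualForm X i x w = (eulerDet X x)⁻¹ * dualNum X i x w := rfl

lemma dualForm_analyticAt (hX : ∀ j, AnalyticAt ℂ (X j) x) (hx : eulerDet X x ≠ 0) (i : Fin d) :
    AnalyticAt ℂ (dualForm X i) x :=
  ((eulerDet_analyticAt hX).inv hx).smul (dualNum_analyticAt hX i)

lemma dualNum_self (i : Fin d) : dualNum X i x x = 0 := by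
  rw [dualNum_apply, frameCoeff_base]; simp

lemma dualForm_self (i : Fin d) : dualForm X i x x = 0 := by
  rw [dualForm_apply, dualNum_self, mul_zero]

lemma dualForm_field (hx : eulerDet X x ≠ 0) (i j : Fin d) :
    dualForm X i x (X j x) = if i = j then 1 else 0 := by
  rw [dualForm_apply, dualNum_apply, frameCoeff_field, ← eulerDet, Pi.single_apply]
  by_cases h : i = j <;> simp [h, hx]

lemma dualForm_expansion (hx : eulerDet X x ≠ 0) (w : Fin (d + 1) → ℂ) :
    w = ((eulerDet X x)⁻¹ * volForm X x w) • x + ∑ j, dualForm X j x w • X j x := by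
  have h := frame_expansion (X := X) (x := x) x w
  change eulerDet X x • w = _ at h
  calc w = (eulerDet X x)⁻¹ • eulerDet X x • w := (inv_smul_smul₀ hx w).symm
    _ = _ := by
      rw [h, smul_add, smul_smul, Finset.smul_sum]
      congr 1
      refine Finset.sum_congr rfl fun j _ => ?_
      rw [smul_smul, dualForm_apply, dualNum_apply]

lemma fderiv_dualForm_field (hX : ∀ j, AnalyticAt ℂ (X j) x) (hx : eulerDet X x ≠ 0)
    (i j : Fin d) (u : Fin (d + 1) → ℂ) :
    fderiv ℂ (dualForm X i) x u (X j x) = - dualForm X i x (fderiv ℂ (X j) x u) := by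
  have h1 : fderiv ℂ (fun y => dualForm X i y (X j y)) x u = 0 := by
    have : (fun y => dualForm X i y (X j y)) =ᶠ[𝓝 x] fun _ => if i = j then 1 else 0 := by
      filter_upwards [(eulerDet_analyticAt hX).continuousAt.eventually_ne hx] with y hy
      exact dualForm_field hy i j
    rw [this.fderiv_eq]; simp
  rw [fderiv_clm_apply (dualForm_analyticAt hX hx i).differentiableAt
    (hX j).differentiableAt] at h1
  simp at h1
  linear_combination h1

lemma fderiv_dualForm_self (hX : ∀ j, AnalyticAt ℂ (X j) x) (hx : eulerDet X x ≠ 0)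
    (i : Fin d) (u : Fin (d + 1) → ℂ) :
    fderiv ℂ (dualForm X i) x u x = - dualForm X i x u := by
  have h1 : fderiv ℂ (fun y => dualForm X i y y) x u = 0 := by
    simp only [dualForm_self]; simp
  rw [fderiv_clm_apply (𝕜 := ℂ) (u := fun y => y) (dualForm_analyticAt hX hx i).differentiableAt
    differentiableAt_fun_id] at h1
  simp at h1
  linear_combination h1

lemma fderiv_dualForm_symm (hX : ∀ j, AnalyticAt ℂ (X j) x) (hx : eulerDet X x ≠ 0)
    (hc : ∀ i j, VectorField.lieBracket ℂ (X i) (X j) x = 0) (i : Fin d)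
    {u v : Fin (d + 1) → ℂ} (hu : volForm X x u = 0) (hv : volForm X x v = 0) :
    fderiv ℂ (dualForm X i) x u v = fderiv ℂ (dualForm X i) x v u := by
  have hc' : ∀ i j, fderiv ℂ (X i) x (X j x) = fderiv ℂ (X j) x (X i x) := fun i j => by
    have := hc j i
    rwa [VectorField.lieBracket, sub_eq_zero] at this
  have hu' := dualForm_expansion hx u
  have hv' := dualForm_expansion hx v
  rw [hu, mul_zero, zero_smul, zero_add] at hu'
  rw [hv, mul_zero, zero_smul, zero_add] at hv'
  have key : ∀ a b : Fin d → ℂ, fderiv ℂ (dualForm X i) x (∑ j, a j • X j x) (∑ j, b j • X j x) =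
      ∑ j, ∑ k, a j * b k * - dualForm X i x (fderiv ℂ (X k) x (X j x)) := by
    intro a b
    rw [map_sum, map_sum, Finset.sum_comm]
    refine Finset.sum_congr rfl fun k _ => ?_
    rw [map_smul, sum_apply, smul_eq_mul, Finset.mul_sum]
    refine Finset.sum_congr rfl fun j _ => ?_
    rw [map_smul, smul_apply, fderiv_dualForm_field hX hx, smul_eq_mul]
    ring
  rw [hu', hv', key, key, Finset.sum_comm]
  refine Finset.sum_congr rfl fun j _ => Finset.sum_congr rfl fun k _ => ?_
  rw [hc' j k]; ring

/-- The derivative along `Z` of the coefficients of `Z` in the frame `x, X₁ x, …, X_d x`. -/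
lemma fderiv_dualForm_along (hX : ∀ j, AnalyticAt ℂ (X j) x) (hx : eulerDet X x ≠ 0)
    {Z : (Fin (d + 1) → ℂ) → Fin (d + 1) → ℂ} (hZ : AnalyticAt ℂ Z x) (i : Fin d) :
    fderiv ℂ (fun y => dualForm X i y (Z y)) x (Z x) = ((eulerDet X x)⁻¹) ^ 2 *
      (∑ j, dualNum X j x (Z x) * dualNum X i x (VectorField.lieBracket ℂ (X j) Z x) +
        volForm X x (Z x) * dualNum X i x (fderiv ℂ Z x x - Z x)) := by
  have hex := dualForm_expansion hx (Z x)
  set c₀ := (eulerDet X x)⁻¹ * volForm X x (Z x) with hc₀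
  have h1 : fderiv ℂ (fun y => dualForm X i y (Z y)) x (Z x) =
      fderiv ℂ (dualForm X i) x (Z x) (Z x) + dualForm X i x (fderiv ℂ Z x (Z x)) := by
    rw [fderiv_clm_apply (dualForm_analyticAt hX hx i).differentiableAt hZ.differentiableAt]
    simp [add_comm]
  have h2 : fderiv ℂ (dualForm X i) x (Z x) (Z x) = - c₀ * dualForm X i x (Z x) +
      ∑ j, dualForm X j x (Z x) * - dualForm X i x (fderiv ℂ (X j) x (Z x)) := by
    conv_lhs => enter [2]; rw [hex]
    rw [map_add, map_smul, map_sum, fderiv_dualForm_self hX hx]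
    simp only [map_smul, fderiv_dualForm_field hX hx, smul_eq_mul]
    ring
  have h3 : dualForm X i x (fderiv ℂ Z x (Z x)) = c₀ * dualForm X i x (fderiv ℂ Z x x) +
      ∑ j, dualForm X j x (Z x) * dualForm X i x (fderiv ℂ Z x (X j x)) := by
    conv_lhs => enter [2, 2]; rw [hex]
    simp only [map_add, map_smul, map_sum, smul_eq_mul]
  rw [h1, h2, h3]
  have h4 : ∀ j, dualNum X j x (Z x) * dualNum X i x (VectorField.lieBracket ℂ (X j) Z x) *
      ((eulerDet X x)⁻¹) ^ 2 = dualForm X j x (Z x) * - dualForm X i x (fderiv ℂ (X j) x (Z x)) +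
        dualForm X j x (Z x) * dualForm X i x (fderiv ℂ Z x (X j x)) := by
    intro j
    rw [VectorField.lieBracket, map_sub]
    simp only [dualForm_apply]; ring
  rw [mul_add, Finset.mul_sum, map_sub]
  rw [show (∑ j, (eulerDet X x)⁻¹ ^ 2 * (dualNum X j x (Z x) *
      dualNum X i x (VectorField.lieBracket ℂ (X j) Z x))) = _ from
    Finset.sum_congr rfl fun j _ => (mul_comm _ _).trans (h4 j), Finset.sum_add_distrib]
  simp only [hc₀, dualForm_apply]
  ring

end DualForm

section Homotopy

variable {E : Type*} [NormedAddCommGroup E] [NormedSpace ℂ E]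

/-- Homotopy invariance of the integral of a holomorphic one-form over a free homotopy of loops
along which the form is closed. -/
lemma integral_eq_of_homotopy [CompleteSpace E] {α : E → E →L[ℂ] ℂ} {p : ℝ × ℝ → E}
    (hp : ∀ q ∈ Ioo (-1 : ℝ) 2 ×ˢ Ioo (-1 : ℝ) 2, AnalyticAt ℝ p q)
    (hα : ∀ q ∈ Ioo (-1 : ℝ) 2 ×ˢ Ioo (-1 : ℝ) 2, AnalyticAt ℂ α (p q))
    (hs : ∀ q ∈ Ioo (-1 : ℝ) 2 ×ˢ Ioo (-1 : ℝ) 2, ∀ u v,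
      fderiv ℂ α (p q) (fderiv ℝ p q u) (fderiv ℝ p q v) =
        fderiv ℂ α (p q) (fderiv ℝ p q v) (fderiv ℝ p q u))
    (hper : ∀ τ ∈ Ioo (-1 : ℝ) 2, p (1, τ) = p (0, τ)) :
    ∫ t in (0 : ℝ)..1, α (p (t, 0)) (fderiv ℝ p (t, 0) (1, 0)) =
      ∫ t in (0 : ℝ)..1, α (p (t, 1)) (fderiv ℝ p (t, 1) (1, 0)) := by
  set R : Set (ℝ × ℝ) := Ioo (-1 : ℝ) 2 ×ˢ Ioo (-1 : ℝ) 2 with hR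
  have hRo : IsOpen R := isOpen_Ioo.prod isOpen_Ioo
  have hRc : Convex ℝ R := (convex_Ioo _ _).prod (convex_Ioo _ _)
  let ζ : ℝ × ℝ → ℝ × ℝ →L[ℝ] ℂ := fun q =>
    ((α (p q)).restrictScalars ℝ).comp (fderiv ℝ p q)
  have hζa : ∀ q ∈ R, AnalyticAt ℝ ζ q := by
    intro q hq
    have h1 : AnalyticAt ℝ (fun q => (α (p q)).restrictScalars ℝ) q :=
      ((ContinuousLinearMap.restrictScalarsL ℂ E ℂ ℝ ℝ).analyticAt _).comp
        ((hα q hq).restrictScalars.comp (hp q hq))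
    exact ((ContinuousLinearMap.compL ℝ (ℝ × ℝ) E ℂ).analyticAt_bilinear _).comp₂ h1
      (hp q hq).fderiv
  have hζd : ∀ q ∈ R, ∀ u v, fderiv ℝ ζ q u v =
      fderiv ℂ α (p q) (fderiv ℝ p q u) (fderiv ℝ p q v) +
        α (p q) (fderiv ℝ (fderiv ℝ p) q u v) := by
    intro q hq u v
    have h1 : HasFDerivAt (fun q => ζ q v) ((ContinuousLinearMap.apply ℝ ℂ v).comp
        (fderiv ℝ ζ q)) q :=
      (ContinuousLinearMap.apply ℝ ℂ v).hasFDerivAt.comp q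
        (hζa q hq).differentiableAt.hasFDerivAt
    have h2 : HasFDerivAt (fun q => fderiv ℝ p q v) ((ContinuousLinearMap.apply ℝ E v).comp
        (fderiv ℝ (fderiv ℝ p) q)) q :=
      (ContinuousLinearMap.apply ℝ E v).hasFDerivAt.comp q
        (hp q hq).fderiv.differentiableAt.hasFDerivAt
    have h3 : HasFDerivAt (fun q => α (p q)) (((fderiv ℂ α (p q)).restrictScalars ℝ).comp
        (fderiv ℝ p q)) q :=
      ((hα q hq).differentiableAt.hasFDerivAt.restrictScalars ℝ).comp q
        (hp q hq).differentiableAt.hasFDerivAt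
    have h4 := (isBoundedBilinearMap_apply (𝕜 := ℂ) (E := E) (F := ℂ)).hasFDerivAt
      (α (p q), fderiv ℝ p q v) |>.restrictScalars ℝ |>.comp q (h3.prodMk h2)
    have h5 := h1.unique h4
    have := DFunLike.congr_fun h5 u
    simp only [ContinuousLinearMap.comp_apply] at this
    simpa [add_comm] using this
  obtain ⟨h, hh⟩ := hRc.exists_forall_hasFDerivAt_of_fderiv_symmetric hRo (ω := ζ)
    (fun q hq => (hζa q hq).differentiableAt.differentiableWithinAt) (fun q hq u v => by
      rw [hζd q hq, hζd q hq, hs q hq u v]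
      have : fderiv ℝ (fderiv ℝ p) q u v = fderiv ℝ (fderiv ℝ p) q v u :=
        ContDiffAt.isSymmSndFDerivAt_of_omega (hp q hq).contDiffAt u v
      rw [this])
  have h01 : ∀ t ∈ Icc (0 : ℝ) 1, t ∈ Ioo (-1 : ℝ) 2 := fun t ht =>
    ⟨by linarith [ht.1], by linarith [ht.2]⟩
  -- fundamental theorem of calculus along horizontal segments
  have hInt : ∀ τ ∈ Icc (0 : ℝ) 1, ∫ t in (0 : ℝ)..1, α (p (t, τ)) (fderiv ℝ p (t, τ) (1, 0)) =
      h (1, τ) - h (0, τ) := by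
    intro τ hτ
    have hm : ∀ t ∈ Icc (0 : ℝ) 1, (t, τ) ∈ R := fun t ht => ⟨h01 t ht, h01 τ hτ⟩
    refine intervalIntegral.integral_eq_sub_of_hasDerivAt (f := fun t => h (t, τ))
      (f' := fun t => ζ (t, τ) (1, 0)) ?_ ?_
    · intro t ht
      rw [uIcc_of_le zero_le_one] at ht
      have := (hh _ (hm t ht)).comp_hasDerivAt t ((hasDerivAt_id t).prodMk (hasDerivAt_const t τ))
      exact this
    · refine ContinuousOn.intervalIntegrable ?_
      rw [uIcc_of_le zero_le_one]
      refine ContinuousOn.clm_apply ?_ continuousOn_const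
      intro t ht
      have h1 : ContinuousAt (fun t : ℝ => (t, τ)) t := by fun_prop
      exact (ContinuousAt.comp (f := fun t : ℝ => (t, τ)) (x := t)
        (hζa _ (hm t ht)).continuousAt h1).continuousWithinAt
  rw [hInt 0 ⟨le_rfl, zero_le_one⟩, hInt 1 ⟨zero_le_one, le_rfl⟩]
  have hvert : ∀ t ∈ Icc (0 : ℝ) 1, ∀ τ ∈ Icc (0 : ℝ) 1,
      HasDerivAt (fun τ => h (t, τ)) (ζ (t, τ) (0, 1)) τ := fun t ht τ hτ =>
    (hh (t, τ) ⟨h01 t ht, h01 τ hτ⟩).comp_hasDerivAt τ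
      ((hasDerivAt_const τ t).prodMk (hasDerivAt_id τ))
  have heq : ∀ τ ∈ Icc (0 : ℝ) 1, ζ (1, τ) (0, 1) = ζ (0, τ) (0, 1) := by
    intro τ hτ
    have h1 : ∀ t ∈ Icc (0 : ℝ) 1, HasDerivAt (fun τ => p (t, τ)) (fderiv ℝ p (t, τ) (0, 1)) τ :=
      fun t ht => (hp (t, τ) ⟨h01 t ht, h01 τ hτ⟩).differentiableAt.hasFDerivAt.comp_hasDerivAt τ
      ((hasDerivAt_const τ t).prodMk (hasDerivAt_id τ))
    have h2 : (fun τ => p (1, τ)) =ᶠ[𝓝 τ] fun τ => p (0, τ) := by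
      filter_upwards [isOpen_Ioo.mem_nhds (h01 τ hτ)] with σ hσ using hper σ hσ
    have h3 := ((h1 0 ⟨le_rfl, zero_le_one⟩).congr_of_eventuallyEq h2).unique
      (h1 1 ⟨zero_le_one, le_rfl⟩)
    change α (p (1, τ)) (fderiv ℝ p (1, τ) (0, 1)) = α (p (0, τ)) (fderiv ℝ p (0, τ) (0, 1))
    rw [hper τ (h01 τ hτ), h3]
  have hc := constant_of_has_deriv_right_zero (f := fun τ => h (1, τ) - h (0, τ)) (a := 0) (b := 1)
    (fun τ hτ => ((hvert 1 ⟨zero_le_one, le_rfl⟩ τ hτ).sub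
      (hvert 0 ⟨le_rfl, zero_le_one⟩ τ hτ)).continuousAt.continuousWithinAt)
    (fun τ hτ => by
      have hτ' := Ico_subset_Icc_self hτ
      have := (hvert 1 ⟨zero_le_one, le_rfl⟩ τ hτ').sub (hvert 0 ⟨le_rfl, zero_le_one⟩ τ hτ')
      rw [heq τ hτ', sub_self] at this
      exact this.hasDerivWithinAt)
  exact (hc 1 ⟨zero_le_one, le_rfl⟩).symm

end Homotopy

section FlowExp

variable {E : Type*} [NormedAddCommGroup E] [NormedSpace ℂ E] [CompleteSpace E]

/-- The flow `t ↦ exp (2πi t S)` of the linear vector field `2πi S`. -/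
noncomputable def flowExp (S : E →L[ℂ] E) (t : ℂ) : E →L[ℂ] E :=
  NormedSpace.exp (t • ((2 * Real.pi * Complex.I : ℂ) • S))

variable {S : E →L[ℂ] E}

lemma flowExp_zero : flowExp S 0 = 1 := by simp [flowExp]

lemma flowExp_analyticAt (t : ℂ) : AnalyticAt ℂ (flowExp S) t := by
  refine (NormedSpace.exp_analytic (𝕂 := ℂ) _).comp
    (f := fun t : ℂ => t • ((2 * Real.pi * Complex.I : ℂ) • S)) ?_
  exact analyticAt_id.fun_smul analyticAt_const

lemma flowExp_continuous : Continuous (flowExp S) :=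
  continuous_iff_continuousAt.2 fun t => (flowExp_analyticAt t).continuousAt

lemma flowExp_hasDerivAt (t : ℂ) :
    HasDerivAt (flowExp S) (((2 * Real.pi * Complex.I : ℂ) • S) * flowExp S t) t :=
  hasDerivAt_exp_smul_const' (𝕂 := ℂ) (𝔸 := E →L[ℂ] E) ((2 * Real.pi * Complex.I : ℂ) • S) t

lemma flowExp_hasDerivAt_apply (x : E) (t : ℝ) :
    HasDerivAt (fun t : ℝ => flowExp S t x)
      ((2 * Real.pi * Complex.I : ℂ) • S (flowExp S t x)) t := by
  have h1 : HasDerivAt (fun t : ℂ => flowExp S t x)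
      ((2 * Real.pi * Complex.I : ℂ) • S (flowExp S t x)) (t : ℂ) :=
    ((ContinuousLinearMap.apply ℂ E x).hasFDerivAt.comp_hasDerivAt (t : ℂ)
      (flowExp_hasDerivAt (S := S) (t : ℂ)))
  exact h1.comp_ofReal_vec

lemma flowExp_add (s t : ℂ) : flowExp S (s + t) = flowExp S s * flowExp S t := by
  rw [flowExp, add_smul]
  exact NormedSpace.exp_add_of_commute_of_mem_ball (𝕂 := ℂ)
    (((Commute.refl _).smul_left s).smul_right t)
    ((NormedSpace.expSeries_radius_eq_top ℂ (E →L[ℂ] E)).symm ▸ edist_lt_top _ _)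
    ((NormedSpace.expSeries_radius_eq_top ℂ (E →L[ℂ] E)).symm ▸ edist_lt_top _ _)

lemma flowExp_commute {R : E →L[ℂ] E} (h : Commute R S) (t : ℂ) : Commute R (flowExp S t) :=
  ((h.smul_right _).smul_right _).exp_right

end FlowExp

section Orbit

open Asymptotics

variable {E : Type*} [NormedAddCommGroup E] [NormedSpace ℂ E] [FiniteDimensional ℂ E]

lemma isBigO_sub_id {u : E → E} (hu : AnalyticAt ℂ u 0) (h0 : u 0 = 0)
    (hd : fderiv ℂ u 0 = ContinuousLinearMap.id ℂ E) :
    (fun x => u x - x) =O[𝓝 0] fun x => ‖x‖ ^ 2 := by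
  obtain ⟨p, hp⟩ := hu
  have h := hp.isBigO_sub_partialSum_pow 2
  refine h.congr_left fun x => ?_
  have h1 : (p 1 fun _ => x) = x := by
    have := hp.fderiv_eq
    rw [hd] at this
    have := DFunLike.congr_fun this x
    rw [show (fun _ : Fin 1 => x) = ![x] from funext fun i => by fin_cases i; rfl]
    simpa using this.symm
  have h2 : (p 0 fun _ => x) = 0 := by
    rw [show (fun _ : Fin 0 => x) = 0 from Subsingleton.elim _ _, hp.coeff_zero, h0]
  rw [zero_add, FormalMultilinearSeries.partialSum, Finset.sum_range_succ, Finset.sum_range_one,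
    h1, h2, zero_add]

/-- A holomorphic local inverse of a map tangent to the identity. -/
lemma exists_local_inverse {u : E → E} (hu : AnalyticAt ℂ u 0) (h0 : u 0 = 0)
    (hd : fderiv ℂ u 0 = ContinuousLinearMap.id ℂ E) :
    ∃ φ : E → E, AnalyticAt ℂ φ 0 ∧ φ 0 = 0 ∧ fderiv ℂ φ 0 = ContinuousLinearMap.id ℂ E ∧
      (∀ᶠ x in 𝓝 0, φ (u x) = x) ∧ ∀ᶠ x in 𝓝 0, u (φ x) = x := by
  have : CompleteSpace E := FiniteDimensional.complete ℂ E
  have hs : HasStrictFDerivAt u ((ContinuousLinearEquiv.refl ℂ E : E ≃L[ℂ] E) : E →L[ℂ] E) 0 := by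
    have := hu.hasStrictFDerivAt
    rw [hd] at this
    exact this
  refine ⟨hs.localInverse u _ 0, ?_, ?_, ?_, hs.eventually_left_inverse, ?_⟩
  · have := (hs.toOpenPartialHomeomorph u).analyticAt_symm' (a := 0)
      (i := ContinuousLinearEquiv.refl ℂ E) hs.mem_toOpenPartialHomeomorph_source
      (by simpa using hu) (by simpa using hd)
    rw [HasStrictFDerivAt.toOpenPartialHomeomorph_coe, h0] at this
    exact this
  · have := hs.localInverse_apply_image
    rwa [h0] at this
  · have := hs.to_localInverse
    rw [h0] at this
    exact this.hasFDerivAt.fderiv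
  · have := hs.eventually_right_inverse
    rwa [h0] at this

/-- The field `Z` is linearized by `u`, with linear part `S`. -/
structure LinearizedBy (S : E →L[ℂ] E) (Z u : E → E) : Prop where
  field : AnalyticAt ℂ Z 0
  map : AnalyticAt ℂ u 0
  field_zero : Z 0 = 0
  map_zero : u 0 = 0
  fderiv_map : fderiv ℂ u 0 = ContinuousLinearMap.id ℂ E
  conj : ∀ᶠ x in 𝓝 0, fderiv ℂ u x (Z x) = S (u x)

lemma LinearizedBy.exists_orbit [CompleteSpace E] {S : E →L[ℂ] E} {Z u : E → E}
    (h : LinearizedBy S Z u)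
    (hS : flowExp S 1 = 1) (y : E) :
    ∃ (o : ℂ → ℝ → E) (C : ℝ), 0 ≤ C ∧ ∀ᶠ s in 𝓝 (0 : ℂ), o s 0 = s • y ∧ o s 1 = s • y ∧
      ∀ t ∈ Ioo (-1 : ℝ) 2, AnalyticAt ℝ (o s) t ∧
        HasDerivAt (o s) ((2 * Real.pi * Complex.I : ℂ) • Z (o s t)) t ∧
        ‖o s t - s • flowExp S t y‖ ≤ C * ‖s‖ ^ 2 := by
  obtain ⟨φ, hφ, hφ0, hφd, hl, hr⟩ := exists_local_inverse h.map h.map_zero h.fderiv_map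
  have hφc : Tendsto φ (𝓝 0) (𝓝 0) := by simpa [ContinuousAt, hφ0] using hφ.continuousAt
  have hconj : ∀ᶠ z in 𝓝 0, fderiv ℂ φ z (S z) = Z (φ z) := by
    filter_upwards [hr, hφc.eventually h.conj, hφc.eventually hl.eventually_nhds,
      hφc.eventually h.map.eventually_analyticAt, hφ.eventually_analyticAt] with z h1 h2 h3 h4 h5
    have h6 : fderiv ℂ (fun x => φ (u x)) (φ z) = ContinuousLinearMap.id ℂ E := by
      rw [(show (fun x => φ (u x)) =ᶠ[𝓝 (φ z)] fun x => x from h3).fderiv_eq, fderiv_fun_id]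
    rw [fderiv_fun_comp _ (by rw [h1]; exact h5.differentiableAt) h4.differentiableAt, h1] at h6
    have := DFunLike.congr_fun h6 (Z (φ z))
    rwa [ContinuousLinearMap.comp_apply, h2, h1] at this
  obtain ⟨M, hM⟩ := (isCompact_Icc (a := (-1 : ℝ)) (b := 2)).exists_bound_of_continuousOn
    (f := fun t : ℝ => flowExp S t)
    (flowExp_continuous.comp Complex.continuous_ofReal).continuousOn
  have hM0 : 0 ≤ M := (norm_nonneg _).trans (hM 0 (by norm_num))
  obtain ⟨C₁, r₁, hC₁, hr₁, hb₁⟩ := isBigO_norm_pow_iff.1 (isBigO_sub_id hφ hφ0 hφd)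
  obtain ⟨C₂, r₂, hC₂, hr₂, hb₂⟩ := isBigO_norm_pow_iff.1
    (isBigO_sub_id h.map h.map_zero h.fderiv_map)
  obtain ⟨C₃, r₃, hC₃, hr₃, hb₃⟩ := isBigO_norm_pow_iff.1
    ((isBigO_norm_of_zero h.map h.map_zero).congr_right fun x => (pow_one ‖x‖).symm)
  obtain ⟨ρ, hρ, hρg⟩ := Metric.eventually_nhds_iff_ball.1 (hconj.and hφ.eventually_analyticAt)
  have hsy : Tendsto (fun s : ℂ => s • y) (𝓝 0) (𝓝 0) := by
    have : ContinuousAt (fun s : ℂ => s • y) 0 := by fun_prop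
    simpa [ContinuousAt] using this
  have husy : Tendsto (fun s : ℂ => M * ‖u (s • y)‖) (𝓝 0) (𝓝 0) := by
    have := (h.map.continuousAt.tendsto.comp (by simpa using hsy)).norm.const_mul M
    simpa [h.map_zero] using this
  refine ⟨fun s t => φ (flowExp S t (u (s • y))),
    C₁ * (M * (C₃ * ‖y‖)) ^ 2 + M * (C₂ * ‖y‖ ^ 2), by positivity, ?_⟩
  filter_upwards [hsy.eventually hl, hsy.eventually (ball_mem_nhds _ hr₂),
    hsy.eventually (ball_mem_nhds _ hr₃), husy.eventually (gt_mem_nhds hρ),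
    husy.eventually (gt_mem_nhds hr₁)] with s h1 h2 h3 h4 h5
  rw [dist_zero_right] at h2 h3
  refine ⟨by simpa [flowExp_zero] using h1, by simpa [hS] using h1, fun t ht => ?_⟩
  have hMt : ‖flowExp S t‖ ≤ M := hM t (Ioo_subset_Icc_self ht)
  set w := flowExp S t (u (s • y)) with hw
  have hwM : ‖w‖ ≤ M * ‖u (s • y)‖ :=
    ((flowExp S t).le_opNorm _).trans (by gcongr)
  obtain ⟨hg1, hg2⟩ := hρg w (by rw [mem_ball_zero_iff]; exact hwM.trans_lt h4)
  refine ⟨?_, ?_, ?_⟩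
  · have ha : AnalyticAt ℝ (fun t : ℝ => flowExp S t (u (s • y))) t := by
      have h7 : AnalyticAt ℂ (fun t : ℂ => flowExp S t (u (s • y))) (t : ℂ) :=
        (flowExp_analyticAt _).clm_app analyticAt_const
      exact h7.restrictScalars.comp (f := fun t : ℝ => (t : ℂ)) (Complex.ofRealCLM.analyticAt t)
    exact AnalyticAt.comp (g := φ) (f := fun t : ℝ => flowExp S t (u (s • y)))
      hg2.restrictScalars ha
  · have h7 := (hg2.differentiableAt.hasFDerivAt.restrictScalars ℝ).comp_hasDerivAt t
      (flowExp_hasDerivAt_apply (S := S) (u (s • y)) t)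
    simp only [← hw] at h7
    have h8 : ((fderiv ℂ φ w).restrictScalars ℝ) ((2 * Real.pi * Complex.I : ℂ) • S w) =
        (2 * Real.pi * Complex.I : ℂ) • Z (φ w) := by
      rw [ContinuousLinearMap.coe_restrictScalars', map_smul, hg1]
    rw [h8] at h7
    exact h7
  · have h7 := hb₁ w (hwM.trans_lt h5)
    have h8 := hb₂ _ h2
    have h9 := hb₃ _ h3
    have h10 : φ w - s • flowExp S t y = (φ w - w) + flowExp S t (u (s • y) - s • y) := by
      rw [map_sub, map_smul, ← hw]; abel
    rw [h10]
    have h11 : ‖w‖ ≤ M * (C₃ * ‖y‖) * ‖s‖ := by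
      refine hwM.trans ?_
      rw [pow_one, norm_smul] at h9
      calc M * ‖u (s • y)‖ ≤ M * (C₃ * (‖s‖ * ‖y‖)) := by gcongr
        _ = _ := by ring
    calc ‖φ w - w + flowExp S t (u (s • y) - s • y)‖
        ≤ ‖φ w - w‖ + ‖flowExp S t (u (s • y) - s • y)‖ := norm_add_le _ _
      _ ≤ C₁ * (M * (C₃ * ‖y‖) * ‖s‖) ^ 2 + M * (C₂ * ‖s • y‖ ^ 2) := by
          refine add_le_add (h7.trans (by gcongr)) (((flowExp S t).le_opNorm _).trans ?_)
          gcongr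
      _ = _ := by rw [norm_smul]; ring

end Orbit

section Tube

variable {E : Type*} [NormedAddCommGroup E] [NormedSpace ℂ E] [FiniteDimensional ℂ E]

/-- `κ` is a radial parametrization of the level sets of `F` near the cone over `Γ`. -/
structure IsTube (F : E → ℂ) (Γ : Set E) (r : ℝ) (m : ℕ) (h₀ : ℂ) (ε C c : ℝ)
    (κ : ℂ × E × ℂ → ℂ) : Prop where
  pos : 0 < ε
  lower_pos : 0 < c
  upper_nonneg : 0 ≤ C
  spec : ∀ s ω g, 0 < ‖s‖ → ‖s‖ < ε → ω ∈ thickening ε Γ → ‖g - h₀‖ < ε →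
    AnalyticAt ℂ κ (s, ω, g) ∧
      ‖κ (s, ω, g) - 1‖ ≤ 1 / 2 ∧ ‖(κ (s, ω, g) * s) • ω‖ < r ∧ ‖s • ω‖ < r ∧
      c * ‖s‖ ^ m ≤ ‖fderiv ℂ F ((κ (s, ω, g) * s) • ω) ((κ (s, ω, g) * s) • ω)‖ ∧
      c * ‖s‖ ^ m ≤ ‖fderiv ℂ F (s • ω) (s • ω)‖ ∧ F ((κ (s, ω, g) * s) • ω) = s ^ m * g ∧
      ‖s‖ ^ m * ‖κ (s, ω, g) - 1‖ ≤ C * ‖F (s • ω) - s ^ m * g‖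

/-- A radial parametrization of the level sets of `F`, near the cone over a compact set `Γ` on
which the leading homogeneous part of `F` is a nonzero constant. -/
theorem exists_tube {F : E → ℂ} {r : ℝ} (hr : 0 < r)
    {H : ℂ × E → ℂ} {m : ℕ} (hm : m ≠ 0) (hH : AnalyticOnNhd ℂ H {q | ‖q.1 • q.2‖ < r})
    (hHF : ∀ s y, s ≠ 0 → s ^ m • H (s, y) = F (s • y)) {Γ : Set E} (hΓ : IsCompact Γ) {h₀ : ℂ}
    (hh₀ : h₀ ≠ 0) (hΓH : ∀ ω ∈ Γ, H (0, ω) = h₀)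
    (hF : ∀ x, ‖x‖ < r → DifferentiableAt ℂ F x) :
    ∃ (ε C c : ℝ) (κ : ℂ × E × ℂ → ℂ), IsTube F Γ r m h₀ ε C c κ := by
  set D : Set (ℂ × E) := {q | ‖q.1 • q.2‖ < r} with hD
  have hDo : IsOpen D := isOpen_lt (by fun_prop) continuous_const
  let G : ℂ × E → ℂ := fun q => m * H q + q.1 * fderiv ℂ H q (1, 0)
  have hG : AnalyticOnNhd ℂ G D := fun q hq =>
    (analyticAt_const.mul (hH q hq)).add
      (analyticAt_fst.mul ((hH q hq).fderiv.clm_app analyticAt_const))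
  have hEuler : ∀ σ y, σ ≠ 0 → ‖σ • y‖ < r → fderiv ℂ F (σ • y) (σ • y) = σ ^ m * G (σ, y) := by
    intro σ y hσ hy
    have h1 : HasDerivAt (fun σ : ℂ => F (σ • y)) (fderiv ℂ F (σ • y) y) σ := by
      have : HasDerivAt (fun σ : ℂ => σ • y) ((1 : ℂ) • y) σ := (hasDerivAt_id σ).smul_const y
      rw [one_smul] at this
      exact (hF _ hy).hasFDerivAt.comp_hasDerivAt σ this
    have h2 : HasDerivAt (fun σ : ℂ => H (σ, y)) (fderiv ℂ H (σ, y) (1, 0)) σ :=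
      (hH (σ, y) hy).differentiableAt.hasFDerivAt.comp_hasDerivAt σ
        ((hasDerivAt_id σ).prodMk (hasDerivAt_const σ y))
    have h3 := (hasDerivAt_pow m σ).mul h2
    have h4 : (fun σ : ℂ => σ ^ m * H (σ, y)) =ᶠ[𝓝 σ] fun σ => F (σ • y) := by
      filter_upwards [eventually_ne_nhds hσ] with τ hτ using hHF τ y hτ
    have h5 := h1.unique (h3.congr_of_eventuallyEq h4.symm)
    rw [map_smul, h5, smul_eq_mul]
    obtain ⟨k, rfl⟩ := Nat.exists_eq_succ_of_ne_zero hm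
    simp only [G, Nat.succ_eq_add_one, Nat.add_sub_cancel, pow_succ]
    ring
  let P : ℂ × (ℂ × E × ℂ) → ℂ := fun q => q.1 ^ m * H (q.1 * q.2.1, q.2.2.1) - q.2.2.2
  have hPa : ∀ q : ℂ × (ℂ × E × ℂ), ‖(q.1 * q.2.1) • q.2.2.1‖ < r → AnalyticAt ℂ P q := by
    intro q hq
    have h1 : AnalyticAt ℂ (fun q : ℂ × (ℂ × E × ℂ) => (q.1 * q.2.1, q.2.2.1)) q :=
      (analyticAt_fst.mul (analyticAt_fst.comp analyticAt_snd)).prod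
        (analyticAt_fst.comp (analyticAt_snd.comp analyticAt_snd))
    have h2 : AnalyticAt ℂ (fun q : ℂ × (ℂ × E × ℂ) => q.1 ^ m) q := analyticAt_fst.pow m
    have h3 : AnalyticAt ℂ (fun q : ℂ × (ℂ × E × ℂ) => q.2.2.2) q :=
      analyticAt_snd.comp (analyticAt_snd.comp analyticAt_snd)
    exact (h2.mul ((hH _ hq).comp h1)).sub h3
  set K : Set (ℂ × E × ℂ) := {0} ×ˢ Γ ×ˢ {h₀} with hK
  have hKc : IsCompact K := isCompact_singleton.prod (hΓ.prod isCompact_singleton)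
  have hKr : ∀ k ∈ K, ‖((1 : ℂ) * k.1) • k.2.1‖ < r := by
    rintro ⟨s, ω, g⟩ ⟨hs, -, -⟩
    obtain rfl : s = 0 := hs
    simpa using hr
  have hK0 : ∀ k ∈ K, k.1 = 0 ∧ k.2.1 ∈ Γ ∧ k.2.2 = h₀ := fun k hk => ⟨hk.1, hk.2.1, hk.2.2⟩
  have hmc : (m : ℂ) * h₀ ≠ 0 := mul_ne_zero (Nat.cast_ne_zero.2 hm) hh₀
  obtain ⟨V, κ, C, hVo, hKV, hκ, hV⟩ := exists_implicit_of_isCompact (P := P) hKc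
    (c := m * h₀) hmc (fun k hk => hPa (1, k) (hKr k hk))
    (fun k hk => by
      obtain ⟨h1, h2, h3⟩ := hK0 k hk
      simp [P, h1, hΓH _ h2, h3])
    (fun k hk => by
      obtain ⟨h1, h2, h3⟩ := hK0 k hk
      have h4 := (hPa (1, k) (hKr k hk)).differentiableAt.hasFDerivAt.comp_hasDerivAt (1 : ℂ)
        ((hasDerivAt_id (1 : ℂ)).prodMk (hasDerivAt_const (1 : ℂ) k))
      have h5 : HasDerivAt (fun z : ℂ => z ^ m * h₀ - h₀) (m * (1 : ℂ) ^ (m - 1) * h₀) 1 :=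
        ((hasDerivAt_pow m (1 : ℂ)).mul_const h₀).sub_const h₀
      have h6 : (P ∘ fun z : ℂ => (z, k)) = fun z => z ^ m * h₀ - h₀ := by
        funext z
        simp [P, h1, hΓH _ h2, h3]
      have h7 := h4.unique (by rw [show (fun z : ℂ => (id z, k)) = fun z => (z, k) from rfl, h6]
                               exact h5)
      rw [h7]; simp) (δ₀ := 1 / 2) (by norm_num)
  have hpos : 0 < ‖(m : ℂ) * h₀‖ / 2 := by positivity
  set V' : Set (ℂ × E × ℂ) := {q | q ∈ V ∧ (κ q * q.1, q.2.1) ∈ D ∧ (q.1, q.2.1) ∈ D ∧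
    ‖(m : ℂ) * h₀‖ / 2 < ‖G (κ q * q.1, q.2.1)‖ ∧ ‖(m : ℂ) * h₀‖ / 2 < ‖G (q.1, q.2.1)‖} with hV'
  have hV'o : IsOpen V' := by
    refine isOpen_iff_mem_nhds.2 fun q hq => ?_
    obtain ⟨h1, h2, h3, h4, h5⟩ := hq
    have hc1 : ContinuousAt (fun q : ℂ × E × ℂ => (κ q * q.1, q.2.1)) q :=
      (((hκ q h1).continuousAt.mul continuousAt_fst)).prodMk (by fun_prop)
    have hc2 : ContinuousAt (fun q : ℂ × E × ℂ => (q.1, q.2.1)) q := by fun_prop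
    have hc3 : ContinuousAt (fun q : ℂ × E × ℂ => ‖G (κ q * q.1, q.2.1)‖) q :=
      (ContinuousAt.comp (f := fun q : ℂ × E × ℂ => (κ q * q.1, q.2.1)) (x := q)
        (hG _ h2).continuousAt hc1).norm
    have hc4 : ContinuousAt (fun q : ℂ × E × ℂ => ‖G (q.1, q.2.1)‖) q :=
      (ContinuousAt.comp (f := fun q : ℂ × E × ℂ => (q.1, q.2.1)) (x := q)
        (hG _ h3).continuousAt hc2).norm
    filter_upwards [hVo.mem_nhds h1, hc1 (hDo.mem_nhds h2), hc2 (hDo.mem_nhds h3),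
      hc3.eventually (lt_mem_nhds h4), hc4.eventually (lt_mem_nhds h5)] with a b1 b2 b3 b4 b5
      using ⟨b1, b2, b3, b4, b5⟩
  have hKV' : K ⊆ V' := by
    intro k hk
    obtain ⟨h1, h2, h3⟩ := hK0 k hk
    have hG0 : G (0, k.2.1) = m * h₀ := by simp [G, hΓH _ h2]
    refine ⟨hKV hk, ?_, ?_, ?_, ?_⟩
    · simpa [hD, h1] using hr
    · simpa [hD, h1] using hr
    · rw [h1, mul_zero, hG0]; linarith
    · rw [h1, hG0]; linarith
  obtain ⟨ε, hε, hεV⟩ := hKc.exists_thickening_subset_open hV'o hKV'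
  refine ⟨ε, |C|, (1 / 2) ^ m * (‖(m : ℂ) * h₀‖ / 2), κ, hε, by positivity, abs_nonneg C, ?_⟩
  intro s ω g hs0 hs hω hg
  have hs0' : s ≠ 0 := norm_pos_iff.1 hs0
  have hmem : (s, ω, g) ∈ V' := by
    refine hεV ?_
    obtain ⟨z, hz, hωz⟩ := mem_thickening_iff.1 hω
    refine mem_thickening_iff.2 ⟨(0, z, h₀), ⟨rfl, hz, rfl⟩, ?_⟩
    rw [Prod.dist_eq, Prod.dist_eq]
    refine max_lt ?_ (max_lt hωz ?_)
    · simpa using hs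
    · simpa [dist_eq_norm] using hg
  obtain ⟨h1, h2, h3, h4, h5⟩ := hmem
  obtain ⟨h6, h7, h8⟩ := hV _ h1
  set k := κ (s, ω, g) with hk
  have hk2 : 1 / 2 ≤ ‖k‖ := by
    have := norm_sub_norm_le (1 : ℂ) k
    rw [norm_one, norm_sub_rev] at this
    linarith
  have hk0 : k ≠ 0 := norm_pos_iff.1 (by linarith)
  simp only [hD, mem_ofPred_eq] at h2 h3 h4 h5
  refine ⟨hκ _ h1, h6, h2, h3, ?_, ?_, ?_, ?_⟩
  · rw [hEuler _ _ (mul_ne_zero hk0 hs0') h2, norm_mul (_ ^ m), norm_pow, norm_mul k, mul_pow]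
    calc (1 / 2) ^ m * (‖(m : ℂ) * h₀‖ / 2) * ‖s‖ ^ m
        = (1 / 2) ^ m * ‖s‖ ^ m * (‖(m : ℂ) * h₀‖ / 2) := by ring
      _ ≤ _ := by gcongr
  · rw [hEuler _ _ hs0' h3, norm_mul (_ ^ m), norm_pow]
    calc (1 / 2) ^ m * (‖(m : ℂ) * h₀‖ / 2) * ‖s‖ ^ m
        ≤ 1 * (‖(m : ℂ) * h₀‖ / 2) * ‖s‖ ^ m := by
          gcongr; exact pow_le_one₀ (by norm_num) (by norm_num)
      _ = ‖s‖ ^ m * (‖(m : ℂ) * h₀‖ / 2) := by ring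
      _ ≤ _ := by gcongr
  · rw [← hHF _ _ (mul_ne_zero hk0 hs0'), smul_eq_mul]
    have h9 : k ^ m * H (k * s, ω) - g = 0 := h7
    rw [mul_pow]
    linear_combination s ^ m * h9
  · rw [← hHF _ _ hs0', smul_eq_mul, ← mul_sub, norm_mul, norm_pow]
    have h9 : P (1, s, ω, g) = H (s, ω) - g := by simp [P]
    rw [h9] at h8
    calc ‖s‖ ^ m * ‖k - 1‖ ≤ ‖s‖ ^ m * (|C| * ‖H (s, ω) - g‖) := by
          gcongr; exact h8.trans (by gcongr; exact le_abs_self C)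
      _ = _ := by ring

end Tube

section Loops

variable {d : ℕ} {X : Fin d → (Fin (d + 1) → ℂ) → Fin (d + 1) → ℂ} {F : (Fin (d + 1) → ℂ) → ℂ}
  {Γ : Set (Fin (d + 1) → ℂ)} {r ε C c : ℝ} {m : ℕ} {h₀ : ℂ}
  {κ : ℂ × (Fin (d + 1) → ℂ) × ℂ → ℂ}

/-- The integrals of the coefficient forms over two nearby loops pushed radially to the same
level set of the first integral coincide. -/
lemma IsTube.integral_eq (h : IsTube F Γ r m h₀ ε C c κ)
    (hX : ∀ j x, ‖x‖ < r → AnalyticAt ℂ (X j) x)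
    (hc : ∀ i j x, ‖x‖ < r → VectorField.lieBracket ℂ (X i) (X j) x = 0)
    (hF : ∀ x, ‖x‖ < r → HasFDerivAt F (volForm X x) x) (i : Fin d)
    {s g c₀ : ℂ} (hc₀ : c₀ ≠ 0) (hs0 : 0 < ‖s‖) (hs : ‖s‖ < ε) (hg : ‖g - h₀‖ < ε)
    {γ a γ' a' : ℝ → Fin (d + 1) → ℂ}
    (hγ : ∀ t ∈ Ioo (-1 : ℝ) 2, AnalyticAt ℝ γ t ∧ HasDerivAt γ (c₀ • γ' t) t ∧ γ t ∈ Γ)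
    (ha : ∀ t ∈ Ioo (-1 : ℝ) 2, AnalyticAt ℝ a t ∧ HasDerivAt a (c₀ • a' t) t ∧
      ‖a t - γ t‖ < ε / 2)
    (hγ1 : γ 1 = γ 0) (ha1 : a 1 = a 0) :
    ∫ t in (0 : ℝ)..1, dualForm X i ((κ (s, γ t, g) * s) • γ t) ((κ (s, γ t, g) * s) • γ' t) =
      ∫ t in (0 : ℝ)..1, dualForm X i ((κ (s, a t, g) * s) • a t)
        ((κ (s, a t, g) * s) • a' t) := by
  let ω : ℝ × ℝ → Fin (d + 1) → ℂ := fun q => γ q.1 + q.2 • (a q.1 - γ q.1)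
  let p : ℝ × ℝ → Fin (d + 1) → ℂ := fun q => (κ (s, ω q, g) * s) • ω q
  set R : Set (ℝ × ℝ) := Ioo (-1 : ℝ) 2 ×ˢ Ioo (-1 : ℝ) 2 with hR
  have hRo : IsOpen R := isOpen_Ioo.prod isOpen_Ioo
  have hωΓ : ∀ q ∈ R, ω q ∈ thickening ε Γ := by
    rintro ⟨t, τ⟩ ⟨ht, hτ⟩
    refine mem_thickening_iff.2 ⟨γ t, (hγ t ht).2.2, ?_⟩
    rw [dist_eq_norm]
    have h1 : |τ| ≤ 2 := abs_le.2 ⟨by linarith [hτ.1], hτ.2.le⟩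
    calc ‖ω (t, τ) - γ t‖ = |τ| * ‖a t - γ t‖ := by simp [ω, norm_smul]
      _ ≤ 2 * ‖a t - γ t‖ := by gcongr
      _ < ε := by linarith [(ha t ht).2.2]
  have hωa : ∀ q ∈ R, AnalyticAt ℝ ω q := by
    rintro ⟨t, τ⟩ ⟨ht, hτ⟩
    have h1 : AnalyticAt ℝ (fun q : ℝ × ℝ => γ q.1) (t, τ) :=
      AnalyticAt.comp (g := γ) (f := Prod.fst) (hγ t ht).1 analyticAt_fst
    have h2 : AnalyticAt ℝ (fun q : ℝ × ℝ => a q.1) (t, τ) :=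
      AnalyticAt.comp (g := a) (f := Prod.fst) (ha t ht).1 analyticAt_fst
    exact h1.add (analyticAt_snd.fun_smul (h2.sub h1))
  have hka : ∀ {w : ℝ × ℝ → Fin (d + 1) → ℂ} {q}, AnalyticAt ℝ w q → w q ∈ thickening ε Γ →
      AnalyticAt ℝ (fun q => κ (s, w q, g)) q := by
    intro w q hw hq
    exact AnalyticAt.comp (g := κ) (f := fun q => (s, w q, g))
      (h.spec s (w q) g hs0 hs hq hg).1.restrictScalars
      (analyticAt_const.prod (hw.prod analyticAt_const))
  have hpa : ∀ q ∈ R, AnalyticAt ℝ p q := fun q hq =>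
    ((hka (hωa q hq) (hωΓ q hq)).mul analyticAt_const).fun_smul (hωa q hq)
  have hpr : ∀ q ∈ R, ‖p q‖ < r := fun q hq => (h.spec s (ω q) g hs0 hs (hωΓ q hq) hg).2.2.1
  have hpB : ∀ q ∈ R, eulerDet X (p q) ≠ 0 := by
    intro q hq
    have h1 := (h.spec s (ω q) g hs0 hs (hωΓ q hq) hg).2.2.2.2.1
    change c * ‖s‖ ^ m ≤ ‖fderiv ℂ F (p q) (p q)‖ at h1
    rw [(hF _ (hpr q hq)).fderiv] at h1
    have h2 : 0 < c * ‖s‖ ^ m := mul_pos h.lower_pos (pow_pos hs0 m)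
    exact norm_pos_iff.1 (h2.trans_le h1)
  have hleaf : ∀ q ∈ R, ∀ u, volForm X (p q) (fderiv ℝ p q u) = 0 := by
    intro q hq u
    have h1 := ((hF _ (hpr q hq)).restrictScalars ℝ).comp q
      (hpa q hq).differentiableAt.hasFDerivAt
    have h2 : F ∘ p =ᶠ[𝓝 q] fun _ => s ^ m * g := by
      filter_upwards [hRo.mem_nhds hq] with q' hq'
      exact (h.spec s (ω q') g hs0 hs (hωΓ q' hq') hg).2.2.2.2.2.2.1
    have h3 := h1.unique ((hasFDerivAt_const (𝕜 := ℝ) (s ^ m * g) q).congr_of_eventuallyEq h2)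
    exact DFunLike.congr_fun h3 u
  have hhom := integral_eq_of_homotopy (α := dualForm X i) (p := p) hpa
    (fun q hq => dualForm_analyticAt (fun j => hX j _ (hpr q hq)) (hpB q hq) i)
    (fun q hq u v => fderiv_dualForm_symm (fun j => hX j _ (hpr q hq)) (hpB q hq)
      (fun k l => hc k l _ (hpr q hq)) i (hleaf q hq u) (hleaf q hq v))
    (fun τ _ => by simp only [p, ω, hγ1, ha1])
  have hside : ∀ τ ∈ Ioo (-1 : ℝ) 2, ∀ b b' : ℝ → Fin (d + 1) → ℂ, (∀ t, ω (t, τ) = b t) →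
      (∀ t ∈ Ioo (-1 : ℝ) 2, HasDerivAt b (c₀ • b' t) t) → ∀ t ∈ Ioo (-1 : ℝ) 2,
      dualForm X i (p (t, τ)) (fderiv ℝ p (t, τ) (1, 0)) =
        c₀ * dualForm X i ((κ (s, b t, g) * s) • b t) ((κ (s, b t, g) * s) • b' t) := by
    intro τ hτ b b' hb hb' t ht
    have hq : (t, τ) ∈ R := ⟨ht, hτ⟩
    have h1 : HasDerivAt (fun t => p (t, τ)) (fderiv ℝ p (t, τ) (1, 0)) t :=
      HasFDerivAt.comp_hasDerivAt (f := fun t : ℝ => (t, τ)) t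
        (hpa _ hq).differentiableAt.hasFDerivAt ((hasDerivAt_id t).prodMk (hasDerivAt_const t τ))
    have h2 : DifferentiableAt ℝ (fun t => κ (s, ω (t, τ), g)) t :=
      DifferentiableAt.comp (g := fun q => κ (s, ω q, g)) (f := fun t : ℝ => (t, τ)) t
        (hka (hωa _ hq) (hωΓ _ hq)).differentiableAt (by fun_prop)
    have h3 : HasDerivAt (fun t => p (t, τ)) ((κ (s, b t, g) * s) • (c₀ • b' t) +
        (deriv (fun t => κ (s, ω (t, τ), g)) t * s) • b t) t := by
      have h4 := (h2.hasDerivAt.mul_const s).smul (hb' t ht)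
      simp only [hb] at h4
      simp only [p, hb]
      exact h4
    rw [h1.unique h3, map_add]
    have h5 : dualForm X i (p (t, τ)) (b t) = 0 := by
      have h6 := dualForm_self (X := X) (x := p (t, τ)) i
      conv_lhs at h6 => enter [2]; simp only [p]
      rw [map_smul, smul_eq_mul, hb] at h6
      refine (mul_eq_zero.1 h6).resolve_left (mul_ne_zero ?_ (norm_pos_iff.1 hs0))
      intro h7
      have h8 := (h.spec s (ω (t, τ)) g hs0 hs (hωΓ _ hq) hg).2.1
      rw [hb, h7] at h8
      norm_num at h8
    rw [map_smul _ _ (b t), h5, smul_zero, add_zero, smul_comm, map_smul, smul_eq_mul]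
    simp only [p, hb]
  have h01 : ∀ t ∈ uIcc (0 : ℝ) 1, t ∈ Ioo (-1 : ℝ) 2 := fun t ht => by
    rw [uIcc_of_le zero_le_one] at ht
    exact ⟨by linarith [ht.1], by linarith [ht.2]⟩
  rw [intervalIntegral.integral_congr (fun t ht => hside 0 (by norm_num) γ γ'
      (fun t => by simp [ω]) (fun t ht => (hγ t ht).2.1) t (h01 t ht)),
    intervalIntegral.integral_congr (fun t ht => hside 1 (by norm_num) a a'
      (fun t => by simp [ω]) (fun t ht => (ha t ht).2.1) t (h01 t ht)),
    intervalIntegral.integral_const_mul, intervalIntegral.integral_const_mul] at hhom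
  exact mul_left_cancel₀ hc₀ hhom

end Loops

section Bounds

open Asymptotics

variable {d : ℕ} {X : Fin d → (Fin (d + 1) → ℂ) → Fin (d + 1) → ℂ}
  {Z : (Fin (d + 1) → ℂ) → Fin (d + 1) → ℂ}

lemma dualForm_scale_bound (hX : ∀ j, AnalyticAt ℂ (X j) 0) (hZ : AnalyticAt ℂ Z 0) (i : Fin d) :
    ∃ C δ : ℝ, 0 ≤ C ∧ 0 < δ ∧ ∀ (k : ℂ) x, ‖k - 1‖ < δ → ‖x‖ < δ → eulerDet X (k • x) ≠ 0 →
      eulerDet X x ≠ 0 → ‖eulerDet X (k • x)‖ * ‖eulerDet X x‖ *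
        ‖k * dualForm X i (k • x) (Z x) - dualForm X i x (Z x)‖ ≤ C * ‖k - 1‖ := by
  let G : ℂ × (Fin (d + 1) → ℂ) → ℂ := fun q =>
    q.1 * dualNum X i (q.1 • q.2) (Z q.2) * eulerDet X q.2 -
      dualNum X i q.2 (Z q.2) * eulerDet X (q.1 • q.2)
  have hG : AnalyticAt ℂ G (1, 0) := by
    have h1 : AnalyticAt ℂ (fun q : ℂ × (Fin (d + 1) → ℂ) => q.1 • q.2) (1, 0) :=
      analyticAt_fst.fun_smul analyticAt_snd
    have h2 : AnalyticAt ℂ (fun q : ℂ × (Fin (d + 1) → ℂ) => q.2) (1, 0) := analyticAt_snd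
    have h3 : ∀ {G : Type} [NormedAddCommGroup G] [NormedSpace ℂ G] {f : (Fin (d + 1) → ℂ) → G},
        AnalyticAt ℂ f 0 → AnalyticAt ℂ (fun q : ℂ × (Fin (d + 1) → ℂ) => f (q.1 • q.2)) (1, 0) :=
      fun {G} _ _ {f} hf => AnalyticAt.comp (g := f) (by simpa using hf) h1
    have h4 : ∀ {G : Type} [NormedAddCommGroup G] [NormedSpace ℂ G] {f : (Fin (d + 1) → ℂ) → G},
        AnalyticAt ℂ f 0 → AnalyticAt ℂ (fun q : ℂ × (Fin (d + 1) → ℂ) => f q.2) (1, 0) :=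
      fun {G} _ _ {f} hf => AnalyticAt.comp (g := f) (by simpa using hf) h2
    exact ((analyticAt_fst.mul ((h3 (dualNum_analyticAt hX i)).clm_app (h4 hZ))).mul
      (h4 (eulerDet_analyticAt hX))).sub
      (((h4 (dualNum_analyticAt hX i)).clm_app (h4 hZ)).mul (h3 (eulerDet_analyticAt hX)))
  obtain ⟨K, T, hT, hLip⟩ := (hG.contDiffAt (n := 1)).exists_lipschitzOnWith
  obtain ⟨δ, hδ, hδT⟩ := Metric.mem_nhds_iff.1 hT
  refine ⟨K, δ, K.2, hδ, fun k x hk hx hBk hB => ?_⟩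
  have hm1 : (k, x) ∈ T := hδT (by
    rw [mem_ball, Prod.dist_eq]; exact max_lt (by simpa [dist_eq_norm] using hk)
        (by simpa using hx))
  have hm2 : ((1 : ℂ), x) ∈ T := hδT (by
    rw [mem_ball, Prod.dist_eq]; exact max_lt (by simpa using hδ) (by simpa using hx))
  have h1 := hLip.dist_le_mul _ hm1 _ hm2
  have h2 : G (1, x) = 0 := by simp [G]
  rw [dist_eq_norm, h2, sub_zero, Prod.dist_eq, dist_self, max_eq_left dist_nonneg,
    dist_eq_norm] at h1
  refine le_trans (le_of_eq ?_) h1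
  rw [← norm_mul, ← norm_mul]
  congr 1
  simp only [G, dualForm_apply]
  field_simp

lemma dualForm_along_bound (hX : ∀ j, AnalyticAt ℂ (X j) 0) (hZ : AnalyticAt ℂ Z 0) {N : ℕ}
    (hl : ∀ j, (fun x => VectorField.lieBracket ℂ (X j) Z x) =O[𝓝 0] fun x => ‖x‖ ^ (N + 1))
    (hv : (fun x => volForm X x (Z x)) =O[𝓝 0] fun x => ‖x‖ ^ (N + 1)) (i : Fin d) :
    ∃ C δ : ℝ, 0 ≤ C ∧ 0 < δ ∧ ∀ x, ‖x‖ < δ → eulerDet X x ≠ 0 → ‖eulerDet X x‖ ^ 2 *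
      ‖fderiv ℂ (fun y => dualForm X i y (Z y)) x (Z x)‖ ≤ C * ‖x‖ ^ (N + 1) := by
  have hb : ∀ {f : (Fin (d + 1) → ℂ) → ℂ}, AnalyticAt ℂ f 0 →
      f =O[𝓝 0] fun _ => (1 : ℝ) := fun hf => hf.continuousAt.norm.isBoundedUnder_le.isBigO_one ℝ
  have hn : ∀ i, (fun x => ‖dualNum X i x‖) =O[𝓝 0] fun _ => (1 : ℝ) := fun i =>
    ((dualNum_analyticAt hX i).continuousAt.norm.isBoundedUnder_le.isBigO_one ℝ).norm_left
  have h1 : (fun x => ∑ j, dualNum X j x (Z x) *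
      dualNum X i x (VectorField.lieBracket ℂ (X j) Z x) +
        volForm X x (Z x) * dualNum X i x (fderiv ℂ Z x x - Z x)) =O[𝓝 0]
      fun x => ‖x‖ ^ (N + 1) := by
    refine IsBigO.add (IsBigO.fun_sum fun j _ => ?_) ?_
    · have h2 : (fun x => dualNum X i x (VectorField.lieBracket ℂ (X j) Z x)) =O[𝓝 0]
          fun x => (1 : ℝ) * ‖x‖ ^ (N + 1) := by
        refine IsBigO.trans (IsBigO.of_bound 1 (Eventually.of_forall fun x => ?_))
          ((hn i).mul (hl j).norm_left)
        rw [one_mul, norm_mul, norm_norm, norm_norm]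
        exact (dualNum X i x).le_opNorm _
      simpa only [one_mul] using (hb ((dualNum_analyticAt hX j).clm_app hZ)).mul h2
    · have h3 : AnalyticAt ℂ (fun x => dualNum X i x (fderiv ℂ Z x x - Z x)) 0 :=
        (dualNum_analyticAt hX i).clm_app ((hZ.fderiv.clm_app analyticAt_id).sub hZ)
      simpa only [mul_one] using hv.mul (hb h3)
  obtain ⟨C, δ, hC, hδ, hCδ⟩ := isBigO_norm_pow_iff.1 h1
  obtain ⟨δ', hδ', hXZ⟩ := Metric.eventually_nhds_iff_ball.1
    ((eventually_all.2 fun j => (hX j).eventually_analyticAt).and hZ.eventually_analyticAt)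
  refine ⟨C, min δ δ', hC.le, lt_min hδ hδ', fun x hx hB => ?_⟩
  obtain ⟨hXx, hZx⟩ := hXZ x (mem_ball_zero_iff.2 (hx.trans_le (min_le_right _ _)))
  rw [fderiv_dualForm_along hXx hB hZx, norm_mul, norm_pow, norm_inv, ← mul_assoc, ← mul_pow,
    mul_inv_cancel₀ (norm_ne_zero_iff.2 hB), one_pow, one_mul]
  exact hCδ x (hx.trans_le (min_le_left _ _))

end Bounds

section Estimates

variable {d : ℕ} {X : Fin d → (Fin (d + 1) → ℂ) → Fin (d + 1) → ℂ} {F : (Fin (d + 1) → ℂ) → ℂ}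
  {Γ : Set (Fin (d + 1) → ℂ)} {r ε C c : ℝ} {m N : ℕ} {h₀ : ℂ}
  {κ : ℂ × (Fin (d + 1) → ℂ) × ℂ → ℂ} {S : (Fin (d + 1) → ℂ) →L[ℂ] Fin (d + 1) → ℂ}
  {Z u : (Fin (d + 1) → ℂ) → Fin (d + 1) → ℂ} {v y : Fin (d + 1) → ℂ}

/-- Commuting analytic vector fields on a ball with a first integral given by the volume. -/
structure IsIntegrableOnBall (X : Fin d → (Fin (d + 1) → ℂ) → Fin (d + 1) → ℂ)
    (F : (Fin (d + 1) → ℂ) → ℂ) (r : ℝ) : Prop where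
  pos : 0 < r
  analytic : ∀ j x, ‖x‖ < r → AnalyticAt ℂ (X j) x
  commute : ∀ i j x, ‖x‖ < r → VectorField.lieBracket ℂ (X i) (X j) x = 0
  integral : ∀ x, ‖x‖ < r → HasFDerivAt F (volForm X x) x

/-- A linearizable vector field commuting with the family `X` up to order `N`. -/
structure IsApproximant (X : Fin d → (Fin (d + 1) → ℂ) → Fin (d + 1) → ℂ)
    (S : (Fin (d + 1) → ℂ) →L[ℂ] Fin (d + 1) → ℂ) (N : ℕ)
    (Z u : (Fin (d + 1) → ℂ) → Fin (d + 1) → ℂ) : Prop extends LinearizedBy S Z u where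
  bracket : ∀ j, (fun x => VectorField.lieBracket ℂ (X j) Z x) =O[𝓝 0] fun x => ‖x‖ ^ (N + 1)
  tangent : (fun x => volForm X x (Z x)) =O[𝓝 0] fun x => ‖x‖ ^ (N + 1)

/-- A closed orbit of `2πi Z` through `s • y`. -/
structure IsOrbit (S : (Fin (d + 1) → ℂ) →L[ℂ] Fin (d + 1) → ℂ)
    (Z : (Fin (d + 1) → ℂ) → Fin (d + 1) → ℂ) (y : Fin (d + 1) → ℂ) (C : ℝ) (s : ℂ)
    (a : ℝ → Fin (d + 1) → ℂ) : Prop where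
  zero : a 0 = s • y
  one : a 1 = s • y
  spec : ∀ t ∈ Ioo (-1 : ℝ) 2, AnalyticAt ℝ a t ∧
    HasDerivAt a ((2 * Real.pi * Complex.I : ℂ) • Z (a t)) t ∧
    ‖a t - s • flowExp S t y‖ ≤ C * ‖s‖ ^ 2

lemma LinearizedBy.exists_isOrbit (h : LinearizedBy S Z u) (hS : flowExp S 1 = 1)
    (y : Fin (d + 1) → ℂ) :
    ∃ (o : ℂ → ℝ → Fin (d + 1) → ℂ) (C A : ℝ), 0 ≤ C ∧ 0 ≤ A ∧
      ∀ᶠ s in 𝓝 (0 : ℂ), IsOrbit S Z y C s (o s) ∧ ∀ t ∈ Ioo (-1 : ℝ) 2, ‖o s t‖ ≤ A * ‖s‖ := by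
  obtain ⟨o, C, hC, ho⟩ := h.exists_orbit hS y
  obtain ⟨M, hM⟩ := (isCompact_Icc (a := (-1 : ℝ)) (b := 2)).exists_bound_of_continuousOn
    (f := fun t : ℝ => flowExp S t y)
    (((flowExp_continuous.comp Complex.continuous_ofReal).clm_apply continuous_const).continuousOn)
  have hM0 : 0 ≤ M := (norm_nonneg _).trans (hM 0 (by norm_num))
  refine ⟨o, C, C + M, hC, by positivity, ?_⟩
  filter_upwards [ho, ball_mem_nhds (0 : ℂ) one_pos] with s ⟨h1, h2, h3⟩ hs
  rw [mem_ball, dist_zero_right] at hs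
  refine ⟨⟨h1, h2, h3⟩, fun t ht => ?_⟩
  have h4 := (h3 t ht).2.2
  calc ‖o s t‖ = ‖(o s t - s • flowExp S t y) + s • flowExp S t y‖ := by simp
    _ ≤ C * ‖s‖ ^ 2 + ‖s‖ * M := by
      refine (norm_add_le _ _).trans (add_le_add h4 ?_)
      rw [norm_smul]
      gcongr
      exact hM t (Ioo_subset_Icc_self ht)
    _ ≤ (C + M) * ‖s‖ := by
      have : C * ‖s‖ ^ 2 ≤ C * ‖s‖ := by
        gcongr
        nlinarith [norm_nonneg s]
      linarith

lemma Icc_subset_Ioo_neg_one_two {t : ℝ} (ht : t ∈ Icc (0 : ℝ) 1) : t ∈ Ioo (-1 : ℝ) 2 :=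
  ⟨by linarith [ht.1], by linarith [ht.2]⟩

lemma IsOrbit.norm_sub_le {s : ℂ} {a : ℝ → Fin (d + 1) → ℂ} (h : IsOrbit S Z y C s a)
    {f : (Fin (d + 1) → ℂ) → ℂ} {f' : (Fin (d + 1) → ℂ) → (Fin (d + 1) → ℂ) →L[ℂ] ℂ} {K : ℝ}
    (hf : ∀ t ∈ Icc (0 : ℝ) 1, HasFDerivAt f (f' (a t)) (a t))
    (hK : ∀ t ∈ Icc (0 : ℝ) 1, ‖f' (a t) (Z (a t))‖ ≤ K) {t : ℝ} (ht : t ∈ Icc (0 : ℝ) 1) :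
    ‖f (a t) - f (s • y)‖ ≤ 2 * Real.pi * K := by
  have h1 : ∀ t ∈ Icc (0 : ℝ) 1, HasDerivWithinAt (fun t => f (a t))
      (f' (a t) ((2 * Real.pi * Complex.I : ℂ) • Z (a t))) (Icc 0 1) t := fun t ht =>
    (((hf t ht).restrictScalars ℝ).comp_hasDerivAt t
      (h.spec t (Icc_subset_Ioo_neg_one_two ht)).2.1).hasDerivWithinAt
  have h2 := norm_image_sub_le_of_norm_deriv_le_segment' (C := 2 * Real.pi * K) h1
    (fun t ht => by
      rw [map_smul, norm_smul]
      have : ‖(2 * Real.pi * Complex.I : ℂ)‖ = 2 * Real.pi := by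
        simp [abs_of_pos Real.pi_pos]
      rw [this]
      exact mul_le_mul_of_nonneg_left (hK t (Ico_subset_Icc_self ht)) (by positivity)) t ht
  rw [h.zero] at h2
  have hK0 : 0 ≤ 2 * Real.pi * K :=
    mul_nonneg (by positivity) ((norm_nonneg _).trans (hK t ht))
  exact h2.trans (mul_le_of_le_one_right hK0 (by linarith [ht.2]))

/-- A first integral is almost constant along the closed orbits of an approximant. -/
lemma IsIntegrableOnBall.orbit_bound (hI : IsIntegrableOnBall X F r)
    (hv : (fun x => volForm X x (Z x)) =O[𝓝 0] fun x => ‖x‖ ^ (N + 1))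
    {o : ℂ → ℝ → Fin (d + 1) → ℂ} {A : ℝ} (hA : 0 ≤ A)
    (ho : ∀ᶠ s in 𝓝 (0 : ℂ), IsOrbit S Z y C s (o s) ∧
      ∀ t ∈ Ioo (-1 : ℝ) 2, ‖o s t‖ ≤ A * ‖s‖) :
    ∃ K : ℝ, 0 ≤ K ∧ ∀ᶠ s in 𝓝 (0 : ℂ), ∀ t ∈ Icc (0 : ℝ) 1,
      ‖F (o s t) - F (s • y)‖ ≤ K * ‖s‖ ^ (N + 1) := by
  obtain ⟨K, ρ, hK, hρ, hb⟩ := isBigO_norm_pow_iff.1 hv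
  have hsm : ∀ᶠ s in 𝓝 (0 : ℂ), A * ‖s‖ < min ρ r :=
    ContinuousAt.eventually_lt (f := fun s : ℂ => A * ‖s‖) (by fun_prop) (by fun_prop)
      (by simpa using ⟨hρ, hI.pos⟩)
  refine ⟨2 * Real.pi * (K * A ^ (N + 1)), by positivity, ?_⟩
  filter_upwards [ho, hsm] with s ⟨h1, h2⟩ h3 t ht
  have h4 : ∀ t ∈ Icc (0 : ℝ) 1, ‖o s t‖ ≤ A * ‖s‖ := fun t ht =>
    h2 t (Icc_subset_Ioo_neg_one_two ht)
  have h5 := h1.norm_sub_le (f := F) (f' := volForm X) (K := K * A ^ (N + 1) * ‖s‖ ^ (N + 1))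
    (fun t ht => hI.integral _ ((h4 t ht).trans_lt (h3.trans_le (min_le_right _ _))))
    (fun t ht => by
      refine (hb _ ((h4 t ht).trans_lt (h3.trans_le (min_le_left _ _)))).trans ?_
      rw [mul_assoc, ← mul_pow]
      gcongr
      exact h4 t ht) ht
  refine h5.trans_eq (by ring)


lemma orbit_near (hε : 0 < ε) {C : ℝ}
    (hy : ∀ t ∈ Ioo (-1 : ℝ) 2, ‖flowExp S t y - flowExp S t v‖ ≤ ε / 4)
    {o : ℂ → ℝ → Fin (d + 1) → ℂ} {A : ℝ}
    (ho : ∀ᶠ s in 𝓝 (0 : ℂ), IsOrbit S Z y C s (o s) ∧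
      ∀ t ∈ Ioo (-1 : ℝ) 2, ‖o s t‖ ≤ A * ‖s‖) :
    ∀ᶠ s in 𝓝[≠] (0 : ℂ), ∀ t ∈ Ioo (-1 : ℝ) 2, ‖s⁻¹ • o s t - flowExp S t v‖ < ε / 2 := by
  have hsm : ∀ᶠ s in 𝓝 (0 : ℂ), C * ‖s‖ < ε / 4 :=
    ContinuousAt.eventually_lt (f := fun s : ℂ => C * ‖s‖) (by fun_prop) (by fun_prop)
      (by simpa using hε)
  filter_upwards [ho.filter_mono nhdsWithin_le_nhds, hsm.filter_mono nhdsWithin_le_nhds,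
    self_mem_nhdsWithin] with s ⟨h1, h2⟩ h3 hs t ht
  have hs0 : s ≠ 0 := hs
  have hs1 : 0 < ‖s‖ := norm_pos_iff.2 hs0
  have h4 : ‖s⁻¹ • o s t - flowExp S t y‖ ≤ C * ‖s‖ := by
    have h5 : s⁻¹ • o s t - flowExp S t y = s⁻¹ • (o s t - s • flowExp S t y) := by
      rw [smul_sub, inv_smul_smul₀ hs0]
    rw [h5, norm_smul, norm_inv, inv_mul_le_iff₀ hs1]
    refine (h1.spec t ht).2.2.trans_eq (by ring)
  have h5 := norm_sub_le_norm_sub_add_norm_sub (s⁻¹ • o s t) (flowExp S t y) (flowExp S t v)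
  linarith [hy t ht]

lemma mem_thickening_of_norm_sub_lt {t : ℝ} {w : Fin (d + 1) → ℂ} (hε : 0 < ε)
    (hΓ : flowExp S t v ∈ Γ) (hw : ‖w - flowExp S t v‖ < ε / 2) : w ∈ thickening ε Γ :=
  mem_thickening_iff.2 ⟨_, hΓ, by rw [dist_eq_norm]; linarith⟩

/-- The value of the coefficient forms along an approximant is almost constant on its orbits,
after pushing radially to a level set of the first integral. -/
lemma IsTube.dualForm_estimate (h : IsTube F Γ r m h₀ ε C c κ) (hI : IsIntegrableOnBall X F r)
    (hZ : IsApproximant X S N Z u) (hmN : m ≤ N) {Co A : ℝ} (hA : 0 ≤ A)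
    (hΓ : ∀ t ∈ Ioo (-1 : ℝ) 2, flowExp S t v ∈ Γ)
    {o : ℂ → ℝ → Fin (d + 1) → ℂ}
    (ho : ∀ᶠ s in 𝓝 (0 : ℂ), IsOrbit S Z y Co s (o s) ∧
      ∀ t ∈ Ioo (-1 : ℝ) 2, ‖o s t‖ ≤ A * ‖s‖)
    (hn : ∀ᶠ s in 𝓝[≠] (0 : ℂ), ∀ t ∈ Ioo (-1 : ℝ) 2,
      ‖s⁻¹ • o s t - flowExp S t v‖ < ε / 2)
    {g : ℂ → ℂ} (hg : ∀ᶠ s in 𝓝[≠] (0 : ℂ), s ^ m * g s = F (s • y) ∧ ‖g s - h₀‖ < ε)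
    (i : Fin d) :
    ∃ K : ℝ, ∀ᶠ s in 𝓝[≠] (0 : ℂ), ∀ t ∈ Icc (0 : ℝ) 1, ‖s‖ ^ (3 * m) *
      ‖κ (s, s⁻¹ • o s t, g s) * dualForm X i (κ (s, s⁻¹ • o s t, g s) • o s t) (Z (o s t)) -
        dualForm X i (s • y) (Z (s • y))‖ ≤ K * ‖s‖ ^ (N + 1) := by
  have hX0 : ∀ j, AnalyticAt ℂ (X j) 0 := fun j => hI.analytic j 0 (by simpa using hI.pos)
  obtain ⟨K, hK, hFb⟩ := hI.orbit_bound hZ.tangent hA ho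
  obtain ⟨C₁, δ₁, hC₁, hδ₁, hb₁⟩ := dualForm_scale_bound hX0 hZ.field i
  obtain ⟨C₂, δ₂, hC₂, hδ₂, hb₂⟩ := dualForm_along_bound hX0 hZ.field hZ.bracket hZ.tangent i
  obtain ⟨ρ, hρ, hZρ⟩ := Metric.eventually_nhds_iff_ball.1 hZ.field.eventually_analyticAt
  have hsm : ∀ᶠ s in 𝓝 (0 : ℂ), A * ‖s‖ < min (min δ₁ δ₂) ρ :=
    ContinuousAt.eventually_lt (f := fun s : ℂ => A * ‖s‖) (by fun_prop) (by fun_prop)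
      (by simpa using ⟨⟨hδ₁, hδ₂⟩, hρ⟩)
  have hsm2 : ∀ᶠ s in 𝓝 (0 : ℂ), C * K * ‖s‖ < δ₁ :=
    ContinuousAt.eventually_lt (f := fun s : ℂ => C * K * ‖s‖) (by fun_prop) (by fun_prop)
      (by simpa using hδ₁)
  have hc := h.lower_pos
  have hC := h.upper_nonneg
  refine ⟨(C₁ * (C * K) + 2 * Real.pi * (C₂ * A ^ (N + 1))) / c ^ 2, ?_⟩
  filter_upwards [ho.filter_mono nhdsWithin_le_nhds, hFb.filter_mono nhdsWithin_le_nhds,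
    hsm.filter_mono nhdsWithin_le_nhds, hsm2.filter_mono nhdsWithin_le_nhds, hn, hg,
    nhdsWithin_le_nhds (ball_mem_nhds (0 : ℂ) (lt_min h.pos one_pos)),
    self_mem_nhdsWithin] with s ⟨h1, h2⟩ h3 h4 h5 h6 ⟨h7, h8⟩ h9 hs
  have hs0 : s ≠ 0 := hs
  have hs1 : 0 < ‖s‖ := norm_pos_iff.2 hs0
  rw [mem_ball, dist_zero_right] at h9
  have hsε : ‖s‖ < ε := h9.trans_le (min_le_left _ _)
  have hsle : ‖s‖ ≤ 1 := (h9.trans_le (min_le_right _ _)).le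
  have hcs : 0 < c * ‖s‖ ^ m := mul_pos hc (pow_pos hs1 m)
  have hot : ∀ t ∈ Icc (0 : ℝ) 1, ‖o s t‖ < min (min δ₁ δ₂) ρ := fun t ht =>
    (h2 t (Icc_subset_Ioo_neg_one_two ht)).trans_lt h4
  have hspec : ∀ t ∈ Icc (0 : ℝ) 1, ‖κ (s, s⁻¹ • o s t, g s) - 1‖ ≤ C * K * ‖s‖ ∧
      c * ‖s‖ ^ m ≤ ‖eulerDet X (κ (s, s⁻¹ • o s t, g s) • o s t)‖ ∧
      c * ‖s‖ ^ m ≤ ‖eulerDet X (o s t)‖ ∧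
      ‖s‖ ^ m * ‖κ (s, s⁻¹ • o s t, g s) - 1‖ ≤ C * K * ‖s‖ ^ (N + 1) ∧ ‖o s t‖ < r := by
    intro t ht
    have ht' := Icc_subset_Ioo_neg_one_two ht
    obtain ⟨-, -, e1, e2, e3, e4, -, e5⟩ := h.spec s (s⁻¹ • o s t) (g s) hs1 hsε
      (mem_thickening_of_norm_sub_lt h.pos (hΓ t ht') (h6 t ht')) h8
    rw [mul_smul, smul_inv_smul₀ hs0] at e1 e3
    rw [smul_inv_smul₀ hs0] at e2 e4 e5
    rw [(hI.integral _ e1).fderiv] at e3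
    rw [(hI.integral _ e2).fderiv] at e4
    have e6 : ‖s‖ ^ m * ‖κ (s, s⁻¹ • o s t, g s) - 1‖ ≤ C * K * ‖s‖ ^ (N + 1) := by
      refine e5.trans ?_
      rw [h7, mul_assoc]
      exact mul_le_mul_of_nonneg_left (h3 t ht) hC
    refine ⟨?_, e3, e4, e6, e2⟩
    refine le_of_mul_le_mul_left (e6.trans ?_) (pow_pos hs1 m)
    calc C * K * ‖s‖ ^ (N + 1) ≤ C * K * ‖s‖ ^ (m + 1) := by
          have := pow_le_pow_of_le_one hs1.le hsle (show m + 1 ≤ N + 1 by omega)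
          gcongr
      _ = _ := by ring
  have hE : ∀ t ∈ Icc (0 : ℝ) 1, eulerDet X (o s t) ≠ 0 := fun t ht =>
    norm_pos_iff.1 (hcs.trans_le (hspec t ht).2.2.1)
  intro t ht
  obtain ⟨e1, e2, e3, e4, e5⟩ := hspec t ht
  set k := κ (s, s⁻¹ • o s t, g s) with hk
  have f1 : c ^ 2 * ‖s‖ ^ (3 * m) * ‖k * dualForm X i (k • o s t) (Z (o s t)) -
      dualForm X i (o s t) (Z (o s t))‖ ≤ C₁ * (C * K) * ‖s‖ ^ (N + 1) := by
    have q := hb₁ k (o s t) (e1.trans_lt h5)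
      ((hot t ht).trans_le ((min_le_left _ _).trans (min_le_left _ _)))
      (norm_pos_iff.1 (hcs.trans_le e2)) (hE t ht)
    calc _ = ‖s‖ ^ m * ((c * ‖s‖ ^ m) * (c * ‖s‖ ^ m) *
          ‖k * dualForm X i (k • o s t) (Z (o s t)) - dualForm X i (o s t) (Z (o s t))‖) := by ring
      _ ≤ ‖s‖ ^ m * (C₁ * ‖k - 1‖) := by
        refine mul_le_mul_of_nonneg_left (le_trans ?_ q) (by positivity)
        gcongr
      _ = C₁ * (‖s‖ ^ m * ‖k - 1‖) := by ring
      _ ≤ C₁ * (C * K * ‖s‖ ^ (N + 1)) := by gcongr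
      _ = _ := by ring
  have f2 : ‖dualForm X i (o s t) (Z (o s t)) - dualForm X i (s • y) (Z (s • y))‖ ≤
      2 * Real.pi * (C₂ * A ^ (N + 1) * ‖s‖ ^ (N + 1) / (c * ‖s‖ ^ m) ^ 2) := by
    refine h1.norm_sub_le (f := fun x => dualForm X i x (Z x))
      (f' := fun x => fderiv ℂ (fun x => dualForm X i x (Z x)) x) (fun t ht => ?_)
      (fun t ht => ?_) ht
    · refine (((dualForm_analyticAt (fun j => hI.analytic j _ (hspec t ht).2.2.2.2)
        (hE t ht) i).clm_app (hZρ _ ?_)).differentiableAt).hasFDerivAt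
      rw [mem_ball, dist_zero_right]
      exact (hot t ht).trans_le (min_le_right _ _)
    · have q := hb₂ (o s t) ((hot t ht).trans_le ((min_le_left _ _).trans (min_le_right _ _)))
        (hE t ht)
      rw [le_div_iff₀ (by positivity), mul_comm]
      calc _ ≤ ‖eulerDet X (o s t)‖ ^ 2 * _ := by
            gcongr
            exact (hspec t ht).2.2.1
        _ ≤ _ := q
        _ ≤ C₂ * (A * ‖s‖) ^ (N + 1) := by
            gcongr
            exact h2 t (Icc_subset_Ioo_neg_one_two ht)
        _ = _ := by rw [mul_pow]; ring
  have f3 : c ^ 2 * ‖s‖ ^ (3 * m) *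
      ‖dualForm X i (o s t) (Z (o s t)) - dualForm X i (s • y) (Z (s • y))‖ ≤
      2 * Real.pi * (C₂ * A ^ (N + 1)) * ‖s‖ ^ (N + 1) := by
    calc _ ≤ c ^ 2 * ‖s‖ ^ (3 * m) *
          (2 * Real.pi * (C₂ * A ^ (N + 1) * ‖s‖ ^ (N + 1) / (c * ‖s‖ ^ m) ^ 2)) := by gcongr
      _ = ‖s‖ ^ m * (2 * Real.pi * (C₂ * A ^ (N + 1)) * ‖s‖ ^ (N + 1)) := by
        have : ‖s‖ ^ (3 * m) = ‖s‖ ^ m * (‖s‖ ^ m) ^ 2 := by ring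
        rw [this]
        field_simp
      _ ≤ _ := mul_le_of_le_one_left (by positivity) (pow_le_one₀ hs1.le hsle)
  rw [div_mul_eq_mul_div, le_div_iff₀ (by positivity)]
  have f4 := norm_sub_le_norm_sub_add_norm_sub (k * dualForm X i (k • o s t) (Z (o s t)))
    (dualForm X i (o s t) (Z (o s t))) (dualForm X i (s • y) (Z (s • y)))
  have f5 := mul_le_mul_of_nonneg_left f4 (show 0 ≤ c ^ 2 * ‖s‖ ^ (3 * m) by positivity)
  rw [mul_add] at f5
  linarith

end Estimates

section LoopCoeff

variable {d : ℕ} {X : Fin d → (Fin (d + 1) → ℂ) → Fin (d + 1) → ℂ} {F : (Fin (d + 1) → ℂ) → ℂ}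
  {Γ : Set (Fin (d + 1) → ℂ)} {r ε C c : ℝ} {m N : ℕ} {h₀ : ℂ}
  {κ : ℂ × (Fin (d + 1) → ℂ) × ℂ → ℂ} {S : (Fin (d + 1) → ℂ) →L[ℂ] Fin (d + 1) → ℂ}
  {Z u : (Fin (d + 1) → ℂ) → Fin (d + 1) → ℂ} {v y : Fin (d + 1) → ℂ}

/-- The period of the `i`-th coefficient form over the loop `t ↦ exp(2πitS) v`, rescaled by `s`
and pushed radially to the level `s ^ m * g`. -/
noncomputable def loopCoeff (X : Fin d → (Fin (d + 1) → ℂ) → Fin (d + 1) → ℂ)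
    (κ : ℂ × (Fin (d + 1) → ℂ) × ℂ → ℂ) (S : (Fin (d + 1) → ℂ) →L[ℂ] Fin (d + 1) → ℂ)
    (v : Fin (d + 1) → ℂ) (i : Fin d) (s g : ℂ) : ℂ :=
  ∫ t in (0 : ℝ)..1, dualForm X i ((κ (s, flowExp S t v, g) * s) • flowExp S t v)
    ((κ (s, flowExp S t v, g) * s) • S (flowExp S t v))

lemma IsTube.loopCoeff_estimate (h : IsTube F Γ r m h₀ ε C c κ) (hI : IsIntegrableOnBall X F r)
    (hZ : IsApproximant X S N Z u) (hS : flowExp S 1 = 1) (hmN : m ≤ N) {Co A : ℝ} (hA : 0 ≤ A)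
    (hΓ : ∀ t ∈ Ioo (-1 : ℝ) 2, flowExp S t v ∈ Γ)
    {o : ℂ → ℝ → Fin (d + 1) → ℂ}
    (ho : ∀ᶠ s in 𝓝 (0 : ℂ), IsOrbit S Z y Co s (o s) ∧
      ∀ t ∈ Ioo (-1 : ℝ) 2, ‖o s t‖ ≤ A * ‖s‖)
    (hn : ∀ᶠ s in 𝓝[≠] (0 : ℂ), ∀ t ∈ Ioo (-1 : ℝ) 2,
      ‖s⁻¹ • o s t - flowExp S t v‖ < ε / 2)
    {g : ℂ → ℂ} (hg : ∀ᶠ s in 𝓝[≠] (0 : ℂ), s ^ m * g s = F (s • y) ∧ ‖g s - h₀‖ < ε)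
    (i : Fin d) :
    ∃ K : ℝ, ∀ᶠ s in 𝓝[≠] (0 : ℂ), ‖s‖ ^ (3 * m) *
      ‖loopCoeff X κ S v i s (g s) - dualForm X i (s • y) (Z (s • y))‖ ≤ K * ‖s‖ ^ (N + 1) := by
  obtain ⟨K, hK⟩ := h.dualForm_estimate hI hZ hmN hA hΓ ho hn hg i
  obtain ⟨ρ, hρ, hZρ⟩ := Metric.eventually_nhds_iff_ball.1 hZ.field.eventually_analyticAt
  have hsm : ∀ᶠ s in 𝓝 (0 : ℂ), A * ‖s‖ < ρ :=
    ContinuousAt.eventually_lt (f := fun s : ℂ => A * ‖s‖) (by fun_prop) (by fun_prop)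
      (by simpa using hρ)
  have hpi : (2 * Real.pi * Complex.I : ℂ) ≠ 0 := by simp [Real.pi_ne_zero]
  refine ⟨K, ?_⟩
  filter_upwards [hK, ho.filter_mono nhdsWithin_le_nhds, hsm.filter_mono nhdsWithin_le_nhds, hn,
    hg, nhdsWithin_le_nhds (ball_mem_nhds (0 : ℂ) h.pos), self_mem_nhdsWithin] with
    s hKs ⟨h1, h2⟩ h3 h4 ⟨h5, h6⟩ h7 hs
  rw [mem_ball, dist_zero_right] at h7
  have hs0 : s ≠ 0 := hs
  have hs1 : 0 < ‖s‖ := norm_pos_iff.2 hs0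
  have hγ : ∀ t ∈ Ioo (-1 : ℝ) 2, AnalyticAt ℝ (fun t : ℝ => flowExp S t v) t := by
    intro t _
    have e1 : AnalyticAt ℝ (fun t : ℝ => (t : ℂ)) t := Complex.ofRealCLM.analyticAt t
    exact AnalyticAt.comp (g := fun z : ℂ => flowExp S z v) (f := fun t : ℝ => (t : ℂ))
      (((flowExp_analyticAt (S := S) (t : ℂ)).clm_app analyticAt_const).restrictScalars) e1
  have hkey := h.integral_eq (X := X) hI.analytic hI.commute hI.integral i
      (c₀ := 2 * Real.pi * Complex.I)
    hpi hs1 h7 h6 (γ := fun t : ℝ => flowExp S t v) (γ' := fun t => S (flowExp S t v))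
    (a := fun t => s⁻¹ • o s t) (a' := fun t => s⁻¹ • Z (o s t))
    (fun t ht => ⟨hγ t ht, flowExp_hasDerivAt_apply v t, hΓ t ht⟩)
    (fun t ht => ⟨analyticAt_const.fun_smul (h1.spec t ht).1, by
      rw [smul_comm]; exact (h1.spec t ht).2.1.const_smul s⁻¹, h4 t ht⟩)
    (by simp [hS, flowExp_zero]) (by simp only [h1.zero, h1.one])
  have hsm : ∀ (k : ℂ) (w : Fin (d + 1) → ℂ), (k * s) • s⁻¹ • w = k • w := fun k w => by
    rw [mul_smul, smul_inv_smul₀ hs0]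
  simp only [hsm] at hkey
  simp only [map_smul] at hkey
  have hcont : ContinuousOn (fun t : ℝ => κ (s, s⁻¹ • o s t, g s) *
      dualForm X i (κ (s, s⁻¹ • o s t, g s) • o s t) (Z (o s t))) (Icc 0 1) := by
    intro t ht
    have ht' := Icc_subset_Ioo_neg_one_two ht
    obtain ⟨e0, -, e1, e2, e3, -⟩ := h.spec s (s⁻¹ • o s t) (g s) hs1 h7
      (mem_thickening_of_norm_sub_lt h.pos (hΓ t ht') (h4 t ht')) h6
    rw [hsm] at e1 e3
    rw [(hI.integral _ e1).fderiv] at e3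
    have e4 : eulerDet X (κ (s, s⁻¹ • o s t, g s) • o s t) ≠ 0 :=
      norm_pos_iff.1 ((mul_pos h.lower_pos (pow_pos hs1 m)).trans_le e3)
    have e5 : ContinuousAt (o s) t := (h1.spec t ht').1.continuousAt
    have e6 : ContinuousAt (fun t => κ (s, s⁻¹ • o s t, g s)) t :=
      ContinuousAt.comp (g := κ) (f := fun t => (s, s⁻¹ • o s t, g s)) e0.continuousAt
        (continuousAt_const.prodMk ((show ContinuousAt (fun t => s⁻¹ • o s t) t by fun_prop).prodMk
          continuousAt_const))
    have e7 : ContinuousAt (fun t => dualForm X i (κ (s, s⁻¹ • o s t, g s) • o s t)) t :=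
      ContinuousAt.comp (g := dualForm X i) (f := fun t => κ (s, s⁻¹ • o s t, g s) • o s t)
        (dualForm_analyticAt (fun j => hI.analytic j _ e1) e4 i).continuousAt (e6.smul e5)
    have e8 : ContinuousAt (fun t => Z (o s t)) t :=
      ContinuousAt.comp (g := Z) (f := o s) (hZρ _ (by
        rw [mem_ball, dist_zero_right]; exact (h2 t ht').trans_lt h3)).continuousAt e5
    exact (e6.mul (e7.clm_apply e8)).continuousWithinAt
  have hLC : loopCoeff X κ S v i s (g s) - dualForm X i (s • y) (Z (s • y)) =
      ∫ t in (0 : ℝ)..1, (κ (s, s⁻¹ • o s t, g s) *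
        dualForm X i (κ (s, s⁻¹ • o s t, g s) • o s t) (Z (o s t)) -
          dualForm X i (s • y) (Z (s • y))) := by
    rw [intervalIntegral.integral_sub (hcont.intervalIntegrable_of_Icc zero_le_one)
      intervalIntegrable_const]
    simp only [intervalIntegral.integral_const, sub_zero, one_smul, sub_left_inj]
    refine Eq.trans ?_ (hkey.trans ?_)
    · simp only [loopCoeff, map_smul]
    · simp only [smul_eq_mul]
  rw [hLC]
  have hfin := intervalIntegral.norm_integral_le_of_norm_le_const (a := (0 : ℝ)) (b := 1)
    (f := fun t => κ (s, s⁻¹ • o s t, g s) *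
        dualForm X i (κ (s, s⁻¹ • o s t, g s) • o s t) (Z (o s t)) -
          dualForm X i (s • y) (Z (s • y))) (C := K * ‖s‖ ^ (N + 1) / ‖s‖ ^ (3 * m))
    (fun t ht => by
      rw [uIoc_of_le zero_le_one] at ht
      rw [le_div_iff₀ (by positivity), mul_comm]
      exact hKs t (Ioc_subset_Icc_self ht))
  rw [sub_zero, abs_one, mul_one, le_div_iff₀ (by positivity), mul_comm] at hfin
  exact hfin

/-- The vector field reconstructed from loop periods agrees with every approximant along the
complex ray through `y`, up to high order. -/
theorem IsTube.reconstruct_estimate (h : IsTube F Γ r m h₀ ε C c κ)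
    (hI : IsIntegrableOnBall X F r)
    (hZ : IsApproximant X S N Z u) (hS : flowExp S 1 = 1) (hmN : m ≤ N)
    (hΓ : ∀ t ∈ Ioo (-1 : ℝ) 2, flowExp S t v ∈ Γ)
    (hy : ∀ t ∈ Ioo (-1 : ℝ) 2, ‖flowExp S t y - flowExp S t v‖ ≤ ε / 4)
    {g : ℂ → ℂ} (hg : ∀ᶠ s in 𝓝[≠] (0 : ℂ), s ^ m * g s = F (s • y) ∧ ‖g s - h₀‖ < ε) :
    ∃ K : ℝ, ∀ᶠ s in 𝓝[≠] (0 : ℂ), ‖s‖ ^ (3 * m) *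
      ‖∑ i, loopCoeff X κ S v i s (g s) • X i (s • y) - Z (s • y)‖ ≤ K * ‖s‖ ^ (N + 1) := by
  obtain ⟨o, Co, A, hCo, hA, ho⟩ := hZ.toLinearizedBy.exists_isOrbit hS y
  have hn := orbit_near h.pos hy ho
  choose K hK using fun i => h.loopCoeff_estimate hI hZ hS hmN hA hΓ ho hn hg i
  have hX0 : ∀ j, AnalyticAt ℂ (X j) 0 := fun j => hI.analytic j 0 (by simpa using hI.pos)
  have hXb : ∀ j, ∃ M, ∀ᶠ s in 𝓝 (0 : ℂ), ‖X j (s • y)‖ ≤ M := fun j => by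
    have h1 : ContinuousAt (fun s : ℂ => ‖X j (s • y)‖) 0 :=
      (ContinuousAt.comp (g := X j) (f := fun s : ℂ => s • y)
        (by simpa using (hX0 j).continuousAt) (by fun_prop)).norm
    exact ⟨_, (h1.eventually_lt continuousAt_const (lt_add_one _)).mono fun _ => le_of_lt⟩
  choose M hM using hXb
  obtain ⟨C₁, δ, hC₁, hδ, hb⟩ := isBigO_norm_pow_iff.1 hZ.tangent
  have hsm : ∀ᶠ s in 𝓝 (0 : ℂ), ‖s • y‖ < δ :=
    ContinuousAt.eventually_lt (f := fun s : ℂ => ‖s • y‖) (by fun_prop) (by fun_prop)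
      (by simpa using hδ)
  have hyΓ : y ∈ thickening ε Γ := by
    refine mem_thickening_iff.2 ⟨_, hΓ 0 (by norm_num), ?_⟩
    have := hy 0 (by norm_num)
    simp only [Complex.ofReal_zero, flowExp_zero, one_apply_eq_self] at this ⊢
    rw [dist_eq_norm]
    linarith [h.pos]
  have hc := h.lower_pos
  refine ⟨∑ i, K i * M i + C₁ * ‖y‖ ^ (N + 1) / c * ‖y‖, ?_⟩
  filter_upwards [eventually_all.2 hK, (eventually_all.2 hM).filter_mono nhdsWithin_le_nhds,
    hsm.filter_mono nhdsWithin_le_nhds, hg,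
    nhdsWithin_le_nhds (ball_mem_nhds (0 : ℂ) (lt_min h.pos one_pos)),
    self_mem_nhdsWithin] with s h1 h2 h3 ⟨_, h4⟩ h5 hs
  rw [mem_ball, dist_zero_right] at h5
  have hs0 : s ≠ 0 := hs
  have hs1 : 0 < ‖s‖ := norm_pos_iff.2 hs0
  have hsle : ‖s‖ ≤ 1 := (h5.trans_le (min_le_right _ _)).le
  obtain ⟨-, -, -, e1, -, e2, -⟩ := h.spec s y (g s) hs1 (h5.trans_le (min_le_left _ _)) hyΓ h4
  rw [(hI.integral _ e1).fderiv] at e2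
  have hE : eulerDet X (s • y) ≠ 0 :=
    norm_pos_iff.1 ((mul_pos hc (pow_pos hs1 m)).trans_le e2)
  have hexp := dualForm_expansion hE (Z (s • y))
  have hdiff : ∑ i, loopCoeff X κ S v i s (g s) • X i (s • y) - Z (s • y) =
      ∑ i, (loopCoeff X κ S v i s (g s) - dualForm X i (s • y) (Z (s • y))) • X i (s • y) -
        ((eulerDet X (s • y))⁻¹ * volForm X (s • y) (Z (s • y))) • s • y := by
    conv_lhs => rw [hexp]
    simp only [sub_smul, Finset.sum_sub_distrib]
    abel
  have hB : ‖s‖ ^ (3 * m) *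
      ‖((eulerDet X (s • y))⁻¹ * volForm X (s • y) (Z (s • y))) • s • y‖ ≤
      C₁ * ‖y‖ ^ (N + 1) / c * ‖y‖ * ‖s‖ ^ (N + 1) := by
    have e3 : ‖(eulerDet X (s • y))⁻¹‖ ≤ (c * ‖s‖ ^ m)⁻¹ := by
      rw [norm_inv]
      exact inv_anti₀ (by positivity) e2
    have e4 := hb _ h3
    rw [norm_smul, norm_mul, norm_smul]
    calc _ ≤ ‖s‖ ^ (3 * m) * ((c * ‖s‖ ^ m)⁻¹ * (C₁ * ‖s • y‖ ^ (N + 1)) * (1 * ‖y‖)) := by gcongr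
      _ = ‖s‖ ^ (2 * m) * (C₁ * ‖y‖ ^ (N + 1) / c * ‖y‖ * ‖s‖ ^ (N + 1)) := by
        rw [norm_smul, mul_pow, show ‖s‖ ^ (3 * m) = ‖s‖ ^ (2 * m) * ‖s‖ ^ m by ring]
        field_simp
      _ ≤ _ := mul_le_of_le_one_left (by positivity) (pow_le_one₀ hs1.le hsle)
  rw [hdiff, add_mul, Finset.sum_mul]
  refine (mul_le_mul_of_nonneg_left (norm_sub_le _ _) (by positivity)).trans ?_
  rw [mul_add]
  refine add_le_add ((mul_le_mul_of_nonneg_left (norm_sum_le _ _) (by positivity)).trans ?_) hB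
  rw [Finset.mul_sum]
  refine Finset.sum_le_sum fun i _ => ?_
  rw [norm_smul, ← mul_assoc]
  calc _ ≤ (K i * ‖s‖ ^ (N + 1)) * M i := by
        refine mul_le_mul (h1 i) (h2 i) (norm_nonneg _) ?_
        exact le_trans (by positivity) (h1 i)
    _ = _ := by ring

end LoopCoeff

section Reconstruction

variable {d : ℕ} {X : Fin d → (Fin (d + 1) → ℂ) → Fin (d + 1) → ℂ} {F : (Fin (d + 1) → ℂ) → ℂ}
  {Γ : Set (Fin (d + 1) → ℂ)} {r ε C c : ℝ} {m N : ℕ} {h₀ : ℂ}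
  {κ : ℂ × (Fin (d + 1) → ℂ) × ℂ → ℂ} {S : (Fin (d + 1) → ℂ) →L[ℂ] Fin (d + 1) → ℂ}
  {Z u : (Fin (d + 1) → ℂ) → Fin (d + 1) → ℂ} {v y : Fin (d + 1) → ℂ}

/-- A germ that vanishes at the origin without vanishing identically has a nonzero leading
homogeneous part, of positive degree. -/
lemma exists_leading_part {E : Type*} [NormedAddCommGroup E] [NormedSpace ℂ E] {F : E → ℂ}
    {p : FormalMultilinearSeries ℂ E ℂ} (hp : HasFPowerSeriesAt F p 0) (h0 : F 0 = 0)
    (hne : ¬ ∀ᶠ x in 𝓝 0, F x = 0) :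
    ∃ m v, m ≠ 0 ∧ (p m fun _ => v) ≠ 0 ∧ F =O[𝓝 0] fun x => ‖x‖ ^ m := by
  classical
  have hex : ∃ m, ∃ v, (p m fun _ => v) ≠ 0 := by
    by_contra! hcon
    refine hne ?_
    filter_upwards [hp.eventually_hasSum] with x hx
    simp only [hcon, zero_add] at hx
    exact hx.unique hasSum_zero
  obtain ⟨v, hv⟩ := Nat.find_spec hex
  refine ⟨Nat.find hex, v, fun h => ?_, hv, ?_⟩
  · rw [h] at hv
    exact hv (by rw [hp.coeff_zero]; exact h0)
  · have h1 := hp.isBigO_sub_partialSum_pow (Nat.find hex)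
    refine h1.congr_left fun y => ?_
    rw [zero_add, FormalMultilinearSeries.partialSum, Finset.sum_eq_zero, sub_zero]
    intro k hk
    have := Nat.find_min hex (Finset.mem_range.1 hk)
    push Not at this
    exact this y

lemma IsIntegrableOnBall.analyticOnNhd (hI : IsIntegrableOnBall X F r) :
    AnalyticOnNhd ℂ F (ball 0 r) :=
  analyticOnNhd_of_hasFDerivAt isOpen_ball fun a ha => hI.integral a (by simpa using ha)

lemma flowExp_add_one (hS : flowExp S 1 = 1) (t : ℂ) : flowExp S (t + 1) = flowExp S t := by
  rw [flowExp_add, hS, mul_one]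

/-- The leading part of the first integral is constant along the linear flow. -/
lemma IsIntegrableOnBall.leading_part_flow (hI : IsIntegrableOnBall X F r)
    (hZ : IsApproximant X S m Z u) (hS : flowExp S 1 = 1)
    {H : ℂ × (Fin (d + 1) → ℂ) → ℂ} (hH : AnalyticOnNhd ℂ H {q | ‖q.1 • q.2‖ < r})
    (hHF : ∀ s y, s ≠ 0 → s ^ m • H (s, y) = F (s • y)) (v : Fin (d + 1) → ℂ) :
    ∀ t ∈ Icc (-1 : ℝ) 2, H (0, flowExp S t v) = H (0, v) := by
  have key : ∀ t ∈ Icc (0 : ℝ) 1, H (0, flowExp S t v) = H (0, v) := by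
    intro t ht
    have ht' := Icc_subset_Ioo_neg_one_two ht
    obtain ⟨o, Co, A, hCo, hA, ho⟩ := hZ.toLinearizedBy.exists_isOrbit hS v
    obtain ⟨K, hK, hb⟩ := hI.orbit_bound hZ.tangent hA ho
    have hlim : Tendsto (fun s : ℂ => s⁻¹ • o s t) (𝓝[≠] 0) (𝓝 (flowExp S t v)) := by
      rw [tendsto_iff_norm_sub_tendsto_zero]
      have h0 : Tendsto (fun s : ℂ => Co * ‖s‖) (𝓝[≠] 0) (𝓝 0) := by
        have : ContinuousAt (fun s : ℂ => Co * ‖s‖) 0 := by fun_prop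
        simpa using this.tendsto.mono_left nhdsWithin_le_nhds
      refine squeeze_zero' (Eventually.of_forall fun _ => norm_nonneg _) ?_ h0
      filter_upwards [ho.filter_mono nhdsWithin_le_nhds, self_mem_nhdsWithin] with s ⟨h1, _⟩ hs
      have hs0 : s ≠ 0 := hs
      have h5 : s⁻¹ • o s t - flowExp S t v = s⁻¹ • (o s t - s • flowExp S t v) := by
        rw [smul_sub, inv_smul_smul₀ hs0]
      rw [h5, norm_smul, norm_inv, inv_mul_le_iff₀ (norm_pos_iff.2 hs0)]
      exact (h1.spec t ht').2.2.trans_eq (by ring)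
    have hid : Tendsto (fun s : ℂ => s) (𝓝[≠] 0) (𝓝 0) := nhdsWithin_le_nhds
    have hH1 : Tendsto (fun s : ℂ => H (s, s⁻¹ • o s t)) (𝓝[≠] 0) (𝓝 (H (0, flowExp S t v))) :=
      (hH (0, flowExp S t v) (by simpa using hI.pos)).continuousAt.tendsto.comp
        (hid.prodMk_nhds hlim)
    have hH2 : Tendsto (fun s : ℂ => H (s, v)) (𝓝[≠] 0) (𝓝 (H (0, v))) :=
      (hH (0, v) (by simpa using hI.pos)).continuousAt.tendsto.comp
        (hid.prodMk_nhds tendsto_const_nhds)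
    have hz : Tendsto (fun s : ℂ => H (s, s⁻¹ • o s t) - H (s, v)) (𝓝[≠] 0) (𝓝 0) := by
      have h0 : Tendsto (fun s : ℂ => K * ‖s‖) (𝓝[≠] 0) (𝓝 0) := by
        have : ContinuousAt (fun s : ℂ => K * ‖s‖) 0 := by fun_prop
        simpa using this.tendsto.mono_left nhdsWithin_le_nhds
      refine squeeze_zero_norm' ?_ h0
      filter_upwards [hb.filter_mono nhdsWithin_le_nhds, self_mem_nhdsWithin] with s h1 hs
      have hs0 : s ≠ 0 := hs
      have h2 := h1 t ht
      have h3 := hHF s (s⁻¹ • o s t) hs0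
      rw [smul_inv_smul₀ hs0] at h3
      rw [← h3, ← hHF s v hs0, ← smul_sub, norm_smul, norm_pow, pow_succ, ← mul_assoc,
        mul_comm K, mul_assoc] at h2
      exact le_of_mul_le_mul_left h2 (pow_pos (norm_pos_iff.2 hs0) m)
    exact sub_eq_zero.1 (tendsto_nhds_unique (hH1.sub hH2) hz)
  intro t ht
  rcases lt_or_ge t 0 with h | h
  · have := key (t + 1) ⟨by linarith [ht.1], by linarith⟩
    push_cast at this
    rwa [flowExp_add_one hS] at this
  rcases le_or_gt t 1 with h' | h'
  · exact key t ⟨h, h'⟩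
  · have := key (t - 1) ⟨by linarith, by linarith [ht.2]⟩
    rw [← flowExp_add_one hS] at this
    simpa using this

lemma IsTube.loopCoeff_analyticAt (h : IsTube F Γ r m h₀ ε C c κ)
    (hI : IsIntegrableOnBall X F r) (hΓ : ∀ t ∈ Icc (0 : ℝ) 1, flowExp S t v ∈ Γ) (i : Fin d)
    {s g : ℂ} (hs : 0 < ‖s‖) (hsε : ‖s‖ < ε) (hg : ‖g - h₀‖ < ε) :
    AnalyticAt ℂ (fun q : ℂ × ℂ => loopCoeff X κ S v i q.1 q.2) (s, g) := by
  set V : Set (ℂ × ℂ) := {q | 0 < ‖q.1‖ ∧ ‖q.1‖ < ε ∧ ‖q.2 - h₀‖ < ε} with hV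
  have hVo : IsOpen V :=
    (isOpen_lt (f := fun _ : ℂ × ℂ => (0 : ℝ)) (g := fun q => ‖q.1‖) (by fun_prop)
      (by fun_prop)).inter
      ((isOpen_lt (f := fun q : ℂ × ℂ => ‖q.1‖) (g := fun _ => ε) (by fun_prop)
        (by fun_prop)).inter
        (isOpen_lt (f := fun q : ℂ × ℂ => ‖q.2 - h₀‖) (g := fun _ => ε) (by fun_prop)
          (by fun_prop)))
  have hspec : ∀ q ∈ V, ∀ t ∈ Icc (0 : ℝ) 1, AnalyticAt ℂ κ (q.1, flowExp S t v, q.2) ∧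
      ∀ᵉ (x : _) (_ : x = (κ (q.1, flowExp S t v, q.2) * q.1) • flowExp S t v),
        AnalyticAt ℂ (dualForm X i) x := by
    rintro q ⟨h1, h2, h3⟩ t ht
    obtain ⟨e0, -, e1, -, e3, -⟩ := h.spec q.1 (flowExp S t v) q.2 h1 h2
      (self_subset_thickening h.pos _ (hΓ t ht)) h3
    refine ⟨e0, fun x hx => ?_⟩
    rw [(hI.integral _ e1).fderiv] at e3
    rw [hx]
    exact dualForm_analyticAt (fun j => hI.analytic j _ e1)
      (norm_pos_iff.1 ((mul_pos h.lower_pos (pow_pos h1 m)).trans_le e3)) i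
  refine analyticOnNhd_integral (V := V) (g := fun (q : ℂ × ℂ) (t : ℝ) =>
    dualForm X i ((κ (q.1, flowExp S t v, q.2) * q.1) • flowExp S t v)
    ((κ (q.1, flowExp S t v, q.2) * q.1) • S (flowExp S t v))) hVo ?_ ?_ (s, g) ⟨hs, hsε, hg⟩
  · rintro ⟨q, t⟩ ⟨hq, ht⟩
    obtain ⟨e0, e1⟩ := hspec q hq t ht
    have hf : Continuous fun p : (ℂ × ℂ) × ℝ => flowExp S p.2 v :=
      (flowExp_continuous.comp (Complex.continuous_ofReal.comp continuous_snd)).clm_apply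
        continuous_const
    have hk : ContinuousAt (fun p : (ℂ × ℂ) × ℝ => κ (p.1.1, flowExp S p.2 v, p.1.2)) (q, t) :=
      ContinuousAt.comp (g := κ) (f := fun p : (ℂ × ℂ) × ℝ => (p.1.1, flowExp S p.2 v, p.1.2))
        e0.continuousAt ((show Continuous fun p : (ℂ × ℂ) × ℝ =>
          (p.1.1, flowExp S p.2 v, p.1.2) by fun_prop).continuousAt)
    have hks := hk.mul (show Continuous fun p : (ℂ × ℂ) × ℝ => p.1.1 by fun_prop).continuousAt
    refine ContinuousAt.continuousWithinAt (ContinuousAt.clm_apply ?_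
      (hks.smul (S.continuous.comp hf).continuousAt))
    exact ContinuousAt.comp (g := dualForm X i)
      (f := fun p : (ℂ × ℂ) × ℝ => (κ (p.1.1, flowExp S p.2 v, p.1.2) * p.1.1) • flowExp S p.2 v)
      (e1 _ rfl).continuousAt (hks.smul hf.continuousAt)
  · intro t ht q hq
    obtain ⟨e0, e1⟩ := hspec q hq t ht
    have hk : AnalyticAt ℂ (fun p : ℂ × ℂ => κ (p.1, flowExp S t v, p.2)) q :=
      AnalyticAt.comp (g := κ) (f := fun p : ℂ × ℂ => (p.1, flowExp S t v, p.2)) e0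
        (analyticAt_fst.prod (analyticAt_const.prod analyticAt_snd))
    have hks := hk.mul analyticAt_fst
    refine AnalyticAt.clm_app ?_ (hks.fun_smul analyticAt_const)
    exact AnalyticAt.comp (g := dualForm X i)
      (f := fun p : ℂ × ℂ => (κ (p.1, flowExp S t v, p.2) * p.1) • flowExp S t v)
      (e1 _ rfl) (hks.fun_smul analyticAt_const)

/-- On a punctured conic neighbourhood of some ray, all approximants are asymptotic to a single
analytic vector field. -/
theorem IsIntegrableOnBall.exists_reconstruction (hI : IsIntegrableOnBall X F r) (hF0 : F 0 = 0)
    (hne : ¬ ∀ᶠ x in 𝓝 0, F x = 0) (hS : flowExp S 1 = 1)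
    (hZ : ∀ N, ∃ Z u, IsApproximant X S N Z u) :
    ∃ (m : ℕ) (v : Fin (d + 1) → ℂ) (ε : ℝ) (W : ℂ × (Fin (d + 1) → ℂ) → Fin (d + 1) → ℂ),
      0 < ε ∧ (∀ s y, 0 < ‖s‖ → ‖s‖ < ε → ‖y - v‖ < ε → AnalyticAt ℂ W (s, y)) ∧
      ∀ N Z u, m ≤ N → IsApproximant X S N Z u → ∀ y, ‖y - v‖ < ε →
        ∃ K : ℝ, ∀ᶠ s in 𝓝[≠] (0 : ℂ),
          ‖s‖ ^ (3 * m) * ‖W (s, y) - Z (s • y)‖ ≤ K * ‖s‖ ^ (N + 1) := by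
  have hFa := hI.analyticOnNhd
  obtain ⟨p, hp⟩ := hFa 0 (by simpa using hI.pos)
  obtain ⟨m, v, hm, hv, hO⟩ := exists_leading_part hp hF0 hne
  obtain ⟨H, hH, hHF, hH0⟩ := exists_factor hp hFa hO
  obtain ⟨Z₀, u₀, hZ₀⟩ := hZ m
  have hflow := hI.leading_part_flow hZ₀ hS hH hHF v
  have hcγ : Continuous fun t : ℝ => flowExp S t v :=
    (flowExp_continuous.comp Complex.continuous_ofReal).clm_apply continuous_const
  set Γ : Set (Fin (d + 1) → ℂ) := (fun t : ℝ => flowExp S t v) '' Icc (-1) 2 with hΓd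
  have hΓc : IsCompact Γ := isCompact_Icc.image hcγ
  have hΓ : ∀ t ∈ Icc (-1 : ℝ) 2, flowExp S t v ∈ Γ := fun t ht => mem_image_of_mem _ ht
  obtain ⟨ε, C, c, κ, hT⟩ := exists_tube hI.pos hm hH hHF hΓc (h₀ := H (0, v))
    (by rw [hH0]; exact hv) (by rintro _ ⟨t, ht, rfl⟩; exact hflow t ht)
    fun x hx => (hI.integral x hx).differentiableAt
  obtain ⟨M, hM⟩ := (isCompact_Icc (a := (-1 : ℝ)) (b := 2)).exists_bound_of_continuousOn
    (f := fun t : ℝ => flowExp S t)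
    (flowExp_continuous.comp Complex.continuous_ofReal).continuousOn
  have hM0 : 0 ≤ M := (norm_nonneg _).trans (hM 0 (by norm_num))
  have hD : IsOpen {q : ℂ × (Fin (d + 1) → ℂ) | ‖q.1 • q.2‖ < r} :=
    isOpen_lt (by fun_prop) continuous_const
  have hvD : ((0 : ℂ), v) ∈ {q : ℂ × (Fin (d + 1) → ℂ) | ‖q.1 • q.2‖ < r} := by
    simpa using hI.pos
  have hev : ∀ᶠ q in 𝓝 ((0 : ℂ), v), ‖q.1 • q.2‖ < r ∧ ‖H q - H (0, v)‖ < ε :=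
    (show ∀ᶠ q in 𝓝 ((0 : ℂ), v), ‖q.1 • q.2‖ < r from hD.mem_nhds hvD).and
        ((hH _ hvD).continuousAt.sub continuousAt_const |>.norm.eventually_lt
      continuousAt_const (by simpa using hT.pos))
  obtain ⟨ρ, hρ, hball⟩ := Metric.eventually_nhds_iff_ball.1 hev
  have hMy : 0 < ε / 4 / (M + 1) := by have := hT.pos; positivity
  refine ⟨m, v, min (min ρ ε) (ε / 4 / (M + 1)),
    fun q => ∑ i, loopCoeff X κ S v i q.1 (H q) • X i (q.1 • q.2),
    lt_min (lt_min hρ hT.pos) hMy, ?_, ?_⟩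
  · intro s y hs0 hs hy
    have hq := hball (s, y) (by
      rw [mem_ball, Prod.dist_eq, dist_zero_right, dist_eq_norm]
      exact max_lt (hs.trans_le ((min_le_left _ _).trans (min_le_left _ _)))
        (hy.trans_le ((min_le_left _ _).trans (min_le_left _ _))))
    refine Finset.analyticAt_fun_sum _ fun i _ => AnalyticAt.fun_smul ?_ ?_
    · exact AnalyticAt.comp (g := fun q : ℂ × ℂ => loopCoeff X κ S v i q.1 q.2)
        (f := fun q : ℂ × (Fin (d + 1) → ℂ) => (q.1, H q))
        (hT.loopCoeff_analyticAt hI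
          (fun t ht => hΓ t (Ioo_subset_Icc_self (Icc_subset_Ioo_neg_one_two ht))) i hs0
          (hs.trans_le ((min_le_left _ _).trans (min_le_right _ _))) hq.2)
        (analyticAt_fst.prod (hH _ hq.1))
    · exact AnalyticAt.comp (g := X i) (f := fun q : ℂ × (Fin (d + 1) → ℂ) => q.1 • q.2)
        (hI.analytic i _ hq.1) (analyticAt_fst.fun_smul analyticAt_snd)
  · intro N Z u hmN hZu y hy
    refine hT.reconstruct_estimate hI hZu hS hmN (fun t ht => hΓ t (Ioo_subset_Icc_self ht))
      (fun t ht => ?_) (g := fun s => H (s, y)) ?_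
    · rw [← map_sub]
      refine (ContinuousLinearMap.le_opNorm _ _).trans ?_
      calc _ ≤ (M + 1) * (ε / 4 / (M + 1)) := by
            gcongr
            · exact (hM t (Ioo_subset_Icc_self ht)).trans (by linarith)
            · exact (hy.trans_le (min_le_right _ _)).le
        _ = ε / 4 := by field_simp
    · filter_upwards [nhdsWithin_le_nhds (ball_mem_nhds (0 : ℂ) hρ), self_mem_nhdsWithin]
        with s hs hs0
      refine ⟨hHF s y hs0, (hball (s, y) ?_).2⟩
      rw [mem_ball, Prod.dist_eq]
      exact max_lt hs (by
        rw [dist_eq_norm]; exact hy.trans_le ((min_le_left _ _).trans (min_le_left _ _)))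

end Reconstruction

section RayLimit

variable {E F : Type*} [NormedAddCommGroup E] [NormedSpace ℂ E] [NormedAddCommGroup F]
  [NormedSpace ℂ F]

/-- Cauchy estimates for the Taylor coefficients of a function asymptotic, at a puncture, to a
holomorphic function. -/
lemma norm_coeff_le_of_asymptotic [CompleteSpace F] {a f : ℂ → F} {ρ ε M K : ℝ} (hρ : 0 < ρ)
    (hρε : ρ < ε)
    (ha : ∀ s, 0 < ‖s‖ → ‖s‖ < ε → DifferentiableAt ℂ a s) (hM : ∀ s, ‖s‖ = ρ → ‖a s‖ ≤ M)
    {q : FormalMultilinearSeries ℂ ℂ F} (hq : HasFPowerSeriesAt f q 0) {J : ℕ}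
    (h : ∀ᶠ s in 𝓝[≠] (0 : ℂ), ‖a s - f s‖ ≤ K * ‖s‖ ^ (J + 1)) :
    ‖q J fun _ => 1‖ ≤ M * ρ⁻¹ ^ J := by
  set b := Function.update a 0 (f 0) with hb
  have hba : ∀ s, s ≠ 0 → b s = a s := fun s hs => Function.update_of_ne hs _ _
  have htend : Tendsto a (𝓝[≠] 0) (𝓝 (f 0)) := by
    have h0 : Tendsto (fun s : ℂ => K * ‖s‖ ^ (J + 1)) (𝓝[≠] 0) (𝓝 0) := by
      have : ContinuousAt (fun s : ℂ => K * ‖s‖ ^ (J + 1)) 0 := by fun_prop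
      simpa using this.tendsto.mono_left nhdsWithin_le_nhds
    have h1 := squeeze_zero_norm' h h0
    have h2 := h1.add (hq.continuousAt.tendsto.mono_left (nhdsWithin_le_nhds (s := {0}ᶜ)))
    simpa using h2
  have hbc : ContinuousAt b 0 := continuousAt_update_same.2 htend
  have hbd : DifferentiableOn ℂ b (ball 0 ε) := by
    refine (Complex.differentiableOn_compl_singleton_and_continuousAt_iff
      (ball_mem_nhds 0 (hρ.trans hρε))).1 ⟨fun s hs => ?_, hbc⟩
    have hs0 : s ≠ 0 := hs.2
    have h1 := ha s (norm_pos_iff.2 hs0) (by simpa using hs.1)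
    refine (h1.congr_of_eventuallyEq ?_).differentiableWithinAt
    filter_upwards [eventually_ne_nhds hs0] with w hw using hba w hw
  have hps := (hbd.mono (closedBall_subset_ball
    (show ((⟨ρ, hρ.le⟩ : NNReal) : ℝ) < ε from hρε))).hasFPowerSeriesOnBall
    (R := ⟨ρ, hρ.le⟩) hρ
  have hsub := (hps.hasFPowerSeriesAt.sub hq)
  have hO : (b - f) =O[𝓝 0] fun x => ‖x‖ ^ (J + 1) := by
    refine Asymptotics.IsBigO.of_bound K ?_
    rw [eventually_nhdsWithin_iff] at h
    filter_upwards [h] with s hs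
    rw [norm_pow, norm_norm]
    by_cases hs0 : s = 0
    · simp [hs0, hb]
    · rw [Pi.sub_apply, hba s hs0]
      exact hs hs0
  have h2 := coeff_eq_zero_of_isBigO hsub hO J (lt_add_one J) 1
  rw [FormalMultilinearSeries.sub_apply, sub_apply, sub_eq_zero] at h2
  rw [← h2]
  refine (ContinuousMultilinearMap.le_opNorm _ _).trans ?_
  simp only [norm_one, Finset.prod_const_one, mul_one]
  refine (norm_cauchyPowerSeries_le _ _ _ _).trans ?_
  change (2 * Real.pi)⁻¹ * (∫ θ in (0 : ℝ)..2 * Real.pi, ‖b (circleMap 0 ρ θ)‖) * |ρ|⁻¹ ^ J ≤ _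
  rw [abs_of_pos hρ]
  gcongr
  have h3 : ∀ θ, ‖b (circleMap 0 ρ θ)‖ ≤ M := fun θ => by
    have : ‖circleMap 0 ρ θ‖ = ρ := by simp [abs_of_pos hρ]
    rw [hba _ (by rw [← norm_pos_iff, this]; exact hρ)]
    exact hM _ this
  have h4 := intervalIntegral.norm_integral_le_of_norm_le_const (a := 0) (b := 2 * Real.pi)
    (f := fun θ => ‖b (circleMap 0 ρ θ)‖) (C := M) fun θ _ => by rw [norm_norm]; exact h3 θ
  rw [sub_zero, abs_of_pos Real.two_pi_pos] at h4
  rw [inv_mul_le_iff₀ Real.two_pi_pos]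
  exact (Real.le_norm_self _).trans (h4.trans_eq (mul_comm _ _))

/-- A homogeneous polynomial is controlled by its values on an arbitrary ball. -/
lemma norm_homogeneous_le (q : ContinuousMultilinearMap ℂ (fun _ : Fin j => E) F) {v : E}
    {δ B : ℝ} (hδ : 0 < δ) (hB : ∀ y, ‖y - v‖ ≤ δ → ‖q fun _ => y‖ ≤ B) (y : E) :
    ‖q fun _ => y‖ ≤ B * (δ⁻¹ * ‖y‖) ^ j := by
  have hsm : ∀ (c : ℂ) (y : E), (q fun _ => c • y) = c ^ j • q fun _ => y := fun c y => by
    rw [q.map_smul_univ (fun _ => c) (fun _ => y)]; simp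
  have key : ∀ y : E, ‖y‖ ≤ 1 → ‖q fun _ => y‖ ≤ B * δ⁻¹ ^ j := by
    intro y hy
    have hd : DiffContOnCl ℂ (fun w : ℂ => q fun _ => y + w • v) (ball 0 δ⁻¹) := by
      refine Differentiable.diffContOnCl fun w => ?_
      refine (q.analyticAt.comp (f := fun w : ℂ => fun _ : Fin j => y + w • v)
        (AnalyticAt.pi fun _ => ?_)).differentiableAt
      exact analyticAt_const.add (analyticAt_id.fun_smul analyticAt_const)
    have h1 := Complex.norm_le_of_forall_mem_frontier_norm_le isBounded_ball hd
      (C := B * δ⁻¹ ^ j) (fun w hw => ?_) (z := 0) (subset_closure (by simpa using hδ))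
    · simpa using h1
    · rw [frontier_ball 0 (by positivity), mem_sphere_zero_iff_norm] at hw
      have hw0 : w ≠ 0 := norm_pos_iff.1 (by rw [hw]; positivity)
      have h2 : y + w • v = w • (v + w⁻¹ • y) := by
        rw [smul_add, smul_inv_smul₀ hw0, add_comm]
      rw [h2, hsm, norm_smul, norm_pow, hw, mul_comm]
      gcongr
      refine hB _ ?_
      rw [add_sub_cancel_left, norm_smul, norm_inv, hw, inv_inv]
      exact mul_le_of_le_one_right hδ.le hy
  by_cases hy : y = 0
  · have h1 := key 0 (by simp)
    rw [hy]
    rcases Nat.eq_zero_or_pos j with hj | hj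
    · subst hj; simpa using h1
    · have : (q fun _ => (0 : E)) = 0 := q.map_coord_zero (⟨0, hj⟩ : Fin j) rfl
      rw [this]
      simp [hj.ne']
  · have hy0 : 0 < ‖y‖ := norm_pos_iff.2 hy
    have h1 := key ((‖y‖⁻¹ : ℂ) • y) (by
      rw [norm_smul]; simp [hy0.ne'])
    rw [hsm, norm_smul, norm_pow] at h1
    simp only [norm_inv, Complex.norm_real, norm_norm] at h1
    rw [inv_pow, inv_mul_le_iff₀ (by positivity)] at h1
    refine h1.trans_eq ?_
    rw [mul_pow]; ring

/-- Germs asymptotic to a common function on a punctured conic neighbourhood of a ray, to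
increasing orders, converge formally to an analytic germ. -/
theorem exists_common_limit [FiniteDimensional ℂ E] [CompleteSpace F] {W : ℂ × E → F} {v : E}
    {ε : ℝ} (hε : 0 < ε)
    (hW : ∀ s y, 0 < ‖s‖ → ‖s‖ < ε → ‖y - v‖ < ε → AnalyticAt ℂ W (s, y))
    {Z : ℕ → E → F} (hZ : ∀ J, AnalyticAt ℂ (Z J) 0)
    (hWZ : ∀ J y, ‖y - v‖ < ε → ∃ K : ℝ, ∀ᶠ s in 𝓝[≠] (0 : ℂ),
      ‖W (s, y) - Z J (s • y)‖ ≤ K * ‖s‖ ^ (J + 1)) :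
    ∃ Z' : E → F, AnalyticAt ℂ Z' 0 ∧
      ∀ J, (fun x => Z' x - Z J x) =O[𝓝 0] fun x => ‖x‖ ^ (J + 1) := by
  have : ProperSpace E := FiniteDimensional.proper ℂ E
  choose p hp using hZ
  have hpy : ∀ J y, HasFPowerSeriesAt (fun s : ℂ => Z J (s • y))
      ((p J).compContinuousLinearMap ((ContinuousLinearMap.id ℂ ℂ).smulRight y)) 0 := fun J y =>
    HasFPowerSeriesAt.compContinuousLinearMap (u := (ContinuousLinearMap.id ℂ ℂ).smulRight y)
      (x := 0) (by simpa using hp J)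
  have hpc : ∀ J k y, (((p J).compContinuousLinearMap
      ((ContinuousLinearMap.id ℂ ℂ).smulRight y) k) fun _ => 1) = p J k fun _ => y := by
    intro J k y
    rw [FormalMultilinearSeries.compContinuousLinearMap_apply]
    congr 1
    ext i
    simp
  have hK : IsCompact (sphere (0 : ℂ) (ε / 2) ×ˢ closedBall v (ε / 2)) :=
    (isCompact_sphere _ _).prod (isCompact_closedBall _ _)
  obtain ⟨M, hM⟩ := hK.exists_bound_of_continuousOn (f := W) (fun q hq => by
    have h1 : ‖q.1‖ = ε / 2 := by simpa using hq.1
    have h2 : ‖q.2 - v‖ ≤ ε / 2 := by simpa [dist_eq_norm] using hq.2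
    exact (hW q.1 q.2 (by rw [h1]; positivity) (by rw [h1]; linarith)
      (by linarith)).continuousAt.continuousWithinAt)
  have hb : ∀ J y, ‖y - v‖ ≤ ε / 2 → ‖p J J fun _ => y‖ ≤ M * (ε / 2)⁻¹ ^ J := by
    intro J y hy
    have hy' : ‖y - v‖ < ε := by linarith
    obtain ⟨K, hKs⟩ := hWZ J y hy'
    rw [← hpc]
    refine norm_coeff_le_of_asymptotic (a := fun s => W (s, y)) (ε := ε) (by positivity)
      (by linarith) (fun s h1 h2 => ?_) (fun s hs => hM (s, y) ⟨by simpa using hs, by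
        simpa [dist_eq_norm] using hy⟩) (hpy J y) hKs
    exact ((hW s y h1 h2 hy').comp (f := fun s : ℂ => (s, y))
      (analyticAt_id.prod analyticAt_const)).differentiableAt
  have hcons : ∀ J k, k ≤ J → ∀ y, (p J k fun _ => y) = p k k fun _ => y := by
    intro J k hk y
    have h1 := norm_homogeneous_le (p J k - p k k) (v := v) (δ := ε / 2) (B := 0) (by positivity)
      (fun y hy => ?_) y
    · rw [zero_mul, norm_le_zero_iff, sub_apply, sub_eq_zero] at h1
      exact h1
    · have hy' : ‖y - v‖ < ε := by linarith
      obtain ⟨K₁, hK₁⟩ := hWZ J y hy'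
      obtain ⟨K₂, hK₂⟩ := hWZ k y hy'
      have h2 := norm_coeff_le_of_asymptotic (a := fun _ => (0 : F)) (ρ := 1) (ε := 2) (M := 0)
        (K := |K₁| + |K₂|) (J := k)
        one_pos one_lt_two (fun s _ _ => differentiableAt_const _) (fun _ _ => by simp)
        ((hpy J y).sub (hpy k y)) ?_
      · rw [FormalMultilinearSeries.sub_apply, sub_apply, hpc, hpc] at h2
        simpa using h2
      · filter_upwards [hK₁, hK₂, nhdsWithin_le_nhds (ball_mem_nhds (0 : ℂ) one_pos)]
          with s h3 h4 h5
        rw [mem_ball, dist_zero_right] at h5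
        have h6 : (0 : F) - (((fun s : ℂ => Z J (s • y)) - fun s : ℂ => Z k (s • y)) s) =
            (W (s, y) - Z J (s • y)) - (W (s, y) - Z k (s • y)) := by
          simp only [Pi.sub_apply]; abel
        rw [h6, add_mul]
        refine (norm_sub_le _ _).trans (add_le_add (h3.trans ?_) (h4.trans ?_))
        · calc K₁ * ‖s‖ ^ (J + 1) ≤ |K₁| * ‖s‖ ^ (J + 1) := by gcongr; exact le_abs_self _
            _ ≤ |K₁| * ‖s‖ ^ (k + 1) := by
              have := pow_le_pow_of_le_one (norm_nonneg s) h5.le (show k + 1 ≤ J + 1 by omega)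
              gcongr
        · gcongr
          exact le_abs_self _
  set R : ℝ := (ε / 2)⁻¹ * (ε / 2)⁻¹ with hR
  have hRpos : 0 < R := by positivity
  have hM0 : 0 ≤ M := by
    refine (norm_nonneg _).trans (hM (((ε / 2 : ℝ) : ℂ), v) ⟨?_, ?_⟩)
    · rw [mem_sphere_zero_iff_norm, Complex.norm_real, Real.norm_of_nonneg (by positivity)]
    · exact mem_closedBall_self (by positivity)
  have hgrow : ∀ J y, ‖p J J fun _ => y‖ ≤ M * (R * ‖y‖) ^ J := by
    intro J y
    refine (norm_homogeneous_le (p J J) (by positivity) (hb J) y).trans_eq ?_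
    rw [hR, mul_pow, mul_pow, mul_pow]; ring
  set U : Set E := ball 0 (R⁻¹ / 2) with hU
  have hUle : ∀ x ∈ U, R * ‖x‖ ≤ 1 / 2 := by
    intro x hx
    rw [hU, mem_ball_zero_iff] at hx
    calc R * ‖x‖ ≤ R * (R⁻¹ / 2) := by gcongr
      _ = 1 / 2 := by field_simp
  have hsum : Summable fun j : ℕ => M * (1 / 2 : ℝ) ^ j :=
    summable_geometric_two.mul_left M
  have hbd : ∀ j, ∀ x ∈ U, ‖p j j fun _ => x‖ ≤ M * (1 / 2 : ℝ) ^ j := fun j x hx =>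
    (hgrow j x).trans (by have := hUle x hx; gcongr)
  have hunif := tendstoUniformlyOn_tsum_nat (f := fun j (x : E) => p j j fun _ => x) hsum hbd
  have hpa : ∀ (J j : ℕ) (x : E), AnalyticAt ℂ (fun x => p J j fun _ => x) x := fun J j x =>
    (p J j).analyticAt.comp (f := fun x : E => fun _ : Fin j => x)
      (AnalyticAt.pi fun _ => analyticAt_id)
  have hana := analyticOnNhd_of_tendstoUniformlyOn isOpen_ball (fun k x _ =>
    Finset.analyticAt_fun_sum _ fun j _ => hpa j j x) hunif
  have hU0 : (0 : E) ∈ U := mem_ball_self (by positivity)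
  refine ⟨fun x => ∑' j, p j j fun _ => x, hana 0 hU0, fun J => ?_⟩
  have h1 := (hp J).isBigO_sub_partialSum_pow (J + 1)
  have h2 : (fun x => (∑' j, p j j fun _ => x) - (p J).partialSum (J + 1) x) =O[𝓝 0]
      fun x => ‖x‖ ^ (J + 1) := by
    refine Asymptotics.IsBigO.of_bound (2 * M * R ^ (J + 1)) ?_
    filter_upwards [ball_mem_nhds (0 : E) (show 0 < R⁻¹ / 2 by positivity)] with x hx
    have hsx : Summable fun j => p j j fun _ => x :=
      Summable.of_norm_bounded hsum fun j => hbd j x hx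
    rw [← hsx.sum_add_tsum_nat_add (J + 1), FormalMultilinearSeries.partialSum,
      Finset.sum_congr rfl fun k hk => hcons J k (Nat.lt_succ_iff.1 (Finset.mem_range.1 hk)) x,
      add_sub_cancel_left]
    have h3 : HasSum (fun j : ℕ => M * (R * ‖x‖) ^ (J + 1) * (1 / 2 : ℝ) ^ j)
        (M * (R * ‖x‖) ^ (J + 1) * 2) := hasSum_geometric_two.mul_left _
    refine (tsum_of_norm_bounded h3 fun j => ?_).trans_eq ?_
    · refine (hgrow _ x).trans ?_
      have := hUle x hx
      calc M * (R * ‖x‖) ^ (j + (J + 1)) = M * (R * ‖x‖) ^ (J + 1) * (R * ‖x‖) ^ j := by ring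
        _ ≤ M * (R * ‖x‖) ^ (J + 1) * (1 / 2) ^ j := by gcongr
    · rw [norm_pow, norm_norm, mul_pow]; ring
  refine (h2.sub h1).congr_left fun x => ?_
  rw [zero_add]
  abel

end RayLimit

section CommutingField

variable {E : Type*} [NormedAddCommGroup E] [NormedSpace ℂ E] [FiniteDimensional ℂ E]

lemma AnalyticAt.lieBracket {V W : E → E} {x : E} (hV : AnalyticAt ℂ V x)
    (hW : AnalyticAt ℂ W x) : AnalyticAt ℂ (VectorField.lieBracket ℂ V W) x :=
  (hW.fderiv_clm_apply hV).sub (hV.fderiv_clm_apply hW)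

lemma isBigO_lieBracket_sub {V W W' : E → E} {N : ℕ} (hV : AnalyticAt ℂ V 0)
    (hW : AnalyticAt ℂ W 0) (hW' : AnalyticAt ℂ W' 0)
    (h : (fun x => W x - W' x) =O[𝓝 0] fun x => ‖x‖ ^ (N + 1)) :
    (fun x => VectorField.lieBracket ℂ V W x - VectorField.lieBracket ℂ V W' x) =O[𝓝 0]
      fun x => ‖x‖ ^ N := by
  have hb : ∀ {G : Type _} [NormedAddCommGroup G] {f : E → G} (_ : ContinuousAt f 0),
      f =O[𝓝 0] fun _ => (1 : ℝ) := fun hf => hf.tendsto.isBigO_one ℝ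
  have h1 : (fun x => fderiv ℂ (fun y => W y - W' y) x (V x)) =O[𝓝 0] fun x => ‖x‖ ^ N := by
    have := (isBigO_fderiv (hW.sub hW') h).norm_left.mul (hb hV.continuousAt).norm_left
    simp only [mul_one] at this
    exact (Asymptotics.IsBigO.of_norm_le fun x => (fderiv ℂ (W - W') x).le_opNorm (V x)).trans
      this
  have h2 : (fun x => fderiv ℂ V x (W x - W' x)) =O[𝓝 0] fun x => ‖x‖ ^ N := by
    have := (hb hV.fderiv.continuousAt).norm_left.mul
      (h.trans (isBigO_pow_of_le N.le_succ)).norm_left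
    simp only [one_mul] at this
    exact (Asymptotics.IsBigO.of_norm_le fun x => (fderiv ℂ V x).le_opNorm _).trans this
  refine (h1.sub h2).congr' ?_ EventuallyEq.rfl
  filter_upwards [hW.eventually_analyticAt, hW'.eventually_analyticAt] with x h3 h4
  rw [fderiv_fun_sub h3.differentiableAt h4.differentiableAt]
  simp only [VectorField.lieBracket, sub_apply, map_sub]
  abel

/-- A flat limit of almost commuting fields commutes. -/
lemma eventually_lieBracket_eq_zero {V W : E → E} (hV : AnalyticAt ℂ V 0) (hW : AnalyticAt ℂ W 0)
    {Z : ℕ → E → E} (hZ : ∀ N, AnalyticAt ℂ (Z N) 0)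
    (hWZ : ∀ N, (fun x => W x - Z N x) =O[𝓝 0] fun x => ‖x‖ ^ (N + 1))
    (h : ∀ N, VectorField.lieBracket ℂ V (Z N) =O[𝓝 0] fun x => ‖x‖ ^ N) :
    ∀ᶠ x in 𝓝 0, VectorField.lieBracket ℂ V W x = 0 := by
  refine eventually_eq_zero_of_flat (hV.lieBracket hW) fun N => ?_
  refine ((isBigO_lieBracket_sub hV hW (hZ N) (hWZ N)).add (h N)).congr_left fun x => ?_
  abel

lemma LinearizedBy.fderiv_field {S : E →L[ℂ] E} {Z u : E → E} (h : LinearizedBy S Z u) :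
    fderiv ℂ Z 0 = S := by
  ext1 v
  have h1 := congrArg (fun L : E →L[ℂ] E => L v) (EventuallyEq.fderiv_eq h.conj)
  have h2 : fderiv ℂ (fun x => S (u x)) 0 = S ∘L fderiv ℂ u 0 :=
    ((S.hasFDerivAt).comp 0 h.map.differentiableAt.hasFDerivAt).fderiv
  simp only [fderiv_fderiv_clm_apply h.map h.field, h.field_zero, h2, h.fderiv_map] at h1
  simpa using h1

variable {d : ℕ}

/-- The germ at `0` of a commuting family of isochore vector fields vanishing at `0` and
generically independent. -/
structure IsIsochoreSystem (X : Fin d → (Fin (d + 1) → ℂ) → Fin (d + 1) → ℂ) : Prop where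
  analytic : ∀ j, AnalyticAt ℂ (X j) 0
  zero : ∀ j, X j 0 = 0
  commute : ∀ i j, ∀ᶠ x in 𝓝 0, VectorField.lieBracket ℂ (X i) (X j) x = 0
  trace : ∀ j, ∀ᶠ x in 𝓝 0,
    LinearMap.trace ℂ _ (fderiv ℂ (X j) x : (Fin (d + 1) → ℂ) →ₗ[ℂ] Fin (d + 1) → ℂ) = 0
  nondeg : ¬ ∀ᶠ x in 𝓝 0, volForm X x = 0

variable {X : Fin d → (Fin (d + 1) → ℂ) → Fin (d + 1) → ℂ}

lemma IsIsochoreSystem.exists_isIntegrableOnBall (h : IsIsochoreSystem X) :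
    ∃ F r, IsIntegrableOnBall X F r ∧ F 0 = 0 ∧ (¬ ∀ᶠ x in 𝓝 0, F x = 0) ∧
      ∃ x ∈ ball (0 : Fin (d + 1) → ℂ) r, volForm X x ≠ 0 := by
  have hev : ∀ᶠ x in 𝓝 (0 : Fin (d + 1) → ℂ), (∀ j, AnalyticAt ℂ (X j) x) ∧
      (∀ i j, VectorField.lieBracket ℂ (X i) (X j) x = 0) ∧ ∀ j,
      LinearMap.trace ℂ _ (fderiv ℂ (X j) x : (Fin (d + 1) → ℂ) →ₗ[ℂ] Fin (d + 1) → ℂ) = 0 := by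
    refine (eventually_all.2 fun j => (h.analytic j).eventually_analyticAt).and
      ((eventually_all.2 fun i => eventually_all.2 fun j => h.commute i j).and
      (eventually_all.2 h.trace))
  obtain ⟨r, hr, hev⟩ := Metric.eventually_nhds_iff.1 hev
  simp only [dist_zero_right] at hev
  have hn : ∃ x ∈ ball (0 : Fin (d + 1) → ℂ) r, volForm X x ≠ 0 := by
    by_contra! hc
    exact h.nondeg (by filter_upwards [ball_mem_nhds _ hr] with x hx using hc x hx)
  obtain ⟨F, hF, hF'⟩ := exists_first_integral (X := X) isOpen_ball (convex_ball 0 r)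
    (fun j x hx => (hev (by simpa using hx)).1 j)
    (fun i j x hx => (hev (by simpa using hx)).2.1 i j)
    (fun j x hx => (hev (by simpa using hx)).2.2 j) hn
  refine ⟨fun x => F x - F 0, r, ⟨hr, fun j x hx => (hev hx).1 j, fun i j x hx =>
    (hev hx).2.1 i j, fun x hx => (hF' x (by simpa using hx)).sub_const _⟩, sub_self _,
    fun h0 => h.nondeg ?_, hn⟩
  filter_upwards [h0.eventually_nhds, ball_mem_nhds _ hr] with x hx hxr
  have h1 : (fun x => F x - F 0) =ᶠ[𝓝 x] fun _ => 0 := hx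
  rw [← ((hF' x hxr).sub_const (F 0)).fderiv, h1.fderiv_eq]
  simp

/-- **Convergence of the toric part**: for an additive `ρ` with integral values on the spectrum
of the linear part of `X i`, the corresponding formal vector field commuting with the system
converges. -/
theorem IsIsochoreSystem.exists_commuting_field (h : IsIsochoreSystem X) (i : Fin d)
    {S : (Fin (d + 1) → ℂ) →L[ℂ] Fin (d + 1) → ℂ} {ρ : ℂ → ℂ}
    (hρ : ∀ a b, ρ (a + b) = ρ a + ρ b)
    (hSX : ActsOnGenEigenspaces (S : Module.End ℂ (Fin (d + 1) → ℂ))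
      (fderiv ℂ (X i) 0 : Module.End ℂ (Fin (d + 1) → ℂ)) ρ) (hS : flowExp S 1 = 1) :
    ∃ Z : (Fin (d + 1) → ℂ) → Fin (d + 1) → ℂ, AnalyticAt ℂ Z 0 ∧ Z 0 = 0 ∧ fderiv ℂ Z 0 = S ∧
      (∀ j, ∀ᶠ x in 𝓝 0, VectorField.lieBracket ℂ (X j) Z x = 0) ∧
      (∀ᶠ x in 𝓝 0, LinearMap.trace ℂ _
        (fderiv ℂ Z x : (Fin (d + 1) → ℂ) →ₗ[ℂ] Fin (d + 1) → ℂ) = 0) ∧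
      (∀ R : (Fin (d + 1) → ℂ) →L[ℂ] Fin (d + 1) → ℂ,
        (∀ᶠ x in 𝓝 0, VectorField.lieBracket ℂ (fun y => R y) (X i) x = 0) →
          ∀ᶠ x in 𝓝 0, VectorField.lieBracket ℂ (fun y => R y) Z x = 0) ∧
      ∀ N, ∃ Z' u, LinearizedBy S Z' u ∧ (fun x => Z x - Z' x) =O[𝓝 0] fun x => ‖x‖ ^ (N + 1) := by
  obtain ⟨F, r, hI, hF0, hFne, hn⟩ := h.exists_isIntegrableOnBall
  choose Z u hZ hu hZ0 hu0 hdu hconj hbr hInt using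
    exists_approx_normalization (h.analytic i) (h.zero i) hρ hSX
  have hball : ∀ᶠ x in 𝓝 (0 : Fin (d + 1) → ℂ), HasFDerivAt F (volForm X x) x := by
    filter_upwards [ball_mem_nhds _ hI.pos] with x hx using hI.integral x (by simpa using hx)
  have hlin : ∀ N, LinearizedBy S (Z N) (u N) := fun N =>
    ⟨hZ N, hu N, hZ0 N, hu0 N, hdu N, hconj N⟩
  have happ : ∀ N, IsApproximant X S N (Z N) (u N) := fun N =>
    { hlin N with
      bracket := fun j => hbr N (X j) (h.analytic j) (h.zero j) (h.commute j i)
      tangent := by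
        refine (hInt N F (hI.analyticOnNhd 0 (mem_ball_self hI.pos)) ?_).congr' ?_ EventuallyEq.rfl
        · filter_upwards [hball] with x hx
          rw [hx.fderiv, volForm_self]
        · filter_upwards [hball] with x hx
          rw [hx.fderiv] }
  obtain ⟨m, v, ε, W, hε, hW, hWZ⟩ := hI.exists_reconstruction hF0 hFne hS
    fun N => ⟨_, _, happ N⟩
  obtain ⟨Z', hZ', hZZ⟩ := exists_common_limit hε hW (Z := fun J => Z (J + 3 * m))
    (fun J => hZ _) (fun J y hy => by
      obtain ⟨K, hK⟩ := hWZ (J + 3 * m) _ _ (by omega) (happ _) y hy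
      refine ⟨K, ?_⟩
      filter_upwards [hK, self_mem_nhdsWithin] with s hs hs0
      have h1 : 0 < ‖s‖ ^ (3 * m) := pow_pos (norm_pos_iff.2 hs0) _
      refine le_of_mul_le_mul_left (hs.trans_eq ?_) h1
      ring)
  have hbig : ∀ {N M : ℕ}, N ≤ M + 1 → ∀ {G : Type} [NormedAddCommGroup G]
      {f : (Fin (d + 1) → ℂ) → G}, f =O[𝓝 0] (fun x => ‖x‖ ^ (M + 1)) →
      f =O[𝓝 0] fun x => ‖x‖ ^ N := fun hNM _ _ _ hf => hf.trans (isBigO_pow_of_le hNM)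
  have hcomm : ∀ V : (Fin (d + 1) → ℂ) → Fin (d + 1) → ℂ, AnalyticAt ℂ V 0 → V 0 = 0 →
      (∀ᶠ x in 𝓝 0, VectorField.lieBracket ℂ V (X i) x = 0) →
      ∀ᶠ x in 𝓝 0, VectorField.lieBracket ℂ V Z' x = 0 := fun V hV hV0 hVX =>
    eventually_lieBracket_eq_zero hV hZ' (fun N => hZ (N + 3 * m)) hZZ fun N =>
      hbig (by omega) (hbr _ V hV hV0 hVX)
  have hXZ : ∀ j, ∀ᶠ x in 𝓝 0, VectorField.lieBracket ℂ (X j) Z' x = 0 := fun j =>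
    hcomm _ (h.analytic j) (h.zero j) (h.commute j i)
  have htan : ∀ᶠ x in 𝓝 0, volForm X x (Z' x) = 0 := by
    have hvol := volForm_analyticAt h.analytic
    refine eventually_eq_zero_of_flat (hvol.clm_app hZ') fun N => ?_
    have h1 := ((hvol.continuousAt.tendsto.isBigO_one ℝ).norm_left.mul (hZZ N).norm_left)
    simp only [one_mul] at h1
    have h2 := (Asymptotics.IsBigO.of_norm_le fun x =>
      (volForm X x).le_opNorm (Z' x - Z (N + 3 * m) x)).trans h1
    refine (hbig (by omega) (h2.add (hbig (by omega) (happ (N + 3 * m)).tangent))).congr_left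
      fun x => ?_
    rw [map_sub]; ring
  refine ⟨Z', hZ', ?_, ?_, hXZ, ?_, fun R hR => hcomm _ (R.analyticAt 0) (map_zero R) hR,
    fun N => ⟨_, _, hlin (N + 3 * m), hZZ N⟩⟩
  · simpa [hZ0] using eq_zero_of_isBigO_pow (hZZ 0)
  · have h1 := isBigO_fderiv (N := 1) (hZ'.sub (hZ _)) (hZZ 1)
    have h2 := eq_zero_of_isBigO_pow (k := 0) h1
    rw [fderiv_sub hZ'.differentiableAt (hZ _).differentiableAt, (hlin _).fderiv_field,
      sub_eq_zero] at h2
    exact h2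
  · obtain ⟨ε', hε', hev⟩ := Metric.eventually_nhds_iff.1
      ((hZ'.eventually_analyticAt).and ((eventually_all.2 hXZ).and htan))
    have hδ : 0 < min r ε' := lt_min hI.pos hε'
    have hev' : ∀ x ∈ ball (0 : Fin (d + 1) → ℂ) (min r ε'), ‖x‖ < r ∧ dist x 0 < ε' := by
      intro x hx
      have := mem_ball.1 hx
      exact ⟨by simpa using this.trans_le (min_le_left _ _), this.trans_le (min_le_right _ _)⟩
    filter_upwards [ball_mem_nhds _ hδ] with x hx
    refine trace_eq_zero_of_commute (X := X) isOpen_ball (convex_ball 0 _).isPreconnected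
      (fun j y hy => hI.analytic j y (hev' y hy).1) (fun y hy => hI.integral y (hev' y hy).1) ?_
      (fun y hy => (hev (hev' y hy).2).1) (fun j y hy => ?_)
      (fun y hy => (hev (hev' y hy).2).2.2) x hx
    · by_contra! hc
      exact h.nondeg (by filter_upwards [ball_mem_nhds _ hδ] with x hx using hc x hx)
    · rw [VectorField.lieBracket_swap, (hev (hev' y hy).2).2.1 j, neg_zero]

end CommutingField

section Picard

variable {E : Type*} [NormedAddCommGroup E] [NormedSpace ℂ E] [FiniteDimensional ℂ E]

/-- A nonautonomous field on the ball of radius `a` vanishing at the origin with small Lipschitz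
constant, whose integral curves are defined on `[0, 1]`. -/
structure IsSmallField (G : ℝ → E → E) (a : ℝ) : Prop where
  pos : 0 < a
  continuousOn : ContinuousOn (fun p : ℝ × E => G p.1 p.2) (Icc 0 1 ×ˢ ball 0 a)
  analytic : ∀ t ∈ Icc (0 : ℝ) 1, AnalyticOnNhd ℂ (G t) (ball 0 a)
  zero : ∀ t ∈ Icc (0 : ℝ) 1, G t 0 = 0
  lipschitz : ∀ t ∈ Icc (0 : ℝ) 1, ∀ x ∈ ball (0 : E) a, ∀ y ∈ ball (0 : E) a,
    ‖G t x - G t y‖ ≤ 1 / 2 * ‖x - y‖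

/-- The Picard iterates for the initial value problem `du/dt = G(t, u)`, `u(0) = x`. -/
noncomputable def picard (G : ℝ → E → E) : ℕ → E → ℝ → E
  | 0, x, _ => x
  | k + 1, x, θ => x + θ • ∫ s in (0 : ℝ)..1, G (θ * s) (picard G k x (θ * s))

variable {G : ℝ → E → E} {a : ℝ}

lemma mul_mem_unitInterval {θ s : ℝ} (hθ : θ ∈ Icc (0 : ℝ) 1) (hs : s ∈ Icc (0 : ℝ) 1) :
    θ * s ∈ Icc (0 : ℝ) 1 :=
  ⟨mul_nonneg hθ.1 hs.1, mul_le_one₀ hθ.2 hs.1 hs.2⟩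

lemma norm_smul_integral_le {f : ℝ → E} {C θ : ℝ} (hθ : θ ∈ Icc (0 : ℝ) 1)
    (hf : ∀ s ∈ Icc (0 : ℝ) 1, ‖f s‖ ≤ C) : ‖θ • ∫ s in (0 : ℝ)..1, f s‖ ≤ C := by
  have hC : 0 ≤ C := (norm_nonneg _).trans (hf 0 ⟨le_rfl, zero_le_one⟩)
  have h1 := intervalIntegral.norm_integral_le_of_norm_le_const (a := 0) (b := 1) (f := f) (C := C)
    fun s hs => hf s (by rw [uIoc_of_le zero_le_one] at hs; exact ⟨hs.1.le, hs.2⟩)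
  rw [norm_smul, Real.norm_of_nonneg hθ.1]
  calc θ * _ ≤ 1 * C := by
        gcongr
        · exact hθ.2
        · simpa using h1
    _ = C := one_mul C

namespace IsSmallField

lemma norm_le (h : IsSmallField G a) {t : ℝ} (ht : t ∈ Icc (0 : ℝ) 1) {x : E}
    (hx : x ∈ ball (0 : E) a) : ‖G t x‖ ≤ 1 / 2 * ‖x‖ := by
  simpa [h.zero t ht] using h.lipschitz t ht x hx 0 (mem_ball_self h.pos)

lemma norm_picard_le (h : IsSmallField G a) (k : ℕ) {x : E} (hx : x ∈ ball (0 : E) (a / 2)) :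
    ∀ θ ∈ Icc (0 : ℝ) 1, ‖picard G k x θ‖ ≤ 2 * ‖x‖ := by
  induction k with
  | zero => intro θ _; simp only [picard]; linarith [norm_nonneg x]
  | succ k ih =>
    intro θ hθ
    rw [mem_ball_zero_iff] at hx
    have h1 := norm_smul_integral_le (C := ‖x‖) (f := fun s => G (θ * s) (picard G k x (θ * s))) hθ
      fun s hs => by
        have h2 := ih _ (mul_mem_unitInterval hθ hs)
        have := h.norm_le (mul_mem_unitInterval hθ hs) (x := picard G k x (θ * s))
          (by rw [mem_ball_zero_iff]; linarith)
        linarith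
    simp only [picard]
    linarith [norm_add_le x (θ • ∫ s in (0 : ℝ)..1, G (θ * s) (picard G k x (θ * s)))]

lemma picard_mem (h : IsSmallField G a) (k : ℕ) {x : E} (hx : x ∈ ball (0 : E) (a / 2)) {θ : ℝ}
    (hθ : θ ∈ Icc (0 : ℝ) 1) : picard G k x θ ∈ ball (0 : E) a := by
  have := h.norm_picard_le k hx θ hθ
  rw [mem_ball_zero_iff] at hx ⊢
  linarith

lemma continuousOn_field (h : IsSmallField G a) {T : Type*} [TopologicalSpace T] {A : Set T}
    {θ : T → ℝ} {v : T → E} (hθ : ContinuousOn θ A) (hv : ContinuousOn v A)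
    (hθA : ∀ p ∈ A, θ p ∈ Icc (0 : ℝ) 1) (hvA : ∀ p ∈ A, v p ∈ ball (0 : E) a) :
    ContinuousOn (fun p => G (θ p) (v p)) A :=
  h.continuousOn.comp (hθ.prodMk hv) fun p hp => ⟨hθA p hp, hvA p hp⟩

lemma continuousOn_picard (h : IsSmallField G a) (k : ℕ) :
    ContinuousOn (fun p : E × ℝ => picard G k p.1 p.2) (ball (0 : E) (a / 2) ×ˢ Icc (0 : ℝ) 1) := by
  induction k with
  | zero => exact continuousOn_fst
  | succ k ih =>
    simp only [picard]
    refine continuousOn_fst.add (continuousOn_snd.smul ?_)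
    have hc : ContinuousOn (Function.uncurry fun (p : E × ℝ) (s : unitInterval) =>
        G (p.2 * s) (picard G k p.1 (p.2 * s)))
        ((ball (0 : E) (a / 2) ×ˢ Icc (0 : ℝ) 1) ×ˢ univ) := by
      have hm : ∀ q ∈ (ball (0 : E) (a / 2) ×ˢ Icc (0 : ℝ) 1) ×ˢ (univ : Set unitInterval),
          q.1.2 * (q.2 : ℝ) ∈ Icc (0 : ℝ) 1 := fun q hq => mul_mem_unitInterval hq.1.2 q.2.2
      refine h.continuousOn_field (θ := fun q : (E × ℝ) × unitInterval => q.1.2 * (q.2 : ℝ))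
        (v := fun q => picard G k q.1.1 (q.1.2 * q.2)) (by fun_prop) ?_ hm
        fun q hq => h.picard_mem k hq.1.1 (hm q hq)
      exact ih.comp (f := fun q : (E × ℝ) × unitInterval => (q.1.1, q.1.2 * (q.2 : ℝ)))
        (by fun_prop) fun q hq => ⟨hq.1.1, hm q hq⟩
    have : CompleteSpace E := FiniteDimensional.complete ℂ E
    refine ((integralCM E).continuous.comp_continuousOn (continuousOn_toCM hc)).congr fun p hp => ?_
    exact (integralCM_eq _ fun t => toCM_apply hc hp t).symm

lemma continuousOn_integrand (h : IsSmallField G a) (k : ℕ) {x : E}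
    (hx : x ∈ ball (0 : E) (a / 2)) {θ : ℝ} (hθ : θ ∈ Icc (0 : ℝ) 1) :
    ContinuousOn (fun s => G (θ * s) (picard G k x (θ * s))) (Icc (0 : ℝ) 1) :=
  h.continuousOn_field (by fun_prop) ((h.continuousOn_picard k).comp (f := fun s : ℝ => (x, θ * s))
    (by fun_prop) fun s hs => ⟨hx, mul_mem_unitInterval hθ hs⟩)
    (fun s hs => mul_mem_unitInterval hθ hs)
    fun s hs => h.picard_mem k hx (mul_mem_unitInterval hθ hs)

lemma analyticOnNhd_picard (h : IsSmallField G a) (k : ℕ) :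
    ∀ θ ∈ Icc (0 : ℝ) 1, AnalyticOnNhd ℂ (fun x => picard G k x θ) (ball (0 : E) (a / 2)) := by
  induction k with
  | zero => exact fun _ _ => analyticOnNhd_id
  | succ k ih =>
    intro θ hθ
    have hm : ∀ s ∈ Icc (0 : ℝ) 1, θ * s ∈ Icc (0 : ℝ) 1 := fun s => mul_mem_unitInterval hθ
    have : CompleteSpace E := FiniteDimensional.complete ℂ E
    have hInt : AnalyticOnNhd ℂ (fun x => ∫ s in (0 : ℝ)..1, G (θ * s) (picard G k x (θ * s)))
        (ball (0 : E) (a / 2)) := by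
      refine analyticOnNhd_integral isOpen_ball ?_ fun s hs x hx =>
        (h.analytic _ (hm s hs) _ (h.picard_mem k hx (hm s hs))).comp
          (f := fun x => picard G k x (θ * s)) (ih _ (hm s hs) x hx)
      exact h.continuousOn_field (θ := fun q : E × ℝ => θ * q.2)
        (v := fun q => picard G k q.1 (θ * q.2)) (by fun_prop)
        ((h.continuousOn_picard k).comp (f := fun q : E × ℝ => (q.1, θ * q.2)) (by fun_prop)
          fun q hq => ⟨hq.1, hm _ hq.2⟩) (fun q hq => hm _ hq.2)
        fun q hq => h.picard_mem k hq.1 (hm _ hq.2)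
    intro x hx
    simp only [picard]
    refine analyticAt_id.add ?_
    have := (analyticAt_const (v := (θ : ℂ))).fun_smul (hInt x hx)
    simpa using this

/-- Picard iterates are close to any approximate solution. -/
lemma norm_picard_sub_le (h : IsSmallField G a) {x : E} (hx : x ∈ ball (0 : E) (a / 2)) {v : ℝ → E}
    (hv : ContinuousOn v (Icc 0 1)) (hva : ∀ θ ∈ Icc (0 : ℝ) 1, v θ ∈ ball (0 : E) a) {A δ : ℝ}
    (hA : ∀ θ ∈ Icc (0 : ℝ) 1, ‖x - v θ‖ ≤ A)
    (hδ : ∀ θ ∈ Icc (0 : ℝ) 1, ‖v θ - (x + θ • ∫ s in (0 : ℝ)..1, G (θ * s) (v (θ * s)))‖ ≤ δ)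
    (k : ℕ) : ∀ θ ∈ Icc (0 : ℝ) 1, ‖picard G k x θ - v θ‖ ≤ A * (1 / 2) ^ k + 2 * δ := by
  have hδ0 : 0 ≤ δ := (norm_nonneg _).trans (hδ 0 ⟨le_rfl, zero_le_one⟩)
  induction k with
  | zero => intro θ hθ; simpa [picard] using (hA θ hθ).trans (by linarith)
  | succ k ih =>
    intro θ hθ
    have hm : ∀ s ∈ Icc (0 : ℝ) 1, θ * s ∈ Icc (0 : ℝ) 1 := fun s => mul_mem_unitInterval hθ
    have hi1 := (h.continuousOn_integrand k hx hθ).intervalIntegrable_of_Icc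
      (μ := MeasureTheory.volume) zero_le_one
    have hi2 : IntervalIntegrable (fun s => G (θ * s) (v (θ * s))) MeasureTheory.volume 0 1 :=
      (h.continuousOn_field (θ := fun s : ℝ => θ * s) (v := fun s => v (θ * s)) (by fun_prop)
        (hv.comp (by fun_prop) hm) hm fun s hs => hva _ (hm s hs)).intervalIntegrable_of_Icc
        zero_le_one
    have h1 := norm_smul_integral_le (C := 1 / 2 * (A * (1 / 2) ^ k + 2 * δ)) hθ
      (f := fun s => G (θ * s) (picard G k x (θ * s)) - G (θ * s) (v (θ * s))) fun s hs => by
        have h2 := ih _ (hm s hs)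
        have h3 := h.lipschitz _ (hm s hs) _ (h.picard_mem k hx (hm s hs)) _ (hva _ (hm s hs))
        linarith
    rw [intervalIntegral.integral_sub hi1 hi2, smul_sub] at h1
    have h4 : picard G (k + 1) x θ - v θ =
        ((θ • ∫ s in (0 : ℝ)..1, G (θ * s) (picard G k x (θ * s))) -
          θ • ∫ s in (0 : ℝ)..1, G (θ * s) (v (θ * s))) -
        (v θ - (x + θ • ∫ s in (0 : ℝ)..1, G (θ * s) (v (θ * s)))) := by
      simp only [picard]; abel
    rw [h4, pow_succ]
    have := norm_sub_le ((θ • ∫ s in (0 : ℝ)..1, G (θ * s) (picard G k x (θ * s))) -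
          θ • ∫ s in (0 : ℝ)..1, G (θ * s) (v (θ * s)))
        (v θ - (x + θ • ∫ s in (0 : ℝ)..1, G (θ * s) (v (θ * s))))
    linarith [hδ θ hθ]

lemma norm_picard_succ_sub_le (h : IsSmallField G a) {x : E} (hx : x ∈ ball (0 : E) (a / 2))
    (k : ℕ) : ∀ θ ∈ Icc (0 : ℝ) 1, ‖picard G (k + 1) x θ - picard G k x θ‖ ≤ a * (1 / 2) ^ k := by
  have hxa := mem_ball_zero_iff.1 hx
  induction k with
  | zero =>
    intro θ hθ
    simp only [picard, add_sub_cancel_left, pow_zero, mul_one]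
    refine norm_smul_integral_le hθ fun s hs => ?_
    have := h.norm_le (mul_mem_unitInterval hθ hs) (x := x) (by
      rw [mem_ball_zero_iff]; linarith [h.pos])
    linarith [norm_nonneg x, h.pos]
  | succ k ih =>
    intro θ hθ
    have hm : ∀ s ∈ Icc (0 : ℝ) 1, θ * s ∈ Icc (0 : ℝ) 1 := fun s => mul_mem_unitInterval hθ
    have hi := fun k => (h.continuousOn_integrand k hx hθ).intervalIntegrable_of_Icc
      (μ := MeasureTheory.volume) zero_le_one
    rw [picard, picard, add_sub_add_left_eq_sub, ← smul_sub,
      ← intervalIntegral.integral_sub (hi _) (hi _)]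
    refine norm_smul_integral_le hθ fun s hs => ?_
    have h3 := h.lipschitz _ (hm s hs) _ (h.picard_mem (k + 1) hx (hm s hs)) _
      (h.picard_mem k hx (hm s hs))
    rw [pow_succ]
    linarith [ih _ (hm s hs)]

lemma continuousOn_picard_time (h : IsSmallField G a) (k : ℕ) {x : E}
    (hx : x ∈ ball (0 : E) (a / 2)) : ContinuousOn (picard G k x) (Icc 0 1) :=
  (h.continuousOn_picard k).comp (f := fun s : ℝ => (x, s)) (by fun_prop) fun _ hs => ⟨hx, hs⟩

/-- The time average of the solutions of `du/dt = G(t, u)`, as a limit of Picard iterates. -/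
theorem exists_average (h : IsSmallField G a) :
    ∃ L : E → E, AnalyticOnNhd ℂ L (ball (0 : E) (a / 2)) ∧ ∀ x ∈ ball (0 : E) (a / 2),
      Tendsto (fun k => ∫ θ in (0 : ℝ)..1, picard G k x θ) atTop (𝓝 (L x)) := by
  have : CompleteSpace E := FiniteDimensional.complete ℂ E
  have hdist : ∀ x ∈ ball (0 : E) (a / 2), ∀ k, dist (∫ θ in (0 : ℝ)..1, picard G k x θ)
      (∫ θ in (0 : ℝ)..1, picard G (k + 1) x θ) ≤ a * (1 / 2) ^ k := by
    intro x hx k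
    have hi := fun k => (h.continuousOn_picard_time k hx).intervalIntegrable_of_Icc
      (μ := MeasureTheory.volume) zero_le_one
    rw [dist_comm, dist_eq_norm, ← intervalIntegral.integral_sub (hi _) (hi _)]
    simpa using norm_smul_integral_le (θ := 1) ⟨zero_le_one, le_rfl⟩
      (h.norm_picard_succ_sub_le hx k)
  have hex : ∀ x, ∃ y, x ∈ ball (0 : E) (a / 2) →
      Tendsto (fun k => ∫ θ in (0 : ℝ)..1, picard G k x θ) atTop (𝓝 y) := by
    intro x
    by_cases hx : x ∈ ball (0 : E) (a / 2)
    · obtain ⟨y, hy⟩ := cauchySeq_tendsto_of_complete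
        (cauchySeq_of_le_geometric (1 / 2) a (by norm_num) (hdist x hx))
      exact ⟨y, fun _ => hy⟩
    · exact ⟨0, fun h => absurd h hx⟩
  choose L hL using hex
  refine ⟨L, analyticOnNhd_of_tendstoUniformlyOn (f := fun k x => ∫ θ in (0 : ℝ)..1, picard G k x θ)
    isOpen_ball (fun k => analyticOnNhd_integral isOpen_ball (h.continuousOn_picard k)
      (h.analyticOnNhd_picard k)) ?_, hL⟩
  rw [Metric.tendstoUniformlyOn_iff]
  intro ε hε
  have h0 : Tendsto (fun k : ℕ => a * (1 / 2 : ℝ) ^ k / (1 - 1 / 2)) atTop (𝓝 0) := by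
    have := ((tendsto_pow_atTop_nhds_zero_of_lt_one (r := (1 / 2 : ℝ)) (by norm_num)
      (by norm_num)).const_mul a).div_const (1 - 1 / 2)
    simpa using this
  filter_upwards [h0.eventually_lt_const hε] with k hk x hx
  rw [dist_comm]
  exact (dist_le_of_le_geometric_of_tendsto (1 / 2) a (by norm_num) (hdist x hx)
      (hL x hx) k).trans_lt
    hk

/-- The average of the solution is close to the average of an approximate solution. -/
lemma norm_average_sub_le (h : IsSmallField G a) {x y : E} (hx : x ∈ ball (0 : E) (a / 2))
    (hy : Tendsto (fun k => ∫ θ in (0 : ℝ)..1, picard G k x θ) atTop (𝓝 y)) {v : ℝ → E}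
    (hv : ContinuousOn v (Icc 0 1)) (hva : ∀ θ ∈ Icc (0 : ℝ) 1, v θ ∈ ball (0 : E) a) {δ : ℝ}
    (hδ : ∀ θ ∈ Icc (0 : ℝ) 1, ‖v θ - (x + θ • ∫ s in (0 : ℝ)..1, G (θ * s) (v (θ * s)))‖ ≤ δ) :
    ‖y - ∫ θ in (0 : ℝ)..1, v θ‖ ≤ 2 * δ := by
  have h0 : Tendsto (fun k : ℕ => 2 * a * (1 / 2 : ℝ) ^ k + 2 * δ) atTop (𝓝 (2 * δ)) := by
    have := ((tendsto_pow_atTop_nhds_zero_of_lt_one (r := (1 / 2 : ℝ)) (by norm_num)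
      (by norm_num)).const_mul (2 * a)).add_const (2 * δ)
    simpa using this
  refine le_of_tendsto_of_tendsto' (hy.sub_const _).norm h0 fun k => ?_
  have hi := (h.continuousOn_picard_time k hx).intervalIntegrable_of_Icc
      (μ := MeasureTheory.volume) zero_le_one
  have hi' := hv.intervalIntegrable_of_Icc (μ := MeasureTheory.volume) zero_le_one
  rw [← intervalIntegral.integral_sub hi hi']
  have := norm_smul_integral_le (θ := 1) ⟨zero_le_one, le_rfl⟩
    (h.norm_picard_sub_le hx hv hva (A := 2 * a) (fun θ hθ => by
      have h1 := mem_ball_zero_iff.1 (hva θ hθ)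
      have h2 := mem_ball_zero_iff.1 hx
      linarith [norm_sub_le x (v θ), h.pos]) hδ k)
  simpa using this

/-- Picard iterates are equivariant under the linear symmetries of the field. -/
lemma picard_equivariant (h : IsSmallField G a) {T : E →L[ℂ] E} {x : E}
    (hx : x ∈ ball (0 : E) (a / 2))
    (hT : ∀ t ∈ Icc (0 : ℝ) 1, ∀ y, ‖y‖ ≤ 2 * ‖x‖ → G t (T y) = T (G t y)) (k : ℕ) :
    ∀ θ ∈ Icc (0 : ℝ) 1, picard G k (T x) θ = T (picard G k x θ) := by
  have : CompleteSpace E := FiniteDimensional.complete ℂ E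
  induction k with
  | zero => exact fun _ _ => rfl
  | succ k ih =>
    intro θ hθ
    have hm : ∀ s ∈ Icc (0 : ℝ) 1, θ * s ∈ Icc (0 : ℝ) 1 := fun s => mul_mem_unitInterval hθ
    have hi := (h.continuousOn_integrand k hx hθ).intervalIntegrable_of_Icc
      (μ := MeasureTheory.volume) zero_le_one
    have h1 : T (θ • ∫ s in (0 : ℝ)..1, G (θ * s) (picard G k x (θ * s))) =
        θ • T (∫ s in (0 : ℝ)..1, G (θ * s) (picard G k x (θ * s))) := by simp
    rw [picard, picard, map_add, h1, ← T.intervalIntegral_comp_comm hi]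
    congr 2
    refine intervalIntegral.integral_congr fun s hs => ?_
    rw [uIcc_of_le zero_le_one] at hs
    rw [ih _ (hm s hs), hT _ (hm s hs) _ (h.norm_picard_le k hx _ (hm s hs))]

end IsSmallField

end Picard

section TwistedField

variable {E : Type*} [NormedAddCommGroup E] [NormedSpace ℂ E] [FiniteDimensional ℂ E]

/-- The field governing `e^{-2πi t S} x(t)` for a solution of `dx/dt = 2πi Z(x)`. -/
noncomputable def twistedField (S : E →L[ℂ] E) (Z : E → E) (t : ℝ) (x : E) : E :=
  flowExp S (-t : ℂ) ((2 * Real.pi * Complex.I : ℂ) • (Z (flowExp S t x) - S (flowExp S t x)))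

variable {S : E →L[ℂ] E} {Z : E → E}

lemma exists_flowExp_bound (S : E →L[ℂ] E) :
    ∃ B : ℝ, 1 ≤ B ∧ ∀ t ∈ Icc (-1 : ℝ) 1, ∀ x, ‖flowExp S t x‖ ≤ B * ‖x‖ := by
  have : CompleteSpace E := FiniteDimensional.complete ℂ E
  obtain ⟨B, hB⟩ := (isCompact_Icc (a := (-1 : ℝ)) (b := 1)).exists_bound_of_continuousOn
    (f := fun t : ℝ => flowExp S t)
    (flowExp_continuous.comp Complex.continuous_ofReal).continuousOn
  refine ⟨max B 1, le_max_right _ _, fun t ht x => ((flowExp S t).le_opNorm x).trans ?_⟩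
  gcongr
  exact (hB t ht).trans (le_max_left _ _)

lemma flowExp_neg_apply (t : ℂ) (x : E) : flowExp S (-t) (flowExp S t x) = x := by
  have : CompleteSpace E := FiniteDimensional.complete ℂ E
  rw [← mul_apply_eq_comp, ← flowExp_add, neg_add_cancel, flowExp_zero, one_apply_eq_self]

lemma flowExp_apply_neg (t : ℂ) (x : E) : flowExp S t (flowExp S (-t) x) = x := by
  simpa using flowExp_neg_apply (S := S) (-t) x

lemma flowExp_apply_continuous : Continuous fun p : ℝ × E => flowExp S p.1 p.2 := by
  have : CompleteSpace E := FiniteDimensional.complete ℂ E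
  exact (flowExp_continuous.comp (Complex.continuous_ofReal.comp continuous_fst)).clm_apply
    continuous_snd

lemma norm_two_pi_I : ‖(2 * Real.pi * Complex.I : ℂ)‖ = 2 * Real.pi := by
  simp [abs_of_pos Real.pi_pos]

lemma norm_flowExp_neg_smul_le {B : ℝ} (hB : ∀ t ∈ Icc (-1 : ℝ) 1, ∀ x, ‖flowExp S t x‖ ≤ B * ‖x‖)
    {t : ℝ} (ht : t ∈ Icc (0 : ℝ) 1) (y : E) :
    ‖flowExp S (-t : ℂ) ((2 * Real.pi * Complex.I : ℂ) • y)‖ ≤ B * (2 * Real.pi * ‖y‖) := by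
  have := hB (-t) ⟨by linarith [ht.2], by linarith [ht.1]⟩ ((2 * Real.pi * Complex.I : ℂ) • y)
  rw [norm_smul, norm_two_pi_I] at this
  simpa using this

lemma exists_isSmallField (hZ : AnalyticAt ℂ Z 0) (hZ0 : Z 0 = 0) (hdZ : fderiv ℂ Z 0 = S) :
    ∃ a C, IsSmallField (twistedField S Z) a ∧ 0 ≤ C ∧
      ∀ t ∈ Icc (0 : ℝ) 1, ∀ x ∈ ball (0 : E) a, ‖twistedField S Z t x‖ ≤ C * ‖x‖ ^ 2 := by
  have hcs : CompleteSpace E := FiniteDimensional.complete ℂ E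
  obtain ⟨B, hB1, hB⟩ := exists_flowExp_bound S
  have hB0 : 0 < B := by linarith
  set g : E → E := fun x => Z x - S x with hg
  have hga : AnalyticAt ℂ g 0 := hZ.sub (S.analyticAt 0)
  have hdg : fderiv ℂ g 0 = 0 := by
    rw [hg, fderiv_fun_sub hZ.differentiableAt (S.differentiableAt), hdZ, S.fderiv, sub_self]
  have hgO : g =O[𝓝 0] fun x => ‖x‖ ^ 2 := by
    have h1 := isBigO_sub_id (u := fun x => x + g x) (analyticAt_id.add hga) (by simp [hg, hZ0])
      (by rw [fderiv_fun_add differentiableAt_fun_id hga.differentiableAt, hdg, add_zero]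
          exact fderiv_id)
    simpa using h1
  obtain ⟨C, r₁, hC, hr₁, hgC⟩ := isBigO_norm_pow_iff.1 hgO
  set c : ℝ := 1 / 2 * (B * (2 * Real.pi * B))⁻¹ with hc
  have hc0 : 0 < c := by positivity
  have hev : ∀ᶠ x in 𝓝 (0 : E), AnalyticAt ℂ g x ∧ ‖fderiv ℂ g x‖ < c := by
    refine hga.eventually_analyticAt.and ?_
    have h1 : Tendsto (fun x => ‖fderiv ℂ g x‖) (𝓝 0) (𝓝 0) := by
      have := hga.fderiv.continuousAt.norm.tendsto
      rwa [hdg, norm_zero] at this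
    exact h1.eventually_lt_const hc0
  obtain ⟨r₂, hr₂, hev⟩ := Metric.eventually_nhds_iff.1 hev
  set a : ℝ := min r₁ r₂ / B with ha
  have ha0 : 0 < a := by positivity
  have hmem : ∀ t ∈ Icc (0 : ℝ) 1, ∀ x ∈ ball (0 : E) a, ‖flowExp S t x‖ < min r₁ r₂ := by
    intro t ht x hx
    rw [mem_ball_zero_iff, ha, lt_div_iff₀ hB0] at hx
    refine (hB t ⟨by linarith [ht.1], ht.2⟩ x).trans_lt ?_
    linarith
  have hmem₂ : ∀ t ∈ Icc (0 : ℝ) 1, ∀ x ∈ ball (0 : E) a, flowExp S t x ∈ ball (0 : E) r₂ :=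
    fun t ht x hx => by
      rw [mem_ball_zero_iff]; exact (hmem t ht x hx).trans_le (min_le_right _ _)
  refine ⟨a, B * (2 * Real.pi * (C * B ^ 2)), ⟨ha0, ?_, ?_, ?_, ?_⟩, by positivity, ?_⟩
  · have h1 : ContinuousOn (fun p : ℝ × E => g (flowExp S p.1 p.2)) (Icc 0 1 ×ˢ ball 0 a) := by
      intro p hp
      have h2 := (hev (hmem₂ p.1 hp.1 p.2 hp.2)).1.continuousAt
      exact (ContinuousAt.comp (f := fun p : ℝ × E => flowExp S p.1 p.2) h2
        flowExp_apply_continuous.continuousAt).continuousWithinAt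
    refine ContinuousOn.clm_apply (f := fun p : ℝ × E => flowExp S (-p.1 : ℂ)) ?_
      (h1.const_smul (2 * Real.pi * Complex.I : ℂ))
    exact (flowExp_continuous.comp (by fun_prop)).continuousOn
  · intro t ht x hx
    refine ((flowExp S (-t : ℂ)).analyticAt _).comp
      (f := fun x => (2 * Real.pi * Complex.I : ℂ) • g (flowExp S t x)) ?_
    exact analyticAt_const.fun_smul ((hev (hmem₂ t ht x hx)).1.comp ((flowExp S t).analyticAt x))
  · intro t _
    simp [twistedField, hZ0]
  · intro t ht x hx y hy
    have h1 := Convex.norm_image_sub_le_of_norm_fderiv_le (𝕜 := ℂ) (f := g) (C := c)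
      (fun z hz => (hev hz).1.differentiableAt) (fun z hz => (hev hz).2.le) (convex_ball 0 r₂)
      (hmem₂ t ht y hy) (hmem₂ t ht x hx)
    have h2 := hB t ⟨by linarith [ht.1], ht.2⟩ (x - y)
    rw [map_sub] at h2
    have h3 : twistedField S Z t x - twistedField S Z t y = flowExp S (-t : ℂ)
        ((2 * Real.pi * Complex.I : ℂ) • (g (flowExp S t x) - g (flowExp S t y))) := by
      rw [smul_sub, map_sub]; rfl
    rw [h3]
    refine (norm_flowExp_neg_smul_le hB ht _).trans ?_
    calc B * (2 * Real.pi * ‖g (flowExp S t x) - g (flowExp S t y)‖)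
        ≤ B * (2 * Real.pi * (c * (B * ‖x - y‖))) := by
          have := h1.trans (mul_le_mul_of_nonneg_left h2 hc0.le)
          have := Real.pi_pos
          gcongr
      _ = 1 / 2 * ‖x - y‖ := by rw [hc]; field_simp
  · intro t ht x hx
    refine (norm_flowExp_neg_smul_le hB ht _).trans ?_
    have h1 := hgC (flowExp S t x) ((hmem t ht x hx).trans_le (min_le_left _ _))
    have h2 := hB t ⟨by linarith [ht.1], ht.2⟩ x
    calc B * (2 * Real.pi * ‖g (flowExp S t x)‖)
        ≤ B * (2 * Real.pi * (C * (B * ‖x‖) ^ 2)) := by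
          have := Real.pi_pos
          gcongr
          exact h1.trans (by gcongr)
      _ = _ := by ring

/-- A field commuting with a linear field is equivariant under its flow. -/
lemma eventually_flowExp_comm (hZ : AnalyticAt ℂ Z 0) {R : E →L[ℂ] E}
    (hR : ∀ᶠ x in 𝓝 0, VectorField.lieBracket ℂ (fun y => R y) Z x = 0) :
    ∀ᶠ x in 𝓝 0, ∀ t ∈ Icc (-1 : ℝ) 1, Z (flowExp R t x) = flowExp R t (Z x) := by
  have hcs : CompleteSpace E := FiniteDimensional.complete ℂ E
  obtain ⟨B, hB1, hB⟩ := exists_flowExp_bound R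
  have hB0 : 0 < B := by linarith
  obtain ⟨r, hr, hev⟩ := Metric.eventually_nhds_iff.1 (hZ.eventually_analyticAt.and hR)
  filter_upwards [ball_mem_nhds (0 : E) (div_pos hr hB0)] with x hx t ht
  rw [mem_ball_zero_iff, lt_div_iff₀ hB0] at hx
  have hd : ∀ σ ∈ Icc (-1 : ℝ) 1,
      HasDerivAt (fun σ : ℝ => flowExp R (-σ : ℂ) (Z (flowExp R σ x))) 0 σ := by
    intro σ hσ
    obtain ⟨h1, h2⟩ := @hev (flowExp R σ x) (by
      rw [dist_zero_right]; exact (hB σ hσ x).trans_lt (by linarith))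
    have h3' : HasFDerivAt Z (fderiv ℂ Z (flowExp R σ x)) (flowExp R σ x) :=
      h1.differentiableAt.hasFDerivAt
    have h3 : HasDerivAt (fun σ : ℝ => Z (flowExp R σ x))
        (fderiv ℂ Z (flowExp R σ x) ((2 * Real.pi * Complex.I : ℂ) • R (flowExp R σ x))) σ :=
      ((h3'.restrictScalars ℝ).comp_hasDerivAt σ (flowExp_hasDerivAt_apply (S := R) x σ) :)
    have h4 : HasDerivAt (fun σ : ℝ => flowExp R (-σ : ℂ))
        (-(((2 * Real.pi * Complex.I : ℂ) • R) * flowExp R (-σ : ℂ))) σ := by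
      have h5 := (flowExp_hasDerivAt (S := R) (-(σ : ℂ))).scomp (σ : ℂ) (hasDerivAt_neg (σ : ℂ))
      simpa [Function.comp_def] using h5.comp_ofReal_vec
    have h6 := (ContinuousLinearMap.restrictScalarsL ℂ E E ℝ ℝ).hasFDerivAt.comp_hasDerivAt σ h4
    have h7 := HasDerivAt.clm_apply h6 h3
    refine h7.congr_deriv ?_
    have hcomm := (flowExp_commute (S := R) (Commute.refl R) (-σ : ℂ)).eq
    have hc := DFunLike.congr_fun hcomm (Z (flowExp R σ x))
    simp only [mul_apply_eq_comp] at hc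
    rw [VectorField.lieBracket, sub_eq_zero] at h2
    have hRf : fderiv ℂ (fun y => R y) (flowExp R σ x) = R := R.fderiv
    rw [hRf] at h2
    rw [map_smul, h2]
    simp [hc]
  have h8 := Convex.norm_image_sub_le_of_norm_hasDerivWithin_le (C := 0)
    (fun σ hσ => (hd σ hσ).hasDerivWithinAt) (fun σ _ => by simp) (convex_Icc (-1 : ℝ) 1)
    (show (0 : ℝ) ∈ Icc (-1 : ℝ) 1 by constructor <;> norm_num) ht
  rw [zero_mul, norm_le_zero_iff, sub_eq_zero] at h8
  simp only [Complex.ofReal_zero, neg_zero, flowExp_zero, one_apply_eq_self] at h8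
  rw [← h8, flowExp_apply_neg]

/-- A map equivariant under the flow of a linear field is infinitesimally equivariant. -/
lemma fderiv_apply_of_equivariant {L : E → E} {R : E →L[ℂ] E} {x : E} (hL : DifferentiableAt ℂ L x)
    (h : ∀ t ∈ Icc (-1 : ℝ) 1, L (flowExp R t x) = flowExp R t (L x)) :
    fderiv ℂ L x (R x) = R (L x) := by
  have hcs : CompleteSpace E := FiniteDimensional.complete ℂ E
  have h1 := flowExp_hasDerivAt_apply (S := R) (L x) 0
  have h0 := flowExp_hasDerivAt_apply (S := R) x 0
  have hx0 : flowExp R ((0 : ℝ) : ℂ) x = x := by simp [flowExp_zero]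
  have h2 : HasDerivAt (fun t : ℝ => L (flowExp R t x))
      (fderiv ℂ L x ((2 * Real.pi * Complex.I : ℂ) • R (flowExp R ((0 : ℝ) : ℂ) x))) 0 := by
    have h3 : HasFDerivAt L (fderiv ℂ L x) (flowExp R ((0 : ℝ) : ℂ) x) := by
      rw [hx0]; exact hL.hasFDerivAt
    exact (h3.restrictScalars ℝ).comp_hasDerivAt (0 : ℝ) h0
  have h4 : (fun t : ℝ => L (flowExp R t x)) =ᶠ[𝓝 0] fun t : ℝ => flowExp R t (L x) := by
    filter_upwards [Icc_mem_nhds (show (-1 : ℝ) < 0 by norm_num) one_pos] with t ht using h t ht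
  have h5 := h2.unique (h1.congr_of_eventuallyEq h4)
  rw [hx0] at h5
  simp only [Complex.ofReal_zero, flowExp_zero, one_apply_eq_self, map_smul] at h5
  exact smul_right_injective E Complex.two_pi_I_ne_zero h5

end TwistedField

section EquivariantLinearization

open Asymptotics

variable {E : Type*} [NormedAddCommGroup E] [NormedSpace ℂ E] [FiniteDimensional ℂ E]
variable {S : E →L[ℂ] E} {Z : E → E}

lemma eventually_forall_flowExp {p : E → Prop} (hp : ∀ᶠ x in 𝓝 0, p x) :
    ∀ᶠ x in 𝓝 (0 : E), ∀ t ∈ Icc (-1 : ℝ) 1, p (flowExp S t x) := by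
  obtain ⟨B, hB1, hB⟩ := exists_flowExp_bound S
  have hB0 : 0 < B := by linarith
  obtain ⟨r, hr, hp⟩ := Metric.eventually_nhds_iff.1 hp
  filter_upwards [ball_mem_nhds (0 : E) (div_pos hr hB0)] with x hx t ht
  rw [mem_ball_zero_iff, lt_div_iff₀ hB0] at hx
  exact hp (by rw [dist_zero_right]; exact (hB t ht x).trans_lt (by linarith))

/-- The local inverse of a map conjugating a field to a linear one. -/
lemma eventually_inverse_conj {u φ V : E → E} {R : E →L[ℂ] E} (hu : AnalyticAt ℂ u 0)
    (hφ : AnalyticAt ℂ φ 0) (hφ0 : φ 0 = 0) (hl : ∀ᶠ x in 𝓝 0, φ (u x) = x)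
    (hr : ∀ᶠ x in 𝓝 0, u (φ x) = x) (hc : ∀ᶠ x in 𝓝 0, fderiv ℂ u x (V x) = R (u x)) :
    ∀ᶠ z in 𝓝 0, fderiv ℂ φ z (R z) = V (φ z) := by
  have hcs : CompleteSpace E := FiniteDimensional.complete ℂ E
  have hφc : Tendsto φ (𝓝 0) (𝓝 0) := by simpa [ContinuousAt, hφ0] using hφ.continuousAt
  filter_upwards [hr, hφc.eventually hc, hφc.eventually hl.eventually_nhds,
    hφc.eventually hu.eventually_analyticAt, hφ.eventually_analyticAt] with z h1 h2 h3 h4 h5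
  have h6 : fderiv ℂ (fun x => φ (u x)) (φ z) = ContinuousLinearMap.id ℂ E := by
    rw [(show (fun x => φ (u x)) =ᶠ[𝓝 (φ z)] fun x => x from h3).fderiv_eq, fderiv_fun_id]
  rw [fderiv_fun_comp _ (by rw [h1]; exact h5.differentiableAt) h4.differentiableAt, h1] at h6
  have := DFunLike.congr_fun h6 (V (φ z))
  rwa [ContinuousLinearMap.comp_apply, h2, h1] at this

/-- The average of a map over the circle action generated by `S`. -/
noncomputable def circleConjAverage (S : E →L[ℂ] E) (φ : E → E) (w : E) : E :=
  ∫ θ in (0 : ℝ)..1, flowExp S (-θ : ℂ) (φ (flowExp S θ w))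

lemma continuousOn_flowExp_conj {φ : E → E} {w : E}
    (h : ∀ t ∈ Icc (-1 : ℝ) 1, AnalyticAt ℂ φ (flowExp S t w)) :
    ContinuousOn (fun θ : ℝ => flowExp S (-θ : ℂ) (φ (flowExp S θ w))) (Icc 0 1) := by
  have hcs : CompleteSpace E := FiniteDimensional.complete ℂ E
  refine ContinuousOn.clm_apply (f := fun θ : ℝ => flowExp S (-θ : ℂ)) ?_ fun t ht => ?_
  · exact (flowExp_continuous.comp (by fun_prop)).continuousOn
  · refine (ContinuousAt.comp (f := fun θ : ℝ => flowExp S θ w)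
      (h t ⟨by linarith [ht.1], ht.2⟩).continuousAt ?_).continuousWithinAt
    exact (flowExp_apply_continuous.comp (Continuous.prodMk_left w)).continuousAt

lemma analyticAt_circleConjAverage {φ : E → E} (hφ : AnalyticAt ℂ φ 0) :
    AnalyticAt ℂ (circleConjAverage S φ) 0 := by
  have hcs : CompleteSpace E := FiniteDimensional.complete ℂ E
  obtain ⟨r, hr, h⟩ := Metric.eventually_nhds_iff_ball.1
    (eventually_forall_flowExp (S := S) hφ.eventually_analyticAt)
  refine analyticOnNhd_integral (V := ball 0 r)
    (g := fun w θ => flowExp S (-θ : ℂ) (φ (flowExp S θ w))) isOpen_ball ?_ ?_ 0 (mem_ball_self hr)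
  · refine ContinuousOn.clm_apply (f := fun p : E × ℝ => flowExp S (-p.2 : ℂ))
      (g := fun p : E × ℝ => φ (flowExp S p.2 p.1)) ?_ fun p hp => ?_
    · exact (flowExp_continuous.comp (by fun_prop)).continuousOn
    · refine (ContinuousAt.comp (f := fun p : E × ℝ => flowExp S p.2 p.1)
        (h p.1 hp.1 p.2 ⟨by linarith [hp.2.1], hp.2.2⟩).continuousAt ?_).continuousWithinAt
      exact (flowExp_apply_continuous.comp continuous_swap).continuousAt
  · intro t ht w hw
    exact ((flowExp S (-t : ℂ)).analyticAt _).comp (f := fun w => φ (flowExp S t w))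
      ((h w hw t ⟨by linarith [ht.1], ht.2⟩).comp ((flowExp S t).analyticAt w))

lemma fderiv_circleConjAverage (hS : flowExp S 1 = 1) {φ : E → E} (hφ : AnalyticAt ℂ φ 0) :
    ∀ᶠ w in 𝓝 0, fderiv ℂ (circleConjAverage S φ) w (S w) = S (circleConjAverage S φ w) := by
  have hcs : CompleteSpace E := FiniteDimensional.complete ℂ E
  filter_upwards [(analyticAt_circleConjAverage (S := S) hφ).eventually_analyticAt,
    eventually_forall_flowExp (S := S) hφ.eventually_analyticAt] with w hw h
  refine fderiv_apply_of_equivariant hw.differentiableAt fun t _ => ?_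
  set G : ℝ → E := fun θ => flowExp S t (flowExp S (-θ : ℂ) (φ (flowExp S θ w))) with hG
  have hper : Function.Periodic G 1 := by
    intro θ
    have h1 : flowExp S (-1) = 1 := by
      have h2 := flowExp_add (S := S) (-1) 1
      rwa [neg_add_cancel, flowExp_zero, hS, mul_one, eq_comm] at h2
    simp only [hG, Complex.ofReal_add, Complex.ofReal_one, neg_add, flowExp_add, h1, hS, mul_one]
  have hi := (continuousOn_flowExp_conj h).intervalIntegrable_of_Icc
    (μ := MeasureTheory.volume) zero_le_one
  have h1 : flowExp S t (circleConjAverage S φ w) = ∫ θ in (0 : ℝ)..1, G θ :=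
    ((flowExp S t).intervalIntegral_comp_comm hi).symm
  have h2 := hper.intervalIntegral_add_eq 0 t
  rw [zero_add, add_comm t 1] at h2
  have h3 := intervalIntegral.integral_comp_add_right (a := 0) (b := 1) G t
  rw [zero_add] at h3
  rw [h1, h2, ← h3, circleConjAverage]
  refine intervalIntegral.integral_congr fun θ _ => ?_
  simp only [hG, Complex.ofReal_add, neg_add_rev, flowExp_add, mul_apply_eq_comp, flowExp_apply_neg]

/-- The conjugated orbit solves the twisted equation. -/
lemma hasDerivAt_flowExp_conj {φ Z' : E → E} {w : E} {θ : ℝ}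
    (hφ : AnalyticAt ℂ φ (flowExp S θ w))
    (hc : fderiv ℂ φ (flowExp S θ w) (S (flowExp S θ w)) = Z' (φ (flowExp S θ w))) :
    HasDerivAt (fun θ : ℝ => flowExp S (-θ : ℂ) (φ (flowExp S θ w)))
      (twistedField S Z' θ (flowExp S (-θ : ℂ) (φ (flowExp S θ w)))) θ := by
  have hcs : CompleteSpace E := FiniteDimensional.complete ℂ E
  have h3' : HasFDerivAt φ (fderiv ℂ φ (flowExp S θ w)) (flowExp S θ w) :=
    hφ.differentiableAt.hasFDerivAt
  have h3 : HasDerivAt (fun θ : ℝ => φ (flowExp S θ w))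
      (fderiv ℂ φ (flowExp S θ w) ((2 * Real.pi * Complex.I : ℂ) • S (flowExp S θ w))) θ :=
    ((h3'.restrictScalars ℝ).comp_hasDerivAt θ (flowExp_hasDerivAt_apply (S := S) w θ) :)
  have h4 : HasDerivAt (fun θ : ℝ => flowExp S (-θ : ℂ))
      (-(((2 * Real.pi * Complex.I : ℂ) • S) * flowExp S (-θ : ℂ))) θ := by
    have h5 := (flowExp_hasDerivAt (S := S) (-(θ : ℂ))).scomp (θ : ℂ) (hasDerivAt_neg (θ : ℂ))
    simpa [Function.comp_def] using h5.comp_ofReal_vec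
  have h6 := (ContinuousLinearMap.restrictScalarsL ℂ E E ℝ ℝ).hasFDerivAt.comp_hasDerivAt θ h4
  refine (HasDerivAt.clm_apply h6 h3).congr_deriv ?_
  have hcomm := (flowExp_commute (S := S) (Commute.refl S) (-θ : ℂ)).eq
  have hc' := DFunLike.congr_fun hcomm (φ (flowExp S θ w))
  simp only [mul_apply_eq_comp] at hc'
  rw [twistedField, flowExp_apply_neg, map_smul, hc, smul_sub, map_sub]
  simp [hc']
  abel

lemma norm_twistedField_sub_le {Z' : E → E} {B : ℝ}
    (hB : ∀ t ∈ Icc (-1 : ℝ) 1, ∀ x, ‖flowExp S t x‖ ≤ B * ‖x‖) {t : ℝ} (ht : t ∈ Icc (0 : ℝ) 1)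
    (x : E) : ‖twistedField S Z' t x - twistedField S Z t x‖ ≤
      B * (2 * Real.pi * ‖Z (flowExp S t x) - Z' (flowExp S t x)‖) := by
  have h1 : twistedField S Z' t x - twistedField S Z t x = flowExp S (-t : ℂ)
      ((2 * Real.pi * Complex.I : ℂ) • (Z' (flowExp S t x) - Z (flowExp S t x))) := by
    rw [twistedField, twistedField, ← map_sub, ← smul_sub, sub_sub_sub_cancel_right]
  rw [h1, norm_sub_rev (Z (flowExp S t x))]
  exact norm_flowExp_neg_smul_le hB ht _

end EquivariantLinearization

section AverageEstimate

open Asymptotics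

variable {E : Type*} [NormedAddCommGroup E] [NormedSpace ℂ E] [FiniteDimensional ℂ E]
variable {S : E →L[ℂ] E} {Z : E → E}

lemma continuousOn_comp_mul {f : ℝ → E} (hf : ContinuousOn f (Icc 0 1)) {θ : ℝ}
    (hθ : θ ∈ Icc (0 : ℝ) 1) : ContinuousOn (fun s => f (θ * s)) (Icc 0 1) :=
  hf.comp (continuous_const_mul θ).continuousOn fun _ hs => mul_mem_unitInterval hθ hs

/-- Integral form of a differential equation on the unit interval. -/
lemma eq_add_smul_integral {v f : ℝ → E} (hf : ContinuousOn f (Icc 0 1))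
    (hv : ∀ t ∈ Icc (0 : ℝ) 1, HasDerivAt v (f t) t) {θ : ℝ} (hθ : θ ∈ Icc (0 : ℝ) 1) :
    v θ = v 0 + θ • ∫ s in (0 : ℝ)..1, f (θ * s) := by
  have : CompleteSpace E := FiniteDimensional.complete ℂ E
  have hsub : uIcc 0 θ ⊆ Icc (0 : ℝ) 1 := by
    rw [uIcc_of_le hθ.1]; exact Icc_subset_Icc_right hθ.2
  have h1 := intervalIntegral.integral_eq_sub_of_hasDerivAt (fun t ht => hv t (hsub ht))
    (hf.mono hsub).intervalIntegrable
  rw [intervalIntegral.smul_integral_comp_mul_left, mul_zero, mul_one, h1]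
  abel

theorem average_sub_isBigO {a : ℝ} (h : IsSmallField (twistedField S Z) a) {L : E → E}
    (hL : ∀ x ∈ ball (0 : E) (a / 2), Tendsto
      (fun k => ∫ θ in (0 : ℝ)..1, picard (twistedField S Z) k x θ) atTop (𝓝 (L x)))
    {Z' u φ : E → E} {N : ℕ} (hZ' : AnalyticAt ℂ Z' 0)
    (hu : AnalyticAt ℂ u 0) (hu0 : u 0 = 0)
    (hφ : AnalyticAt ℂ φ 0) (hφ0 : φ 0 = 0) (hl : ∀ᶠ x in 𝓝 0, φ (u x) = x)
    (hc : ∀ᶠ z in 𝓝 0, fderiv ℂ φ z (S z) = Z' (φ z))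
    (hN : (fun x => Z x - Z' x) =O[𝓝 0] fun x => ‖x‖ ^ N) :
    (fun x => L x - circleConjAverage S φ (u x)) =O[𝓝 0] fun x => ‖x‖ ^ N := by
  have hcs : CompleteSpace E := FiniteDimensional.complete ℂ E
  obtain ⟨B, hB1, hB⟩ := exists_flowExp_bound S
  have hB0 : 0 < B := by linarith
  have huc : Tendsto u (𝓝 0) (𝓝 0) := by simpa [ContinuousAt, hu0] using hu.continuousAt
  have hφc : Tendsto φ (𝓝 0) (𝓝 0) := by simpa [ContinuousAt, hφ0] using hφ.continuousAt
  obtain ⟨C₁, r₁, hC₁, hr₁, hb₁⟩ := isBigO_norm_pow_iff.1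
    ((isBigO_norm_of_zero hu hu0).congr_right fun x => (pow_one ‖x‖).symm)
  obtain ⟨C₂, r₂, hC₂, hr₂, hb₂⟩ := isBigO_norm_pow_iff.1
    ((isBigO_norm_of_zero hφ hφ0).congr_right fun x => (pow_one ‖x‖).symm)
  obtain ⟨C₃, r₃, hC₃, hr₃, hb₃⟩ := isBigO_norm_pow_iff.1 hN
  set K := C₂ * (B * C₁) with hK
  have hK0 : 0 < K := by positivity
  have hev := huc.eventually (eventually_forall_flowExp (S := S)
    ((hφ.eventually_analyticAt.and hc).and
      ((show ∀ᶠ z in 𝓝 (0 : E), z ∈ ball (0 : E) r₂ from ball_mem_nhds _ hr₂).and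
        (hφc.eventually hZ'.eventually_analyticAt))))
  have ha := h.pos
  refine IsBigO.of_bound (2 * (B * (2 * Real.pi * (C₃ * K ^ N)))) ?_
  filter_upwards [hev, hl, ball_mem_nhds (0 : E) hr₁, ball_mem_nhds (0 : E) (half_pos ha),
    ball_mem_nhds (0 : E) (div_pos ha (mul_pos hB0 hK0)), ball_mem_nhds (0 : E) (div_pos hr₃ hK0)]
    with x hx hlx hx₁ hxa hxK hx₃
  rw [mem_ball_zero_iff] at hx₁
  rw [mem_ball_zero_iff, lt_div_iff₀ (by positivity)] at hxK hx₃
  rw [norm_pow, norm_norm]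
  set w := u x with hw
  have hI : ∀ t ∈ Icc (0 : ℝ) 1, t ∈ Icc (-1 : ℝ) 1 := fun t ht => ⟨by linarith [ht.1], ht.2⟩
  have hφw : ∀ t ∈ Icc (0 : ℝ) 1, ‖φ (flowExp S t w)‖ ≤ K * ‖x‖ := by
    intro t ht
    have h1 := hb₂ _ (mem_ball_zero_iff.1 (hx t (hI t ht)).2.1)
    have h2 := hB t (hI t ht) w
    have h3 := hb₁ x hx₁
    rw [pow_one] at h1 h3
    calc _ ≤ C₂ * (B * (C₁ * ‖x‖)) := h1.trans (by gcongr; exact h2.trans (by gcongr))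
      _ = K * ‖x‖ := by ring
  set v : ℝ → E := fun θ => flowExp S (-θ : ℂ) (φ (flowExp S θ w)) with hv
  have hvf : ∀ t : ℝ, flowExp S t (v t) = φ (flowExp S t w) := fun t => flowExp_apply_neg _ _
  have hvc : ContinuousOn v (Icc 0 1) := continuousOn_flowExp_conj fun t ht => (hx t ht).1.1
  have hva : ∀ θ ∈ Icc (0 : ℝ) 1, v θ ∈ ball (0 : E) a := by
    intro t ht
    rw [mem_ball_zero_iff]
    have h1 := hB (-t) ⟨by linarith [ht.2], by linarith [ht.1]⟩ (φ (flowExp S t w))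
    rw [Complex.ofReal_neg] at h1
    have h2 : B * ‖φ (flowExp S t w)‖ ≤ B * (K * ‖x‖) := by gcongr; exact hφw t ht
    exact (h1.trans h2).trans_lt (by linarith)
  have hv0 : v 0 = x := by simp [hv, flowExp_zero, hlx]
  have hf : ContinuousOn (fun t => twistedField S Z' t (v t)) (Icc 0 1) := by
    refine ContinuousOn.clm_apply (f := fun t : ℝ => flowExp S (-t : ℂ))
      ((flowExp_continuous.comp (by fun_prop)).continuousOn) ?_
    refine ContinuousOn.const_smul ?_ (2 * Real.pi * Complex.I : ℂ)
    simp only [hvf]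
    have h1 : ContinuousOn (fun t : ℝ => φ (flowExp S t w)) (Icc 0 1) := fun t ht =>
      (ContinuousAt.comp (f := fun t : ℝ => flowExp S t w) (hx t (hI t ht)).1.1.continuousAt
        (flowExp_apply_continuous.comp (Continuous.prodMk_left w)).continuousAt).continuousWithinAt
    refine ContinuousOn.sub (fun t ht => ?_) (S.continuous.comp_continuousOn h1)
    exact ContinuousAt.comp_continuousWithinAt (f := fun t : ℝ => φ (flowExp S t w))
      (hx t (hI t ht)).2.2.continuousAt (h1 t ht)
  have hd := fun t ht => hasDerivAt_flowExp_conj (Z' := Z') (hx t (hI t ht)).1.1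
    (hx t (hI t ht)).1.2
  have hfG : ContinuousOn (fun t => twistedField S Z t (v t)) (Icc 0 1) :=
    h.continuousOn.comp (continuousOn_id.prodMk hvc) fun t ht => ⟨ht, hva t ht⟩
  have hδ : ∀ θ ∈ Icc (0 : ℝ) 1,
      ‖v θ - (x + θ • ∫ s in (0 : ℝ)..1, twistedField S Z (θ * s) (v (θ * s)))‖ ≤
        B * (2 * Real.pi * (C₃ * K ^ N)) * ‖x‖ ^ N := by
    intro θ hθ
    have h1 := eq_add_smul_integral hf hd hθ
    have e1 := (continuousOn_comp_mul hf hθ).intervalIntegrable_of_Icc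
      (μ := MeasureTheory.volume) zero_le_one
    have e2 := (continuousOn_comp_mul hfG hθ).intervalIntegrable_of_Icc
      (μ := MeasureTheory.volume) zero_le_one
    rw [show v θ = _ from h1,
      show flowExp S (-(0 : ℝ) : ℂ) (φ (flowExp S ((0 : ℝ) : ℂ) w)) = x from hv0,
      add_sub_add_left_eq_sub, ← smul_sub, ← intervalIntegral.integral_sub e1 e2]
    refine norm_smul_integral_le hθ fun s hs => ?_
    have hm := mul_mem_unitInterval hθ hs
    refine (norm_twistedField_sub_le hB hm _).trans ?_
    rw [hvf]
    have h2 := hb₃ (φ (flowExp S (θ * s : ℝ) w)) ((hφw _ hm).trans_lt (by linarith))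
    have h3 : C₃ * ‖φ (flowExp S (θ * s : ℝ) w)‖ ^ N ≤ C₃ * (K * ‖x‖) ^ N := by
      gcongr; exact hφw _ hm
    have := Real.pi_pos
    calc _ ≤ B * (2 * Real.pi * (C₃ * (K * ‖x‖) ^ N)) := by gcongr; exact h2.trans h3
      _ = _ := by ring
  refine (h.norm_average_sub_le hxa (hL x hxa) hvc hva hδ).trans (le_of_eq ?_)
  ring

end AverageEstimate

section EquivariantLinearizationExists

open Asymptotics

variable {E : Type*} [NormedAddCommGroup E] [NormedSpace ℂ E] [FiniteDimensional ℂ E]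
variable {S : E →L[ℂ] E} {Z : E → E}

/-- Linear parts of commuting fields commute. -/
lemma commute_of_lieBracket_eq_zero {R : E →L[ℂ] E} (hZ : AnalyticAt ℂ Z 0)
    (hR : ∀ᶠ x in 𝓝 0, VectorField.lieBracket ℂ (fun y => R y) Z x = 0) :
    Commute R (fderiv ℂ Z 0) := by
  have hcs : CompleteSpace E := FiniteDimensional.complete ℂ E
  refine ContinuousLinearMap.ext fun v => ?_
  have h1 : (fun x => fderiv ℂ Z x (R x)) =ᶠ[𝓝 0] fun x => R (Z x) := by
    filter_upwards [hR] with x hx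
    rw [VectorField.lieBracket, sub_eq_zero] at hx
    have hRf : fderiv ℂ (fun y => R y) x = R := R.fderiv
    rwa [hRf] at hx
  have h2 := h1.fderiv_eq (𝕜 := ℂ)
  rw [fderiv_clm_apply (𝕜 := ℂ) hZ.fderiv.differentiableAt R.differentiableAt] at h2
  have h3 : fderiv ℂ (fun x => R (Z x)) 0 = R ∘L fderiv ℂ Z 0 :=
    ((R.hasFDerivAt (x := Z 0)).comp (0 : E) hZ.differentiableAt.hasFDerivAt).fderiv
  rw [h3, show fderiv ℂ (fun x => R x) 0 = R from R.fderiv] at h2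
  have h4 := DFunLike.congr_fun h2 v
  simpa using h4.symm

lemma twistedField_equivariant {T : E →L[ℂ] E} (hT : Commute T S) {t : ℝ} {y : E}
    (hZT : Z (T (flowExp S t y)) = T (Z (flowExp S t y))) :
    twistedField S Z t (T y) = T (twistedField S Z t y) := by
  have hcs : CompleteSpace E := FiniteDimensional.complete ℂ E
  have h1 : ∀ (s : ℂ) z, T (flowExp S s z) = flowExp S s (T z) := fun s z => by
    simpa using DFunLike.congr_fun (flowExp_commute hT s).eq z
  have h2 : ∀ z, T (S z) = S (T z) := fun z => by simpa using DFunLike.congr_fun hT.eq z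
  rw [twistedField, twistedField, h1, ← h1, hZT, ← h2, ← map_sub, ← map_smul]

/-- A field formally linearizable with periodic linear part is linearizable by a transformation
equivariant under all its linear symmetries. -/
theorem exists_equivariant_linearization (hS : flowExp S 1 = 1) (hZ : AnalyticAt ℂ Z 0)
    (hZ0 : Z 0 = 0) (hdZ : fderiv ℂ Z 0 = S)
    (happ : ∀ N : ℕ, ∃ Z' u, LinearizedBy S Z' u ∧
      (fun x => Z x - Z' x) =O[𝓝 0] fun x => ‖x‖ ^ (N + 1)) :
    ∃ L, LinearizedBy S Z L ∧ ∀ R : E →L[ℂ] E,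
      (∀ᶠ x in 𝓝 0, VectorField.lieBracket ℂ (fun y => R y) Z x = 0) →
      ∀ᶠ x in 𝓝 0, fderiv ℂ L x (R x) = R (L x) := by
  have hcs : CompleteSpace E := FiniteDimensional.complete ℂ E
  obtain ⟨a, C, ha, hC, hb⟩ := exists_isSmallField hZ hZ0 hdZ
  have ha0 := ha.pos
  obtain ⟨L, hLa, hL⟩ := ha.exists_average
  have hLa0 : AnalyticAt ℂ L 0 := hLa 0 (mem_ball_self (half_pos ha0))
  have hLO : (fun x => L x - x) =O[𝓝 0] fun x => ‖x‖ ^ 2 := by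
    refine IsBigO.of_bound (2 * C) ?_
    filter_upwards [ball_mem_nhds (0 : E) (half_pos ha0)] with x hx
    have hxa : x ∈ ball (0 : E) a := ball_subset_ball (by linarith) hx
    have h1 := ha.norm_average_sub_le hx (hL x hx) (v := fun _ => x) continuousOn_const
      (fun _ _ => hxa) (δ := C * ‖x‖ ^ 2) fun θ hθ => by
        rw [sub_add_cancel_left, norm_neg]
        exact norm_smul_integral_le hθ fun s hs => hb _ (mul_mem_unitInterval hθ hs) x hxa
    simpa [mul_assoc] using h1
  have hL0 : L 0 = 0 := by
    obtain ⟨c, r, -, hr, h⟩ := isBigO_norm_pow_iff.1 hLO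
    simpa using h 0 (by simpa using hr)
  have hdL : fderiv ℂ L 0 = ContinuousLinearMap.id ℂ E := by
    have h1 : HasFDerivAt L (ContinuousLinearMap.id ℂ E) 0 := by
      rw [hasFDerivAt_iff_isLittleO_nhds_zero]
      refine (hLO.congr_left fun x => by simp [hL0]).trans_isLittleO ?_
      simpa using (isLittleO_norm_pow_id (E' := E) one_lt_two)
    exact h1.fderiv
  refine ⟨L, ⟨hZ, hLa0, hZ0, hL0, hdL, ?_⟩, fun R hR => ?_⟩
  · have hflat : ∀ᶠ x in 𝓝 0, fderiv ℂ L x (Z x) - S (L x) = 0 := by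
      refine eventually_eq_zero_of_flat ((hLa0.fderiv_clm_apply hZ).sub
        ((S.analyticAt _).comp hLa0)) fun N => ?_
      obtain ⟨Z', u, hu, hN⟩ := happ N
      obtain ⟨φ, hφ, hφ0, hφd, hl, hr⟩ := exists_local_inverse hu.map hu.map_zero hu.fderiv_map
      have hc := eventually_inverse_conj hu.map hφ hφ0 hl hr hu.conj
      set M := circleConjAverage S φ with hM
      have hMa : AnalyticAt ℂ M 0 := analyticAt_circleConjAverage hφ
      have hM' : AnalyticAt ℂ M (u 0) := by rw [hu.map_zero]; exact hMa
      have hMu : AnalyticAt ℂ (fun x => M (u x)) 0 := hM'.comp hu.map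
      have hO := average_sub_isBigO ha hL hu.field hu.map hu.map_zero hφ hφ0 hl hc hN
      have huc : Tendsto u (𝓝 0) (𝓝 0) := by
        simpa [ContinuousAt, hu.map_zero] using hu.map.continuousAt
      have hMconj : ∀ᶠ x in 𝓝 0, fderiv ℂ (fun x => M (u x)) x (Z' x) = S (M (u x)) := by
        filter_upwards [huc.eventually (fderiv_circleConjAverage hS hφ), hu.conj,
          huc.eventually hMa.eventually_analyticAt, hu.map.eventually_analyticAt] with x h1 h2 h3 h4
        rw [fderiv_fun_comp _ h3.differentiableAt h4.differentiableAt,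
          ContinuousLinearMap.comp_apply, h2, h1]
      have e1 := isBigO_fderiv_apply (hLa0.sub hMu) hZ hZ0 hO
      have e2 : (fun x => fderiv ℂ (fun x => M (u x)) x (Z x - Z' x)) =O[𝓝 0]
          fun x => ‖x‖ ^ (N + 1) := by
        have e3 : (fderiv ℂ fun x => M (u x)) =O[𝓝 0] fun _ => (1 : ℝ) :=
          hMu.fderiv.continuousAt.isBigO_one ℝ
        have e4 := e3.norm_left.mul hN.norm_left
        refine IsBigO.trans (IsBigO.of_bound 1 (Eventually.of_forall fun x => ?_))
          (e4.congr_right fun x => one_mul _)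
        simpa using (fderiv ℂ (fun x => M (u x)) x).le_opNorm (Z x - Z' x)
      have e5 := (S.isBigO_comp (fun x => L x - M (u x)) (𝓝 0)).trans hO
      refine IsBigO.trans ?_ (isBigO_pow_of_le (Nat.le_succ N))
      refine ((e1.add e2).sub e5).congr' ?_ EventuallyEq.rfl
      filter_upwards [hMconj, hLa0.eventually_analyticAt, hMu.eventually_analyticAt]
        with x h1 h2 h3
      have h4 : fderiv ℂ (L - fun x => M (u x)) x = fderiv ℂ L x - fderiv ℂ (fun x => M (u x)) x :=
        fderiv_sub h2.differentiableAt h3.differentiableAt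
      rw [h4, sub_apply, map_sub, map_sub, h1]
      abel
    exact hflat.mono fun x hx => sub_eq_zero.1 hx
  · have hcom : Commute R S := hdZ ▸ commute_of_lieBracket_eq_zero hZ hR
    obtain ⟨B, hB1, hB⟩ := exists_flowExp_bound S
    obtain ⟨r, hr, hev⟩ := Metric.eventually_nhds_iff.1 (eventually_forall_flowExp (S := S)
      (eventually_flowExp_comm hZ hR))
    filter_upwards [ball_mem_nhds (0 : E) (half_pos ha0), ball_mem_nhds (0 : E) (half_pos hr),
      eventually_forall_flowExp (S := R) (show ∀ᶠ x in 𝓝 (0 : E), x ∈ ball (0 : E) (a / 2) from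
        ball_mem_nhds _ (half_pos ha0))] with x hx hxr hxR
    refine fderiv_apply_of_equivariant (hLa x hx).differentiableAt fun σ hσ => ?_
    have hT : Commute (flowExp R σ) S := (flowExp_commute hcom.symm σ).symm
    rw [mem_ball_zero_iff] at hxr
    have h1 := fun k => ha.picard_equivariant (T := flowExp R σ) hx (fun t ht y hy =>
      twistedField_equivariant hT (hev (y := y) (by rw [dist_zero_right]; linarith) t
        ⟨by linarith [ht.1], ht.2⟩ σ hσ)) k
    refine tendsto_nhds_unique (hL _ (hxR σ hσ)) ?_
    refine (((flowExp R σ).continuous.tendsto _).comp (hL x hx)).congr fun k => ?_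
    have hi := (ha.continuousOn_picard_time k hx).intervalIntegrable_of_Icc
      (μ := MeasureTheory.volume) zero_le_one
    rw [Function.comp_apply, ← (flowExp R σ).intervalIntegral_comp_comm hi]
    refine intervalIntegral.integral_congr fun θ hθ => ?_
    rw [uIcc_of_le zero_le_one] at hθ
    exact (h1 k θ hθ).symm

end EquivariantLinearizationExists

section Jacobian

variable {d : ℕ}

/-- The Jacobian determinant. -/
noncomputable def jacobian (u : (Fin (d + 1) → ℂ) → Fin (d + 1) → ℂ) (x : Fin (d + 1) → ℂ) : ℂ :=
  LinearMap.det (fderiv ℂ u x : (Fin (d + 1) → ℂ) →ₗ[ℂ] Fin (d + 1) → ℂ)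

lemma detRows_apply_single (A : (Fin (d + 1) → ℂ) →ₗ[ℂ] Fin (d + 1) → ℂ) :
    detRows d (fun i => A (Pi.single i 1)) = LinearMap.det A := by
  rw [detRows_apply, ← LinearMap.det_toMatrix', ← Matrix.det_transpose]
  rfl

variable {u : (Fin (d + 1) → ℂ) → Fin (d + 1) → ℂ} {x : Fin (d + 1) → ℂ}

lemma jacobian_eq_detRows : jacobian u = fun x =>
    detRows d fun i => fderiv ℂ u x (Pi.single i 1) :=
  funext fun x => (detRows_apply_single (fderiv ℂ u x : (Fin (d + 1) → ℂ) →ₗ[ℂ] _)).symm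

lemma AnalyticAt.jacobian (hu : AnalyticAt ℂ u x) : AnalyticAt ℂ (jacobian u) x := by
  rw [jacobian_eq_detRows]
  exact (detRows_analyticAt _).comp
    (f := fun x => fun i => fderiv ℂ u x (Pi.single i 1))
    (AnalyticAt.pi fun i => hu.fderiv_clm_apply analyticAt_const)

lemma jacobian_comp {g : (Fin (d + 1) → ℂ) → Fin (d + 1) → ℂ} (hg : DifferentiableAt ℂ g (u x))
    (hu : DifferentiableAt ℂ u x) :
    jacobian (fun x => g (u x)) x = jacobian g (u x) * jacobian u x := by
  rw [jacobian, fderiv_fun_comp _ hg hu, jacobian, jacobian, ← LinearMap.det_comp]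
  rfl

lemma det_clm_mul (A B : (Fin (d + 1) → ℂ) →L[ℂ] Fin (d + 1) → ℂ) :
    LinearMap.det ((A * B : (Fin (d + 1) → ℂ) →L[ℂ] _) : (Fin (d + 1) → ℂ) →ₗ[ℂ] Fin (d + 1) → ℂ) =
      LinearMap.det (A : (Fin (d + 1) → ℂ) →ₗ[ℂ] Fin (d + 1) → ℂ) *
        LinearMap.det (B : (Fin (d + 1) → ℂ) →ₗ[ℂ] Fin (d + 1) → ℂ) :=
  LinearMap.det_comp _ _

lemma trace_clm_mul_comm (A B : (Fin (d + 1) → ℂ) →L[ℂ] Fin (d + 1) → ℂ) :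
    LinearMap.trace ℂ _
      ((A * B : (Fin (d + 1) → ℂ) →L[ℂ] _) : (Fin (d + 1) → ℂ) →ₗ[ℂ] Fin (d + 1) → ℂ) =
    LinearMap.trace ℂ _
      ((B * A : (Fin (d + 1) → ℂ) →L[ℂ] _) : (Fin (d + 1) → ℂ) →ₗ[ℂ] Fin (d + 1) → ℂ) :=
  LinearMap.trace_mul_comm ℂ (A : Module.End ℂ (Fin (d + 1) → ℂ)) (B : Module.End ℂ _)

lemma jacobian_ne_zero (h : IsUnit (fderiv ℂ u x)) : jacobian u x ≠ 0 := by
  obtain ⟨B, hB⟩ := h.exists_right_inv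
  intro h0
  have h1 := det_clm_mul (fderiv ℂ u x) B
  rw [hB, ← jacobian, h0, zero_mul] at h1
  exact one_ne_zero ((LinearMap.det_id (A := ℂ) (M := Fin (d + 1) → ℂ)).symm.trans h1)

/-- The Jacobian determinant of a map conjugating `V` to `W`, along `V`. -/
lemma fderiv_jacobian {V : (Fin (d + 1) → ℂ) → Fin (d + 1) → ℂ}
    {W : (Fin (d + 1) → ℂ) → Fin (d + 1) → ℂ} (hu : AnalyticAt ℂ u x) (hV : AnalyticAt ℂ V x)
    (hW : DifferentiableAt ℂ W (u x))
    (hc : ∀ᶠ y in 𝓝 x, fderiv ℂ u y (V y) = W (u y)) (h : IsUnit (fderiv ℂ u x)) :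
    fderiv ℂ (jacobian u) x (V x) =
      (LinearMap.trace ℂ _ (fderiv ℂ W (u x) : (Fin (d + 1) → ℂ) →ₗ[ℂ] Fin (d + 1) → ℂ) -
        LinearMap.trace ℂ _ (fderiv ℂ V x : (Fin (d + 1) → ℂ) →ₗ[ℂ] Fin (d + 1) → ℂ)) *
        jacobian u x := by
  set R := fderiv ℂ W (u x)
  set M : Fin (d + 1) → Fin (d + 1) → ℂ := fun i => fderiv ℂ u x (Pi.single i 1) with hM
  obtain ⟨A, hA⟩ := h
  have hsecond : ∀ v, fderiv ℂ (fderiv ℂ u) x (V x) v =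
      R (fderiv ℂ u x v) - fderiv ℂ u x (fderiv ℂ V x v) := by
    intro v
    have h1 := fderiv_fderiv_clm_apply hu hV v
    have h2 : fderiv ℂ (fun y => W (u y)) x = R ∘L fderiv ℂ u x :=
      (hW.hasFDerivAt.comp x hu.differentiableAt.hasFDerivAt).fderiv
    rw [(show (fun y => fderiv ℂ u y (V y)) =ᶠ[𝓝 x] fun y => W (u y) from hc).fderiv_eq, h2,
      hu.fderiv_fderiv_comm] at h1
    rw [← ContinuousLinearMap.comp_apply, h1, add_sub_cancel_right]
  have hf : HasFDerivAt (fun y => fun i => fderiv ℂ u y (Pi.single i 1))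
      (ContinuousLinearMap.pi (R := ℂ) fun i => (fderiv ℂ (fderiv ℂ u) x).flip (Pi.single i 1)) x :=
    hasFDerivAt_pi.2 fun i => by
      have := hu.fderiv.differentiableAt.hasFDerivAt.clm_apply
        (hasFDerivAt_const (𝕜 := ℂ) (Pi.single i 1 : Fin (d + 1) → ℂ) x)
      simpa using this
  have hJ : fderiv ℂ (jacobian u) x (V x) =
      ∑ i, detRows d (Function.update M i (fderiv ℂ (fderiv ℂ u) x (V x) (Pi.single i 1))) := by
    rw [jacobian_eq_detRows, show (fun x => detRows d fun i => fderiv ℂ u x (Pi.single i 1)) =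
      detRows d ∘ fun y => fun i => fderiv ℂ u y (Pi.single i 1) from rfl,
      (((detRows d).hasFDerivAt M).comp x hf).fderiv]
    simp [ContinuousMultilinearMap.linearDeriv_apply]
  set B : (Fin (d + 1) → ℂ) →L[ℂ] Fin (d + 1) → ℂ := (A : (Fin (d + 1) → ℂ) →L[ℂ] _) *
    fderiv ℂ V x * ((A⁻¹ : ((Fin (d + 1) → ℂ) →L[ℂ] Fin (d + 1) → ℂ)ˣ) : (Fin (d + 1) → ℂ) →L[ℂ] _)
    with hB
  have hBM : ∀ v, B (fderiv ℂ u x v) = fderiv ℂ u x (fderiv ℂ V x v) := by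
    intro v
    rw [← hA, hB, ← mul_apply_eq_comp, mul_assoc, A.inv_mul, mul_one]
    rfl
  have htr : LinearMap.trace ℂ _ (B : (Fin (d + 1) → ℂ) →ₗ[ℂ] Fin (d + 1) → ℂ) =
      LinearMap.trace ℂ _ (fderiv ℂ V x : (Fin (d + 1) → ℂ) →ₗ[ℂ] Fin (d + 1) → ℂ) := by
    rw [hB, mul_assoc, trace_clm_mul_comm, mul_assoc, A.inv_mul, mul_one]
  have h1 := sum_det_update_row ((R - B : (Fin (d + 1) → ℂ) →L[ℂ] _) : (Fin (d + 1) → ℂ) →ₗ[ℂ] _) M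
  have h2 : LinearMap.trace ℂ _ ((R - B : (Fin (d + 1) → ℂ) →L[ℂ] _) :
      (Fin (d + 1) → ℂ) →ₗ[ℂ] Fin (d + 1) → ℂ) = LinearMap.trace ℂ _
        (R : (Fin (d + 1) → ℂ) →ₗ[ℂ] Fin (d + 1) → ℂ) - LinearMap.trace ℂ _
        (fderiv ℂ V x : (Fin (d + 1) → ℂ) →ₗ[ℂ] Fin (d + 1) → ℂ) := by
    rw [← htr, ← map_sub]; rfl
  rw [hJ, congrFun jacobian_eq_detRows x, ← h2]
  refine Eq.trans ?_ h1
  refine Finset.sum_congr rfl fun i _ => ?_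
  rw [hsecond, ← hBM]
  rfl

lemma det_smul_id_add_smulRight {c : ℂ} (hc : c ≠ 0) (b : (Fin (d + 1) → ℂ) →L[ℂ] ℂ)
    (y : Fin (d + 1) → ℂ) :
    LinearMap.det ((c • ContinuousLinearMap.id ℂ (Fin (d + 1) → ℂ) + b.smulRight y :
      (Fin (d + 1) → ℂ) →L[ℂ] _) : (Fin (d + 1) → ℂ) →ₗ[ℂ] Fin (d + 1) → ℂ) =
      c ^ d * (c + b y) := by
  have h : ((c • ContinuousLinearMap.id ℂ (Fin (d + 1) → ℂ) + b.smulRight y :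
      (Fin (d + 1) → ℂ) →L[ℂ] _) : (Fin (d + 1) → ℂ) →ₗ[ℂ] Fin (d + 1) → ℂ) =
      c • LinearMap.transvection (c⁻¹ • (b : (Fin (d + 1) → ℂ) →ₗ[ℂ] ℂ)) y := by
    ext v i
    simp [LinearMap.transvection.apply]
    field_simp
  rw [h, LinearMap.det_smul, LinearMap.transvection.det]
  simp [pow_succ]
  field_simp

end Jacobian

section RadialScaling

variable {E : Type*} [NormedAddCommGroup E] [NormedSpace ℂ E] [FiniteDimensional ℂ E]

/-- The weighted radial average solving `n k + dk(y) y = n h`. -/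
noncomputable def radialAverage (d : ℕ) (h : E → ℂ) (y : E) : ℂ :=
  ((d : ℂ) + 1) * ∫ t in (0 : ℝ)..1, (t : ℂ) ^ d * h (t • y)

variable {d : ℕ} {h : E → ℂ}

lemma analyticOnNhd_radialAverage {r : ℝ} (hh : AnalyticOnNhd ℂ h (ball 0 r)) :
    AnalyticOnNhd ℂ (radialAverage d h) (ball 0 r) := by
  have hcs : CompleteSpace E := FiniteDimensional.complete ℂ E
  have hm : ∀ y ∈ ball (0 : E) r, ∀ t ∈ Icc (0 : ℝ) 1, t • y ∈ ball (0 : E) r := fun y hy t ht => by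
    rw [mem_ball_zero_iff] at hy ⊢
    rw [norm_smul, Real.norm_of_nonneg ht.1]
    exact (mul_le_of_le_one_left (norm_nonneg y) ht.2).trans_lt hy
  have h1 : AnalyticOnNhd ℂ (fun y => ∫ t in (0 : ℝ)..1, (t : ℂ) ^ d * h (t • y)) (ball 0 r) := by
    refine analyticOnNhd_integral (g := fun y t => (t : ℂ) ^ d * h (t • y)) isOpen_ball ?_ ?_
    · refine ContinuousOn.mul (f := fun p : E × ℝ => (p.2 : ℂ) ^ d)
        (g := fun p : E × ℝ => h (p.2 • p.1)) (by fun_prop) fun p hp => ?_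
      exact (ContinuousAt.comp (f := fun p : E × ℝ => p.2 • p.1)
        (hh _ (hm p.1 hp.1 p.2 hp.2)).continuousAt (by fun_prop)).continuousWithinAt
    · intro t ht y hy
      refine analyticAt_const.mul ((hh _ (hm y hy t ht)).comp (f := fun y : E => t • y) ?_)
      exact ((t • ContinuousLinearMap.id ℂ E : E →L[ℂ] E)).analyticAt y
  exact fun y hy => analyticAt_const.mul (h1 y hy)

lemma radialAverage_zero : radialAverage d h 0 = h 0 := by
  have h1 : ∫ t in (0 : ℝ)..1, (t : ℂ) ^ d * h (t • (0 : E)) =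
      (((∫ t in (0 : ℝ)..1, t ^ d) : ℝ) : ℂ) * h 0 := by
    simp only [smul_zero]
    rw [intervalIntegral.integral_mul_const, ← intervalIntegral.integral_ofReal]
    simp
  have h2 : (d : ℂ) + 1 ≠ 0 := Nat.cast_add_one_ne_zero d
  rw [radialAverage, h1, integral_pow]
  push_cast
  rw [one_pow, zero_pow (Nat.succ_ne_zero d), sub_zero]
  field_simp

/-- The defining equation of the radial average. -/
lemma radialAverage_add_fderiv {r : ℝ} (hh : AnalyticOnNhd ℂ h (ball 0 r)) {y : E}
    (hy : y ∈ ball (0 : E) r) :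
    ((d : ℂ) + 1) * radialAverage d h y + fderiv ℂ (radialAverage d h) y y =
      ((d : ℂ) + 1) * h y := by
  set k := radialAverage d h with hk
  have hka := analyticOnNhd_radialAverage (d := d) hh y hy
  have hev : ∀ᶠ s : ℝ in 𝓝 1, 0 < s ∧ s • y ∈ ball (0 : E) r := by
    refine (lt_mem_nhds one_pos).and ?_
    have : ContinuousAt (fun s : ℝ => s • y) 1 := by fun_prop
    exact this.preimage_mem_nhds (by rw [one_smul]; exact isOpen_ball.mem_nhds hy)
  have hc : ∀ s : ℝ, 0 < s → s • y ∈ ball (0 : E) r →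
      ContinuousOn (fun τ : ℝ => (τ : ℂ) ^ d * h (τ • y)) (Icc 0 s) := by
    intro s hs0 hs
    refine ContinuousOn.mul (f := fun τ : ℝ => (τ : ℂ) ^ d) (by fun_prop) fun τ hτ => ?_
    refine (ContinuousAt.comp (f := fun τ : ℝ => τ • y) (hh _ ?_).continuousAt
      (by fun_prop)).continuousWithinAt
    rw [mem_ball_zero_iff] at hs ⊢
    rw [norm_smul, Real.norm_of_nonneg hτ.1]
    rw [norm_smul, Real.norm_of_nonneg hs0.le] at hs
    exact (mul_le_mul_of_nonneg_right hτ.2 (norm_nonneg y)).trans_lt hs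
  have hF : (fun s : ℝ => (s : ℂ) ^ (d + 1) * k (s • y)) =ᶠ[𝓝 1]
      fun s => ((d : ℂ) + 1) * ∫ τ in (0 : ℝ)..s, (τ : ℂ) ^ d * h (τ • y) := by
    filter_upwards [hev] with s hs
    have h1 := intervalIntegral.smul_integral_comp_mul_left (a := 0) (b := 1)
      (fun τ : ℝ => (τ : ℂ) ^ d * h (τ • y)) s
    rw [mul_zero, mul_one] at h1
    rw [← h1, hk, radialAverage]
    have h2 : ∀ t : ℝ, ((s * t : ℝ) : ℂ) ^ d * h ((s * t) • y) =
        (s : ℂ) ^ d * ((t : ℂ) ^ d * h (t • s • y)) := by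
      intro t
      rw [smul_smul, mul_comm t s]; push_cast; ring
    simp only [h2]
    rw [intervalIntegral.integral_const_mul, Complex.real_smul]
    ring
  have h1 : HasDerivAt (fun s : ℝ => ∫ τ in (0 : ℝ)..s, (τ : ℂ) ^ d * h (τ • y))
      (((1 : ℝ) : ℂ) ^ d * h ((1 : ℝ) • y)) 1 := by
    obtain ⟨s, hs1, hs⟩ : ∃ s : ℝ, 1 < s ∧ s • y ∈ ball (0 : E) r := by
      obtain ⟨ε, hε, he⟩ := Metric.eventually_nhds_iff.1 hev
      refine ⟨1 + ε / 2, by linarith, (he ?_).2⟩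
      rw [Real.dist_eq, add_sub_cancel_left, abs_of_pos (half_pos hε)]; linarith
    have hcs := hc s (by linarith) hs
    refine intervalIntegral.integral_hasDerivAt_right
      ((hcs.mono (by rw [uIcc_of_le zero_le_one]
                     exact Icc_subset_Icc_right hs1.le)).intervalIntegrable)
      ?_ (hcs.continuousAt (Icc_mem_nhds one_pos hs1))
    exact (hcs.mono Ioo_subset_Icc_self).stronglyMeasurableAtFilter isOpen_Ioo 1 ⟨one_pos, hs1⟩
  have h2 : HasDerivAt (fun s : ℝ => k (s • y)) (fderiv ℂ k y y) 1 := by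
    have h3 : HasFDerivAt k (fderiv ℂ k y) ((1 : ℝ) • y) := by
      rw [one_smul]; exact hka.differentiableAt.hasFDerivAt
    have h4 : HasDerivAt (fun s : ℝ => s • y) y 1 := by
      simpa using (hasDerivAt_id (1 : ℝ)).smul_const y
    exact (h3.restrictScalars ℝ).comp_hasDerivAt (1 : ℝ) h4
  have h3 : HasDerivAt (fun s : ℝ => (s : ℂ) ^ (d + 1)) ((d : ℂ) + 1) 1 := by
    have := ((hasDerivAt_id ((1 : ℝ) : ℂ)).pow (d + 1)).comp_ofReal
    simpa using this
  have h4 := (h3.mul h2).unique ((h1.const_mul ((d : ℂ) + 1)).congr_of_eventuallyEq hF)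
  simpa using h4

/-- A function invariant under a linear field is invariant under its flow. -/
lemma eventually_flowExp_invariant (hh : AnalyticAt ℂ h 0) {R : E →L[ℂ] E}
    (hR : ∀ᶠ x in 𝓝 0, fderiv ℂ h x (R x) = 0) :
    ∀ᶠ x in 𝓝 0, ∀ t ∈ Icc (-1 : ℝ) 1, h (flowExp R t x) = h x := by
  have hcs : CompleteSpace E := FiniteDimensional.complete ℂ E
  have h1 := eventually_flowExp_comm (Z := fun x => h x • x)
    (hh.fun_smul analyticAt_id) (R := R) (by
    filter_upwards [hR, hh.eventually_analyticAt] with x hx ha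
    rw [VectorField.lieBracket, fderiv_fun_smul ha.differentiableAt differentiableAt_fun_id]
    have hRf : fderiv ℂ (fun y => R y) x = R := R.fderiv
    rw [hRf]
    simp [hx])
  filter_upwards [h1] with x hx t ht
  rcases eq_or_ne x 0 with rfl | h0
  · rw [map_zero]
  · have h2 := hx t ht
    rw [map_smul] at h2
    refine smul_left_injective ℂ (fun h3 => h0 ?_) h2
    rw [← flowExp_neg_apply (S := R) t x, h3, map_zero]

end RadialScaling

section IsochoreScaling

variable {d : ℕ}

/-- Prescribing the Jacobian determinant by an equivariant radial scaling. -/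
lemma exists_scaling {h : (Fin (d + 1) → ℂ) → ℂ} (hh : AnalyticAt ℂ h 0) (h0 : h 0 = 1) :
    ∃ ψ : (Fin (d + 1) → ℂ) → Fin (d + 1) → ℂ, AnalyticAt ℂ ψ 0 ∧ ψ 0 = 0 ∧
      fderiv ℂ ψ 0 = ContinuousLinearMap.id ℂ _ ∧ (∀ᶠ y in 𝓝 0, jacobian ψ y = h y) ∧
      ∀ R : (Fin (d + 1) → ℂ) →L[ℂ] Fin (d + 1) → ℂ, (∀ᶠ y in 𝓝 0, fderiv ℂ h y (R y) = 0) →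
        ∀ᶠ y in 𝓝 0, fderiv ℂ ψ y (R y) = R (ψ y) := by
  obtain ⟨r, hr, hr'⟩ := Metric.eventually_nhds_iff.1 hh.eventually_analyticAt
  have hhr : AnalyticOnNhd ℂ h (ball 0 r) := fun y hy => hr' hy
  set k := radialAverage d h with hk
  have hka := analyticOnNhd_radialAverage (d := d) hhr
  have hk0 : k 0 = 1 := by rw [hk, radialAverage_zero, h0]
  have hd : (d : ℂ) + 1 ≠ 0 := Nat.cast_add_one_ne_zero d
  set g : (Fin (d + 1) → ℂ) → ℂ := fun y => Complex.exp (((d : ℂ) + 1)⁻¹ * Complex.log (k y))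
    with hg
  have hg0 : g 0 = 1 := by simp [hg, hk0]
  have hslit : ∀ᶠ y in 𝓝 0, y ∈ ball (0 : Fin (d + 1) → ℂ) r ∧ k y ∈ Complex.slitPlane := by
    refine (show ∀ᶠ y in 𝓝 0, y ∈ ball (0 : Fin (d + 1) → ℂ) r from ball_mem_nhds _ hr).and
      ((hka 0 (mem_ball_self hr)).continuousAt.eventually_mem
        (Complex.isOpen_slitPlane.mem_nhds ?_))
    show k 0 ∈ _
    rw [hk0]; exact Complex.one_mem_slitPlane
  have hga : ∀ y ∈ ball (0 : Fin (d + 1) → ℂ) r, k y ∈ Complex.slitPlane → AnalyticAt ℂ g y :=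
    fun y hy hs => (analyticAt_const.mul ((hka y hy).clog hs)).cexp
  have hdψ : ∀ y ∈ ball (0 : Fin (d + 1) → ℂ) r, k y ∈ Complex.slitPlane →
      fderiv ℂ (fun y => g y • y) y =
        g y • ContinuousLinearMap.id ℂ _ + (fderiv ℂ g y).smulRight y := fun y hy hs =>
    ((hga y hy hs).differentiableAt.hasFDerivAt.fun_smul (hasFDerivAt_id y)).fderiv
  have hr0 := hslit.self_of_nhds
  refine ⟨fun y => g y • y, (hga 0 hr0.1 hr0.2).fun_smul analyticAt_id, smul_zero _, ?_, ?_, ?_⟩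
  · rw [hdψ 0 hr0.1 hr0.2, hg0]
    ext v i
    simp
  · filter_upwards [hslit] with y hy
    have hk1 : k y ≠ 0 := Complex.slitPlane_ne_zero hy.2
    have hgp : g y ^ (d + 1) = k y := by
      rw [hg, ← Complex.exp_nat_mul]
      push_cast
      rw [mul_inv_cancel_left₀ hd, Complex.exp_log hk1]
    have hdg : fderiv ℂ g y = g y • ((d : ℂ) + 1)⁻¹ • (k y)⁻¹ • fderiv ℂ k y :=
      (((((hka y hy.1).differentiableAt.hasFDerivAt).clog hy.2).const_mul _).cexp).fderiv
    have h1 := radialAverage_add_fderiv (d := d) hhr hy.1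
    rw [jacobian, hdψ y hy.1 hy.2, det_smul_id_add_smulRight (Complex.exp_ne_zero _), hdg]
    simp only [smul_apply, smul_eq_mul]
    rw [show g y ^ d * (g y + g y * (((d : ℂ) + 1)⁻¹ * ((k y)⁻¹ * fderiv ℂ k y y))) =
      g y ^ (d + 1) * (1 + ((d : ℂ) + 1)⁻¹ * ((k y)⁻¹ * fderiv ℂ k y y)) by ring, hgp]
    field_simp
    rw [← hk] at h1
    linear_combination h1
  · intro R hR
    obtain ⟨s, hs, hinv⟩ := Metric.eventually_nhds_iff.1 (eventually_flowExp_invariant hh hR)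
    filter_upwards [hslit, ball_mem_nhds _ hs] with y hy hys
    refine fderiv_apply_of_equivariant
      ((hga y hy.1 hy.2).fun_smul analyticAt_id).differentiableAt fun t ht => ?_
    have hkt : k (flowExp R t y) = k y := by
      rw [hk, radialAverage, radialAverage]
      congr 1
      refine intervalIntegral.integral_congr fun τ hτ => ?_
      rw [uIcc_of_le zero_le_one] at hτ
      have h2 : τ • flowExp R t y = flowExp R t (τ • y) := by
        rw [← Complex.coe_smul, ← Complex.coe_smul, map_smul]
      show _ * h _ = _ * h _
      rw [h2, hinv _ t ht]
      rw [dist_zero_right, norm_smul, Real.norm_of_nonneg hτ.1]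
      exact (mul_le_of_le_one_left (norm_nonneg y) hτ.2).trans_lt (mem_ball_zero_iff.1 hys)
    show g _ • _ = flowExp R t (g y • y)
    rw [map_smul, show g (flowExp R t y) = g y by rw [hg]; simp only [hkt]]

/-- An equivariant linearization can be corrected to a volume-preserving one. -/
lemma exists_isochore_conj {L : (Fin (d + 1) → ℂ) → Fin (d + 1) → ℂ} (hL : AnalyticAt ℂ L 0)
    (hL0 : L 0 = 0) (hdL : fderiv ℂ L 0 = ContinuousLinearMap.id ℂ _) :
    ∃ φ : (Fin (d + 1) → ℂ) → Fin (d + 1) → ℂ, AnalyticAt ℂ φ 0 ∧ φ 0 = 0 ∧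
      fderiv ℂ φ 0 = ContinuousLinearMap.id ℂ _ ∧ (∀ᶠ x in 𝓝 0, jacobian φ x = 1) ∧
      ∀ (V : (Fin (d + 1) → ℂ) → Fin (d + 1) → ℂ) (R : (Fin (d + 1) → ℂ) →L[ℂ] Fin (d + 1) → ℂ),
        AnalyticAt ℂ V 0 → (∀ᶠ x in 𝓝 0, fderiv ℂ L x (V x) = R (L x)) →
        (∀ᶠ x in 𝓝 0, LinearMap.trace ℂ _
          (fderiv ℂ V x : (Fin (d + 1) → ℂ) →ₗ[ℂ] Fin (d + 1) → ℂ) =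
          LinearMap.trace ℂ _ (R : (Fin (d + 1) → ℂ) →ₗ[ℂ] Fin (d + 1) → ℂ)) →
        ∀ᶠ z in 𝓝 0, fderiv ℂ φ z (R z) = V (φ z) := by
  obtain ⟨l, hl, hl0, hdl, hlL, hLl⟩ := exists_local_inverse hL hL0 hdL
  have hJ0 : jacobian L 0 = 1 := by rw [jacobian, hdL]; exact LinearMap.det_id (A := ℂ)
  have hlc : Tendsto l (𝓝 0) (𝓝 0) := by simpa [ContinuousAt, hl0] using hl.continuousAt
  have hLc : Tendsto L (𝓝 0) (𝓝 0) := by simpa [ContinuousAt, hL0] using hL.continuousAt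
  have hJa : AnalyticAt ℂ (fun y => jacobian L (l y)) 0 :=
    AnalyticAt.comp (g := jacobian L) (by rw [hl0]; exact hL.jacobian) hl
  have hJ1 : jacobian L (l 0) ≠ 0 := by rw [hl0, hJ0]; exact one_ne_zero
  obtain ⟨ψ, hψ, hψ0, hdψ, hψJ, hψR⟩ := exists_scaling (h := fun y => (jacobian L (l y))⁻¹)
    (hJa.fun_inv hJ1) (by simp only [hl0, hJ0, inv_one])
  have hu : AnalyticAt ℂ (fun x => ψ (L x)) 0 :=
    AnalyticAt.comp (g := ψ) (by rw [hL0]; exact hψ) hL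
  have hdu : fderiv ℂ (fun x => ψ (L x)) 0 = ContinuousLinearMap.id ℂ _ := by
    rw [fderiv_fun_comp _ (by rw [hL0]; exact hψ.differentiableAt) hL.differentiableAt, hL0, hdψ,
      hdL]
    rfl
  obtain ⟨φ, hφ, hφ0, hdφ, hφu, huφ⟩ := exists_local_inverse hu (by simp only [hL0, hψ0]) hdu
  have hφc : Tendsto φ (𝓝 0) (𝓝 0) := by simpa [ContinuousAt, hφ0] using hφ.continuousAt
  have hunit := isUnit_fderiv_eventually hL (by rw [hdL]; exact isUnit_one)
  have huJ : ∀ᶠ x in 𝓝 0, jacobian (fun x => ψ (L x)) x = 1 := by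
    filter_upwards [hLc.eventually hψJ, hLc.eventually hψ.eventually_analyticAt,
      hL.eventually_analyticAt, hlL, hunit] with x h1 h2 h3 h4 h5
    rw [jacobian_comp h2.differentiableAt h3.differentiableAt, h1, h4,
      inv_mul_cancel₀ (jacobian_ne_zero h5)]
  refine ⟨φ, hφ, hφ0, hdφ, ?_, fun V R hV hc htr => ?_⟩
  · filter_upwards [huφ.eventually_nhds, hφc.eventually huJ,
      hφc.eventually hu.eventually_analyticAt, hφ.eventually_analyticAt] with x h1 h2 h3 h4
    have h5 := jacobian_comp h3.differentiableAt h4.differentiableAt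
    rw [h2, one_mul] at h5
    rw [← h5, jacobian,
      (show (fun x => ψ (L (φ x))) =ᶠ[𝓝 x] fun x => x from h1).fderiv_eq, fderiv_fun_id]
    exact LinearMap.det_id (A := ℂ)
  · refine eventually_inverse_conj hu hφ hφ0 hφu huφ ?_
    have hRψ := hψR R (by
      filter_upwards [eventually_inverse_conj hL hl hl0 hlL hLl hc, hlc.eventually htr,
        hlc.eventually hc.eventually_nhds, hlc.eventually hL.eventually_analyticAt,
        hlc.eventually hV.eventually_analyticAt, hlc.eventually hunit,
        hl.eventually_analyticAt] with y h1 h2 h3 h4 h5 h6 h7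
      have h8 := fderiv_jacobian h4 h5 R.differentiableAt h3 h6
      rw [R.fderiv, h2, sub_self, zero_mul, ← h1] at h8
      have h9 := (h4.jacobian.differentiableAt.hasFDerivAt.comp y
        h7.differentiableAt.hasFDerivAt)
      have h10 := (((hasDerivAt_inv (jacobian_ne_zero h6)).comp_hasFDerivAt y h9).fderiv :)
      rw [show (fun y => (jacobian L (l y))⁻¹) = Inv.inv ∘ (jacobian L ∘ l) from rfl, h10]
      simp [h8])
    filter_upwards [hLc.eventually hRψ, hc, hLc.eventually hψ.eventually_analyticAt,
      hL.eventually_analyticAt] with x h1 h2 h3 h4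
    rw [fderiv_fun_comp _ h3.differentiableAt h4.differentiableAt,
      ContinuousLinearMap.comp_apply, h2, h1]

end IsochoreScaling

section Pullback

variable {d : ℕ}

lemma detRows_map (A : (Fin (d + 1) → ℂ) →L[ℂ] Fin (d + 1) → ℂ)
    (M : Fin (d + 1) → Fin (d + 1) → ℂ) : detRows d (fun i => A (M i)) =
      LinearMap.det (A : (Fin (d + 1) → ℂ) →ₗ[ℂ] Fin (d + 1) → ℂ) * detRows d M := by
  rw [detRows_apply, detRows_apply, ← LinearMap.det_toMatrix', mul_comm,
    ← Matrix.det_transpose (LinearMap.toMatrix' _), ← Matrix.det_mul]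
  congr 1
  ext i j
  have h := congrFun (LinearMap.toMatrix'_mulVec
    (A : (Fin (d + 1) → ℂ) →ₗ[ℂ] Fin (d + 1) → ℂ) (M i)) j
  simp only [ContinuousLinearMap.coe_coe] at h
  rw [Matrix.of_apply, ← h, Matrix.mul_apply, Matrix.mulVec, dotProduct]
  exact Finset.sum_congr rfl fun k _ => mul_comm _ _

section Conjugacy

variable {E : Type*} [NormedAddCommGroup E] [NormedSpace ℂ E] [FiniteDimensional ℂ E]

/-- Lie brackets are natural under conjugacies. -/
lemma eventually_lieBracket_conj {φ V W V' W' : E → E} (hφ : AnalyticAt ℂ φ 0) (hφ0 : φ 0 = 0)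
    (hd : IsUnit (fderiv ℂ φ 0)) (hV : AnalyticAt ℂ V 0) (hW : AnalyticAt ℂ W 0)
    (hV' : AnalyticAt ℂ V' 0) (hW' : AnalyticAt ℂ W' 0)
    (hcV : ∀ᶠ x in 𝓝 0, fderiv ℂ φ x (V' x) = V (φ x))
    (hcW : ∀ᶠ x in 𝓝 0, fderiv ℂ φ x (W' x) = W (φ x))
    (h : ∀ᶠ x in 𝓝 0, VectorField.lieBracket ℂ V W x = 0) :
    ∀ᶠ x in 𝓝 0, VectorField.lieBracket ℂ V' W' x = 0 := by
  have hcs : CompleteSpace E := FiniteDimensional.complete ℂ E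
  have hφc : Tendsto φ (𝓝 0) (𝓝 0) := by simpa [ContinuousAt, hφ0] using hφ.continuousAt
  filter_upwards [hcV.eventually_nhds, hcW.eventually_nhds, hφc.eventually h,
    hφc.eventually hV.eventually_analyticAt, hφc.eventually hW.eventually_analyticAt,
    hV'.eventually_analyticAt, hW'.eventually_analyticAt, hφ.eventually_analyticAt,
    isUnit_fderiv_eventually hφ hd] with x h1 h2 h3 h4 h5 h6 h7 h8 h9
  have h10 := fderiv_lieBracket_apply h8 h6 h7
  rw [(show (fun y => fderiv ℂ φ y (W' y)) =ᶠ[𝓝 x] fun y => W (φ y) from h2).fderiv_eq,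
    (show (fun y => fderiv ℂ φ y (V' y)) =ᶠ[𝓝 x] fun y => V (φ y) from h1).fderiv_eq,
    fderiv_fun_comp _ h5.differentiableAt h8.differentiableAt,
    fderiv_fun_comp _ h4.differentiableAt h8.differentiableAt, ContinuousLinearMap.comp_apply,
    ContinuousLinearMap.comp_apply, h1.self_of_nhds, h2.self_of_nhds] at h10
  obtain ⟨B, hB⟩ := h9.exists_left_inv
  have h11 := congrArg B (h10.trans h3)
  rwa [← mul_apply_eq_comp, hB, one_apply_eq_self, map_zero] at h11

lemma fderiv_eq_of_conj {φ V V' : E → E} (hφ : AnalyticAt ℂ φ 0) (hφ0 : φ 0 = 0)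
    (hd : fderiv ℂ φ 0 = ContinuousLinearMap.id ℂ E) (hV : AnalyticAt ℂ V 0)
    (hV' : AnalyticAt ℂ V' 0) (hV'0 : V' 0 = 0)
    (hc : ∀ᶠ x in 𝓝 0, fderiv ℂ φ x (V' x) = V (φ x)) : fderiv ℂ V' 0 = fderiv ℂ V 0 := by
  have hcs : CompleteSpace E := FiniteDimensional.complete ℂ E
  ext1 v
  have h1 := congrArg (fun L : E →L[ℂ] E => L v) (EventuallyEq.fderiv_eq (𝕜 := ℂ) hc)
  simp only [fderiv_fderiv_clm_apply hφ hV', fderiv_fun_comp (0 : E)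
    (show DifferentiableAt ℂ V (φ 0) by rw [hφ0]; exact hV.differentiableAt)
    hφ.differentiableAt, hd, hφ0, hV'0] at h1
  simpa using h1

end Conjugacy

variable {X : Fin d → (Fin (d + 1) → ℂ) → Fin (d + 1) → ℂ}

/-- Pulling back an isochore system by a volume-preserving map. -/
lemma IsIsochoreSystem.exists_pullback (h : IsIsochoreSystem X)
    {φ : (Fin (d + 1) → ℂ) → Fin (d + 1) → ℂ} (hφ : AnalyticAt ℂ φ 0) (hφ0 : φ 0 = 0)
    (hd : fderiv ℂ φ 0 = ContinuousLinearMap.id ℂ _) (hJ : ∀ᶠ x in 𝓝 0, jacobian φ x = 1) :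
    ∃ X', IsIsochoreSystem X' ∧ (∀ j, ∀ᶠ x in 𝓝 0, fderiv ℂ φ x (X' j x) = X j (φ x)) ∧
      ∀ j, fderiv ℂ (X' j) 0 = fderiv ℂ (X j) 0 := by
  have hu : IsUnit (fderiv ℂ φ 0) := by rw [hd]; exact isUnit_one
  have hφc : Tendsto φ (𝓝 0) (𝓝 0) := by simpa [ContinuousAt, hφ0] using hφ.continuousAt
  have hXφ : ∀ j, AnalyticAt ℂ (fun x => X j (φ x)) 0 := fun j =>
    AnalyticAt.comp (g := X j) (by rw [hφ0]; exact h.analytic j) hφ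
  set X' : Fin d → (Fin (d + 1) → ℂ) → Fin (d + 1) → ℂ :=
    fun j x => Ring.inverse (fderiv ℂ φ x) (X j (φ x)) with hX'
  have ha : ∀ j, AnalyticAt ℂ (X' j) 0 := fun j =>
    (analyticAt_ringInverse hφ.fderiv hu).clm_app (hXφ j)
  have hue := isUnit_fderiv_eventually hφ hu
  have hc : ∀ᶠ x in 𝓝 0, ∀ j, fderiv ℂ φ x (X' j x) = X j (φ x) := by
    filter_upwards [hue] with x hx j
    rw [hX', ← mul_apply_eq_comp, Ring.mul_inverse_cancel _ hx, one_apply_eq_self]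
  have hc' : ∀ j, ∀ᶠ x in 𝓝 0, fderiv ℂ φ x (X' j x) = X j (φ x) := fun j =>
    hc.mono fun x hx => hx j
  have h0 : ∀ j, X' j 0 = 0 := fun j => by simp only [hX', hφ0, h.zero, map_zero]
  refine ⟨X', ⟨ha, h0, fun i j => ?_, fun j => ?_, fun hn => ?_⟩, hc', fun j =>
    fderiv_eq_of_conj hφ hφ0 hd (h.analytic j) (ha j) (h0 j) (hc' j)⟩
  · exact eventually_lieBracket_conj hφ hφ0 hu (h.analytic i) (h.analytic j) (ha i) (ha j)
      (hc' i) (hc' j) (h.commute i j)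
  · filter_upwards [(hc' j).eventually_nhds, hφ.eventually_analyticAt,
      (ha j).eventually_analyticAt, hφc.eventually (h.analytic j).eventually_analyticAt,
      hue, hJ.eventually_nhds, hφc.eventually (h.trace j)] with x h1 h2 h3 h4 h5 h6 h7
    have h8 := fderiv_jacobian h2 h3 h4.differentiableAt h1 h5
    rw [(show jacobian φ =ᶠ[𝓝 x] fun _ => 1 from h6).fderiv_eq, h7, h6.self_of_nhds] at h8
    simpa using h8
  · refine h.nondeg ?_
    obtain ⟨l, hl, hl0, -, -, hφl⟩ := exists_local_inverse hφ hφ0 hd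
    have hlc : Tendsto l (𝓝 0) (𝓝 0) := by simpa [ContinuousAt, hl0] using hl.continuousAt
    have h1 : ∀ᶠ x in 𝓝 0, volForm X (φ x) = 0 := by
      filter_upwards [hc, hn, hue] with x h1 h2 h3
      obtain ⟨B, hB⟩ := h3.exists_right_inv
      ext1 w
      have h4 := detRows_map (fderiv ℂ φ x) (frame X' (B w) x)
      rw [← volForm_apply, h2, zero_apply, mul_zero] at h4
      rw [volForm_apply, zero_apply, ← h4]
      congr 1
      refine funext fun i => ?_
      refine Fin.cases ?_ (fun j => ?_) i
      · show w = fderiv ℂ φ x (B w)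
        rw [← mul_apply_eq_comp, hB, one_apply_eq_self]
      · exact (h1 j).symm
    filter_upwards [hlc.eventually h1, hφl] with y h2 h3
    rwa [h3] at h2

/-- Linearizing one semisimple part of the system by a volume-preserving map, keeping the
linear symmetries. -/
theorem IsIsochoreSystem.exists_conj (h : IsIsochoreSystem X) (i : Fin d)
    {S : (Fin (d + 1) → ℂ) →L[ℂ] Fin (d + 1) → ℂ} {ρ : ℂ → ℂ}
    (hρ : ∀ a b, ρ (a + b) = ρ a + ρ b)
    (hSX : ActsOnGenEigenspaces (S : Module.End ℂ (Fin (d + 1) → ℂ))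
      (fderiv ℂ (X i) 0 : Module.End ℂ (Fin (d + 1) → ℂ)) ρ) (hS : flowExp S 1 = 1) :
    ∃ (φ : (Fin (d + 1) → ℂ) → Fin (d + 1) → ℂ)
      (X' : Fin d → (Fin (d + 1) → ℂ) → Fin (d + 1) → ℂ),
      AnalyticAt ℂ φ 0 ∧ φ 0 = 0 ∧ fderiv ℂ φ 0 = ContinuousLinearMap.id ℂ _ ∧
      (∀ᶠ x in 𝓝 0, jacobian φ x = 1) ∧ IsIsochoreSystem X' ∧
      (∀ j, ∀ᶠ x in 𝓝 0, fderiv ℂ φ x (X' j x) = X j (φ x)) ∧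
      (∀ j, fderiv ℂ (X' j) 0 = fderiv ℂ (X j) 0) ∧
      (∀ j, ∀ᶠ x in 𝓝 0, VectorField.lieBracket ℂ (fun y => S y) (X' j) x = 0) ∧
      ∀ R : (Fin (d + 1) → ℂ) →L[ℂ] Fin (d + 1) → ℂ,
        (∀ j, ∀ᶠ x in 𝓝 0, VectorField.lieBracket ℂ (fun y => R y) (X j) x = 0) →
        ∀ j, ∀ᶠ x in 𝓝 0, VectorField.lieBracket ℂ (fun y => R y) (X' j) x = 0 := by
  obtain ⟨Z, hZ, hZ0, hdZ, hbr, htr, hR, happ⟩ := h.exists_commuting_field i hρ hSX hS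
  obtain ⟨L, hL, hLR⟩ := exists_equivariant_linearization hS hZ hZ0 hdZ happ
  obtain ⟨φ, hφ, hφ0, hdφ, hJ, hconj⟩ := exists_isochore_conj hL.map hL.map_zero hL.fderiv_map
  obtain ⟨X', hX', hc, hdX'⟩ := h.exists_pullback hφ hφ0 hdφ hJ
  have hu : IsUnit (fderiv ℂ φ 0) := by rw [hdφ]; exact isUnit_one
  refine ⟨φ, X', hφ, hφ0, hdφ, hJ, hX', hc, hdX', fun j => ?_, fun R hRX j => ?_⟩
  · have htS := htr.self_of_nhds
    rw [hdZ] at htS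
    refine eventually_lieBracket_conj hφ hφ0 hu hZ (h.analytic j) (S.analyticAt 0)
      (hX'.analytic j) (hconj Z S hZ hL.conj (by rw [htS]; exact htr)) (hc j) ?_
    filter_upwards [hbr j] with x hx
    rw [VectorField.lieBracket_swap, hx, neg_zero]
  · refine eventually_lieBracket_conj hφ hφ0 hu (R.analyticAt 0) (h.analytic j) (R.analyticAt 0)
      (hX'.analytic j) (hconj (fun y => R y) R (R.analyticAt 0) (hLR R (hR R (hRX i))) ?_) (hc j)
      (hRX j)
    exact Eventually.of_forall fun x => by
      have hRf : fderiv ℂ (fun y => R y) x = R := R.fderiv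
      rw [hRf]

end Pullback

section Iteration

variable {d : ℕ} {X : Fin d → (Fin (d + 1) → ℂ) → Fin (d + 1) → ℂ}

/-- Linearizing finitely many semisimple parts simultaneously. -/
theorem IsIsochoreSystem.exists_conj_finset {ι : Type*} (s : Finset ι) (h : IsIsochoreSystem X)
    {i : ι → Fin d} {S : ι → (Fin (d + 1) → ℂ) →L[ℂ] Fin (d + 1) → ℂ} {ρ : ι → ℂ → ℂ}
    (hρ : ∀ k a b, ρ k (a + b) = ρ k a + ρ k b)
    (hSX : ∀ k, ActsOnGenEigenspaces (S k : Module.End ℂ (Fin (d + 1) → ℂ))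
      (fderiv ℂ (X (i k)) 0 : Module.End ℂ (Fin (d + 1) → ℂ)) (ρ k))
    (hS : ∀ k, flowExp (S k) 1 = 1) :
    ∃ (φ : (Fin (d + 1) → ℂ) → Fin (d + 1) → ℂ)
      (X' : Fin d → (Fin (d + 1) → ℂ) → Fin (d + 1) → ℂ),
      AnalyticAt ℂ φ 0 ∧ φ 0 = 0 ∧ (∀ᶠ x in 𝓝 0, jacobian φ x = 1) ∧ IsIsochoreSystem X' ∧
      (∀ j, ∀ᶠ x in 𝓝 0, fderiv ℂ φ x (X' j x) = X j (φ x)) ∧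
      (∀ j, fderiv ℂ (X' j) 0 = fderiv ℂ (X j) 0) ∧
      ∀ k ∈ s, ∀ j, ∀ᶠ x in 𝓝 0, VectorField.lieBracket ℂ (fun y => S k y) (X' j) x = 0 := by
  classical
  induction s using Finset.induction_on with
  | empty =>
    refine ⟨id, X, analyticAt_id, rfl, Eventually.of_forall fun x => ?_, h, fun j =>
      Eventually.of_forall fun x => ?_, fun j => rfl, by simp⟩
    · rw [jacobian, fderiv_id]; exact LinearMap.det_id (A := ℂ)
    · rw [fderiv_id]; rfl
  | insert a s ha ih =>
    obtain ⟨φ, X', hφ, hφ0, hJ, hX', hc, hd, hbr⟩ := ih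
    obtain ⟨ψ, X'', hψ, hψ0, -, hJ', hX'', hc', hd', hbr', hR⟩ :=
      hX'.exists_conj (i a) (hρ a) (S := S a) (by rw [hd]; exact hSX a) (hS a)
    have hψc : Tendsto ψ (𝓝 0) (𝓝 0) := by simpa [ContinuousAt, hψ0] using hψ.continuousAt
    refine ⟨fun x => φ (ψ x), X'', AnalyticAt.comp (g := φ) (by rwa [hψ0]) hψ,
      by simp only [hψ0, hφ0], ?_, hX'', fun j => ?_, fun j => (hd' j).trans (hd j),
      fun k hk => ?_⟩
    · filter_upwards [hψc.eventually hJ, hJ', hψc.eventually hφ.eventually_analyticAt,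
        hψ.eventually_analyticAt] with x h1 h2 h3 h4
      rw [jacobian_comp h3.differentiableAt h4.differentiableAt, h1, h2, one_mul]
    · filter_upwards [hψc.eventually (hc j), hc' j, hψc.eventually hφ.eventually_analyticAt,
        hψ.eventually_analyticAt] with x h1 h2 h3 h4
      rw [fderiv_fun_comp _ h3.differentiableAt h4.differentiableAt,
        ContinuousLinearMap.comp_apply, h2, h1]
    · rcases Finset.mem_insert.1 hk with rfl | hk
      · exact hbr'
      · exact hR (S k) (hbr k hk)

end Iteration

section Spectral

/-- Finitely many complex numbers are integer combinations of finitely many numbers, with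
additive coordinates. -/
lemma exists_additive_coordinates {Λ : Set ℂ} (hΛ : Λ.Finite) :
    ∃ (m : ℕ) (β : Fin m → ℂ) (ρ : Fin m → ℂ → ℂ), (∀ k a b, ρ k (a + b) = ρ k a + ρ k b) ∧
      (∀ k, ∀ μ ∈ Λ, ∃ z : ℤ, ρ k μ = z) ∧ ∀ μ ∈ Λ, ∑ k, β k * ρ k μ = μ := by
  have hfin : Module.Finite ℤ (Submodule.span ℤ Λ) := Module.Finite.span_of_finite ℤ hΛ
  set b := Module.finBasis ℤ (Submodule.span ℤ Λ) with hb
  set v : Fin (Module.finrank ℤ (Submodule.span ℤ Λ)) → ℂ := fun k => b k with hv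
  have h1 : LinearIndependent ℤ v :=
    b.linearIndependent.map' (Submodule.span ℤ Λ).subtype (Submodule.ker_subtype _)
  have h2 : LinearIndependent ℚ v := (LinearIndependent.iff_fractionRing ℤ ℚ).1 h1
  obtain ⟨f, hf⟩ := (Fintype.linearCombination ℚ v).exists_leftInverse_of_injective
    (LinearMap.ker_eq_bot.2 h2.fintypeLinearCombination_injective)
  have h3 : ∀ μ ∈ Λ, ∃ c : Fin (Module.finrank ℤ (Submodule.span ℤ Λ)) → ℤ,
      μ = ∑ k, (c k : ℂ) * v k := fun μ hμ => by
    refine ⟨b.repr ⟨μ, Submodule.subset_span hμ⟩, ?_⟩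
    have := congrArg (Submodule.span ℤ Λ).subtype (b.sum_repr ⟨μ, Submodule.subset_span hμ⟩)
    rw [map_sum] at this
    simpa only [map_zsmul, zsmul_eq_mul, Submodule.subtype_apply] using this.symm
  have h4 : ∀ μ (c : Fin (Module.finrank ℤ (Submodule.span ℤ Λ)) → ℤ),
      μ = ∑ k, (c k : ℂ) * v k → f μ = fun k => (c k : ℚ) := by
    intro μ c hc
    have h5 := LinearMap.congr_fun hf fun k => (c k : ℚ)
    rw [LinearMap.comp_apply, Fintype.linearCombination_apply] at h5
    rw [← LinearMap.id_apply (R := ℚ) fun k => (c k : ℚ), ← h5, hc]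
    congr 1
  refine ⟨_, v, fun k μ => ((f μ k : ℚ) : ℂ), fun k a b => by simp, fun k μ hμ => ?_,
    fun μ hμ => ?_⟩
  · obtain ⟨c, hc⟩ := h3 μ hμ
    exact ⟨c k, by simp only [h4 μ c hc, Rat.cast_intCast]⟩
  · obtain ⟨c, hc⟩ := h3 μ hμ
    simp only [h4 μ c hc, Rat.cast_intCast]
    exact (hc.trans (Finset.sum_congr rfl fun k _ => mul_comm _ _)).symm

variable {E : Type*} [NormedAddCommGroup E] [NormedSpace ℂ E] [FiniteDimensional ℂ E]

lemma exp_apply_of_apply_eq_smul {A : E →L[ℂ] E} {c : ℂ} {v : E} (h : A v = c • v) :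
    NormedSpace.exp A v = Complex.exp c • v := by
  have hcs : CompleteSpace E := FiniteDimensional.complete ℂ E
  have h1 := (NormedSpace.exp_series_hasSum_exp' (𝕂 := ℂ) A).mapL
    (ContinuousLinearMap.apply ℂ E v)
  have h2 := (NormedSpace.exp_series_hasSum_exp' (𝕂 := ℂ) c).smul_const v
  rw [← Complex.exp_eq_exp_ℂ] at h2
  have h3 : ∀ n : ℕ, (A ^ n) v = c ^ n • v := fun n => by
    induction n with
    | zero => simp
    | succ n ih => rw [pow_succ', mul_apply_eq_comp, ih, map_smul, h, smul_smul, pow_succ]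
  refine h1.unique ?_
  convert h2 using 2 with n
  simp [h3, smul_smul]

lemma flowExp_one_eq_one {S : E →L[ℂ] E} {A : Module.End ℂ E} {ρ : ℂ → ℂ}
    (h : ActsOnGenEigenspaces (S : Module.End ℂ E) A ρ)
    (hρ : ∀ μ, A.HasEigenvalue μ → ∃ z : ℤ, ρ μ = z) : flowExp S 1 = 1 := by
  have h1 : ActsOnGenEigenspaces (flowExp S 1 : Module.End ℂ E) A
      (fun μ => Complex.exp (2 * Real.pi * Complex.I * ρ μ)) := by
    intro μ v hv
    refine exp_apply_of_apply_eq_smul ?_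
    have h2 : S v = ρ μ • v := h μ v hv
    simp only [smul_apply, h2, smul_smul, one_mul]
  have h2 : ActsOnGenEigenspaces (1 : Module.End ℂ E) A fun _ => 1 := fun μ v _ => by simp
  have h3 := (h1.congr (c' := fun _ => 1) fun μ hμ => by
    obtain ⟨z, hz⟩ := hρ μ hμ
    rw [hz, mul_comm]
    exact Complex.exp_int_mul_two_pi_mul_I z).ext h2
  ext v
  exact LinearMap.congr_fun h3 v

variable {V : Type*} [AddCommGroup V] [Module ℂ V] [FiniteDimensional ℂ V]
  {T A : Module.End ℂ V}

/-- The endomorphism acting on each generalized eigenspace by the eigenvalue is semisimple. -/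
lemma ActsOnGenEigenspaces.isSemisimple (h : ActsOnGenEigenspaces T A id) : T.IsSemisimple := by
  have hfin : {μ | A.HasEigenvalue μ}.Finite := A.finite_hasEigenvalue
  set P : Polynomial ℂ := ∏ μ ∈ hfin.toFinset, (Polynomial.X - Polynomial.C μ) with hP
  refine Module.End.isSemisimple_of_squarefree_aeval_eq_zero (p := P) ?_ ?_
  · refine (Polynomial.separable_prod_X_sub_C_iff'.2 fun x _ y _ h => h).squarefree
  · have hs : ActsOnGenEigenspaces (Polynomial.aeval T P) A fun μ => P.eval μ := fun μ v hv => by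
      rcases eq_or_ne v 0 with rfl | hv0
      · simp
      · exact Module.End.aeval_apply_of_hasEigenvector ⟨Module.End.mem_eigenspace_iff.2
            (h μ v hv), hv0⟩
    refine (hs.congr (c' := fun _ => 0) fun μ hμ => ?_).ext fun μ v _ => by simp
    rw [hP, Polynomial.eval_prod]
    exact Finset.prod_eq_zero (hfin.mem_toFinset.2 hμ) (by simp)

lemma ActsOnGenEigenspaces.isNilpotent_sub (h : ActsOnGenEigenspaces T A id) :
    IsNilpotent (A - T) := by
  have hp : ∀ μ (n : ℕ), ∀ v ∈ A.maxGenEigenspace μ,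
      ((A - T) ^ n) v = ((A - algebraMap ℂ _ μ) ^ n) v := by
    intro μ n
    induction n with
    | zero => simp
    | succ n ih =>
      intro v hv
      have h1 : (A - T) v = (A - algebraMap ℂ _ μ) v := by
        simp [h μ v hv, Algebra.algebraMap_eq_smul_one]
      have h2 : (A - algebraMap ℂ _ μ) v ∈ A.maxGenEigenspace μ := by
        rw [LinearMap.sub_apply, Algebra.algebraMap_eq_smul_one, LinearMap.smul_apply]
        exact Submodule.sub_mem _ (A.mapsTo_maxGenEigenspace_of_comm rfl μ hv)
          (Submodule.smul_mem _ _ hv)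
      rw [pow_succ, pow_succ, Module.End.mul_apply, Module.End.mul_apply, h1, ih _ h2]
  refine ⟨Module.finrank ℂ V, ?_⟩
  refine ActsOnGenEigenspaces.ext (D := A) (c := fun _ => 0) (fun μ v hv => ?_)
    fun μ v _ => by simp
  rw [hp μ _ v hv, zero_smul]
  rw [Module.End.maxGenEigenspace_eq_genEigenspace_finrank, Module.End.mem_genEigenspace_nat,
    LinearMap.mem_ker] at hv
  rwa [Algebra.algebraMap_eq_smul_one]

end Spectral

section Normalization

variable {d : ℕ} {X : Fin d → (Fin (d + 1) → ℂ) → Fin (d + 1) → ℂ}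

lemma volForm_ne_zero {x : Fin (d + 1) → ℂ} (h : LinearIndependent ℂ fun i => X i x) :
    volForm X x ≠ 0 := by
  intro h0
  have hlt : Submodule.span ℂ (Set.range fun i => X i x) < ⊤ := by
    refine lt_top_iff_ne_top.2 fun ht => ?_
    have h1 := finrank_span_eq_card h
    rw [ht, finrank_top] at h1
    simp at h1
  obtain ⟨w, -, hw⟩ := SetLike.exists_of_lt hlt
  have h2 : LinearIndependent ℂ (frame X w x) := linearIndependent_finCons.2 ⟨h, hw⟩
  have h3 := (Matrix.linearIndependent_rows_iff_isUnit (A := Matrix.of (frame X w x))).1 h2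
  rw [Matrix.isUnit_iff_isUnit_det, ← detRows_apply, ← volForm_apply, h0] at h3
  exact not_isUnit_zero h3

lemma isIsochoreSystem_of_analyticOnNhd {U : Set (Fin (d + 1) → ℂ)} (hU : IsOpen U)
    (hUc : IsConnected U) (h0 : (0 : Fin (d + 1) → ℂ) ∈ U) (hX : ∀ i, AnalyticOnNhd ℂ (X i) U)
    (hX0 : ∀ i, X i 0 = 0)
    (hcomm : ∀ i j, ∀ x ∈ U, VectorField.lieBracket ℂ (X i) (X j) x = 0)
    (htr : ∀ i, ∀ x ∈ U, LinearMap.trace ℂ (Fin (d + 1) → ℂ)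
      (fderiv ℂ (X i) x : (Fin (d + 1) → ℂ) →ₗ[ℂ] Fin (d + 1) → ℂ) = 0)
    (hind : ∃ x ∈ U, LinearIndependent ℂ fun i => X i x) : IsIsochoreSystem X where
  analytic j := hX j 0 h0
  zero := hX0
  commute i j := (hU.eventually_mem h0).mono (hcomm i j)
  trace j := (hU.eventually_mem h0).mono (htr j)
  nondeg hn := by
    obtain ⟨x, hx, hi⟩ := hind
    have ha : AnalyticOnNhd ℂ (volForm X) U := fun y hy => volForm_analyticAt fun j => hX j y hy
    exact volForm_ne_zero hi
      (ha.eqOn_zero_of_preconnected_of_eventuallyEq_zero hUc.isPreconnected h0 hn hx)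

/-- An isochore system is conjugate to one commuting with the semisimple parts of its linear
parts. -/
theorem IsIsochoreSystem.exists_normalization (h : IsIsochoreSystem X) :
    ∃ (φ : (Fin (d + 1) → ℂ) → Fin (d + 1) → ℂ)
      (Y : Fin d → (Fin (d + 1) → ℂ) → Fin (d + 1) → ℂ)
      (S : Fin d → (Fin (d + 1) → ℂ) →L[ℂ] Fin (d + 1) → ℂ),
      AnalyticAt ℂ φ 0 ∧ φ 0 = 0 ∧ (∀ᶠ x in 𝓝 0, jacobian φ x = 1) ∧ IsIsochoreSystem Y ∧
      (∀ j, ∀ᶠ x in 𝓝 0, fderiv ℂ φ x (Y j x) = X j (φ x)) ∧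
      (∀ j, ActsOnGenEigenspaces (S j : Module.End ℂ (Fin (d + 1) → ℂ))
        (fderiv ℂ (Y j) 0 : Module.End ℂ (Fin (d + 1) → ℂ)) id) ∧
      ∀ j, ∀ᶠ x in 𝓝 0, VectorField.lieBracket ℂ (fun y => S j y) (Y j) x = 0 := by
  set A : Fin d → Module.End ℂ (Fin (d + 1) → ℂ) := fun j => (fderiv ℂ (X j) 0 :) with hA
  choose m β ρ hρ hInt hsum using fun j =>
    exists_additive_coordinates (A j).finite_hasEigenvalue
  have hex : ∀ j k, ∃ T : (Fin (d + 1) → ℂ) →L[ℂ] Fin (d + 1) → ℂ,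
      ActsOnGenEigenspaces (T : Module.End ℂ (Fin (d + 1) → ℂ)) (A j) (ρ j k) := fun j k => by
    obtain ⟨P, hP, -⟩ := exists_polynomial_actsOn (A j) (A j) (ρ j k)
    exact ⟨LinearMap.toContinuousLinearMap (Polynomial.aeval (A j) P), hP⟩
  choose T hT using hex
  obtain ⟨φ, Y, hφ, hφ0, hJ, hY, hc, hd, hbr⟩ := h.exists_conj_finset
    (Finset.univ : Finset (Σ j, Fin (m j))) (i := fun p => p.1) (S := fun p => T p.1 p.2)
    (ρ := fun p => ρ p.1 p.2) (fun p => hρ p.1 p.2) (fun p => hT p.1 p.2)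
    fun p => flowExp_one_eq_one (hT p.1 p.2) fun μ hμ => hInt p.1 p.2 μ hμ
  refine ⟨φ, Y, fun j => ∑ k, β j k • T j k, hφ, hφ0, hJ, hY, hc, fun j => ?_, fun j => ?_⟩
  · rw [hd]
    have h1 := (ActsOnGenEigenspaces.sum (s := Finset.univ) fun k _ =>
      (hT j k).smul (β j k)).congr (c' := id) (hsum j)
    convert h1
    ext v
    simp
  · have h2 := eventually_all.2 fun k => hbr ⟨j, k⟩ (Finset.mem_univ _) j
    filter_upwards [h2] with x hx
    have hf : ∀ R : (Fin (d + 1) → ℂ) →L[ℂ] Fin (d + 1) → ℂ,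
        VectorField.lieBracket ℂ (fun y => R y) (Y j) x = fderiv ℂ (Y j) x (R x) - R (Y j x) := by
      intro R
      have hRf : fderiv ℂ (fun y => R y) x = R := R.fderiv
      rw [VectorField.lieBracket, hRf]
    simp only [hf, sub_eq_zero] at hx
    rw [hf]
    simp only [sum_apply, smul_apply, map_sum, map_smul, hx, sub_self]

end Normalization

/-- **Simultaneous volume-preserving normalization of commuting isochore
vector fields** (Zung, improving Vey). Any `(n-1)`-tuple of pairwise
commuting holomorphic isochore vector fields near `0 ∈ ℂⁿ`, vanishing at `0`
and linearly independent almost everywhere, admits a simultaneous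
volume-preserving convergent Poincaré–Dulac normalization. -/
theorem isochore_simultaneous_volPDNormalization_complex
    (n : ℕ) (hn : 1 ≤ n)
    (U : Set (Fin n → ℂ)) (hUopen : IsOpen U) (hUconn : IsConnected U)
    (h0U : (0 : Fin n → ℂ) ∈ U)
    (X : Fin (n - 1) → (Fin n → ℂ) → (Fin n → ℂ))
    (hXan : ∀ i, AnalyticOnNhd ℂ (X i) U)
    (hX0 : ∀ i, X i 0 = 0)
    (hcomm : ∀ i j, ∀ x ∈ U, VectorField.lieBracket ℂ (X i) (X j) x = 0)
    (hiso : ∀ i, ∀ x ∈ U,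
      LinearMap.trace ℂ (Fin n → ℂ)
        (fderiv ℂ (X i) x : (Fin n → ℂ) →ₗ[ℂ] (Fin n → ℂ)) = 0)
    (hXind : ∃ x ∈ U, LinearIndependent ℂ (fun i => X i x)) :
    ∃ (V : Set (Fin n → ℂ)) (φ : (Fin n → ℂ) → (Fin n → ℂ))
      (Y : Fin (n - 1) → (Fin n → ℂ) → (Fin n → ℂ)),
      IsOpen V ∧ (0 : Fin n → ℂ) ∈ V ∧
      AnalyticOnNhd ℂ φ V ∧ φ 0 = 0 ∧
      (∀ x ∈ V,
        LinearMap.det (fderiv ℂ φ x : (Fin n → ℂ) →ₗ[ℂ] (Fin n → ℂ)) = 1) ∧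
      (∀ i, AnalyticOnNhd ℂ (Y i) V) ∧ (∀ i, Y i 0 = 0) ∧
      (∀ i, InPDNormalForm ℂ (Y i) V) ∧
      ∀ i, ∀ x ∈ V, fderiv ℂ φ x (Y i x) = X i (φ x) := by
  obtain ⟨d, rfl⟩ : ∃ d, n = d + 1 := ⟨n - 1, by omega⟩
  obtain ⟨φ, Y, S, hφ, hφ0, hJ, hY, hc, hS, hbr⟩ :=
    (isIsochoreSystem_of_analyticOnNhd (d := d) hUopen hUconn h0U hXan hX0 hcomm hiso
      hXind).exists_normalization
  have hev : ∀ᶠ x in 𝓝 (0 : Fin (d + 1) → ℂ), AnalyticAt ℂ φ x ∧ jacobian φ x = 1 ∧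
      (∀ j, AnalyticAt ℂ (Y j) x) ∧ (∀ j, fderiv ℂ φ x (Y j x) = X j (φ x)) ∧
      ∀ j, VectorField.lieBracket ℂ (fun y => S j y) (Y j) x = 0 :=
    hφ.eventually_analyticAt.and (hJ.and ((eventually_all.2 fun j =>
      (hY.analytic j).eventually_analyticAt).and ((eventually_all.2 hc).and
          (eventually_all.2 hbr))))
  obtain ⟨V, hV, hVo, hV0⟩ := _root_.eventually_nhds_iff.1 hev
  refine ⟨V, φ, Y, hVo, hV0, fun x hx => (hV x hx).1, hφ0, fun x hx => (hV x hx).2.1,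
    fun j x hx => (hV x hx).2.2.1 j, hY.zero, fun j => ?_, fun j x hx => (hV x hx).2.2.2.1 j⟩
  have hcm := commute_of_lieBracket_eq_zero (hY.analytic j) (hbr j)
  refine ⟨S j, fderiv ℂ (Y j) 0 - S j, by abel, (hS j).isSemisimple, (hS j).isNilpotent_sub,
    (hcm.sub_right (Commute.refl _)).eq, fun x hx => ?_⟩
  rw [VectorField.lieBracket_swap, (hV x hx).2.2.2.2 j, neg_zero]
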